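/- For every C > 0 there exists C' > 0 such that the following holds. Let H₀, H, N, 𝐏, 𝓛 satisfy: 1 ≤ H₀ ≤ H, log H₀ ≥ (log H)^{2/3} (log log H)², 𝐏 a set of primes in [H₀, H], 𝓛 = ∑_{p∈𝐏} 1/p ≥ e, and log H ≤ √((log N)/𝓛). Let f, g : 𝐍 → ℂ (extended by zero outside 𝐍) satisfy |f|₂ ≤ 1, |g|₂ ≤ 1, |f|₄ ≤ e^{C𝓛} and |g|₄ ≤ e^{C𝓛}. Then (1/(N𝓛)) · | ∑_{n∈𝐍} ∑_{σ∈{−1,1}} ∑_{p∈𝐏, p∣n} f(n) conj(g(n+σp)) − ∑_{n∈𝐍} ∑_{σ∈{−1,1}} ∑_{p∈𝐏} f(n) conj(g(n+σp))/p | ≤ C'/√𝓛. -/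

import Mathlib

namespace MC
open Finset Classical

/-- data of a word pattern with its reduced formal positions -/
structure Walk (n j : ℕ) (K : Finset ℕ) (c : ℕ → ℕ) (B : ℕ → ℕ → ℚ) : Prop where
  c_le : ∀ i, i < n → c i ≤ i
  c_idem : ∀ i, i < n → c (c i) = c i
  step : ∀ i, i < n → c i ∉ K → ∃ s : ℚ, s ≠ 0 ∧ ∀ z, B (i+1) z = B i z + if z = c i then s else 0
  coh : ∀ i, i < n → c i ∉ K → ∀ z, z ≠ c i → B (i+1) z = B (c i + 1) z
  block : ∀ i i', i < n → i' < n → i / j = i' / j → c i = c i' → i = i'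

noncomputable def pI (B : ℕ → ℕ → ℚ) (t : ℕ) : ℕ :=
  Nat.find (⟨t, rfl⟩ : ∃ t', B t' = B t)

lemma pI_spec (B : ℕ → ℕ → ℚ) (t : ℕ) : B (pI B t) = B t :=
  Nat.find_spec (⟨t, rfl⟩ : ∃ t', B t' = B t)

lemma pI_le (B : ℕ → ℕ → ℚ) (t : ℕ) : pI B t ≤ t :=
  Nat.find_min' _ rfl

lemma pI_le_of_eq {B : ℕ → ℕ → ℚ} {t t' : ℕ} (h : B t' = B t) : pI B t ≤ t' :=
  Nat.find_min' _ h

lemma pI_congr {B : ℕ → ℕ → ℚ} {t t' : ℕ} (h : B t = B t') : pI B t = pI B t' :=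
  le_antisymm (pI_le_of_eq ((pI_spec B t').trans h.symm)) (pI_le_of_eq ((pI_spec B t).trans h))

lemma pI_idem (B : ℕ → ℕ → ℚ) (t : ℕ) : pI B (pI B t) = pI B t :=
  pI_congr (pI_spec B t)

lemma eq_of_pI {B : ℕ → ℕ → ℚ} {t t' : ℕ} (h : pI B t = pI B t') : B t = B t' := by
  rw [← pI_spec B t, h, pI_spec B]

def Inc (B : ℕ → ℕ → ℚ) (u y : ℕ) : Prop := ∀ z, z ≠ y → B u z = B (y+1) z

lemma Inc_congr {B : ℕ → ℕ → ℚ} {u u' y : ℕ} (h : B u = B u') : Inc B u y ↔ Inc B u' y := by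
  simp only [Inc, h]

lemma Inc_pI {B : ℕ → ℕ → ℚ} {u y : ℕ} : Inc B (pI B u) y ↔ Inc B u y := Inc_congr (pI_spec B u)

noncomputable def Pos (n : ℕ) (B : ℕ → ℕ → ℚ) : Finset ℕ := (range (n+1)).filter fun u => pI B u = u
noncomputable def Lt (n : ℕ) (K : Finset ℕ) (c : ℕ → ℕ) : Finset ℕ :=
  (range n).filter fun y => c y = y ∧ y ∉ K
noncomputable def IncS (n : ℕ) (K : Finset ℕ) (c : ℕ → ℕ) (B : ℕ → ℕ → ℚ) : Finset (ℕ × ℕ) :=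
  ((Pos n B) ×ˢ (Lt n K c)).filter fun q => Inc B q.1 q.2
noncomputable def bd (n j : ℕ) (K : Finset ℕ) (c : ℕ → ℕ) : Finset ℕ :=
  (range (n+1)).filter fun t => t = 0 ∨ t = n ∨ j ∣ t ∨ (t < n ∧ c t ∈ K) ∨ (0 < t ∧ c (t-1) ∈ K)

lemma pI_mem_Pos {n : ℕ} {B : ℕ → ℕ → ℚ} {t : ℕ} (ht : t ≤ n) : pI B t ∈ Pos n B := by
  simp only [Pos, mem_filter, mem_range, pI_idem, and_true]
  have := pI_le B t; omega

lemma Pos_eq {n : ℕ} {B : ℕ → ℕ → ℚ} {u u' : ℕ} (h : u ∈ Pos n B) (h' : u' ∈ Pos n B)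
    (e : B u = B u') : u = u' := by
  simp only [Pos, mem_filter] at h h'
  rw [← h.2, ← h'.2, pI_congr e]

section
variable {n j : ℕ} {K : Finset ℕ} {c : ℕ → ℕ} {B : ℕ → ℕ → ℚ}

lemma Walk.inc_end (W : Walk n j K c B) {i : ℕ} (hi : i < n) (hc : c i ∉ K) : Inc B (i+1) (c i) :=
  W.coh i hi hc

lemma Walk.inc_start (W : Walk n j K c B) {i : ℕ} (hi : i < n) (hc : c i ∉ K) : Inc B i (c i) := by
  intro z hz
  obtain ⟨s, _, h⟩ := W.step i hi hc
  have := h z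
  rw [if_neg hz, add_zero] at this
  rw [← this]; exact W.coh i hi hc z hz

lemma Walk.ne_step (W : Walk n j K c B) {i : ℕ} (hi : i < n) (hc : c i ∉ K) : B (i+1) ≠ B i := by
  intro h
  obtain ⟨s, hs, h'⟩ := W.step i hi hc
  have := h' (c i)
  rw [h, if_pos rfl] at this
  apply hs; linarith

lemma Walk.mem_Lt (W : Walk n j K c B) {i : ℕ} (hi : i < n) (hc : c i ∉ K) : c i ∈ Lt n K c := by
  simp only [Lt, mem_filter, mem_range]
  exact ⟨lt_of_le_of_lt (W.c_le i hi) hi, W.c_idem i hi, hc⟩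

lemma mem_bd_of {t : ℕ} (ht : t ≤ n)
    (h : t = 0 ∨ t = n ∨ j ∣ t ∨ (t < n ∧ c t ∈ K) ∨ (0 < t ∧ c (t-1) ∈ K)) : t ∈ bd n j K c := by
  simp only [bd, mem_filter, mem_range]; exact ⟨by omega, h⟩

/-- facts about interior times -/
lemma Walk.interior (W : Walk n j K c B) {t : ℕ} (ht : t ≤ n) (hb : t ∉ bd n j K c) :
    ∃ k, t = k + 1 ∧ t < n ∧ c t ∉ K ∧ c k ∉ K ∧ c t ≠ c k ∧ k / j = t / j := by
  simp only [bd, mem_filter, mem_range, not_and, not_or] at hb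
  obtain ⟨h0, h1, h2, h3, h4⟩ := hb (by omega)
  obtain ⟨k, rfl⟩ := Nat.exists_eq_succ_of_ne_zero h0
  have hlt : k + 1 < n := by omega
  have hd : k / j = (k+1) / j := by
    rw [Nat.succ_div, if_neg h2, add_zero]
  refine ⟨k, rfl, hlt, h3 hlt, by simpa using h4 (by omega), ?_, hd⟩
  intro he
  have := W.block (k+1) k hlt (by omega) hd.symm he
  omega

/-- acyclicity -/
lemma acyclic (W : Walk n j K c B) :
    (IncS n K c B).card + 1 ≤ (Pos n B).card + (Lt n K c).card := by
  classical
  -- non base incidences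
  set NB := (IncS n K c B).filter fun q => q.1 ≠ pI B q.2 with hNB
  have hbase : ((IncS n K c B).filter fun q => ¬ (q.1 ≠ pI B q.2)).card ≤ (Lt n K c).card := by
    apply card_le_card_of_injOn (fun q => q.2)
    · intro q hq
      simp only [coe_filter, Set.mem_ofPred_eq, IncS, mem_filter, mem_product] at hq
      exact hq.1.1.2
    · intro q hq q' hq' h
      simp only [coe_filter, Set.mem_ofPred_eq, not_not] at hq hq'
      ext
      · rw [hq.2, hq'.2]; simp only at h; rw [h]
      · exact h
  have hsum : NB.card + ((IncS n K c B).filter fun q => ¬ (q.1 ≠ pI B q.2)).card = (IncS n K c B).card := by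
    convert card_filter_add_card_filter_not (s := IncS n K c B) (fun q => q.1 ≠ pI B q.2)
  have h0 : (0 : ℕ) ∈ Pos n B := by
    simp only [Pos, mem_filter, mem_range]; exact ⟨by omega, by have := pI_le B 0; omega⟩
  suffices hmain : NB.card + 1 ≤ (Pos n B).card by
    rw [← hsum]; omega
  -- independent family
  have hPm : ∀ y ∈ Lt n K c, pI B y ∈ Pos n B := by
    intro y hy
    simp only [Lt, mem_filter, mem_range] at hy
    exact pI_mem_Pos (by omega)
  let v : Option NB → (Pos n B → ℚ) := fun o => match o with
    | none => fun u => if (u : ℕ) = 0 then 1 else 0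
    | some q => fun u => (if (u : ℕ) = q.1.1 then 1 else 0) - (if (u:ℕ) = pI B q.1.2 then 1 else 0)
  have hli : LinearIndependent ℚ v := by
    rw [Fintype.linearIndependent_iff]
    intro lam hl
    -- test functions
    have test : ∀ φ : ℕ → ℚ, lam none * φ 0 + ∑ q : NB, lam (some q) * (φ q.1.1 - φ (pI B q.1.2)) = 0 := by
      intro φ
      have h1 : ∑ u : Pos n B, (∑ o, lam o • v o) u * φ u = 0 := by
        rw [hl]; simp
      simp only [Finset.sum_apply, Pi.smul_apply, smul_eq_mul, Finset.sum_mul] at h1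
      rw [Finset.sum_comm, Fintype.sum_option] at h1
      have key : ∀ k ∈ Pos n B, ∑ u : Pos n B, (if (u:ℕ) = k then (1:ℚ) else 0) * φ u = φ k := by
        intro k hk
        rw [Finset.sum_eq_single (⟨k, hk⟩ : Pos n B)]
        · simp
        · intro b _ hb
          have : (b:ℕ) ≠ k := fun h => hb (Subtype.ext h)
          simp [this]
        · simp
      rw [← h1]
      congr 1
      · simp only [v, mul_assoc]
        rw [← Finset.mul_sum, key 0 h0]
      · apply Finset.sum_congr rfl
        intro q _
        have hq := q.2
        simp only [hNB, IncS, mem_filter, mem_product] at hq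
        simp only [v, mul_assoc]
        rw [← Finset.mul_sum]
        congr 1
        simp only [sub_mul, Finset.sum_sub_distrib]
        rw [key _ hq.1.1.1, key _ (hPm _ hq.1.1.2)]
    have hnone : lam none = 0 := by
      have := test (fun _ => 1)
      simpa using this
    intro o
    cases o with
    | none => exact hnone
    | some q0 =>
      have := test (fun u => if B u q0.1.2 = B q0.1.1 q0.1.2 then 1 else 0)
      rw [hnone, zero_mul, zero_add] at this
      have hq0 := q0.2
      simp only [hNB, IncS, mem_filter, mem_product] at hq0
      have hb0 : Inc B q0.1.2 q0.1.2 := by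
        have hy := hq0.1.1.2
        simp only [Lt, mem_filter, mem_range] at hy
        have := W.inc_start hy.1 (by rw [hy.2.1]; exact hy.2.2)
        rwa [hy.2.1] at this
      rw [Finset.sum_eq_single q0] at this
      · rw [if_pos rfl, if_neg] at this
        · simpa using this
        · intro h
          apply hq0.2
          apply Pos_eq hq0.1.1.1 (hPm _ hq0.1.1.2)
          ext z
          by_cases hz : z = q0.1.2
          · rw [hz, h]
          · rw [hq0.1.2 z hz, pI_spec B, hb0 z hz]
      · intro q _ hne
        have hq := q.2
        simp only [hNB, IncS, mem_filter, mem_product] at hq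
        have hb : Inc B q.1.2 q.1.2 := by
          have hy := hq.1.1.2
          simp only [Lt, mem_filter, mem_range] at hy
          have := W.inc_start hy.1 (by rw [hy.2.1]; exact hy.2.2)
          rwa [hy.2.1] at this
        by_cases hy : q.1.2 = q0.1.2
        · rw [if_neg, if_neg]; · simp
          · intro h
            apply hq0.2
            apply Pos_eq hq0.1.1.1 (hPm _ hq0.1.1.2)
            ext z
            by_cases hz : z = q0.1.2
            · rw [hz, ← h, pI_spec B, pI_spec B, hy]
            · rw [hq0.1.2 z hz, pI_spec B, hb0 z hz]
          · intro h
            apply hne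
            apply Subtype.ext
            apply Prod.ext _ hy
            apply Pos_eq hq.1.1.1 hq0.1.1.1
            ext z
            by_cases hz : z = q0.1.2
            · rw [hz, h]
            · rw [hq0.1.2 z hz, hq.1.2 z (by rw [hy]; exact hz), hy]
        · have e : B q.1.1 q0.1.2 = B (pI B q.1.2) q0.1.2 := by
            rw [hq.1.2 _ (Ne.symm hy), pI_spec B, hb _ (Ne.symm hy)]
          rw [e]; simp
      · simp
  have hcard := hli.fintype_card_le_finrank
  rw [Module.finrank_fintype_fun_eq_card, Fintype.card_option, Fintype.card_coe, Fintype.card_coe] at hcard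
  exact hcard

end
end MC


namespace MC
open Finset Classical

noncomputable def degU (n : ℕ) (K : Finset ℕ) (c : ℕ → ℕ) (B : ℕ → ℕ → ℚ) (u : ℕ) : ℕ :=
  ((Lt n K c).filter fun y => Inc B u y).card

noncomputable def Ext (n : ℕ) (K : Finset ℕ) (c : ℕ → ℕ) (B : ℕ → ℕ → ℚ) : Finset (ℕ × ℕ) :=
  (IncS n K c B).filter fun q => q.1 ≠ pI B q.2 ∧ q.1 ≠ pI B (q.2 + 1)
noncomputable def Hi (n : ℕ) (K : Finset ℕ) (c : ℕ → ℕ) (B : ℕ → ℕ → ℚ) : Finset (ℕ × ℕ) :=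
  (IncS n K c B).filter fun q => 3 ≤ degU n K c B q.1
noncomputable def Lo (n j : ℕ) (K : Finset ℕ) (c : ℕ → ℕ) (B : ℕ → ℕ → ℚ) : Finset (ℕ × ℕ) :=
  (IncS n K c B).filter fun q => q.1 ∈ (bd n j K c).image (pI B) ∧ degU n K c B q.1 ≤ 2

section
variable {n j : ℕ} {K : Finset ℕ} {c : ℕ → ℕ} {B : ℕ → ℕ → ℚ}

lemma card_IncS_filter (p : ℕ → Prop) [DecidablePred p] :
    ((IncS n K c B).filter fun q => p q.1).card
      = ∑ u ∈ (Pos n B).filter p, degU n K c B u := by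
  have : (IncS n K c B).filter (fun q => p q.1) =
      ((Pos n B).filter p).biUnion fun u => ((Lt n K c).filter fun y => Inc B u y).image fun y => (u, y) := by
    ext ⟨u, y⟩
    simp only [IncS, mem_filter, mem_product, mem_biUnion, mem_image, Prod.mk.injEq]
    constructor
    · rintro ⟨⟨⟨h1, h2⟩, h3⟩, h4⟩
      exact ⟨u, ⟨h1, h4⟩, y, ⟨h2, h3⟩, rfl, rfl⟩
    · rintro ⟨u', ⟨h1, h4⟩, y', ⟨h2, h3⟩, rfl, rfl⟩
      exact ⟨⟨⟨h1, h2⟩, h3⟩, h4⟩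
  rw [this, card_biUnion]
  · apply sum_congr rfl
    intro u _
    rw [degU, card_image_of_injective]
    intro a b h; simpa using h
  · intro u _ u' _ hne
    rw [Function.onFun, disjoint_left]
    rintro ⟨a, b⟩ h h'
    simp only [mem_image, Prod.mk.injEq] at h h'
    obtain ⟨_, _, rfl, _⟩ := h
    obtain ⟨_, _, h, _⟩ := h'
    exact hne h.symm

lemma card_IncS : (IncS n K c B).card = ∑ u ∈ Pos n B, degU n K c B u := by
  have := card_IncS_filter (n := n) (K := K) (c := c) (B := B) (fun _ => True)
  simpa using this

lemma Lt_c {y : ℕ} (hy : y ∈ Lt n K c) : y < n ∧ c y = y ∧ y ∉ K := by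
  simpa only [Lt, mem_filter, mem_range] using hy

lemma Walk.inc_a (W : Walk n j K c B) {y : ℕ} (hy : y ∈ Lt n K c) : Inc B y y := by
  obtain ⟨h1, h2, h3⟩ := Lt_c hy
  have := W.inc_start h1 (by rw [h2]; exact h3)
  rwa [h2] at this

lemma inc_b {y : ℕ} : Inc B (y+1) y := fun _ _ => rfl

lemma Walk.pI_ne (W : Walk n j K c B) {i : ℕ} (hi : i < n) (hc : c i ∉ K) : pI B (i+1) ≠ pI B i :=
  fun h => W.ne_step hi hc (eq_of_pI h)

lemma Walk.pI_ne' (W : Walk n j K c B) {y : ℕ} (hy : y ∈ Lt n K c) : pI B (y+1) ≠ pI B y := by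
  obtain ⟨h1, h2, h3⟩ := Lt_c hy
  exact W.pI_ne h1 (by rw [h2]; exact h3)

lemma card_Ext (W : Walk n j K c B) : (Ext n K c B).card + 2 * (Lt n K c).card = (IncS n K c B).card := by
  have h1 : (IncS n K c B) = Ext n K c B ∪ ((Lt n K c).image (fun y => (pI B y, y)) ∪
      (Lt n K c).image (fun y => (pI B (y+1), y))) := by
    ext ⟨u, y⟩
    simp only [Ext, mem_filter, mem_union, mem_image, Prod.mk.injEq]
    constructor
    · intro h
      have h' := h
      simp only [IncS, mem_filter, mem_product] at h'
      by_cases ha : u = pI B y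
      · right; left; exact ⟨y, h'.1.2, ha.symm, rfl⟩
      by_cases hb : u = pI B (y+1)
      · right; right; exact ⟨y, h'.1.2, hb.symm, rfl⟩
      left; exact ⟨h, ha, hb⟩
    · rintro (h | ⟨y', hy, rfl, rfl⟩ | ⟨y', hy, rfl, rfl⟩)
      · exact h.1
      · simp only [IncS, mem_filter, mem_product]
        exact ⟨⟨pI_mem_Pos (Lt_c hy).1.le, hy⟩, Inc_pI.2 (W.inc_a hy)⟩
      · simp only [IncS, mem_filter, mem_product]
        exact ⟨⟨pI_mem_Pos (Lt_c hy).1, hy⟩, Inc_pI.2 inc_b⟩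
  rw [h1, card_union_of_disjoint, card_union_of_disjoint, card_image_of_injective, card_image_of_injective]
  · ring
  · intro a b h; simp only [Prod.mk.injEq] at h; exact h.2
  · intro a b h; simp only [Prod.mk.injEq] at h; exact h.2
  · rw [disjoint_left]
    rintro ⟨u, y⟩ h h'
    simp only [mem_image, Prod.mk.injEq] at h h'
    obtain ⟨y1, h1, h2, h3⟩ := h
    obtain ⟨y2, _, h5, h6⟩ := h'
    subst h3; subst h6
    exact W.pI_ne' h1 (by rw [h2, h5])
  · rw [disjoint_left]
    rintro ⟨u, y⟩ h h'
    simp only [Ext, mem_filter] at h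
    simp only [mem_union, mem_image, Prod.mk.injEq] at h'
    rcases h' with ⟨y', _, h2, h3⟩ | ⟨y', _, h2, h3⟩
    · exact h.2.1 (by rw [← h2, h3])
    · exact h.2.2 (by rw [← h2, h3])

lemma two_le_degU (W : Walk n j K c B) {u : ℕ} (hu : u ≤ n) (hb : u ∉ bd n j K c) : 2 ≤ degU n K c B u := by
  obtain ⟨k, hk, hlt, h1, h2, h3, _⟩ := W.interior hu hb
  have : ({c u, c k} : Finset ℕ) ⊆ (Lt n K c).filter fun y => Inc B u y := by
    intro y hy
    simp only [mem_insert, mem_singleton] at hy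
    rw [mem_filter]
    rcases hy with rfl | rfl
    · exact ⟨W.mem_Lt hlt h1, W.inc_start hlt h1⟩
    · refine ⟨W.mem_Lt (by omega) h2, ?_⟩
      rw [hk]; exact W.inc_end (by omega) h2
  calc 2 = ({c u, c k} : Finset ℕ).card := by rw [card_pair h3]
    _ ≤ _ := card_le_card this

lemma deg_ineq (W : Walk n j K c B) : 3 * (Ext n K c B).card + (Hi n K c B).card ≤ 6 * (bd n j K c).card := by
  have h1 := acyclic W
  have h2 := card_Ext W
  have h3 := card_IncS (n := n) (K := K) (c := c) (B := B)
  have h4 : (Hi n K c B).card = ∑ u ∈ Pos n B, if 3 ≤ degU n K c B u then degU n K c B u else 0 := by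
    rw [← Finset.sum_filter, Hi]
    exact card_IncS_filter (n := n) (K := K) (c := c) (B := B) (fun u => 3 ≤ degU n K c B u)
  have h5 : ∑ u ∈ Pos n B, (if 3 ≤ degU n K c B u then degU n K c B u else 0) + 6 * (Pos n B).card
      ≤ 3 * ∑ u ∈ Pos n B, degU n K c B u + 6 * (bd n j K c).card := by
    have : (∑ u ∈ Pos n B, if u ∈ bd n j K c then 6 else 0) ≤ 6 * (bd n j K c).card := by
      rw [← Finset.sum_filter, Finset.sum_const, smul_eq_mul, mul_comm]
      apply Nat.mul_le_mul_left
      apply card_le_card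
      intro u hu
      exact (mem_filter.1 hu).2
    refine le_trans ?_ (Nat.add_le_add_left this _)
    rw [Finset.mul_sum, ← Finset.sum_add_distrib, mul_comm 6, ← smul_eq_mul, ← Finset.sum_const, ← Finset.sum_add_distrib]
    apply Finset.sum_le_sum
    intro u hu
    simp only [Pos, mem_filter, mem_range] at hu
    by_cases hb : u ∈ bd n j K c
    · rw [if_pos hb]; split_ifs <;> omega
    · have := two_le_degU W (by omega : u ≤ n) hb
      rw [if_neg hb]; split_ifs <;> omega
  omega

lemma card_Ext_le (W : Walk n j K c B) : (Ext n K c B).card ≤ 2 * (bd n j K c).card := by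
  have := deg_ineq W; omega

lemma card_Lo_le : (Lo n j K c B).card ≤ 2 * (bd n j K c).card := by
  rw [Lo, card_IncS_filter (fun u => u ∈ (bd n j K c).image (pI B) ∧ degU n K c B u ≤ 2)]
  calc _ ≤ ∑ u ∈ (Pos n B).filter (fun u => u ∈ (bd n j K c).image (pI B) ∧ degU n K c B u ≤ 2), 2 := by
        apply Finset.sum_le_sum
        intro u hu; exact (mem_filter.1 hu).2.2
    _ ≤ _ := by
      rw [Finset.sum_const, smul_eq_mul, mul_comm]
      apply Nat.mul_le_mul_left
      refine le_trans (card_le_card ?_) (card_image_le (s := bd n j K c) (f := pI B))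
      intro u hu; exact (mem_filter.1 hu).2.1

/-- incidences whose letter is later than the position -/
noncomputable def Late (n : ℕ) (K : Finset ℕ) (c : ℕ → ℕ) (B : ℕ → ℕ → ℚ) : Finset (ℕ × ℕ) :=
  (IncS n K c B).filter fun q => q.1 < q.2

lemma card_HL (W : Walk n j K c B) : (Hi n K c B ∪ Lo n j K c B).card ≤ 8 * (bd n j K c).card := by
  have := card_union_le (Hi n K c B) (Lo n j K c B)
  have := deg_ineq W
  have := card_Lo_le (n := n) (j := j) (K := K) (c := c) (B := B)
  omega

lemma three_le_degU (W : Walk n j K c B) {u t y : ℕ} (ht : t ≤ n) (hb : t ∉ bd n j K c)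
    (hut : B t = B u) (hy : y ∈ Lt n K c) (hi : Inc B u y) (h1 : c t ≠ y) (h2 : c (t-1) ≠ y) :
    3 ≤ degU n K c B u := by
  obtain ⟨k, hk, hlt, g1, g2, g3, _⟩ := W.interior ht hb
  have hk' : t - 1 = k := by omega
  rw [hk'] at h2
  have : ({y, c t, c k} : Finset ℕ) ⊆ (Lt n K c).filter fun y => Inc B u y := by
    intro z hz
    simp only [mem_insert, mem_singleton] at hz
    rw [mem_filter]
    rcases hz with rfl | rfl | rfl
    · exact ⟨hy, hi⟩
    · exact ⟨W.mem_Lt hlt g1, (Inc_congr hut).1 (W.inc_start hlt g1)⟩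
    · refine ⟨W.mem_Lt (by omega) g2, (Inc_congr hut).1 ?_⟩
      rw [hk]; exact W.inc_end (by omega) g2
  calc 3 = ({y, c t, c k} : Finset ℕ).card := by
        rw [card_insert_of_notMem, card_pair g3]
        simp only [mem_insert, mem_singleton, not_or]
        exact ⟨h1.symm, h2.symm⟩
    _ ≤ _ := card_le_card this

lemma card_Late (W : Walk n j K c B) : (Late n K c B).card ≤ 8 * (bd n j K c).card := by
  refine le_trans (card_le_card ?_) (card_HL W)
  rintro ⟨u, y⟩ h
  simp only [Late, mem_filter] at h
  have h' := h.1
  simp only [IncS, mem_filter, mem_product, Pos, mem_range] at h'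
  simp only [mem_union, Hi, Lo, mem_filter]
  by_cases hd : 3 ≤ degU n K c B u
  · left; exact ⟨h.1, hd⟩
  right
  refine ⟨h.1, ?_, by omega⟩
  by_cases hb : u ∈ bd n j K c
  · exact mem_image.2 ⟨u, hb, h'.1.1.2⟩
  exfalso
  apply hd
  obtain ⟨k, hk, hlt, _⟩ := W.interior (by omega) hb
  apply three_le_degU W (t := u) (by omega) hb rfl h'.1.2 h'.2
  · have := W.c_le u hlt; omega
  · have := W.c_le (u-1) (by omega); omega

/-- touched lone letters -/
lemma card_touched (W : Walk n j K c B) :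
    ((Lt n K c).filter fun y => (∀ i, i < n → c i = y → i = y) ∧
      ∃ v, v ≤ n ∧ v ≠ y ∧ v ≠ y + 1 ∧ Inc B v y).card ≤ 10 * (bd n j K c).card := by
  have key : ((Lt n K c).filter fun y => (∀ i, i < n → c i = y → i = y) ∧
      ∃ v, v ≤ n ∧ v ≠ y ∧ v ≠ y + 1 ∧ Inc B v y) ⊆
      (Ext n K c B ∪ (Hi n K c B ∪ Lo n j K c B)).image Prod.snd := by
    intro y hy
    rw [mem_filter] at hy
    obtain ⟨hy, hl, v, hv, hv1, hv2, hinc⟩ := hy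
    have hmem : (pI B v, y) ∈ IncS n K c B := by
      simp only [IncS, mem_filter, mem_product]
      exact ⟨⟨pI_mem_Pos hv, hy⟩, Inc_pI.2 hinc⟩
    rw [mem_image]
    refine ⟨(pI B v, y), ?_, rfl⟩
    simp only [mem_union, Ext, Hi, Lo, mem_filter]
    by_cases hd : 3 ≤ degU n K c B (pI B v)
    · right; left; exact ⟨hmem, hd⟩
    right; right
    refine ⟨hmem, ?_, by omega⟩
    by_cases hb : v ∈ bd n j K c
    · exact mem_image.2 ⟨v, hb, rfl⟩
    exfalso
    apply hd
    obtain ⟨k, hk, hlt, _⟩ := W.interior hv hb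
    apply three_le_degU W (t := v) hv hb (pI_spec B v).symm hy (Inc_pI.2 hinc)
    · intro h; exact hv1 (hl v hlt h)
    · intro h; have := hl (v-1) (by omega) h; omega
  refine le_trans (card_le_card key) (le_trans card_image_le ?_)
  have := card_union_le (Ext n K c B) (Hi n K c B ∪ Lo n j K c B)
  have := card_HL W
  have := card_Ext_le W
  omega

end
end MC


namespace MC
open Finset Classical

structure IsPath (B : ℕ → ℕ → ℚ) (u y : ℕ → ℕ) (a l : ℕ) : Prop where
  hs : ∀ k, a ≤ k → k ≤ l → Inc B (u k) (y k)
  he : ∀ k, a ≤ k → k < l → Inc B (u (k+1)) (y k)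
  hne : ∀ k, a ≤ k → k < l → B (u (k+1)) ≠ B (u k)
  hinj : ∀ k k', a ≤ k → k ≤ l → a ≤ k' → k' ≤ l → y k = y k' → k = k'

lemma IsPath.const {B : ℕ → ℕ → ℚ} {u y : ℕ → ℕ} {a l : ℕ} (P : IsPath B u y a l) (z s t : ℕ)
    (hs : a ≤ s) (hst : s ≤ t) (ht : t ≤ l) (h : ∀ k, s ≤ k → k < t → y k ≠ z) :
    B (u t) z = B (u s) z := by
  induction t, hst using Nat.le_induction with
  | base => rfl
  | succ t hst ih =>
    have hz := (h t hst (by omega)).symm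
    rw [P.he t (by omega) (by omega) z hz, ← P.hs t (by omega) (by omega) z hz]
    exact ih (by omega) (fun k hk hk' => h k hk (by omega))

lemma IsPath.step {B : ℕ → ℕ → ℚ} {u y : ℕ → ℕ} {a l : ℕ} (P : IsPath B u y a l) {k : ℕ}
    (h : a ≤ k) (h' : k < l) : B (u (k+1)) (y k) ≠ B (u k) (y k) := by
  intro e
  apply P.hne k h h'
  ext z
  by_cases hz : z = y k
  · rw [hz, e]
  · rw [P.he k h h' z hz, P.hs k h h'.le z hz]

lemma path_unique {B : ℕ → ℕ → ℚ} {u y u' y' : ℕ → ℕ} {a l : ℕ} (P : IsPath B u y a l)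
    (P' : IsPath B u' y' a l) (hal : a < l) (h0 : B (u a) = B (u' a)) (hl : y l = y' l) :
    y a = y' a ∧ B (u (a+1)) = B (u' (a+1)) := by
  have hya : y a ≠ y l := fun h => by have := P.hinj a l le_rfl hal.le hal.le le_rfl h; omega
  have e1 : B (u l) (y a) = B (u (a+1)) (y a) :=
    P.const _ _ _ (by omega) (by omega) le_rfl (fun k hk hk' h => by
      have := P.hinj k a (by omega) (by omega) le_rfl hal.le h; omega)
  have e2 : B (u l) (y a) = B (u' l) (y a) := by
    rw [P.hs l hal.le le_rfl _ hya, P'.hs l hal.le le_rfl _ (hl ▸ hya), hl]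
  have e3 : B (u' l) (y a) ≠ B (u' a) (y a) := by
    rw [← e2, e1, ← h0]; exact P.step le_rfl hal
  have hex : ∃ k, a ≤ k ∧ k < l ∧ y' k = y a := by
    by_contra hcon
    push Not at hcon
    exact e3 (P'.const _ _ _ le_rfl hal.le le_rfl hcon)
  obtain ⟨k, hk1, hk2, hk3⟩ := hex
  have hka : k = a := by
    by_contra hka
    have hne : y' a ≠ y' k := fun h => hka (P'.hinj a k le_rfl hal.le hk1 hk2.le h).symm
    have f1 : B (u' k) (y' a) = B (u' (a+1)) (y' a) :=
      P'.const _ _ _ (by omega) (by omega) (by omega) (fun i hi hi' h => by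
        have := P'.hinj i a (by omega) (by omega) le_rfl hal.le h; omega)
    have f2 := P'.step le_rfl hal
    apply f2
    rw [← f1, ← h0, P'.hs k hk1 hk2.le _ hne, P.hs a le_rfl hal.le _ (hk3 ▸ hne), hk3]
  subst hka
  refine ⟨hk3.symm, ?_⟩
  have e1' : B (u' l) (y k) = B (u' (k+1)) (y k) :=
    P'.const _ _ _ (by omega) (by omega) le_rfl (fun i hi hi' h => by
      have := P'.hinj i k (by omega) (by omega) le_rfl hal.le (h.trans hk3.symm); omega)
  ext z
  by_cases hz : z = y k
  · rw [hz, ← e1, e2, e1']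
  · rw [P.he k le_rfl hal z hz, P'.he k le_rfl hal z (by rw [hk3]; exact hz), hk3]

def isN (K : Finset ℕ) (c : ℕ → ℕ) (B : ℕ → ℕ → ℚ) (i : ℕ) : Prop :=
  c i ∉ K ∧ c i = i ∧ pI B (i+1) = i+1
def isF (n j : ℕ) (K : Finset ℕ) (c : ℕ → ℕ) (B : ℕ → ℕ → ℚ) (i : ℕ) : Prop :=
  c i ∉ K ∧ c i < i ∧ pI B (i+1) < i+1 ∧ i+1 ∉ bd n j K c ∧ c (i+1) < i+1

noncomputable def Fs (n j : ℕ) (K : Finset ℕ) (c : ℕ → ℕ) (B : ℕ → ℕ → ℚ) : Finset ℕ :=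
  (range n).filter fun i => isF n j K c B i
noncomputable def Es (n j : ℕ) (K : Finset ℕ) (c : ℕ → ℕ) (B : ℕ → ℕ → ℚ) : Finset ℕ :=
  (range n).filter fun i => ¬ isN K c B i ∧ ¬ isF n j K c B i
noncomputable def Et (n j : ℕ) (K : Finset ℕ) (c : ℕ → ℕ) (B : ℕ → ℕ → ℚ) : Finset (ℕ × ℕ × ℕ) :=
  (Es n j K c B).image fun i => (i, c i, pI B (i+1))

section
variable {n j : ℕ} {K : Finset ℕ} {c : ℕ → ℕ} {B : ℕ → ℕ → ℚ}

lemma card_Es (W : Walk n j K c B) : (Es n j K c B).card ≤ 20 * (bd n j K c).card := by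
  set Sa := (range n).filter fun i => c i ∈ K
  set Sb := (range n).filter fun i => c i ∉ K ∧ c i = i ∧ pI B (i+1) < i+1
  set Sc := (range n).filter fun i => c i ∉ K ∧ c i < i ∧ pI B (i+1) = i+1
  set Sd := (range n).filter fun i => i + 1 ∈ bd n j K c
  set Se := (range n).filter fun i => i + 1 ∉ bd n j K c ∧ pI B (i+1) < i + 1 ∧ c (i+1) = i+1
  have hsub : Es n j K c B ⊆ Sa ∪ (Sb ∪ (Sc ∪ (Sd ∪ Se))) := by
    intro i hi
    simp only [Es, mem_filter, mem_range] at hi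
    simp only [isN, isF] at hi
    obtain ⟨hi, h1, h2⟩ := hi
    simp only [Sa, Sb, Sc, Sd, Se, mem_union, mem_filter, mem_range]
    have := W.c_le i hi
    have := pI_le B (i+1)
    have h3 : i + 1 < n → c (i+1) ≤ i + 1 := W.c_le (i+1)
    have h4 : i + 1 ∉ bd n j K c → i + 1 < n := fun h => by
      obtain ⟨k, _, h, _⟩ := W.interior (by omega) h
      exact h
    by_cases ha : c i ∈ K
    · simp [ha, hi]
    by_cases hb : i + 1 ∈ bd n j K c
    · simp [hb, hi]
    have := h3 (h4 hb)
    simp only [ha, hb, not_false_eq_true, true_and, hi, false_or, false_and] at h1 h2 ⊢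
    omega
  have ca : Sa.card ≤ (bd n j K c).card := by
    apply card_le_card
    intro i hi
    simp only [Sa, mem_filter, mem_range] at hi
    exact mem_bd_of (by omega) (by tauto)
  have cb : Sb.card ≤ 8 * (bd n j K c).card := by
    refine le_trans ?_ (card_Late W)
    apply card_le_card_of_injOn (fun i => (pI B (i+1), i))
    · intro i hi
      simp only [Sb, coe_filter, mem_range, Set.mem_ofPred_eq] at hi
      obtain ⟨hi, h1, h2, h3⟩ := hi
      simp only [Late, IncS, mem_filter, mem_product, mem_coe]
      have hL : i ∈ Lt n K c := by simp only [Lt, mem_filter, mem_range]; exact ⟨hi, h2, by rwa [h2] at h1⟩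
      refine ⟨⟨⟨pI_mem_Pos hi, hL⟩, Inc_pI.2 inc_b⟩, ?_⟩
      have h4 := W.pI_ne' hL
      by_contra h5
      have h6 : pI B (i+1) = i := by omega
      apply h4
      have := pI_idem B (i+1)
      rw [h6] at this
      rw [this, h6]
    · intro a _ b _ h; simp only [Prod.mk.injEq] at h; exact h.2
  have cc : Sc.card ≤ 2 * (bd n j K c).card := by
    refine le_trans ?_ (card_Ext_le W)
    apply card_le_card_of_injOn (fun i => (i+1, c i))
    · intro i hi
      simp only [Sc, coe_filter, mem_range, Set.mem_ofPred_eq] at hi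
      obtain ⟨hi, h1, h2, h3⟩ := hi
      simp only [Ext, IncS, mem_filter, mem_product, mem_coe]
      refine ⟨⟨⟨?_, W.mem_Lt hi h1⟩, W.inc_end hi h1⟩, ?_, ?_⟩
      · simp only [Pos, mem_filter, mem_range]; exact ⟨by omega, h3⟩
      · have := pI_le B (c i); omega
      · have := pI_le B (c i + 1); omega
    · intro a _ b _ h; simp only [Prod.mk.injEq] at h; omega
  have cd : Sd.card ≤ (bd n j K c).card := by
    apply card_le_card_of_injOn (fun i => i+1)
    · intro i hi
      simp only [Sd, coe_filter, mem_range, Set.mem_ofPred_eq] at hi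
      exact hi.2
    · intro a _ b _ h; simp only at h; omega
  have ce : Se.card ≤ 8 * (bd n j K c).card := by
    refine le_trans ?_ (card_Late W)
    apply card_le_card_of_injOn (fun i => (pI B (i+1), i+1))
    · intro i hi
      simp only [Se, coe_filter, mem_range, Set.mem_ofPred_eq] at hi
      obtain ⟨hi, h1, h2, h3⟩ := hi
      obtain ⟨k, _, hlt, hK, _⟩ := W.interior (by omega : i + 1 ≤ n) h1
      have hL : i+1 ∈ Lt n K c := by have := W.mem_Lt hlt hK; rwa [h3] at this
      simp only [Late, IncS, mem_filter, mem_product, mem_coe]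
      exact ⟨⟨⟨pI_mem_Pos (by omega), hL⟩, Inc_pI.2 (W.inc_a hL)⟩, h2⟩
    · intro a _ b _ h; simp only [Prod.mk.injEq] at h; omega
  have := card_le_card hsub
  have := card_union_le Sa (Sb ∪ (Sc ∪ (Sd ∪ Se)))
  have := card_union_le Sb (Sc ∪ (Sd ∪ Se))
  have := card_union_le Sc (Sd ∪ Se)
  have := card_union_le Sd Se
  omega

lemma IncS_iff (W : Walk n j K c B) (u y : ℕ) : (u, y) ∈ IncS n K c B ↔
    (y ∈ Lt n K c ∧ (u = pI B y ∨ u = pI B (y+1))) ∨ (u, y) ∈ Ext n K c B := by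
  simp only [Ext, mem_filter]
  constructor
  · intro h
    by_cases h1 : u = pI B y ∨ u = pI B (y+1)
    · left
      simp only [IncS, mem_filter, mem_product] at h
      exact ⟨h.1.2, h1⟩
    · right; exact ⟨h, by tauto⟩
  · rintro (⟨h, rfl | rfl⟩ | h)
    · simp only [IncS, mem_filter, mem_product]
      exact ⟨⟨pI_mem_Pos (Lt_c h).1.le, h⟩, Inc_pI.2 (W.inc_a h)⟩
    · simp only [IncS, mem_filter, mem_product]
      exact ⟨⟨pI_mem_Pos (Lt_c h).1, h⟩, Inc_pI.2 inc_b⟩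
    · exact h.1

/-- an F-run from `a` to `l` -/
structure Run (n j : ℕ) (K : Finset ℕ) (c : ℕ → ℕ) (B : ℕ → ℕ → ℚ) (a l : ℕ) : Prop where
  lt : a < l
  ln : l < n
  lab : ∀ k, a ≤ k → k ≤ l → c k < a ∧ c k ∉ K
  pos : ∀ k, a ≤ k → k ≤ l → pI B k ≤ a
  path : IsPath B (pI B) c a l

lemma mk_run (W : Walk n j K c B) {a l : ℕ} (hal : a < l)
    (hF : ∀ k, a ≤ k → k < l → isF n j K c B k) (hl : ¬ isF n j K c B l) (hln : l ≤ n) :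
    Run n j K c B a l := by
  have hinn : ∀ k, a ≤ k → k < l → k + 1 < n ∧ c (k+1) ∉ K ∧ k / j = (k+1) / j := by
    intro k h1 h2
    obtain ⟨k', hk', h3, h4, _, _, h5⟩ := W.interior (by omega : k + 1 ≤ n) (hF k h1 h2).2.2.2.1
    have : k = k' := by omega
    subst this
    exact ⟨h3, h4, h5⟩
  have hln' : l < n := by have := (hinn (l-1) (by omega) (by omega)).1; omega
  have hold : ∀ k, a ≤ k → k ≤ l → c k < k ∧ c k ∉ K := by
    intro k h1 h2
    rcases eq_or_lt_of_le h1 with rfl | h1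
    · exact ⟨(hF _ le_rfl hal).2.1, (hF _ le_rfl hal).1⟩
    · obtain ⟨m, rfl⟩ : ∃ m, k = m + 1 := ⟨k - 1, by omega⟩
      exact ⟨(hF m (by omega) (by omega)).2.2.2.2, (hinn m (by omega) (by omega)).2.1⟩
  have hlab : ∀ k, a ≤ k → k ≤ l → c k < a ∧ c k ∉ K := by
    intro k h1 h2
    refine ⟨?_, (hold k h1 h2).2⟩
    by_contra h3
    have h4 := hold k h1 h2
    have h5 := hF (c k) (by omega) (by omega)
    have := W.c_idem k (by omega)
    have := h5.2.1
    omega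
  have hblk : ∀ k, a ≤ k → k ≤ l → k / j = a / j := by
    intro k h1 h2
    induction k, h1 using Nat.le_induction with
    | base => rfl
    | succ m hm ih => rw [← (hinn m hm (by omega)).2.2]; exact ih (by omega)
  refine ⟨hal, hln', hlab, ?_, ?_, ?_, ?_, ?_⟩
  · intro k h1 h2
    by_contra h3
    have h4 := pI_le B k
    have h5 := (hF (pI B k - 1) (by omega) (by omega)).2.2.1
    have h6 : pI B k - 1 + 1 = pI B k := by omega
    rw [h6, pI_idem] at h5
    omega
  · intro k h1 h2
    exact Inc_pI.2 (W.inc_start (by omega) (hlab k h1 h2).2)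
  · intro k h1 h2
    exact Inc_pI.2 (W.inc_end (by omega) (hlab k h1 h2.le).2)
  · intro k h1 h2 h
    rw [pI_spec B, pI_spec B] at h
    exact W.ne_step (by omega) (hlab k h1 h2.le).2 h
  · intro k k' h1 h2 h3 h4 h
    exact W.block k k' (by omega) (by omega) (by rw [hblk k h1 h2, hblk k' h3 h4]) h

lemma code_inj {c' : ℕ → ℕ} {B' : ℕ → ℕ → ℚ} (W : Walk n j K c B) (W' : Walk n j K c' B')
    (hE : Et n j K c B = Et n j K c' B') (hF : Fs n j K c B = Fs n j K c' B')
    (hX : Ext n K c B = Ext n K c' B') : ∀ i, i < n → c i = c' i := by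
  have main : ∀ i, i ≤ n → (∀ k, k < i → c k = c' k) ∧ (∀ t, t ≤ i → pI B t = pI B' t) := by
    intro i
    induction i with
    | zero =>
      intro _
      refine ⟨by simp, ?_⟩
      intro t ht
      have := pI_le B t
      have := pI_le B' t
      omega
    | succ i ih =>
      intro hi
      obtain ⟨ih1, ih2⟩ := ih (by omega)
      suffices h : c i = c' i ∧ pI B (i+1) = pI B' (i+1) by
        constructor
        · intro k hk
          rcases Nat.lt_succ_iff_lt_or_eq.1 hk with h' | rfl
          · exact ih1 k h'
          · exact h.1
        · intro t ht
          rcases Nat.le_succ_iff.1 ht with h' | rfl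
          · exact ih2 t h'
          · exact h.2
      have hFiff : ∀ k, k < n → (isF n j K c B k ↔ isF n j K c' B' k) := by
        intro k hk
        have := congrArg (fun s => k ∈ s) hF
        simpa [Fs, hk] using this
      have hEval : ∀ k, k < n → ¬ isN K c B k → ¬ isF n j K c B k → c k = c' k ∧ pI B (k+1) = pI B' (k+1) := by
        intro k hk h1 h2
        have : (k, c k, pI B (k+1)) ∈ Et n j K c' B' := by
          rw [← hE]
          exact mem_image.2 ⟨k, by simp [Es, hk, h1, h2], rfl⟩
        obtain ⟨k', _, h⟩ := mem_image.1 this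
        simp only [Prod.mk.injEq] at h
        obtain ⟨rfl, h1, h2⟩ := h
        exact ⟨h1.symm, h2.symm⟩
      have hEval' : ∀ k, k < n → ¬ isN K c' B' k → ¬ isF n j K c' B' k → c k = c' k ∧ pI B (k+1) = pI B' (k+1) := by
        intro k hk h1 h2
        have : (k, c' k, pI B' (k+1)) ∈ Et n j K c B := by
          rw [hE]
          exact mem_image.2 ⟨k, by simp [Es, hk, h1, h2], rfl⟩
        obtain ⟨k', _, h⟩ := mem_image.1 this
        simp only [Prod.mk.injEq] at h
        obtain ⟨rfl, h1, h2⟩ := h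
        exact ⟨h1, h2⟩
      by_cases hf : isF n j K c B i
      · -- F step
        have hf' := (hFiff i (by omega)).1 hf
        have hex : ∃ l, i ≤ l ∧ (l = n ∨ ¬ isF n j K c B l) := ⟨n, by omega, Or.inl rfl⟩
        set l := Nat.find hex with hldef
        have hl := Nat.find_spec hex
        rw [← hldef] at hl
        have hmin : ∀ k, i ≤ k → k < l → k ≠ n ∧ isF n j K c B k := by
          intro k h1 h2
          have := Nat.find_min hex (hldef ▸ h2)
          push Not at this
          exact this h1
        have hln : l ≤ n := Nat.find_min' hex ⟨by omega, Or.inl rfl⟩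
        have hil : i < l := by
          rcases eq_or_lt_of_le hl.1 with h | h
          · rw [← h] at hl
            rcases hl.2 with h' | h'
            · omega
            · exact absurd hf h'
          · exact h
        have hlF : ¬ isF n j K c B l := by
          rcases hl.2 with h | h
          · intro h'
            obtain ⟨k, hk, h1, _⟩ := W.interior (by omega : (l-1)+1 ≤ n) (hmin (l-1) (by omega) (by omega)).2.2.2.2.1
            omega
          · exact h
        have R := mk_run W hil (fun k h1 h2 => (hmin k h1 h2).2) hlF hln
        have hlF' : ¬ isF n j K c' B' l := fun h => hlF ((hFiff l R.ln).2 h)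
        have R' := mk_run W' hil (fun k h1 h2 => (hFiff k (by omega)).1 (hmin k h1 h2).2) hlF' hln
        have hnN : ¬ isN K c B l := fun h => by
          have := (R.lab l hil.le le_rfl).1
          have := h.2.1
          omega
        have hcl := (hEval l R.ln hnN hlF).1
        -- transfer of incidences
        have trans : ∀ u y, u ≤ i → y < i → pI B' u = u → c' y = y → y ∉ K → Inc B' u y → Inc B u y := by
          intro u y hu hy h1 h2 h3 h4
          have hL : y ∈ Lt n K c' := by simp only [Lt, mem_filter, mem_range]; exact ⟨by omega, h2, h3⟩
          have hL2 : y ∈ Lt n K c := by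
            simp only [Lt, mem_filter, mem_range]; exact ⟨by omega, (ih1 y hy).trans h2, h3⟩
          have hm : (u, y) ∈ IncS n K c' B' := by
            simp only [IncS, Pos, mem_filter, mem_product, mem_range]
            exact ⟨⟨⟨by omega, h1⟩, hL⟩, h4⟩
          have hm2 : (u, y) ∈ IncS n K c B := by
            rw [IncS_iff W]
            rw [IncS_iff W'] at hm
            rcases hm with ⟨_, h⟩ | h
            · left
              rw [ih2 y (by omega), ih2 (y+1) (by omega)]
              exact ⟨hL2, h⟩
            · right; rw [hX]; exact h
          simp only [IncS, mem_filter] at hm2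
          exact hm2.2
        have hpI : ∀ u, u ≤ i → pI B' u = u → pI B u = u := fun u h1 h2 => by rw [ih2 u h1, h2]
        have hcid : ∀ k, i ≤ k → k ≤ l → c' (c' k) = c' k := fun k _ h => W'.c_idem k (by have := R.ln; omega)
        have P' : IsPath B (pI B') c' i l := by
          refine ⟨?_, ?_, ?_, R'.path.hinj⟩
          · intro k h1 h2
            exact trans _ _ (R'.pos k h1 h2) (R'.lab k h1 h2).1 (pI_idem _ _) (hcid k h1 h2) (R'.lab k h1 h2).2
              (R'.path.hs k h1 h2)
          · intro k h1 h2
            exact trans _ _ (R'.pos (k+1) (by omega) (by omega)) (R'.lab k h1 h2.le).1 (pI_idem _ _)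
              (hcid k h1 h2.le) (R'.lab k h1 h2.le).2 (R'.path.he k h1 h2)
          · intro k h1 h2 h
            have e1 := hpI _ (R'.pos (k+1) (by omega) (by omega)) (pI_idem B' (k+1))
            have e2 := hpI _ (R'.pos k h1 h2.le) (pI_idem B' k)
            have := pI_congr h
            rw [e1, e2] at this
            exact R'.path.hne k h1 h2 (by rw [this])
        have h0 : B (pI B i) = B (pI B' i) := by rw [ih2 i le_rfl]
        have res := path_unique R.path P' hil h0 hcl
        refine ⟨res.1, ?_⟩
        have := pI_congr res.2
        rw [pI_idem, hpI _ (R'.pos (i+1) (by omega) (by omega)) (pI_idem B' (i+1))] at this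
        exact this
      · by_cases hn : isN K c B i
        · by_cases hn' : isN K c' B' i
          · exact ⟨by rw [hn.2.1, hn'.2.1], by rw [hn.2.2, hn'.2.2]⟩
          · exact hEval' i (by omega) hn' (fun h => hf ((hFiff i (by omega)).2 h))
        · exact hEval i (by omega) hn hf
  exact (main n le_rfl).1

end
end MC


namespace MC
open Finset Classical

lemma card_small {α : Type*} (X : Finset α) (k : ℕ) :
    (X.powerset.filter fun S => S.card ≤ k).card ≤ (X.card + 1) ^ k := by
  classical
  induction k with
  | zero =>
    rw [pow_zero, card_le_one]
    intro a ha b hb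
    simp only [mem_filter, nonpos_iff_eq_zero, card_eq_zero] at ha hb
    rw [ha.2, hb.2]
  | succ k ih =>
    have hsub : (X.powerset.filter fun S => S.card ≤ k+1) ⊆
        ((insertNone X) ×ˢ (X.powerset.filter fun S => S.card ≤ k)).image
          (fun q => q.1.elim q.2 (fun a => insert a q.2)) := by
      intro S hS
      simp only [mem_filter, mem_powerset] at hS
      rw [mem_image]
      rcases S.eq_empty_or_nonempty with rfl | ⟨a, ha⟩
      · exact ⟨(none, ∅), by simp, rfl⟩
      · refine ⟨(some a, S.erase a), ?_, by simp [insert_erase ha]⟩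
        simp only [mem_product, some_mem_insertNone, mem_filter, mem_powerset]
        refine ⟨hS.1 ha, (erase_subset _ _).trans hS.1, ?_⟩
        rw [card_erase_of_mem ha]; omega
    calc _ ≤ _ := card_le_card hsub
      _ ≤ _ := card_image_le
      _ = (X.card + 1) * (X.powerset.filter fun S => S.card ≤ k).card := by
        rw [card_product, card_insertNone]
      _ ≤ (X.card + 1) * (X.card+1)^k := Nat.mul_le_mul_left _ ih
      _ = _ := by ring

theorem pattern_count (n j β : ℕ) (K : Finset ℕ) (CC : Finset (ℕ → ℕ))
    (h : ∀ c ∈ CC, (∀ i, n ≤ i → c i = 0) ∧ ∃ B, Walk n j K c B ∧ (bd n j K c).card ≤ β) :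
    CC.card ≤ 2 ^ n * (n + 2) ^ (64 * β) := by
  classical
  have h' : ∀ c, ∃ B : ℕ → ℕ → ℚ, c ∈ CC → Walk n j K c B ∧ (bd n j K c).card ≤ β := by
    intro c
    by_cases hc : c ∈ CC
    · obtain ⟨B, hB⟩ := (h c hc).2; exact ⟨B, fun _ => hB⟩
    · exact ⟨fun _ _ => 0, fun h => absurd h hc⟩
  choose B hB using h'
  set X3 := (range (n+1)) ×ˢ (range (n+1)) ×ˢ (range (n+1)) with hX3
  set X2 := (range (n+1)) ×ˢ (range (n+1)) with hX2
  set T := (range n).powerset ×ˢ (X3.powerset.filter fun S => S.card ≤ 20 * β) ×ˢ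
    (X2.powerset.filter fun S => S.card ≤ 2 * β) with hT
  have hle : CC.card ≤ T.card := by
    apply card_le_card_of_injOn (fun c => (Fs n j K c (B c), Et n j K c (B c), Ext n K c (B c)))
    · intro c hc
      obtain ⟨W, hb⟩ := hB c hc
      simp only [hT, mem_coe, mem_product, mem_powerset, mem_filter]
      refine ⟨filter_subset _ _, ⟨?_, ?_⟩, ?_, ?_⟩
      · intro q hq
        obtain ⟨i, hi, rfl⟩ := mem_image.1 hq
        simp only [Es, mem_filter, mem_range] at hi
        simp only [hX3, hX2, mem_product, mem_range]
        have := W.c_le i hi.1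
        have := pI_le (B c) (i+1)
        have := hi.1
        exact ⟨by omega, by omega, by omega⟩
      · exact card_image_le.trans ((card_Es W).trans (Nat.mul_le_mul_left _ hb))
      · intro q hq
        simp only [Ext, IncS, Pos, Lt, mem_filter, mem_product, mem_range] at hq
        simp only [hX2, mem_product, mem_range]
        omega
      · exact (card_Ext_le W).trans (Nat.mul_le_mul_left _ hb)
    · intro c hc c' hc' he
      simp only [Prod.mk.injEq] at he
      have := code_inj (hB c hc).1 (hB c' hc').1 he.2.1 he.1 he.2.2
      funext i
      by_cases hi : i < n
      · exact this i hi
      · rw [(h c hc).1 i (by omega), (h c' hc').1 i (by omega)]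
  have e3 : X3.card + 1 ≤ (n+2)^3 := by
    rw [hX3, hX2, card_product, card_product, card_range]
    nlinarith [Nat.zero_le n]
  have e2 : X2.card + 1 ≤ (n+2)^2 := by
    rw [hX2, card_product, card_range]
    nlinarith [Nat.zero_le n]
  refine hle.trans ?_
  rw [hT, card_product, card_product, card_powerset, card_range]
  apply Nat.mul_le_mul_left
  calc _ ≤ (X3.card+1)^(20*β) * (X2.card+1)^(2*β) := Nat.mul_le_mul (card_small _ _) (card_small _ _)
    _ ≤ ((n+2)^3)^(20*β) * ((n+2)^2)^(2*β) :=
      Nat.mul_le_mul (Nat.pow_le_pow_left e3 _) (Nat.pow_le_pow_left e2 _)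
    _ = (n+2)^(64*β) := by rw [← pow_mul, ← pow_mul, ← pow_add]; congr 1; ring

lemma card_cut {q j : ℕ} {K : Finset ℕ} {c : ℕ → ℕ}
    (hblk : ∀ i i', i < q*j → i' < q*j → i / j = i' / j → c i = c i' → i = i') :
    ((range (q*j)).filter fun i => c i ∈ K).card ≤ K.card * q := by
  calc _ ≤ (K ×ˢ range q).card := by
        apply card_le_card_of_injOn (fun i => (c i, i / j))
        · intro i hi
          simp only [coe_filter, mem_range, Set.mem_ofPred_eq] at hi
          simp only [coe_product, Set.mem_prod, mem_coe, mem_range]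
          exact ⟨hi.2, Nat.div_lt_of_lt_mul (by rw [mul_comm]; exact hi.1)⟩
        · intro a ha b hb h
          simp only [coe_filter, mem_range, Set.mem_ofPred_eq] at ha hb
          simp only [Prod.mk.injEq] at h
          exact hblk a b ha.1 hb.1 h.2 h.1
    _ = _ := by rw [card_product, card_range]

lemma card_bd {q j : ℕ} {K : Finset ℕ} {c : ℕ → ℕ} (hj : 0 < j)
    (hblk : ∀ i i', i < q*j → i' < q*j → i / j = i' / j → c i = c i' → i = i') :
    (bd (q*j) j K c).card ≤ q + 1 + 2 * (K.card * q) := by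
  have hcut := card_cut (K := K) hblk
  set cut := (range (q*j)).filter fun i => c i ∈ K
  have hsub : bd (q*j) j K c ⊆ (range (q+1)).image (fun k => k * j) ∪ (cut ∪ cut.image (fun i => i+1)) := by
    intro t ht
    simp only [bd, mem_filter, mem_range] at ht
    simp only [mem_union, mem_image, mem_range, cut, mem_filter]
    obtain ⟨h1, h2⟩ := ht
    rcases h2 with rfl | rfl | ⟨k, rfl⟩ | h | h
    · left; exact ⟨0, by omega, by simp⟩
    · left; exact ⟨q, by omega, rfl⟩
    · left
      refine ⟨k, ?_, by ring⟩
      by_contra hk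
      have : (q+1) * j ≤ k * j := Nat.mul_le_mul_right _ (by omega)
      nlinarith
    · right; left; exact h
    · right; right; exact ⟨t-1, ⟨by omega, h.2⟩, by omega⟩
  have h1 := card_le_card hsub
  have h2 := card_union_le ((range (q+1)).image (fun k => k * j)) (cut ∪ cut.image (fun i => i+1))
  have h3 := card_union_le cut (cut.image (fun i => i+1))
  have h4 := card_image_le (s := cut) (f := fun i => i+1)
  have h5 := card_image_le (s := range (q+1)) (f := fun k => k*j)
  rw [card_range] at h5
  omega

end MC


namespace MC
open Finset Classical

noncomputable def lab (n : ℕ) (c : ℕ → ℕ) : Finset ℕ := (range n).filter fun y => c y = y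

/-- formal position -/
def Ap (c : ℕ → ℕ) (s : ℕ → ℤ) (t z : ℕ) : ℤ := ∑ i ∈ range t, if c i = z then s i else 0

def Frow (c : ℕ → ℕ) (s : ℕ → ℤ) (ρ : ℕ × ℕ × ℤ) (z : ℕ) : ℤ := Ap c s ρ.2.1 z - Ap c s (ρ.1 + 1) z

structure Good (n : ℕ) (c : ℕ → ℕ) (s : ℕ → ℤ) (I : Finset (ℕ × ℕ × ℤ)) (J : Finset ℕ) : Prop where
  sub : J ⊆ lab n c
  card : I.card = J.card
  dis : ∀ ρ ∈ I, ρ.1 ∉ J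
  inj : ∀ δ : ℕ → ℚ, (∀ ρ ∈ I, ∑ z ∈ J, (Frow c s ρ z : ℚ) * δ z = 0) → ∀ z ∈ J, δ z = 0

section
variable {n : ℕ} {c : ℕ → ℕ} {s : ℕ → ℤ} {I : Finset (ℕ × ℕ × ℤ)} {J : Finset ℕ}

lemma exists_kappa (G : Good n c s I J) {y : ℕ} (hy : y ∉ J) :
    ∃ κ : ℕ → ℚ, κ y = 1 ∧ ∀ ρ ∈ I, ∑ z ∈ insert y J, (Frow c s ρ z : ℚ) * κ z = 0 := by
  let T : (J → ℚ) →ₗ[ℚ] (I → ℚ) :=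
    { toFun := fun δ ρ => ∑ z : J, (Frow c s ρ z : ℚ) * δ z
      map_add' := by intro a b; ext ρ; simp [mul_add, Finset.sum_add_distrib]
      map_smul' := by
        intro a b; ext ρ
        simp only [Pi.smul_apply, smul_eq_mul, RingHom.id_apply, Finset.mul_sum]
        apply Finset.sum_congr rfl; intro z _; ring }
  have hinj : Function.Injective T := by
    rw [← LinearMap.ker_eq_bot, LinearMap.ker_eq_bot']
    intro δ hδ
    have h := G.inj (fun z => if h : z ∈ J then δ ⟨z, h⟩ else 0) (by
      intro ρ hρ
      have := congrFun hδ ⟨ρ, hρ⟩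
      simp only [T, LinearMap.coe_mk, AddHom.coe_mk, Pi.zero_apply] at this
      rw [← this, ← Finset.sum_coe_sort J]
      apply Finset.sum_congr rfl
      intro z _
      simp)
    ext z
    have := h z z.2
    simpa using this
  have hsurj : Function.Surjective T := by
    apply (LinearMap.injective_iff_surjective_of_finrank_eq_finrank _).1 hinj
    simp [G.card]
  obtain ⟨δ, hδ⟩ := hsurj (fun ρ => - (Frow c s ρ y : ℚ))
  refine ⟨fun z => if z = y then 1 else if h : z ∈ J then δ ⟨z, h⟩ else 0, by simp, ?_⟩
  intro ρ hρ
  have := congrFun hδ ⟨ρ, hρ⟩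
  simp only [T, LinearMap.coe_mk, AddHom.coe_mk] at this
  rw [Finset.sum_insert hy]
  rw [← Finset.sum_coe_sort J]
  have e : ∑ z : J, (Frow c s ρ z : ℚ) * (if (z:ℕ) = y then 1 else if h : (z:ℕ) ∈ J then δ ⟨z, h⟩ else 0)
      = ∑ z : J, (Frow c s ρ z : ℚ) * δ z := by
    apply Finset.sum_congr rfl
    intro z _
    have : (z:ℕ) ≠ y := fun h => hy (h ▸ z.2)
    simp [this]
  rw [e, this]; simp

lemma Good.extend (G : Good n c s I J) {y : ℕ} (hy : y ∉ J) (hyl : y ∈ lab n c)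
    (hyI : ∀ ρ ∈ I, ρ.1 ≠ y) {κ : ℕ → ℚ} (h1 : κ y = 1)
    (h2 : ∀ ρ ∈ I, ∑ z ∈ insert y J, (Frow c s ρ z : ℚ) * κ z = 0) {ρ : ℕ × ℕ × ℤ}
    (hρJ : ρ.1 ∉ J) (hρy : ρ.1 ≠ y) (h3 : ∑ z ∈ insert y J, (Frow c s ρ z : ℚ) * κ z ≠ 0) :
    Good n c s (insert ρ I) (insert y J) := by
  have hρI : ρ ∉ I := fun h => h3 (h2 ρ h)
  refine ⟨?_, ?_, ?_, ?_⟩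
  · intro z hz
    rcases mem_insert.1 hz with rfl | hz
    · exact hyl
    · exact G.sub hz
  · rw [card_insert_of_notMem hρI, card_insert_of_notMem hy, G.card]
  · intro ρ' h
    rw [mem_insert, not_or]
    rcases mem_insert.1 h with rfl | h
    · exact ⟨hρy, hρJ⟩
    · exact ⟨hyI _ h, G.dis _ h⟩
  · intro δ hδ
    have hJ : ∀ z ∈ J, δ z - δ y * κ z = 0 := by
      apply G.inj (fun z => δ z - δ y * κ z)
      intro ρ' h'
      have e1 := hδ ρ' (mem_insert_of_mem h')
      have e2 := h2 ρ' h'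
      rw [Finset.sum_insert hy] at e1 e2
      rw [h1] at e2
      have : ∑ z ∈ J, (Frow c s ρ' z : ℚ) * (δ z - δ y * κ z)
          = ∑ z ∈ J, (Frow c s ρ' z : ℚ) * δ z - δ y * ∑ z ∈ J, (Frow c s ρ' z : ℚ) * κ z := by
        rw [Finset.mul_sum, ← Finset.sum_sub_distrib]
        apply Finset.sum_congr rfl; intro z _; ring
      rw [this]
      linear_combination e1 - δ y * e2
    have hall : ∀ z ∈ insert y J, δ z = δ y * κ z := by
      intro z hz
      rcases mem_insert.1 hz with rfl | hz
      · rw [h1, mul_one]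
      · linear_combination hJ z hz
    have hy0 : δ y = 0 := by
      have e := hδ ρ (mem_insert_self _ _)
      have : ∑ z ∈ insert y J, (Frow c s ρ z : ℚ) * δ z = δ y * ∑ z ∈ insert y J, (Frow c s ρ z : ℚ) * κ z := by
        rw [Finset.mul_sum]
        apply Finset.sum_congr rfl
        intro z hz; rw [hall z hz]; ring
      rw [this] at e
      exact (mul_eq_zero.1 e).resolve_right h3
    intro z hz
    rw [hall z hz, hy0, zero_mul]

lemma Ap_succ (t z : ℕ) : Ap c s (t+1) z = Ap c s t z + if c t = z then s t else 0 := by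
  simp only [Ap, Finset.sum_range_succ]

theorem exists_IJ (n : ℕ) (c : ℕ → ℕ) (s : ℕ → ℤ) (hs : ∀ i, s i ≠ 0)
    (hc1 : ∀ i, i < n → c i ≤ i) (hc2 : ∀ i, i < n → c (c i) = c i) (V : Finset (ℕ × ℕ × ℤ)) :
    ∃ I J, I ⊆ V ∧ Good n c s I J ∧ ∃ B : ℕ → ℕ → ℚ,
      (∀ i, i < n → c i ∉ J ∪ I.image Prod.fst →
        ∃ t : ℚ, t ≠ 0 ∧ ∀ z, B (i+1) z = B i z + if z = c i then t else 0) ∧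
      (∀ ρ ∈ V, ρ.1 ∉ J ∪ I.image Prod.fst → ∀ z, z ≠ ρ.1 → B ρ.2.1 z = B (ρ.1 + 1) z) := by
  set S := (V.powerset ×ˢ (lab n c).powerset).filter fun q => Good n c s q.1 q.2 with hS
  have hne : S.Nonempty := by
    refine ⟨(∅, ∅), ?_⟩
    simp only [hS, mem_filter, mem_product, mem_powerset, empty_subset, true_and]
    exact ⟨by simp, by simp, by simp, by simp⟩
  obtain ⟨⟨I, J⟩, hm, hmax⟩ := exists_max_image S (fun q => q.2.card) hne
  simp only [hS, mem_filter, mem_product, mem_powerset] at hm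
  obtain ⟨⟨hIV, hJ⟩, G⟩ := hm
  set K := J ∪ I.image Prod.fst with hK
  have hκ : ∀ y, ∃ κ : ℕ → ℚ, y ∉ J → κ y = 1 ∧ ∀ ρ ∈ I, ∑ z ∈ insert y J, (Frow c s ρ z : ℚ) * κ z = 0 := by
    intro y
    by_cases hy : y ∈ J
    · exact ⟨0, fun h => absurd hy h⟩
    · obtain ⟨κ, h⟩ := exists_kappa G hy
      exact ⟨κ, fun _ => h⟩
  choose κ hκ using hκ
  refine ⟨I, J, hIV, G, fun t z => if z ∈ lab n c ∧ z ∉ K then ∑ x ∈ insert z J, (Ap c s t x : ℚ) * κ z x else 0, ?_, ?_⟩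
  · intro i hi hcK
    have hcJ : c i ∉ J := fun h => hcK (mem_union_left _ h)
    have hcl : c i ∈ lab n c := by
      simp only [lab, mem_filter, mem_range]
      exact ⟨lt_of_le_of_lt (hc1 i hi) hi, hc2 i hi⟩
    refine ⟨s i, by exact_mod_cast hs i, ?_⟩
    intro z
    by_cases hz : z ∈ lab n c ∧ z ∉ K
    · simp only [if_pos hz, Ap_succ]
      push_cast
      simp only [add_mul, Finset.sum_add_distrib]
      congr 1
      by_cases hzc : z = c i
      · rw [if_pos hzc]
        rw [Finset.sum_eq_single (c i)]
        · rw [if_pos rfl, ← hzc, (hκ z (by rw [hzc]; exact hcJ)).1, mul_one]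
        · intro b _ hb; rw [if_neg (Ne.symm hb), zero_mul]
        · intro h; exfalso; apply h; rw [hzc]; exact mem_insert_self _ _
      · rw [if_neg hzc]
        apply Finset.sum_eq_zero
        intro x hx
        rw [if_neg, zero_mul]
        rintro rfl
        rcases mem_insert.1 hx with h | h
        · exact hzc h.symm
        · exact hcJ h
    · simp only [if_neg hz]
      rw [if_neg, add_zero]
      rintro rfl
      exact hz ⟨hcl, hcK⟩
  · intro ρ hρ hρK z hz
    by_cases hzl : z ∈ lab n c ∧ z ∉ K
    · simp only [if_pos hzl]
      rw [← sub_eq_zero, ← Finset.sum_sub_distrib]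
      by_contra hcon
      have hzJ : z ∉ J := fun h => hzl.2 (mem_union_left _ h)
      have hρJ : ρ.1 ∉ J := fun h => hρK (mem_union_left _ h)
      have hcon' : ∑ x ∈ insert z J, (Frow c s ρ x : ℚ) * κ z x ≠ 0 := by
        intro h; apply hcon; rw [← h]
        apply Finset.sum_congr rfl
        intro x _
        rw [Frow]; push_cast; ring
      have G' := G.extend hzJ hzl.1 (fun ρ' h' h => hzl.2 (mem_union_right _ (mem_image.2 ⟨ρ', h', h⟩)))
        (hκ z hzJ).1 (hκ z hzJ).2 hρJ hz.symm hcon'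
      have := hmax (insert ρ I, insert z J) (by
        simp only [hS, mem_filter, mem_product, mem_powerset]
        exact ⟨⟨insert_subset hρ hIV, G'.sub⟩, G'⟩)
      simp only [card_insert_of_notMem hzJ] at this
      omega
    · simp only [if_neg hzl]

end
end MC


namespace MC
open Finset Classical

def posn (w : ℕ → ℕ) (s : ℕ → ℤ) (t : ℕ) : ℤ := ∑ i ∈ range t, s i * (w i : ℤ)

section
variable {n : ℕ} {c : ℕ → ℕ} {s : ℕ → ℤ} {I : Finset (ℕ × ℕ × ℤ)} {J : Finset ℕ}

lemma posn_eq (hc1 : ∀ i, i < n → c i ≤ i) (hc2 : ∀ i, i < n → c (c i) = c i) {w : ℕ → ℕ}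
    (hw : ∀ i, i < n → w i = w (c i)) {t : ℕ} (ht : t ≤ n) :
    posn w s t = ∑ z ∈ lab n c, Ap c s t z * (w z : ℤ) := by
  simp only [Ap, Finset.sum_mul]
  rw [Finset.sum_comm, posn]
  apply Finset.sum_congr rfl
  intro i hi
  have hi' : i < n := by have := mem_range.1 hi; omega
  rw [Finset.sum_eq_single (c i)]
  · rw [if_pos rfl, hw i hi']
  · intro b _ hb; rw [if_neg (Ne.symm hb), zero_mul]
  · intro h; exfalso; apply h
    simp only [lab, mem_filter, mem_range]
    exact ⟨lt_of_le_of_lt (hc1 i hi') hi', hc2 i hi'⟩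

lemma abs_Ap (hs : ∀ i, |s i| ≤ 1) (t z : ℕ) : |Ap c s t z| ≤ t := by
  calc |Ap c s t z| ≤ ∑ i ∈ range t, |if c i = z then s i else 0| := Finset.abs_sum_le_sum_abs _ _
    _ ≤ ∑ i ∈ range t, 1 := by
      apply Finset.sum_le_sum; intro i _
      split_ifs
      · exact hs i
      · simp
    _ = t := by simp

lemma sol_unique (hc1 : ∀ i, i < n → c i ≤ i) (hc2 : ∀ i, i < n → c (c i) = c i)
    (hs : ∀ i, |s i| ≤ 1) (G : Good n c s I J)
    (hI : ∀ ρ ∈ I, ρ.1 ∈ lab n c ∧ ρ.2.1 ≤ n) {τ : ℤ} {l : ℕ} (hl : 1 ≤ l) (hn : 1 ≤ n)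
    {w w' : ℕ → ℕ}
    (h1 : ∀ i, i < n → w i = w (c i)) (h1' : ∀ i, i < n → w' i = w' (c i))
    (h0 : ∀ i, n ≤ i → w i = 0) (h0' : ∀ i, n ≤ i → w' i = 0)
    (hbig : ∀ i, i < n → 2 * n^2 * l ≤ w i)
    (hr : ∀ ρ ∈ I, (w ρ.1 : ℤ) ∣ posn w s ρ.2.1 - posn w s (ρ.1+1) + ρ.2.2 * τ)
    (hr' : ∀ ρ ∈ I, (w' ρ.1 : ℤ) ∣ posn w' s ρ.2.1 - posn w' s (ρ.1+1) + ρ.2.2 * τ)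
    (heq : ∀ y ∈ lab n c, y ∉ J → w y = w' y) (hdiv : ∀ y ∈ J, w y / l = w' y / l) : w = w' := by
  have hδ : ∀ z ∈ J, (w z : ℤ) - w' z = 0 := by
    have := G.inj (fun z => (((w z : ℤ) - w' z : ℤ) : ℚ)) ?_
    · intro z hz
      have := this z hz
      exact_mod_cast this
    · intro ρ hρ
      obtain ⟨hρl, hρn⟩ := hI ρ hρ
      have hlt : ρ.1 < n := by simp only [lab, mem_filter, mem_range] at hρl; exact hρl.1
      have hwe : w ρ.1 = w' ρ.1 := heq _ hρl (G.dis ρ hρ)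
      have hd := hr' ρ hρ
      rw [← hwe] at hd
      have hd2 := dvd_sub (hr ρ hρ) hd
      have e : (posn w s ρ.2.1 - posn w s (ρ.1+1) + ρ.2.2 * τ) - (posn w' s ρ.2.1 - posn w' s (ρ.1+1) + ρ.2.2 * τ)
          = ∑ z ∈ J, Frow c s ρ z * ((w z : ℤ) - w' z) := by
        rw [posn_eq hc1 hc2 h1 hρn, posn_eq hc1 hc2 h1 hlt, posn_eq hc1 hc2 h1' hρn, posn_eq hc1 hc2 h1' hlt]
        rw [Finset.sum_subset G.sub (f := fun z => Frow c s ρ z * ((w z : ℤ) - w' z))]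
        · rw [add_sub_add_right_eq_sub, ← Finset.sum_sub_distrib, ← Finset.sum_sub_distrib, ← Finset.sum_sub_distrib]
          apply Finset.sum_congr rfl
          intro z _
          rw [Frow]; ring
        · intro z hz hz'
          rw [heq z hz hz']; simp
      rw [e] at hd2
      have hz : ∑ z ∈ J, Frow c s ρ z * ((w z : ℤ) - w' z) = 0 := by
        apply Int.eq_zero_of_abs_lt_dvd hd2
        have hb : (2 * n^2 * l : ℤ) ≤ w ρ.1 := by exact_mod_cast hbig _ hlt
        refine lt_of_lt_of_le ?_ hb
        have hJn : (J.card : ℤ) ≤ n := by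
          have := card_le_card G.sub
          have h2 : (lab n c).card ≤ n := by
            have := card_filter_le (range n) (fun y => c y = y)
            rwa [card_range] at this
          exact_mod_cast this.trans h2
        calc |∑ z ∈ J, Frow c s ρ z * ((w z : ℤ) - w' z)| ≤ ∑ z ∈ J, |Frow c s ρ z * ((w z : ℤ) - w' z)| :=
              Finset.abs_sum_le_sum_abs _ _
          _ ≤ ∑ z ∈ J, (2 * n) * ((l:ℤ) - 1) := by
            apply Finset.sum_le_sum
            intro z hz
            rw [abs_mul]
            apply mul_le_mul _ _ (abs_nonneg _) (by positivity)
            · rw [Frow]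
              have := abs_Ap (c := c) hs ρ.2.1 z
              have := abs_Ap (c := c) hs (ρ.1+1) z
              have := abs_sub (Ap c s ρ.2.1 z) (Ap c s (ρ.1+1) z)
              push_cast at *
              omega
            · have e1 := hdiv z hz
              have m1 := Nat.div_add_mod (w z) l
              have m2 := Nat.div_add_mod (w' z) l
              have l1 := Nat.mod_lt (w z) (by omega : l > 0)
              have l2 := Nat.mod_lt (w' z) (by omega : l > 0)
              rw [e1] at m1
              rw [abs_le]
              constructor <;> omega
          _ = J.card * ((2 * n) * ((l:ℤ) - 1)) := by rw [Finset.sum_const, nsmul_eq_mul]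
          _ ≤ n * ((2 * n) * ((l:ℤ) - 1)) := by
            apply mul_le_mul_of_nonneg_right hJn
            apply mul_nonneg (by positivity)
            have : (1:ℤ) ≤ l := by exact_mod_cast hl
            linarith
          _ < _ := by
            have : (1:ℤ) ≤ n := by exact_mod_cast hn
            nlinarith
      exact_mod_cast hz
  have hlab : ∀ y ∈ lab n c, w y = w' y := by
    intro y hy
    by_cases hyJ : y ∈ J
    · have := hδ y hyJ; omega
    · exact heq y hy hyJ
  funext i
  by_cases hi : i < n
  · rw [h1 i hi, h1' i hi]
    apply hlab
    simp only [lab, mem_filter, mem_range]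
    exact ⟨lt_of_le_of_lt (hc1 i hi) hi, hc2 i hi⟩
  · rw [h0 i (by omega), h0' i (by omega)]

theorem weight_sum (hc1 : ∀ i, i < n → c i ≤ i) (hc2 : ∀ i, i < n → c (c i) = c i)
    (hs : ∀ i, |s i| ≤ 1) (G : Good n c s I J)
    (hI : ∀ ρ ∈ I, ρ.1 ∈ lab n c ∧ ρ.2.1 ≤ n) {τ : ℤ} {l Hn : ℕ} (hl : 1 ≤ l) (hn : 1 ≤ n)
    (P : Finset ℕ) (hP : ∀ p ∈ P, 2 * n^2 * l ≤ p ∧ p ≤ Hn) (WW : Finset (ℕ → ℕ))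
    (h1 : ∀ w ∈ WW, ∀ i, i < n → w i = w (c i))
    (h0 : ∀ w ∈ WW, ∀ i, n ≤ i → w i = 0)
    (hwP : ∀ w ∈ WW, ∀ i, i < n → w i ∈ P)
    (hr : ∀ w ∈ WW, ∀ ρ ∈ I, (w ρ.1 : ℤ) ∣ posn w s ρ.2.1 - posn w s (ρ.1+1) + ρ.2.2 * τ) :
    ∑ w ∈ WW, ∏ y ∈ lab n c, (2 / (w y : ℝ)) ≤
      (∑ p ∈ P, 2 / (p : ℝ)) ^ ((lab n c).card - J.card) *
        (2 / (l:ℝ) * ∑ t ∈ Icc 1 Hn, 1 / (t:ℝ)) ^ J.card := by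
  set Φ : (ℕ → ℕ) → (lab n c → ℕ) := fun w y => if (y : ℕ) ∈ J then w y / l else w y with hΦ
  set T : lab n c → Finset ℕ := fun y => if (y:ℕ) ∈ J then Icc 1 Hn else P with hT
  set ψ : lab n c → ℕ → ℝ := fun y t => if (y:ℕ) ∈ J then 2 / (l:ℝ) * (1 / (t:ℝ)) else 2 / (t:ℝ) with hψ
  have hψ0 : ∀ y t, 0 ≤ ψ y t := by
    intro y t; simp only [hψ]; split_ifs <;> positivity
  have hllt : ∀ y ∈ lab n c, y < n := by
    intro y hy; simp only [lab, mem_filter, mem_range] at hy; exact hy.1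
  have hmem : ∀ w ∈ WW, Φ w ∈ Fintype.piFinset T := by
    intro w hw
    rw [Fintype.mem_piFinset]
    intro y
    simp only [hΦ, hT]
    have hp := hwP w hw y (hllt y y.2)
    split_ifs
    · obtain ⟨a, b⟩ := hP _ hp
      rw [mem_Icc]
      refine ⟨?_, (Nat.div_le_self _ _).trans b⟩
      rw [Nat.one_le_div_iff (by omega)]
      exact le_trans (Nat.le_mul_of_pos_left _ (by positivity)) a
    · exact hp
  have hinj : Set.InjOn Φ WW := by
    intro w hw w' hw' he
    apply sol_unique (n := n) hc1 hc2 hs G hI hl hn (h1 w hw) (h1 w' hw') (h0 w hw) (h0 w' hw')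
      (fun i hi => (hP _ (hwP w hw i hi)).1) (hr w hw) (hr w' hw')
    · intro y hy hyJ
      have := congrFun he ⟨y, hy⟩
      simpa [hΦ, hyJ] using this
    · intro y hy
      have := congrFun he ⟨y, G.sub hy⟩
      simpa [hΦ, hy] using this
  calc ∑ w ∈ WW, ∏ y ∈ lab n c, (2 / (w y : ℝ)) ≤ ∑ w ∈ WW, ∏ y, ψ y (Φ w y) := by
        apply Finset.sum_le_sum
        intro w hw
        rw [← Finset.prod_coe_sort (lab n c)]
        apply Finset.prod_le_prod
        · intros; positivity
        · intro y _
          have hp := hwP w hw y (hllt y y.2)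
          have hp2 := (hP _ hp).1
          simp only [hψ, hΦ]
          split_ifs with hJ
          · have hq : 1 ≤ w y / l := by
              rw [Nat.one_le_div_iff (by omega)]
              exact le_trans (Nat.le_mul_of_pos_left _ (by positivity)) hp2
            have hle : w y / l * l ≤ w y := Nat.div_mul_le_self _ _
            have hqR : (1:ℝ) ≤ ((w y / l : ℕ) : ℝ) := by exact_mod_cast hq
            have hlR : (1:ℝ) ≤ (l:ℝ) := by exact_mod_cast hl
            have hleR : ((w y / l : ℕ) : ℝ) * l ≤ w y := by exact_mod_cast hle
            rw [div_mul_div_comm, mul_one]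
            apply div_le_div_of_nonneg_left (by norm_num) (by positivity)
            linarith [mul_comm (l:ℝ) ((w y / l : ℕ) : ℝ)]
          · exact le_rfl
    _ = ∑ g ∈ WW.image Φ, ∏ y, ψ y (g y) := by
        rw [Finset.sum_image hinj]
    _ ≤ ∑ g ∈ Fintype.piFinset T, ∏ y, ψ y (g y) := by
        apply Finset.sum_le_sum_of_subset_of_nonneg
        · intro g hg
          obtain ⟨w, hw, rfl⟩ := mem_image.1 hg
          exact hmem w hw
        · intros; exact Finset.prod_nonneg (fun _ _ => hψ0 _ _)
    _ = ∏ y, ∑ t ∈ T y, ψ y t := by rw [Finset.prod_univ_sum]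
    _ = ∏ y : lab n c, (if (y:ℕ) ∈ J then 2 / (l:ℝ) * ∑ t ∈ Icc 1 Hn, 1 / (t:ℝ) else ∑ p ∈ P, 2 / (p : ℝ)) := by
        apply Finset.prod_congr rfl
        intro y _
        simp only [hT, hψ]
        split_ifs
        · rw [Finset.mul_sum]
        · rfl
    _ = ∏ y ∈ lab n c, (if y ∈ J then 2 / (l:ℝ) * ∑ t ∈ Icc 1 Hn, 1 / (t:ℝ) else ∑ p ∈ P, 2 / (p : ℝ)) := by
        rw [← Finset.prod_coe_sort (lab n c)]
    _ = _ := by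
        rw [Finset.prod_ite, Finset.prod_const, Finset.prod_const, mul_comm]
        have e1 : (lab n c).filter (fun y => y ∈ J) = J := by
          ext y; simp only [mem_filter]; exact ⟨fun h => h.2, fun h => ⟨G.sub h, h⟩⟩
        have e2 : ((lab n c).filter (fun y => y ∉ J)).card = (lab n c).card - J.card := by
          rw [← card_sdiff_of_subset G.sub]; congr 1; ext y; simp
        rw [e1, e2]

end
end MC


namespace MC
open Finset Classical

def Rows (n : ℕ) : Finset (ℕ × ℕ × ℤ) := range n ×ˢ range (n+1) ×ˢ ({-1, 0, 1} : Finset ℤ)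

/-- certificate for a word -/
structure Cert (n j : ℕ) (s : ℕ → ℤ) (τ : ℤ) (w : ℕ → ℕ) (I : Finset (ℕ × ℕ × ℤ)) (J : Finset ℕ) (c : ℕ → ℕ)
    (B : ℕ → ℕ → ℚ) : Prop where
  walk : Walk n j (J ∪ I.image Prod.fst) c B
  good : Good n c s I J
  rows : I ⊆ Rows n
  rlab : ∀ ρ ∈ I, ρ.1 ∈ lab n c
  c0 : ∀ i, n ≤ i → c i = 0
  cw : ∀ i, i < n → w i = w (c i)
  cwinj : ∀ i i', i < n → i' < n → w i = w i' → c i = c i'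
  valid : ∀ ρ ∈ I, (w ρ.1 : ℤ) ∣ posn w s ρ.2.1 - posn w s (ρ.1+1) + ρ.2.2 * τ
  coh : ∀ y v (cc : ℤ), y ∈ lab n c → v ≤ n → cc ∈ ({-1, 0, 1} : Finset ℤ) → y ∉ J ∪ I.image Prod.fst →
    (w y : ℤ) ∣ posn w s v - posn w s (y+1) + cc * τ → Inc B v y

noncomputable def wt (n : ℕ) (w : ℕ → ℕ) : ℝ := ∏ p ∈ (range n).image w, (2 / (p : ℝ))

lemma Cert.wt_eq {n j : ℕ} {s : ℕ → ℤ} {τ : ℤ} {w : ℕ → ℕ} {I : Finset (ℕ × ℕ × ℤ)} {J : Finset ℕ} {c : ℕ → ℕ}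
    {B : ℕ → ℕ → ℚ} (C : Cert n j s τ w I J c B) : wt n w = ∏ y ∈ lab n c, (2 / (w y : ℝ)) := by
  have : (range n).image w = (lab n c).image w := by
    ext p
    simp only [mem_image, mem_range, lab, mem_filter]
    constructor
    · rintro ⟨i, hi, rfl⟩
      exact ⟨c i, ⟨lt_of_le_of_lt (C.walk.c_le i hi) hi, C.walk.c_idem i hi⟩, (C.cw i hi).symm⟩
    · rintro ⟨i, hi, rfl⟩
      exact ⟨i, hi.1, rfl⟩
  rw [wt, this, Finset.prod_image]
  intro a ha b hb h
  simp only [lab, coe_filter, mem_range, Set.mem_ofPred_eq] at ha hb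
  rw [← ha.2, ← hb.2]
  exact C.cwinj a b ha.1 hb.1 h

theorem sum_words {n j q : ℕ} (hnq : n = q * j) (hj : 0 < j) (hn : 1 ≤ n) (s : ℕ → ℤ) (hs : ∀ i, |s i| ≤ 1)
    (τ : ℤ) {l Hn : ℕ} (hl : 1 ≤ l) (P : Finset ℕ) (hP : ∀ p ∈ P, 2 * n^2 * l ≤ p ∧ p ≤ Hn)
    (X Q : ℝ) (hX : ∑ p ∈ P, 2 / (p : ℝ) ≤ X) (hX1 : 1 ≤ X)
    (hQ : 2 / (l:ℝ) * ∑ t ∈ Icc 1 Hn, 1 / (t:ℝ) ≤ Q) (Dm : ℕ → ℕ) (r0 : ℕ) (WW : Finset (ℕ → ℕ))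
    (h0 : ∀ w ∈ WW, ∀ i, n ≤ i → w i = 0)
    (hwP : ∀ w ∈ WW, ∀ i, i < n → w i ∈ P)
    (hC : ∀ w ∈ WW, ∃ I J c B, Cert n j s τ w I J c B ∧ (lab n c).card ≤ Dm J.card ∧ r0 ≤ J.card) :
    ∑ w ∈ WW, wt n w ≤
      ∑ r ∈ Icc r0 n, ((n:ℝ) + 2)^(5*r) * (2^n * ((n:ℝ)+2)^(64 * (q + 1 + 4 * r * q))) * (X ^ Dm r * Q ^ r) := by
  have hC' : ∀ w, ∃ k : Finset (ℕ × ℕ × ℤ) × Finset ℕ × (ℕ → ℕ), w ∈ WW → ∃ B,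
      Cert n j s τ w k.1 k.2.1 k.2.2 B ∧ (lab n k.2.2).card ≤ Dm k.2.1.card ∧ r0 ≤ k.2.1.card := by
    intro w
    by_cases hw : w ∈ WW
    · obtain ⟨I, J, c, B, h⟩ := hC w hw
      exact ⟨(I, J, c), fun _ => ⟨B, h⟩⟩
    · exact ⟨(∅, ∅, fun _ => 0), fun h => absurd h hw⟩
  choose key hkey using hC'
  have hQ0 : 0 ≤ Q := le_trans (by positivity) hQ
  set KK := WW.image key with hKK
  have hlabn : ∀ c, (lab n c).card ≤ n := by
    intro c
    have := card_filter_le (range n) (fun y => c y = y)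
    rwa [card_range] at this
  -- fibre bound
  have hfib : ∀ k ∈ KK, ∑ w ∈ WW.filter (fun w => key w = k), wt n w ≤ X ^ Dm k.2.1.card * Q ^ k.2.1.card := by
    intro k hk
    obtain ⟨w0, hw0, rfl⟩ := mem_image.1 hk
    obtain ⟨B0, C0, hd0⟩ := hkey w0 hw0
    set k := key w0 with hkdef
    have hfk : ∀ w ∈ WW.filter (fun w => key w = k), ∃ B, Cert n j s τ w k.1 k.2.1 k.2.2 B := by
      intro w hw
      rw [mem_filter] at hw
      obtain ⟨B, C, _⟩ := hkey w hw.1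
      rw [hw.2] at C
      exact ⟨B, C⟩
    have hh := weight_sum (n := n) (c := k.2.2) (s := s) (I := k.1) (J := k.2.1) C0.walk.c_le C0.walk.c_idem hs C0.good
      (fun ρ hρ => ⟨C0.rlab ρ hρ, by
        have := C0.rows hρ
        simp only [Rows, mem_product, mem_range] at this
        omega⟩) (τ := τ) hl hn P hP (WW.filter (fun w => key w = k))
      (fun w hw => by obtain ⟨B, C⟩ := hfk w hw; exact C.cw)
      (fun w hw => h0 w (mem_filter.1 hw).1) (fun w hw => hwP w (mem_filter.1 hw).1)
      (fun w hw => by obtain ⟨B, C⟩ := hfk w hw; exact C.valid)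
    calc ∑ w ∈ WW.filter (fun w => key w = k), wt n w
        = ∑ w ∈ WW.filter (fun w => key w = k), ∏ y ∈ lab n k.2.2, (2 / (w y : ℝ)) := by
          apply Finset.sum_congr rfl
          intro w hw
          obtain ⟨B, C⟩ := hfk w hw
          exact C.wt_eq
      _ ≤ _ := hh
      _ ≤ X ^ ((lab n k.2.2).card - k.2.1.card) * Q ^ k.2.1.card := by gcongr
      _ ≤ X ^ Dm k.2.1.card * Q ^ k.2.1.card := by
          gcongr 2
          omega
  have hr : ∀ k ∈ KK, k.2.1.card ∈ Icc r0 n := by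
    intro k hk
    obtain ⟨w0, hw0, rfl⟩ := mem_image.1 hk
    obtain ⟨B0, C0, hd0⟩ := hkey w0 hw0
    have := card_le_card C0.good.sub
    have := hlabn (key w0).2.2
    rw [mem_Icc]; omega
  -- number of keys
  have hcount : ∀ r, ((KK.filter fun k => k.2.1.card = r).card : ℝ) ≤
      ((n:ℝ) + 2)^(5*r) * (2^n * ((n:ℝ)+2)^(64 * (q + 1 + 4 * r * q))) := by
    intro r
    set KR := KK.filter fun k => k.2.1.card = r with hKR
    have h1 : KR.card ≤ (2^n * (n+2)^(64 * (q + 1 + 4 * r * q))) * (KR.image fun k => (k.1, k.2.1)).card := by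
      apply card_le_mul_card_image
      rintro ⟨I, J⟩ hIJ
      have : (KR.filter fun k => (k.1, k.2.1) = (I, J)).card ≤
          ((KR.filter fun k => (k.1, k.2.1) = (I, J)).image fun k => k.2.2).card := by
        rw [card_image_of_injOn]
        intro a ha b hb h
        simp only [coe_filter, Set.mem_ofPred_eq, Prod.mk.injEq] at ha hb
        simp only at h
        ext1
        · rw [ha.2.1, hb.2.1]
        · ext1
          · rw [ha.2.2, hb.2.2]
          · exact h
      refine this.trans ?_
      apply pattern_count n j (q + 1 + 4 * r * q) (J ∪ I.image Prod.fst)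
      intro c hc
      obtain ⟨k, hk, rfl⟩ := mem_image.1 hc
      simp only [mem_filter, Prod.mk.injEq, hKR] at hk
      obtain ⟨⟨hk, hkr⟩, rfl, rfl⟩ := hk
      obtain ⟨w0, hw0, rfl⟩ := mem_image.1 hk
      obtain ⟨B0, C0, hd0⟩ := hkey w0 hw0
      refine ⟨C0.c0, B0, C0.walk, ?_⟩
      subst hnq
      refine (card_bd hj C0.walk.block).trans ?_
      have e1 := card_union_le (key w0).2.1 ((key w0).1.image Prod.fst)
      have e2 := card_image_le (s := (key w0).1) (f := Prod.fst)
      have e3 := C0.good.card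
      have e4 : ((key w0).2.1 ∪ (key w0).1.image Prod.fst).card ≤ 2 * r := by omega
      have := Nat.mul_le_mul_right q e4
      have e5 : 4 * r * q = 2 * (2 * r * q) := by ring
      omega
    have h2 : (KR.image fun k => (k.1, k.2.1)).card ≤ (n+2)^(5*r) := by
      calc (KR.image fun k => (k.1, k.2.1)).card ≤
          (((Rows n).powerset.filter fun S => S.card ≤ r) ×ˢ ((range n).powerset.filter fun S => S.card ≤ r)).card := by
            apply card_le_card
            rintro ⟨I, J⟩ hIJ
            obtain ⟨k, hk, he⟩ := mem_image.1 hIJ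
            simp only [Prod.mk.injEq] at he
            obtain ⟨rfl, rfl⟩ := he
            simp only [mem_filter, hKR] at hk
            obtain ⟨hk, hkr⟩ := hk
            obtain ⟨w0, hw0, rfl⟩ := mem_image.1 hk
            obtain ⟨B0, C0, hd0⟩ := hkey w0 hw0
            simp only [mem_product, mem_filter, mem_powerset]
            refine ⟨⟨C0.rows, by rw [C0.good.card]; omega⟩, C0.good.sub.trans (filter_subset _ _), by omega⟩
        _ ≤ ((Rows n).card + 1)^r * ((range n).card + 1)^r := by
            rw [card_product]
            exact Nat.mul_le_mul (card_small _ _) (card_small _ _)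
        _ ≤ ((n+2)^4)^r * (n+2)^r := by
            apply Nat.mul_le_mul <;> apply Nat.pow_le_pow_left
            · have : (Rows n).card = n * ((n+1) * 3) := by
                simp [Rows, card_product]
              rw [this]
              nlinarith [Nat.zero_le n, Nat.zero_le (n^2), Nat.zero_le (n^3), Nat.zero_le (n^4)]
            · simp
        _ = (n+2)^(5*r) := by rw [← pow_mul, ← pow_add]; congr 1; ring
    have h3 : KR.card ≤ (n+2)^(5*r) * (2^n * (n+2)^(64 * (q + 1 + 4 * r * q))) := by
      refine h1.trans ?_
      rw [mul_comm]
      exact Nat.mul_le_mul_right _ h2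
    exact_mod_cast h3
  calc ∑ w ∈ WW, wt n w = ∑ k ∈ KK, ∑ w ∈ WW.filter (fun w => key w = k), wt n w := by
        rw [Finset.sum_fiberwise_of_maps_to]
        intro w hw; exact mem_image_of_mem _ hw
    _ ≤ ∑ k ∈ KK, X ^ Dm k.2.1.card * Q ^ k.2.1.card := Finset.sum_le_sum hfib
    _ = ∑ r ∈ Icc r0 n, ∑ k ∈ KK.filter (fun k => k.2.1.card = r), X ^ Dm k.2.1.card * Q ^ k.2.1.card := by
        rw [Finset.sum_fiberwise_of_maps_to hr]
    _ ≤ _ := by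
        apply Finset.sum_le_sum
        intro r _
        have : ∑ k ∈ KK.filter (fun k => k.2.1.card = r), X ^ Dm k.2.1.card * Q ^ k.2.1.card
            = (KK.filter fun k => k.2.1.card = r).card * (X ^ Dm r * Q ^ r) := by
          rw [← nsmul_eq_mul, ← Finset.sum_const]
          apply Finset.sum_congr rfl
          intro k hk
          rw [(mem_filter.1 hk).2]
        rw [this]
        apply mul_le_mul_of_nonneg_right (hcount r)
        positivity

end MC


namespace MC
open Finset Classical

structure Wd (n j : ℕ) (s : ℕ → ℤ) (τ : ℤ) (w : ℕ → ℕ) : Prop where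
  zero : ∀ i, n ≤ i → w i = 0
  blk : ∀ i i', i < n → i' < n → i / j = i' / j → w i = w i' → i = i'
  cons : ∀ i i', i < n → i' < n → w i = w i' → ∃ cc ∈ ({-1, 0, 1} : Finset ℤ),
    (w i : ℤ) ∣ posn w s i - posn w s i' + cc * τ

def LoneU (n : ℕ) (s : ℕ → ℤ) (τ : ℤ) (w : ℕ → ℕ) (y : ℕ) : Prop :=
  y < n ∧ (∀ i, i < n → w i = w y → i = y) ∧
    ∀ v, v ≤ n → v ≠ y → v ≠ y + 1 → ∀ cc ∈ ({-1, 0, 1} : Finset ℤ),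
      ¬ (w y : ℤ) ∣ posn w s v - posn w s (y+1) + cc * τ

lemma posn_succ (w : ℕ → ℕ) (s : ℕ → ℤ) (t : ℕ) : posn w s (t+1) = posn w s t + s t * w t := by
  simp [posn, Finset.sum_range_succ]

theorem exists_cert {n j q : ℕ} (hnq : n = q * j) (hj : 0 < j) (s : ℕ → ℤ) (hs : ∀ i, s i ≠ 0) (τ : ℤ) (w : ℕ → ℕ)
    (W : Wd n j s τ w) : ∃ I J c B, Cert n j s τ w I J c B ∧ (lab n c).card ≤ n ∧
      ((∀ y, ¬ LoneU n s τ w y) → (lab n c).card ≤ (n + 2 * J.card + 10 * (q + 1 + 4 * J.card * q)) / 2) := by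
  set c : ℕ → ℕ := fun i => if i < n then Nat.find (⟨i, rfl⟩ : ∃ i', w i' = w i) else 0 with hc
  have hcw : ∀ i, i < n → w (c i) = w i := by
    intro i hi
    simp only [hc, if_pos hi]
    exact Nat.find_spec (⟨i, rfl⟩ : ∃ i', w i' = w i)
  have hcle : ∀ i, i < n → c i ≤ i := by
    intro i hi
    simp only [hc, if_pos hi]
    exact Nat.find_min' _ rfl
  have hcinj : ∀ i i', i < n → i' < n → w i = w i' → c i = c i' := by
    intro i i' hi hi' h
    simp only [hc, if_pos hi, if_pos hi', h]
  have hcid : ∀ i, i < n → c (c i) = c i := by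
    intro i hi
    exact hcinj _ _ (lt_of_le_of_lt (hcle i hi) hi) hi (hcw i hi)
  set V := (Rows n).filter fun ρ => ρ.1 ∈ lab n c ∧
    (w ρ.1 : ℤ) ∣ posn w s ρ.2.1 - posn w s (ρ.1+1) + ρ.2.2 * τ with hV
  obtain ⟨I, J, hIV, G, B, hst, hco⟩ := exists_IJ n c s hs hcle hcid V
  have hcoh : ∀ y v (cc : ℤ), y ∈ lab n c → v ≤ n → cc ∈ ({-1, 0, 1} : Finset ℤ) → y ∉ J ∪ I.image Prod.fst →
    (w y : ℤ) ∣ posn w s v - posn w s (y+1) + cc * τ → Inc B v y := by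
    intro y v cc hy hv hcc hyK hd
    apply hco (y, v, cc) _ hyK
    simp only [hV, mem_filter, Rows, mem_product, mem_range]
    refine ⟨⟨?_, by omega, hcc⟩, hy, hd⟩
    simp only [lab, mem_filter, mem_range] at hy
    exact hy.1
  have hWalk : Walk n j (J ∪ I.image Prod.fst) c B := by
    refine ⟨hcle, hcid, hst, ?_, ?_⟩
    · intro i hi hK
      obtain ⟨cc, hcc, hd⟩ := W.cons i (c i) hi (lt_of_le_of_lt (hcle i hi) hi) (hcw i hi).symm
      refine hcoh (c i) (i+1) cc ?_ (by omega) hcc hK ?_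
      · simp only [lab, mem_filter, mem_range]
        exact ⟨lt_of_le_of_lt (hcle i hi) hi, hcid i hi⟩
      · rw [posn_succ, posn_succ, hcw i hi]
        have : posn w s i + s i * ↑(w i) - (posn w s (c i) + s (c i) * ↑(w i)) + cc * τ
          = (posn w s i - posn w s (c i) + cc * τ) + (w i) * (s i - s (c i)) := by ring
        rw [this]
        exact dvd_add hd (dvd_mul_right _ _)
    · intro i i' hi hi' hb h
      exact W.blk i i' hi hi' hb (by rw [← hcw i hi, h, hcw i' hi'])
  have hlabn : (lab n c).card ≤ n := by
    have := card_filter_le (range n) (fun y => c y = y)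
    rwa [card_range] at this
  refine ⟨I, J, c, B, ⟨hWalk, G, ?_, ?_, ?_, fun i hi => (hcw i hi).symm, hcinj, ?_, hcoh⟩, hlabn, ?_⟩
  · intro ρ hρ; exact (mem_filter.1 (hIV hρ)).1
  · intro ρ hρ; exact (mem_filter.1 (hIV hρ)).2.1
  · intro i hi; simp only [hc]; rw [if_neg (by omega)]
  · intro ρ hρ; exact (mem_filter.1 (hIV hρ)).2.2
  · intro hU
    set K := J ∪ I.image Prod.fst with hK
    have hKc : K.card ≤ 2 * J.card := by
      have e1 : K.card ≤ J.card + (I.image Prod.fst).card := card_union_le _ _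
      have e2 : (I.image Prod.fst).card ≤ I.card := card_image_le
      have e3 := G.card
      omega
    have hbd : (bd n j K c).card ≤ q + 1 + 4 * J.card * q := by
      subst hnq
      refine (card_bd hj hWalk.block).trans ?_
      have := Nat.mul_le_mul_right q hKc
      have e5 : 4 * J.card * q = 2 * (2 * J.card * q) := by ring
      omega
    have ht := card_touched hWalk
    set lone := (lab n c).filter fun y => ∀ i, i < n → c i = y → i = y with hlone
    have h1 : lone.card ≤ K.card + 10 * (bd n j K c).card := by
      refine le_trans (card_le_card (t := K ∪ ((Lt n K c).filter fun y => (∀ i, i < n → c i = y → i = y) ∧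
        ∃ v, v ≤ n ∧ v ≠ y ∧ v ≠ y + 1 ∧ Inc B v y)) ?_) ?_
      · intro y hy
        simp only [hlone, mem_filter] at hy
        obtain ⟨hy, hl⟩ := hy
        by_cases hyK : y ∈ K
        · exact mem_union_left _ hyK
        · apply mem_union_right
          have hy' := hy
          simp only [lab, mem_filter, mem_range] at hy'
          simp only [mem_filter, Lt, mem_range]
          refine ⟨⟨hy'.1, hy'.2, hyK⟩, hl, ?_⟩
          have := hU y
          simp only [LoneU] at this
          push Not at this
          obtain ⟨v, hv, h1, h2, cc, hcc, hd⟩ := this hy'.1 (by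
            intro i hi h
            exact hl i hi (by rw [hcinj i y hi hy'.1 h, hy'.2]))
          exact ⟨v, hv, h1, h2, hcoh y v cc hy hv hcc hyK hd⟩
      · refine (card_union_le _ _).trans ?_
        omega
    have h2 : 2 * (lab n c).card ≤ n + lone.card := by
      have e : (range n).card = ∑ y ∈ lab n c, ((range n).filter fun i => c i = y).card := by
        apply card_eq_sum_card_fiberwise
        intro i hi
        have hi := mem_range.1 (mem_coe.1 hi)
        simp only [lab, coe_filter, mem_range, Set.mem_ofPred_eq]
        exact ⟨lt_of_le_of_lt (hcle i hi) hi, hcid i hi⟩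
      rw [card_range] at e
      have e2 : lone.card = ∑ y ∈ lab n c, if (∀ i, i < n → c i = y → i = y) then 1 else 0 := by
        rw [hlone, card_filter]
      have e3 : ∑ y ∈ lab n c, 2 ≤ ∑ y ∈ lab n c, (((range n).filter fun i => c i = y).card +
          if (∀ i, i < n → c i = y → i = y) then 1 else 0) := by
        apply Finset.sum_le_sum
        intro y hy
        simp only [lab, mem_filter, mem_range] at hy
        split_ifs with h
        · have : 0 < ((range n).filter fun i => c i = y).card := by
            apply card_pos.2
            exact ⟨y, by simp [hy]⟩
          omega
        · push Not at h
          obtain ⟨i, hi, hiy, hne⟩ := h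
          have : 1 < ((range n).filter fun i => c i = y).card := by
            apply one_lt_card.2
            exact ⟨i, by simp [hi, hiy], y, by simp [hy], hne⟩
          omega
      rw [Finset.sum_add_distrib, ← e, ← e2, Finset.sum_const, smul_eq_mul] at e3
      omega
    omega

end MC


namespace MC
open Finset Classical

noncomputable def mu (G : Finset ℕ → ℝ) (U : Finset ℕ) : ℝ := ∑ U' ∈ U.powerset, (-1)^(U \ U').card * G U'

lemma mu_insert (G : Finset ℕ → ℝ) {v : ℕ} {U : Finset ℕ} (hv : v ∉ U) :
    mu G (insert v U) = mu (fun U => G (insert v U) - G U) U := by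
  rw [mu, Finset.sum_powerset_insert hv, mu, ← Finset.sum_add_distrib]
  apply Finset.sum_congr rfl
  intro U' hU'
  rw [mem_powerset] at hU'
  have h1 : insert v U \ U' = insert v (U \ U') := insert_sdiff_of_notMem _ (fun h => hv (hU' h))
  have h2 : insert v U \ insert v U' = U \ U' := by
    ext x; simp only [mem_sdiff, mem_insert]
    constructor
    · rintro ⟨h | h, h'⟩
      · exact absurd (Or.inl h) h'
      · exact ⟨h, fun hx => h' (Or.inr hx)⟩
    · rintro ⟨h, h'⟩
      exact ⟨Or.inr h, fun hx => hx.elim (fun e => hv (e ▸ h)) h'⟩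
  rw [h1, h2, card_insert_of_notMem (by simp [hv]), pow_succ]
  ring

lemma abs_mu_le (G : Finset ℕ → ℝ) (hG : ∀ U, |G U| ≤ 1) (U : Finset ℕ) : |mu G U| ≤ 2^U.card := by
  calc |mu G U| ≤ ∑ U' ∈ U.powerset, |(-1)^(U \ U').card * G U'| := Finset.abs_sum_le_sum_abs _ _
    _ ≤ ∑ U' ∈ U.powerset, 1 := by
      apply Finset.sum_le_sum; intro U' _
      rw [abs_mul, abs_pow]; simpa using hG U'
    _ = 2^U.card := by simp

theorem bonferroni (V : Finset ℕ) : ∀ (m : ℕ) (B : ℝ) (G : Finset ℕ → ℝ), (∀ U, |G U| ≤ B) →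
    |G V - ∑ U ∈ V.powerset, if U.card < m then mu G U else 0| ≤ B * 2^m * V.card.choose m := by
  induction V using Finset.induction_on with
  | empty =>
    intro m B G hG
    have hB : 0 ≤ B := (abs_nonneg _).trans (hG ∅)
    rcases m with _ | m
    · simpa using hG ∅
    · simp [mu]
  | insert v V hv ih =>
    intro m B G hG
    have hB : 0 ≤ B := (abs_nonneg _).trans (hG ∅)
    rcases m with _ | m
    · simpa using hG (insert v V)
    · rw [Finset.sum_powerset_insert hv]
      have e1 := ih (m+1) B G hG
      have e2 := ih m (2*B) (fun U => G (insert v U) - G U) (by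
        intro U
        have := abs_sub (G (insert v U)) (G U)
        linarith [hG U, hG (insert v U)])
      have e3 : ∑ U ∈ V.powerset, (if (insert v U).card < m + 1 then mu G (insert v U) else 0)
        = ∑ U ∈ V.powerset, if U.card < m then mu (fun U => G (insert v U) - G U) U else 0 := by
        apply Finset.sum_congr rfl
        intro U hU
        have hvU : v ∉ U := fun h => hv (mem_powerset.1 hU h)
        rw [card_insert_of_notMem hvU, mu_insert G hvU]
        simp
      rw [e3, card_insert_of_notMem hv, Nat.choose_succ_succ]
      push_cast
      have : G (insert v V) - ((∑ U ∈ V.powerset, if U.card < m + 1 then mu G U else 0) +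
          ∑ U ∈ V.powerset, if U.card < m then mu (fun U => G (insert v U) - G U) U else 0)
        = (G V - ∑ U ∈ V.powerset, if U.card < m + 1 then mu G U else 0) +
          ((G (insert v V) - G V) - ∑ U ∈ V.powerset, if U.card < m then mu (fun U => G (insert v U) - G U) U else 0) := by ring
      rw [this]
      refine (abs_add_le _ _).trans ?_
      refine (add_le_add e1 e2).trans (le_of_eq ?_)
      ring

lemma esymm_le (S : Finset ℕ) (x : ℕ → ℝ) (hx : ∀ i ∈ S, 0 ≤ x i) {X : ℝ} (hX : 0 < X) (hs : ∑ i ∈ S, x i ≤ X)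
    {m : ℕ} (hm : 0 < m) : ∑ U ∈ S.powersetCard m, ∏ i ∈ U, x i ≤ (Real.exp 1 * X / m)^m := by
  set y : ℝ := m / X with hy
  have hm' : (0:ℝ) < m := by exact_mod_cast hm
  have hy0 : 0 < y := by positivity
  have h1 : y^m * ∑ U ∈ S.powersetCard m, ∏ i ∈ U, x i ≤ ∏ i ∈ S, (1 + y * x i) := by
    rw [Finset.prod_one_add, Finset.mul_sum]
    calc ∑ U ∈ S.powersetCard m, y^m * ∏ i ∈ U, x i = ∑ U ∈ S.powersetCard m, ∏ i ∈ U, y * x i := by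
          apply Finset.sum_congr rfl
          intro U hU
          rw [Finset.prod_mul_distrib, Finset.prod_const, (mem_powersetCard.1 hU).2]
      _ ≤ _ := by
          apply Finset.sum_le_sum_of_subset_of_nonneg
          · intro U hU; exact mem_powerset.2 (mem_powersetCard.1 hU).1
          · intro U hU _
            apply Finset.prod_nonneg
            intro i hi
            exact mul_nonneg hy0.le (hx i (mem_powerset.1 hU hi))
  have h2 : ∏ i ∈ S, (1 + y * x i) ≤ Real.exp m := by
    calc ∏ i ∈ S, (1 + y * x i) ≤ ∏ i ∈ S, Real.exp (y * x i) := by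
          apply Finset.prod_le_prod
          · intro i hi; have := mul_nonneg hy0.le (hx i hi); linarith
          · intro i hi; have := Real.add_one_le_exp (y * x i); linarith
      _ = Real.exp (y * ∑ i ∈ S, x i) := by rw [← Real.exp_sum, Finset.mul_sum]
      _ ≤ Real.exp m := by
          apply Real.exp_le_exp.2
          calc y * ∑ i ∈ S, x i ≤ y * X := by gcongr
            _ = m := by rw [hy]; field_simp
  have h3 : (Real.exp 1 * X / m)^m = Real.exp m / y^m := by
    rw [hy, div_pow, div_pow, mul_pow, ← Real.exp_nat_mul, mul_one]
    field_simp
  rw [h3, le_div_iff₀ (by positivity), mul_comm]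
  exact h1.trans h2

lemma count_modEq (X : ℤ) (T m : ℕ) (hm : 0 < m) (A : Finset ℤ) (hA : A ⊆ Ico X (X+T))
    (h : ∀ a ∈ A, ∀ b ∈ A, (m : ℤ) ∣ a - b) : (A.card : ℝ) ≤ T / m + 1 := by
  rcases A.eq_empty_or_nonempty with rfl | ⟨a, ha⟩
  · simp; positivity
  have hsub : A ⊆ (Ico X (X+T)).filter (fun x => x ≡ a [ZMOD m]) := by
    intro b hb
    rw [mem_filter]
    exact ⟨hA hb, (Int.modEq_iff_dvd.2 (h a ha b hb))⟩
  have h1 := card_le_card hsub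
  have h2 := Int.Ico_filter_modEq_card X (X+T) (r := (m:ℤ)) (by exact_mod_cast hm) a
  have h3 : ((A.card : ℤ) : ℝ) ≤ ((max (⌈((X+T : ℤ) - a) / ((m:ℤ) : ℚ)⌉ - ⌈(X - a) / ((m:ℤ) : ℚ)⌉) 0 : ℤ) : ℝ) := by
    have : (A.card : ℤ) ≤ ((filter (fun x => x ≡ a [ZMOD m]) (Ico X (X+T))).card : ℤ) := by exact_mod_cast h1
    exact_mod_cast this.trans h2.le
  have hm' : (0:ℚ) < m := by exact_mod_cast hm
  have h4 : ((max (⌈((X+T : ℤ) - a) / ((m:ℤ) : ℚ)⌉ - ⌈(X - a) / ((m:ℤ) : ℚ)⌉) 0 : ℤ) : ℚ) ≤ T / m + 1 := by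
    push_cast
    apply max_le _ (by positivity)
    have a1 := Int.ceil_lt_add_one (((X:ℚ)+T - a) / (m : ℚ))
    have a2 := Int.le_ceil (((X:ℚ) - a) / (m : ℚ))
    have a3 : (((X:ℚ)+T - a) / (m : ℚ)) = ((X:ℚ) - a) / (m : ℚ) + T / m := by ring
    linarith
  have h5 : ((A.card : ℤ) : ℝ) ≤ ((T / m + 1 : ℚ) : ℝ) := h3.trans (by exact_mod_cast h4)
  push_cast at h5
  exact h5

/-- CRT counting -/
theorem crt_count (X : ℤ) (T : ℕ) (S : Finset ℕ) (hS : ∀ p ∈ S, p.Prime) (R : ℕ → Finset ℤ) (ρ : ℕ → ℕ)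
    (hR : ∀ p ∈ S, (R p).card ≤ ρ p)
    (A : Finset ℤ) (hA : A ⊆ Ico X (X+T)) (h : ∀ b ∈ A, ∀ p ∈ S, ∃ r ∈ R p, (p:ℤ) ∣ b - r) :
    (A.card : ℝ) ≤ (T / ((∏ p ∈ S, p : ℕ) : ℝ) + 1) * ∏ p ∈ S, (ρ p : ℝ) := by
  choose! r hr hd using h
  set φ : ℤ → (∀ p ∈ S, ℤ) := fun b p _ => r b p with hφ
  have hm : 0 < ∏ p ∈ S, p := Finset.prod_pos fun p hp => (hS p hp).pos
  have h1 : A.card = ∑ u ∈ S.pi R, (A.filter fun b => φ b = u).card := by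
    apply card_eq_sum_card_fiberwise
    intro b hb
    exact mem_coe.2 (mem_pi.2 fun p hp => hr b (mem_coe.1 hb) p hp)
  rw [h1, Nat.cast_sum]
  calc ∑ u ∈ S.pi R, ((A.filter fun b => φ b = u).card : ℝ) ≤ ∑ u ∈ S.pi R, (T / ((∏ p ∈ S, p : ℕ) : ℝ) + 1) := by
        apply Finset.sum_le_sum
        intro u _
        apply count_modEq X T _ hm _ ((filter_subset _ _).trans hA)
        intro a ha b hb
        rw [mem_filter] at ha hb
        push_cast
        apply Finset.prod_dvd_of_coprime
        · intro p hp q hq hpq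
          simp only [Function.onFun]
          rw [Nat.isCoprime_iff_coprime]
          exact (Nat.coprime_primes (hS p hp) (hS q hq)).2 hpq
        · intro p hp
          have e : r a p = r b p := by
            have := ha.2.trans hb.2.symm
            exact congrFun (congrFun this p) hp
          have e1 := hd a ha.1 p hp
          have e2 := hd b hb.1 p hp
          rw [e] at e1
          have := dvd_sub e1 e2
          simpa using this
    _ = (T / ((∏ p ∈ S, p : ℕ) : ℝ) + 1) * ∏ p ∈ S, ((R p).card : ℝ) := by
        rw [Finset.sum_const, card_pi, nsmul_eq_mul]; push_cast; ring
    _ ≤ _ := by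
        apply mul_le_mul_of_nonneg_left _ (by positivity)
        apply Finset.prod_le_prod
        · intro p _; positivity
        · intro p hp
          exact_mod_cast hR p hp

end MC


namespace MC
open Finset Classical

def hit (τ : ℤ) (p : ℕ) (x : ℤ) : Prop := (p:ℤ) ∣ x ∨ (p:ℤ) ∣ x + τ
noncomputable def al (τ : ℤ) (p : ℕ) (x : ℤ) : ℝ :=
  (if (p:ℤ) ∣ x then 1 else 0) - (if (p:ℤ) ∣ x + τ then 1 else 0)
noncomputable def hp (P : Finset ℕ) (τ : ℤ) (x : ℤ) : ℕ := (P.filter fun p => hit τ p x).card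
noncomputable def Yv (P : Finset ℕ) (τ : ℤ) (D : ℕ) (x : ℤ) : ℝ := if hp P τ x ≤ D then 1 else 0
noncomputable def Qw (P : Finset ℕ) (τ : ℤ) (D n : ℕ) (s : ℕ → ℤ) (w : ℕ → ℕ) (b : ℤ) : ℝ :=
  (∏ i ∈ range n, al τ (w i) (b + posn w s i)) * ∏ v ∈ range (n+1), Yv P τ D (b + posn w s v)

lemma abs_al_le (τ : ℤ) (p : ℕ) (x : ℤ) : |al τ p x| ≤ 1 := by
  unfold al; split_ifs <;> simp

lemma hit_of_al {τ : ℤ} {p : ℕ} {x : ℤ} (h : al τ p x ≠ 0) : hit τ p x := by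
  by_contra hn
  simp only [hit, not_or] at hn
  simp [al, hn.1, hn.2] at h

lemma abs_Yv_le (P : Finset ℕ) (τ : ℤ) (D : ℕ) (x : ℤ) : |Yv P τ D x| ≤ 1 := by
  unfold Yv; split_ifs <;> simp

lemma abs_prod_le_one {ι : Type*} (S : Finset ι) (f : ι → ℝ) (h : ∀ i ∈ S, |f i| ≤ 1) : |∏ i ∈ S, f i| ≤ 1 := by
  rw [Finset.abs_prod]
  exact Finset.prod_le_one (fun i _ => abs_nonneg _) h

lemma abs_Qw_le (P : Finset ℕ) (τ : ℤ) (D n : ℕ) (s : ℕ → ℤ) (w : ℕ → ℕ) (b : ℤ) :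
    |Qw P τ D n s w b| ≤ if (∀ i, i < n → al τ (w i) (b + posn w s i) ≠ 0) then 1 else 0 := by
  split_ifs with h
  · unfold Qw
    rw [abs_mul]
    exact mul_le_one₀ (abs_prod_le_one _ _ fun i _ => abs_al_le _ _ _) (abs_nonneg _)
      (abs_prod_le_one _ _ fun i _ => abs_Yv_le _ _ _ _)
  · push Not at h
    obtain ⟨i, hi, h⟩ := h
    rw [Qw, Finset.prod_eq_zero (mem_range.2 hi) h]; simp

lemma hit_iff {τ : ℤ} {p : ℕ} {x : ℤ} : hit τ p x ↔ ∃ e ∈ ({0, 1} : Finset ℤ), (p:ℤ) ∣ x + e * τ := by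
  simp [hit]

lemma cons_of_ne {P : Finset ℕ} {τ : ℤ} {D n : ℕ} {s : ℕ → ℤ} {w : ℕ → ℕ} {b : ℤ} (h : Qw P τ D n s w b ≠ 0) :
    ∀ i i', i < n → i' < n → w i = w i' → ∃ cc ∈ ({-1, 0, 1} : Finset ℤ),
    (w i : ℤ) ∣ posn w s i - posn w s i' + cc * τ := by
  have hal : ∀ i, i < n → al τ (w i) (b + posn w s i) ≠ 0 := by
    by_contra hn
    have := abs_Qw_le P τ D n s w b
    rw [if_neg hn] at this
    exact h (abs_nonpos_iff.1 this)
  intro i i' hi hi' hw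
  obtain ⟨e, he, hd⟩ := hit_iff.1 (hit_of_al (hal i hi))
  obtain ⟨e', he', hd'⟩ := hit_iff.1 (hit_of_al (hal i' hi'))
  rw [← hw] at hd'
  refine ⟨e - e', ?_, ?_⟩
  · simp only [mem_insert, mem_singleton] at he he' ⊢; omega
  · have := dvd_sub hd hd'
    have e : b + posn w s i + e * τ - (b + posn w s i' + e' * τ) = posn w s i - posn w s i' + (e - e') * τ := by ring
    rwa [e] at this

lemma count_hits (P : Finset ℕ) (hP : ∀ p ∈ P, p.Prime) (τ : ℤ) (n : ℕ) (s : ℕ → ℤ) (w : ℕ → ℕ)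
    (hw : ∀ i, i < n → w i ∈ P) (X : ℤ) (T : ℕ) (U : Finset ℕ) (hU : U ⊆ P \ (range n).image w)
    (hT : (∏ p ∈ (range n).image w ∪ U, p) ≤ T) :
    (((Ico X (X+T)).filter fun b => (∀ i, i < n → al τ (w i) (b + posn w s i) ≠ 0) ∧
      ∀ l ∈ U, ∃ v ∈ range (n+1), hit τ l (b + posn w s v)).card : ℝ) ≤
      2 * T * wt n w * ∏ l ∈ U, (2 * ((n:ℝ)+1) / l) := by
  set Λ := (range n).image w with hΛ
  have hΛP : Λ ⊆ P := by
    intro p hp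
    obtain ⟨i, hi, rfl⟩ := mem_image.1 hp
    exact hw i (mem_range.1 hi)
  have hUP : U ⊆ P := hU.trans sdiff_subset
  have hdis : Disjoint Λ U := by
    rw [disjoint_right]; intro a ha h; exact (mem_sdiff.1 (hU ha)).2 h
  have hpr : ∀ p ∈ Λ ∪ U, p.Prime := fun p hp => (mem_union.1 hp).elim (fun h => hP p (hΛP h)) (fun h => hP p (hUP h))
  have hi : ∀ p, ∃ i, p ∈ Λ → i < n ∧ w i = p := by
    intro p
    by_cases h : p ∈ Λ
    · obtain ⟨i, hi, he⟩ := mem_image.1 h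
      exact ⟨i, fun _ => ⟨mem_range.1 hi, he⟩⟩
    · exact ⟨0, fun h' => absurd h' h⟩
  choose ix hix using hi
  set R : ℕ → Finset ℤ := fun p => if p ∈ Λ then ({0,1} : Finset ℤ).image (fun e => -(posn w s (ix p) + e * τ))
    else (range (n+1) ×ˢ ({0,1} : Finset ℤ)).image (fun q => -(posn w s q.1 + q.2 * τ)) with hR
  set ρ : ℕ → ℕ := fun p => if p ∈ Λ then 2 else 2 * (n+1) with hρ
  have hcount := crt_count X T (Λ ∪ U) hpr R ρ (by
    intro p _
    simp only [hR, hρ]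
    split_ifs
    · exact card_image_le
    · refine card_image_le.trans ?_
      rw [card_product, card_range]
      simp; omega) _ (filter_subset (fun b => (∀ i, i < n → al τ (w i) (b + posn w s i) ≠ 0) ∧
      ∀ l ∈ U, ∃ v ∈ range (n+1), hit τ l (b + posn w s v)) (Ico X (X+T))) (by
    intro b hb p hp
    simp only [mem_filter] at hb
    obtain ⟨_, h1, h2⟩ := hb
    simp only [hR]
    split_ifs with h
    · obtain ⟨hi, hwi⟩ := hix p h
      have := hit_of_al (h1 (ix p) hi)
      rw [hwi] at this
      obtain ⟨e, he, hd⟩ := hit_iff.1 this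
      refine ⟨_, mem_image_of_mem _ he, ?_⟩
      have e : b - -(posn w s (ix p) + e * τ) = b + posn w s (ix p) + e * τ := by ring
      rwa [e]
    · have hpU : p ∈ U := (mem_union.1 hp).resolve_left h
      obtain ⟨v, hv, hh⟩ := h2 p hpU
      obtain ⟨e, he, hd⟩ := hit_iff.1 hh
      refine ⟨_, mem_image_of_mem _ (mem_product.2 (⟨hv, he⟩ : (v, e).1 ∈ _ ∧ (v,e).2 ∈ _)), ?_⟩
      have e : b - -(posn w s v + e * τ) = b + posn w s v + e * τ := by ring
      simpa only [e] using hd)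
  refine hcount.trans ?_
  have hpos : 0 < ∏ p ∈ Λ ∪ U, p := Finset.prod_pos fun p hp => (hpr p hp).pos
  have hpos' : (0:ℝ) < ((∏ p ∈ Λ ∪ U, p : ℕ) : ℝ) := by exact_mod_cast hpos
  have h1 : (T / ((∏ p ∈ Λ ∪ U, p : ℕ) : ℝ) + 1) ≤ 2 * T / ((∏ p ∈ Λ ∪ U, p : ℕ) : ℝ) := by
    have : (1:ℝ) ≤ T / ((∏ p ∈ Λ ∪ U, p : ℕ) : ℝ) := by
      rw [le_div_iff₀ hpos', one_mul]; exact_mod_cast hT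
    have e : 2 * (T:ℝ) / ((∏ p ∈ Λ ∪ U, p : ℕ) : ℝ) = T / ((∏ p ∈ Λ ∪ U, p : ℕ) : ℝ) + T / ((∏ p ∈ Λ ∪ U, p : ℕ) : ℝ) := by ring
    rw [e]; linarith
  calc _ ≤ 2 * T / ((∏ p ∈ Λ ∪ U, p : ℕ) : ℝ) * ∏ p ∈ Λ ∪ U, (ρ p : ℝ) := by
        apply mul_le_mul_of_nonneg_right h1; positivity
    _ = 2 * T * ∏ p ∈ Λ ∪ U, ((ρ p : ℝ) / p) := by
        rw [Finset.prod_div_distrib]; push_cast; ring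
    _ = 2 * T * ((∏ p ∈ Λ, ((ρ p : ℝ) / p)) * ∏ p ∈ U, ((ρ p : ℝ) / p)) := by rw [Finset.prod_union hdis]
    _ = _ := by
        rw [wt, ← hΛ, ← mul_assoc]
        congr 1
        · congr 1
          apply Finset.prod_congr rfl; intro p hp; simp [hρ, hp]
        · apply Finset.prod_congr rfl; intro p hp
          have : p ∉ Λ := fun h => disjoint_left.1 hdis h hp
          simp [hρ, this]

lemma wt_nonneg (n : ℕ) (w : ℕ → ℕ) : 0 ≤ wt n w := Finset.prod_nonneg fun _ _ => by positivity

lemma sum_Qw_le (P : Finset ℕ) (hP : ∀ p ∈ P, p.Prime) (τ : ℤ) (D n : ℕ) (s : ℕ → ℤ) (w : ℕ → ℕ)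
    (hw : ∀ i, i < n → w i ∈ P) (X : ℤ) (T : ℕ) (hT : (∏ p ∈ (range n).image w, p) ≤ T) :
    |∑ b ∈ Ico X (X+T), Qw P τ D n s w b| ≤ 2 * T * wt n w := by
  have := count_hits P hP τ n s w hw X T ∅ (by simp) (by simpa using hT)
  simp only [notMem_empty, false_implies, implies_true, and_true, prod_empty, mul_one] at this
  refine le_trans ?_ this
  refine (Finset.abs_sum_le_sum_abs _ _).trans ?_
  rw [card_filter]
  push_cast
  exact Finset.sum_le_sum fun b _ => abs_Qw_le P τ D n s w b

lemma sum_Ico_eq (g : ℤ → ℝ) (X : ℤ) (T : ℕ) : ∑ b ∈ Ico X (X+T), g b = ∑ t ∈ range T, g (X + t) := by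
  symm
  apply Finset.sum_nbij' (fun t : ℕ => X + t) (fun b => (b - X).toNat)
  · intro t ht; simp at ht ⊢; omega
  · intro b hb; simp at hb ⊢; omega
  · intro t ht; simp
  · intro b hb; simp at hb ⊢; omega
  · intro t ht; rfl

lemma sum_shift (g : ℤ → ℝ) {B : ℝ} (hB : ∀ x, |g x| ≤ B) (X : ℤ) (T δ : ℕ) :
    |∑ b ∈ Ico X (X+T), g (b + δ) - ∑ b ∈ Ico X (X+T), g b| ≤ 2 * B * δ := by
  induction δ with
  | zero => simp
  | succ δ ih =>
    have : |∑ b ∈ Ico X (X+T), g (b + (δ+1 : ℕ)) - ∑ b ∈ Ico X (X+T), g (b + δ)| ≤ 2 * B := by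
      rw [sum_Ico_eq, sum_Ico_eq, ← Finset.sum_sub_distrib]
      have e : ∑ t ∈ range T, (g (X + t + (δ+1 : ℕ)) - g (X + t + δ)) = g (X + T + δ) - g (X + (0:ℕ) + δ) := by
        rw [← Finset.sum_range_sub (fun t : ℕ => g (X + t + δ))]
        apply Finset.sum_congr rfl
        intro t _
        congr 2
        push_cast; ring
      rw [e]
      refine (abs_sub _ _).trans ?_
      linarith [hB (X + T + δ), hB (X + (0:ℕ) + δ)]
    have h2 := abs_add_le (∑ b ∈ Ico X (X+T), g (b + (δ+1 : ℕ)) - ∑ b ∈ Ico X (X+T), g (b + δ)) (∑ b ∈ Ico X (X+T), g (b + δ) - ∑ b ∈ Ico X (X+T), g b)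
    rw [sub_add_sub_cancel] at h2
    push_cast at *
    linarith

end MC


namespace MC
open Finset Classical

noncomputable def Gb (τ : ℤ) (D n : ℕ) (s : ℕ → ℤ) (w : ℕ → ℕ) (b : ℤ) (U : Finset ℕ) : ℝ :=
  ∏ v ∈ range (n+1), Yv ((range n).image w ∪ U) τ D (b + posn w s v)

noncomputable def fU (τ : ℤ) (D n : ℕ) (s : ℕ → ℤ) (w : ℕ → ℕ) (U : Finset ℕ) (b : ℤ) : ℝ :=
  (∏ i ∈ range n, al τ (w i) (b + posn w s i)) *
    ((if ∀ l ∈ U, ∃ v ∈ range (n+1), hit τ l (b + posn w s v) then 1 else 0) * mu (Gb τ D n s w b) U)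

lemma abs_Gb_le (τ : ℤ) (D n : ℕ) (s : ℕ → ℤ) (w : ℕ → ℕ) (b : ℤ) (U : Finset ℕ) : |Gb τ D n s w b U| ≤ 1 :=
  abs_prod_le_one _ _ fun i _ => abs_Yv_le _ _ _ _

lemma abs_fU_le (τ : ℤ) (D n : ℕ) (s : ℕ → ℤ) (w : ℕ → ℕ) (U : Finset ℕ) (b : ℤ) : |fU τ D n s w U b| ≤ 2^U.card := by
  unfold fU
  rw [abs_mul, abs_mul]
  have h1 : |∏ i ∈ range n, al τ (w i) (b + posn w s i)| ≤ 1 := abs_prod_le_one _ _ fun i _ => abs_al_le _ _ _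
  have h2 := abs_mu_le (Gb τ D n s w b) (abs_Gb_le τ D n s w b) U
  have h3 : |(if ∀ l ∈ U, ∃ v ∈ range (n+1), hit τ l (b + posn w s v) then (1:ℝ) else 0)| ≤ 1 := by
    split_ifs <;> simp
  have h4 : |(if ∀ l ∈ U, ∃ v ∈ range (n+1), hit τ l (b + posn w s v) then (1:ℝ) else 0)| * |mu (Gb τ D n s w b) U| ≤ 1 * 2^U.card :=
    mul_le_mul h3 h2 (abs_nonneg _) zero_le_one
  calc _ ≤ 1 * (1 * 2^U.card) := mul_le_mul h1 h4 (by positivity) zero_le_one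
    _ = 2^U.card := by ring

lemma dvd_shift {q d x : ℤ} (h : q ∣ d) : q ∣ x + d ↔ q ∣ x := (Int.dvd_add_left h)

/-- swap of the two residue classes of the lone untouched letter -/
lemma fU_swap {τ : ℤ} {D n : ℕ} {s : ℕ → ℤ} {w : ℕ → ℕ} {y : ℕ} (hy : LoneU n s τ w y)
    (hτ : ¬ (w y : ℤ) ∣ τ) {U : Finset ℕ} (hU : w y ∉ U) {δ : ℤ} (hδ : (w y : ℤ) ∣ δ + τ)
    (hδ' : ∀ l ∈ (range n).image w ∪ U, l ≠ w y → (l:ℤ) ∣ δ) {b : ℤ} (hb : (w y : ℤ) ∣ b + posn w s y) :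
    fU τ D n s w U (b + δ) = - fU τ D n s w U b := by
  obtain ⟨hyn, hlone, hunt⟩ := hy
  have hhit : ∀ l ∈ (range n).image w ∪ U, ∀ v ∈ range (n+1), (hit τ l (b + δ + posn w s v) ↔ hit τ l (b + posn w s v)) := by
    intro l hl v hv
    have hv : v ≤ n := by have := mem_range.1 hv; omega
    by_cases hlp : l = w y
    · subst hlp
      have hps : posn w s (y+1) = posn w s y + s y * w y := posn_succ w s y
      by_cases hvy : v = y ∨ v = y + 1
      · have hA : (w y : ℤ) ∣ b + posn w s v := by
          rcases hvy with rfl | rfl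
          · exact hb
          · rw [hps, ← add_assoc]; exact dvd_add hb (dvd_mul_left _ _)
        have hB : (w y : ℤ) ∣ b + δ + posn w s v + τ := by
          have := dvd_add hA hδ
          have e : b + posn w s v + (δ + τ) = b + δ + posn w s v + τ := by ring
          rwa [e] at this
        exact ⟨fun _ => Or.inl hA, fun _ => Or.inr hB⟩
      · push Not at hvy
        have hu := hunt v hv hvy.1 hvy.2
        have key : ∀ (cc : ℤ) (x : ℤ), cc ∈ ({-1,0,1} : Finset ℤ) → (w y : ℤ) ∣ x - (posn w s v - posn w s y + cc * τ) → ¬ (w y : ℤ) ∣ x := by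
          intro cc x hcc hx hx'
          apply hu cc hcc
          have h1 := dvd_sub hx' hx
          have h2 : (w y : ℤ) ∣ s y * w y := dvd_mul_left _ _
          have := dvd_sub h1 h2
          have e : x - (x - (posn w s v - posn w s y + cc * τ)) - s y * w y = posn w s v - posn w s (y+1) + cc * τ := by
            rw [hps]; ring
          rwa [e] at this
        constructor
        · rintro (h | h)
          · exfalso
            refine key (-1) _ (by simp) ?_ h
            have := dvd_add hb hδ
            have e : b + posn w s y + (δ + τ) = b + δ + posn w s v - (posn w s v - posn w s y + (-1) * τ) := by ring
            rwa [e] at this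
          · exfalso
            refine key 0 _ (by simp) ?_ h
            have := dvd_add hb hδ
            have e : b + posn w s y + (δ + τ) = b + δ + posn w s v + τ - (posn w s v - posn w s y + 0 * τ) := by ring
            rwa [e] at this
        · rintro (h | h)
          · exfalso
            refine key 0 _ (by simp) ?_ h
            have e : b + posn w s y = b + posn w s v - (posn w s v - posn w s y + 0 * τ) := by ring
            rwa [e] at hb
          · exfalso
            refine key 1 _ (by simp) ?_ h
            have e : b + posn w s y = b + posn w s v + τ - (posn w s v - posn w s y + 1 * τ) := by ring
            rwa [e] at hb
    · have hd := hδ' l hl hlp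
      unfold hit
      have e1 : b + δ + posn w s v = b + posn w s v + δ := by ring
      have e2 : b + δ + posn w s v + τ = b + posn w s v + τ + δ := by ring
      rw [e1] at *
      rw [dvd_shift hd]
      have e2 : b + posn w s v + δ + τ = b + posn w s v + τ + δ := by ring
      rw [e2, dvd_shift hd]
  have hG : ∀ U' ∈ U.powerset, Gb τ D n s w (b + δ) U' = Gb τ D n s w b U' := by
    intro U' hU'
    unfold Gb
    apply Finset.prod_congr rfl
    intro v hv
    unfold Yv hp
    have : ((range n).image w ∪ U').filter (fun p => hit τ p (b + δ + posn w s v)) = ((range n).image w ∪ U').filter (fun p => hit τ p (b + posn w s v)) := by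
      apply Finset.filter_congr
      intro l hl
      exact hhit l (union_subset_union_right (mem_powerset.1 hU') hl) v hv
    rw [this]
  have hmu : mu (Gb τ D n s w (b + δ)) U = mu (Gb τ D n s w b) U := by
    unfold mu
    apply Finset.sum_congr rfl
    intro U' hU'
    rw [hG U' hU']
  have hif : (∀ l ∈ U, ∃ v ∈ range (n+1), hit τ l (b + δ + posn w s v)) ↔ (∀ l ∈ U, ∃ v ∈ range (n+1), hit τ l (b + posn w s v)) := by
    apply forall₂_congr
    intro l hl
    apply exists_congr
    intro v
    apply and_congr_right
    intro hv
    exact hhit l (mem_union_right _ hl) v hv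
  have hal : ∏ i ∈ range n, al τ (w i) (b + δ + posn w s i) = - ∏ i ∈ range n, al τ (w i) (b + posn w s i) := by
    have : ∀ i ∈ range n, al τ (w i) (b + δ + posn w s i) = (if i = y then -1 else 1) * al τ (w i) (b + posn w s i) := by
      intro i hi
      by_cases hiy : i = y
      · subst hiy
        have h1 : al τ (w i) (b + posn w s i) = 1 := by
          have : ¬ (w i : ℤ) ∣ b + posn w s i + τ := fun h => hτ ((Int.dvd_add_right hb).1 h)
          simp [al, hb, this]
        have h2 : al τ (w i) (b + δ + posn w s i) = -1 := by
          have hB : (w i : ℤ) ∣ b + δ + posn w s i + τ := by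
            have := dvd_add hb hδ
            have e : b + posn w s i + (δ + τ) = b + δ + posn w s i + τ := by ring
            rwa [e] at this
          have : ¬ (w i : ℤ) ∣ b + δ + posn w s i := fun h => hτ ((Int.dvd_add_right h).1 hB)
          simp [al, hB, this]
        rw [h1, h2]; simp
      · have hne : w i ≠ w y := fun h => hiy (hlone i (mem_range.1 hi) h)
        have hd := hδ' (w i) (mem_union_left _ (mem_image_of_mem _ hi)) hne
        have e1 : b + δ + posn w s i = b + posn w s i + δ := by ring
        have e2 : b + posn w s i + δ + τ = b + posn w s i + τ + δ := by ring
        unfold al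
        rw [if_neg hiy, one_mul, e1, e2]
        simp only [dvd_shift hd]
    rw [Finset.prod_congr rfl this, Finset.prod_mul_distrib, Finset.prod_ite_eq' (range n) y (fun _ => (-1:ℝ))]
    simp [hyn]
  unfold fU
  rw [hal, hmu]
  simp only [hif]
  ring

lemma exists_delta {p D' : ℕ} (hp : p.Prime) (hc : Nat.Coprime D' p) (τ : ℤ) :
    ∃ k : ℕ, k < p ∧ (p:ℤ) ∣ ((D' * k : ℕ) : ℤ) + τ := by
  obtain ⟨u, v, huv⟩ := Nat.isCoprime_iff_coprime.2 hc
  have hp0 : (p:ℤ) ≠ 0 := by exact_mod_cast hp.ne_zero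
  have hpos : (0:ℤ) < p := by exact_mod_cast hp.pos
  have h1 := Int.emod_nonneg (-τ * u) hp0
  have h2 := Int.emod_lt_of_pos (-τ * u) hpos
  refine ⟨((-τ * u) % p).toNat, by omega, ?_⟩
  push_cast
  rw [Int.toNat_of_nonneg h1]
  have h3 : (-τ * u) % p = -τ * u - p * ((-τ * u) / p) := by
    have := Int.emod_add_mul_ediv (-τ * u) p; linarith
  rw [h3]
  have : (D':ℤ) * (-τ * u - p * (-τ * u / p)) + τ = p * (τ * v - D' * (-τ * u / p)) := by
    linear_combination (-τ) * huv
  rw [this]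
  exact dvd_mul_right _ _

lemma sum_fU_le (P : Finset ℕ) (hP : ∀ p ∈ P, p.Prime) (τ : ℤ) (D n : ℕ) (s : ℕ → ℤ) (w : ℕ → ℕ)
    (hw : ∀ i, i < n → w i ∈ P) {y : ℕ} (hy : LoneU n s τ w y) (hτ : ¬ (w y : ℤ) ∣ τ)
    {U : Finset ℕ} (hU : U ⊆ P \ (range n).image w) (X : ℤ) (T : ℕ) :
    |∑ b ∈ Ico X (X+T), fU τ D n s w U b| ≤ 2 * 2^U.card * ((∏ p ∈ (range n).image w ∪ U, p : ℕ) : ℝ) := by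
  set Λ := (range n).image w with hΛ
  have hyΛ : w y ∈ Λ := mem_image_of_mem _ (mem_range.2 hy.1)
  have hyU : w y ∉ U := fun h => (mem_sdiff.1 (hU h)).2 hyΛ
  have hpr : ∀ p ∈ Λ ∪ U, p.Prime := by
    intro p hp
    rcases mem_union.1 hp with h | h
    · obtain ⟨i, hi, rfl⟩ := mem_image.1 h
      exact hP _ (hw i (mem_range.1 hi))
    · exact hP p (mem_sdiff.1 (hU h)).1
  have hmem : w y ∈ Λ ∪ U := mem_union_left _ hyΛ
  set D' := ∏ l ∈ (Λ ∪ U).erase (w y), l with hD'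
  have hprod : w y * D' = ∏ p ∈ Λ ∪ U, p := Finset.mul_prod_erase (Λ ∪ U) (fun p => p) hmem
  have hc : Nat.Coprime D' (w y) := by
    apply Nat.Coprime.prod_left
    intro l hl
    rw [mem_erase] at hl
    exact (Nat.coprime_primes (hpr l hl.2) (hpr _ hmem)).2 hl.1
  obtain ⟨k, hk, hδ⟩ := exists_delta (hpr _ hmem) hc τ
  set δ := D' * k with hδdef
  have hδle : δ ≤ ∏ p ∈ Λ ∪ U, p := by
    rw [← hprod, mul_comm (w y)]; exact Nat.mul_le_mul_left _ hk.le
  have hδ' : ∀ l ∈ Λ ∪ U, l ≠ w y → (l:ℤ) ∣ (δ:ℤ) := by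
    intro l hl hne
    have : l ∣ δ := (Finset.dvd_prod_of_mem (fun l => l) (mem_erase.2 ⟨hne, hl⟩)).trans (Dvd.intro _ rfl)
    exact_mod_cast this
  set f1 : ℤ → ℝ := fun b => if (w y : ℤ) ∣ b + posn w s y then fU τ D n s w U b else 0 with hf1
  set f2 : ℤ → ℝ := fun b => if (w y : ℤ) ∣ b + posn w s y + τ then fU τ D n s w U b else 0 with hf2
  have h12 : ∀ b, fU τ D n s w U b = f1 b + f2 b := by
    intro b
    simp only [hf1, hf2]
    by_cases h1 : (w y : ℤ) ∣ b + posn w s y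
    · have : ¬ (w y : ℤ) ∣ b + posn w s y + τ := fun h => hτ ((Int.dvd_add_right h1).1 h)
      simp [h1, this]
    · by_cases h2 : (w y : ℤ) ∣ b + posn w s y + τ
      · simp [h1, h2]
      · have : al τ (w y) (b + posn w s y) = 0 := by simp [al, h1, h2]
        rw [if_neg h1, if_neg h2, fU, Finset.prod_eq_zero (mem_range.2 hy.1) this]; simp
  have h21 : ∀ b, f2 (b + δ) = - f1 b := by
    intro b
    simp only [hf1, hf2]
    have e : (w y : ℤ) ∣ b + δ + posn w s y + τ ↔ (w y : ℤ) ∣ b + posn w s y := by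
      have e : b + δ + posn w s y + τ = b + posn w s y + (δ + τ) := by ring
      rw [e, dvd_shift hδ]
    simp only [e]
    split_ifs with h
    · exact fU_swap hy hτ hyU hδ hδ' h
    · simp
  have hb2 : ∀ x, |f2 x| ≤ 2^U.card := by
    intro x
    simp only [hf2]
    split_ifs
    · exact abs_fU_le _ _ _ _ _ _ _
    · simp
  have hs := sum_shift f2 hb2 X T δ
  have e : ∑ b ∈ Ico X (X+T), fU τ D n s w U b = - (∑ b ∈ Ico X (X+T), f2 (b + δ) - ∑ b ∈ Ico X (X+T), f2 b) := by
    simp only [h12, h21, Finset.sum_add_distrib, Finset.sum_neg_distrib]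
    ring
  rw [e, abs_neg]
  refine hs.trans ?_
  have : (δ:ℝ) ≤ ((∏ p ∈ Λ ∪ U, p : ℕ) : ℝ) := by exact_mod_cast hδle
  gcongr

end MC


namespace MC
open Finset Classical

lemma prod_le_pow (S : Finset ℕ) {Hn k : ℕ} (h : ∀ p ∈ S, p ≤ Hn) (hH : 1 ≤ Hn) (hk : S.card ≤ k) : ∏ p ∈ S, p ≤ Hn^k :=
  (Finset.prod_le_pow_card S (fun p => p) Hn h).trans (Nat.pow_le_pow_right hH hk)

theorem sum_Qw_lone (P : Finset ℕ) (hP : ∀ p ∈ P, p.Prime) {Hn : ℕ} (hH : 1 ≤ Hn) (hPH : ∀ p ∈ P, p ≤ Hn)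
    (τ : ℤ) (D n : ℕ) (s : ℕ → ℤ) (w : ℕ → ℕ)
    (hw : ∀ i, i < n → w i ∈ P) {y : ℕ} (hy : LoneU n s τ w y) (X : ℤ) (T m : ℕ) (hm : 0 < m) (hT : Hn^(n+m) ≤ T)
    {L : ℝ} (hL0 : 0 < L) (hL : ∑ p ∈ P, 1 / (p:ℝ) ≤ L) :
    |∑ b ∈ Ico X (X+T), Qw P τ D n s w b| ≤
      2 * T * wt n w * (2 * (Real.exp 1 * (2 * (n+1) * L) / m))^m + (P.card+1 : ℝ)^m * (2 * 2^m * (Hn:ℝ)^(n+m)) := by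
  by_cases hτ : (w y : ℤ) ∣ τ
  · have : ∀ b, Qw P τ D n s w b = 0 := by
      intro b
      have h0 : al τ (w y) (b + posn w s y) = 0 := by
        unfold al
        have : (w y : ℤ) ∣ b + posn w s y + τ ↔ (w y : ℤ) ∣ b + posn w s y := dvd_shift hτ
        simp only [this, sub_self]
      rw [Qw, Finset.prod_eq_zero (mem_range.2 hy.1) h0, zero_mul]
    simp only [this, Finset.sum_const_zero, abs_zero]
    have := wt_nonneg n w
    positivity
  set Λ := (range n).image w with hΛ
  have hΛP : Λ ⊆ P := by
    intro p hp
    obtain ⟨i, hi, rfl⟩ := mem_image.1 hp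
    exact hw i (mem_range.1 hi)
  have hΛc : Λ.card ≤ n := by have := card_image_le (s := range n) (f := w); rwa [card_range] at this
  have hprodle : ∀ U ⊆ P \ Λ, U.card ≤ m → ∏ p ∈ Λ ∪ U, p ≤ Hn^(n+m) := by
    intro U hU hUm
    apply prod_le_pow _ _ hH
    · have := card_union_le Λ U; omega
    · intro p hp
      rcases mem_union.1 hp with h | h
      · exact hPH p (hΛP h)
      · exact hPH p (mem_sdiff.1 (hU h)).1
  set V : ℤ → Finset ℕ := fun b => (P \ Λ).filter fun l => ∃ v ∈ range (n+1), hit τ l (b + posn w s v) with hV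
  have hQ : ∀ b, Qw P τ D n s w b = (∏ i ∈ range n, al τ (w i) (b + posn w s i)) * Gb τ D n s w b (V b) := by
    intro b
    unfold Qw Gb
    congr 1
    apply Finset.prod_congr rfl
    intro v hv
    unfold Yv hp
    have : P.filter (fun p => hit τ p (b + posn w s v)) = (Λ ∪ V b).filter (fun p => hit τ p (b + posn w s v)) := by
      ext l
      simp only [mem_filter, mem_union, hV, mem_sdiff]
      constructor
      · rintro ⟨h1, h2⟩
        by_cases h : l ∈ Λ
        · exact ⟨Or.inl h, h2⟩
        · exact ⟨Or.inr ⟨⟨h1, h⟩, v, hv, h2⟩, h2⟩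
      · rintro ⟨h1 | h1, h2⟩
        · exact ⟨hΛP h1, h2⟩
        · exact ⟨h1.1.1, h2⟩
    rw [this]
  set E : ℤ → ℝ := fun b => if (∀ i, i < n → al τ (w i) (b + posn w s i) ≠ 0) then 2^m * ((V b).card.choose m : ℝ) else 0 with hE
  have hmain : ∀ b, |Qw P τ D n s w b - ∑ U ∈ (P \ Λ).powerset.filter (fun U => U.card < m), fU τ D n s w U b| ≤ E b := by
    intro b
    have e1 : ∑ U ∈ (P \ Λ).powerset.filter (fun U => U.card < m), fU τ D n s w U b =
        (∏ i ∈ range n, al τ (w i) (b + posn w s i)) * ∑ U ∈ (V b).powerset, if U.card < m then mu (Gb τ D n s w b) U else 0 := by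
      rw [Finset.mul_sum, Finset.sum_filter]
      symm
      apply Finset.sum_subset_zero_on_sdiff
      · exact powerset_mono.2 (filter_subset _ _)
      · intro U hU
        rw [mem_sdiff, mem_powerset, mem_powerset] at hU
        split_ifs with h
        · have : ¬ ∀ l ∈ U, ∃ v ∈ range (n+1), hit τ l (b + posn w s v) := by
            intro hh
            exact hU.2 fun l hl => mem_filter.2 ⟨hU.1 hl, hh l hl⟩
          rw [fU, if_neg this]; ring
        · rfl
      · intro U hU
        rw [mem_powerset] at hU
        have : ∀ l ∈ U, ∃ v ∈ range (n+1), hit τ l (b + posn w s v) := fun l hl => (mem_filter.1 (hU hl)).2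
        rw [fU, if_pos this]
        split_ifs <;> ring
    rw [e1, hQ, ← mul_sub, abs_mul]
    have hb := bonferroni (V b) m 1 (Gb τ D n s w b) (abs_Gb_le τ D n s w b)
    rw [one_mul] at hb
    simp only [hE]
    split_ifs with h
    · have h1 : |∏ i ∈ range n, al τ (w i) (b + posn w s i)| ≤ 1 := abs_prod_le_one _ _ fun i _ => abs_al_le _ _ _
      calc _ ≤ 1 * (2^m * ((V b).card.choose m : ℝ)) := mul_le_mul h1 hb (abs_nonneg _) zero_le_one
        _ = _ := one_mul _
    · push Not at h
      obtain ⟨i, hi, h⟩ := h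
      rw [Finset.prod_eq_zero (mem_range.2 hi) h]; simp
  have hEsum : ∑ b ∈ Ico X (X+T), E b ≤ 2 * T * wt n w * (2 * (Real.exp 1 * (2 * (n+1) * L) / m))^m := by
    have e1 : ∀ b, E b = 2^m * ∑ U ∈ (P \ Λ).powersetCard m, if ((∀ i, i < n → al τ (w i) (b + posn w s i) ≠ 0) ∧
      ∀ l ∈ U, ∃ v ∈ range (n+1), hit τ l (b + posn w s v)) then (1:ℝ) else 0 := by
      intro b
      simp only [hE]
      split_ifs with h
      · congr 1
        rw [← card_powersetCard, Finset.sum_boole]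
        congr 2
        ext U
        simp only [mem_filter, mem_powersetCard]
        constructor
        · rintro ⟨h1, h2⟩
          exact ⟨⟨h1.trans (filter_subset _ _), h2⟩, h, fun l hl => (mem_filter.1 (h1 hl)).2⟩
        · rintro ⟨⟨h1, h2⟩, _, h3⟩
          exact ⟨fun l hl => mem_filter.2 ⟨h1 hl, h3 l hl⟩, h2⟩
      · simp [h]
    simp only [e1]
    rw [← Finset.mul_sum, Finset.sum_comm]
    have e2 : ∀ U ∈ (P \ Λ).powersetCard m, ∑ b ∈ Ico X (X+T), (if ((∀ i, i < n → al τ (w i) (b + posn w s i) ≠ 0) ∧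
      ∀ l ∈ U, ∃ v ∈ range (n+1), hit τ l (b + posn w s v)) then (1:ℝ) else 0) ≤ 2 * T * wt n w * ∏ l ∈ U, (2 * ((n:ℝ)+1) / l) := by
      intro U hU
      rw [mem_powersetCard] at hU
      rw [Finset.sum_boole]
      exact count_hits P hP τ n s w hw X T U hU.1 ((hprodle U hU.1 hU.2.le).trans hT)
    have e3 := esymm_le (P \ Λ) (fun l => 2 * ((n:ℝ)+1) / l) (fun i _ => by positivity) (X := 2 * (n+1) * L) (by positivity) (by
      calc ∑ i ∈ P \ Λ, 2 * ((n:ℝ)+1) / i ≤ ∑ i ∈ P, 2 * ((n:ℝ)+1) / i :=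
            Finset.sum_le_sum_of_subset_of_nonneg sdiff_subset (fun i _ _ => by positivity)
        _ = 2 * (n+1) * ∑ p ∈ P, 1 / (p:ℝ) := by
            rw [Finset.mul_sum]; apply Finset.sum_congr rfl; intro i _; ring
        _ ≤ _ := by gcongr) hm
    have hwn := wt_nonneg n w
    calc _ ≤ 2^m * ∑ U ∈ (P \ Λ).powersetCard m, 2 * T * wt n w * ∏ l ∈ U, (2 * ((n:ℝ)+1) / l) := by
          gcongr with U hU
          exact e2 U hU
      _ = 2 * T * wt n w * (2^m * ∑ U ∈ (P \ Λ).powersetCard m, ∏ l ∈ U, (2 * ((n:ℝ)+1) / l)) := by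
          rw [← Finset.mul_sum]; ring
      _ ≤ 2 * T * wt n w * (2^m * (Real.exp 1 * (2 * (n+1) * L) / m)^m) := by gcongr
      _ = _ := by rw [mul_pow]
  have hf : |∑ b ∈ Ico X (X+T), ∑ U ∈ (P \ Λ).powerset.filter (fun U => U.card < m), fU τ D n s w U b| ≤
      (P.card+1 : ℝ)^m * (2 * 2^m * (Hn:ℝ)^(n+m)) := by
    rw [Finset.sum_comm]
    refine (Finset.abs_sum_le_sum_abs _ _).trans ?_
    calc _ ≤ ∑ U ∈ (P \ Λ).powerset.filter (fun U => U.card < m), 2 * 2^m * (Hn:ℝ)^(n+m) := by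
          apply Finset.sum_le_sum
          intro U hU
          rw [mem_filter, mem_powerset] at hU
          refine (sum_fU_le P hP τ D n s w hw hy hτ hU.1 X T).trans ?_
          have h1 : ((∏ p ∈ Λ ∪ U, p : ℕ) : ℝ) ≤ (Hn:ℝ)^(n+m) := by exact_mod_cast hprodle U hU.1 hU.2.le
          have h2 : (2:ℝ)^U.card ≤ 2^m := pow_le_pow_right₀ (by norm_num) hU.2.le
          gcongr
      _ ≤ _ := by
          rw [Finset.sum_const, nsmul_eq_mul]
          gcongr
          have h1 : ((P \ Λ).powerset.filter (fun U => U.card < m)).card ≤ (P.card + 1)^m := by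
            refine le_trans (card_le_card ?_) (card_small P m)
            intro U hU
            rw [mem_filter, mem_powerset] at hU ⊢
            exact ⟨hU.1.trans sdiff_subset, hU.2.le⟩
          exact_mod_cast h1
  have htot : |∑ b ∈ Ico X (X+T), Qw P τ D n s w b - ∑ b ∈ Ico X (X+T), ∑ U ∈ (P \ Λ).powerset.filter (fun U => U.card < m), fU τ D n s w U b|
      ≤ ∑ b ∈ Ico X (X+T), E b := by
    rw [← Finset.sum_sub_distrib]
    exact (Finset.abs_sum_le_sum_abs _ _).trans (Finset.sum_le_sum fun b _ => hmain b)
  have := abs_sub_abs_le_abs_sub (∑ b ∈ Ico X (X+T), Qw P τ D n s w b) (∑ b ∈ Ico X (X+T), ∑ U ∈ (P \ Λ).powerset.filter (fun U => U.card < m), fU τ D n s w U b)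
  linarith

end MC


namespace MC
open Finset Classical

noncomputable def SS (n q : ℕ) (X Q : ℝ) (Dm : ℕ → ℕ) (r0 : ℕ) : ℝ :=
  ∑ r ∈ Icc r0 n, ((n:ℝ) + 2)^(5*r) * (2^n * ((n:ℝ)+2)^(64 * (q + 1 + 4 * r * q))) * (X ^ Dm r * Q ^ r)

def DmB (n q r : ℕ) : ℕ := (n + 2 * r + 10 * (q + 1 + 4 * r * q)) / 2

theorem trace_words {n j q : ℕ} (hnq : n = q * j) (hj : 0 < j) (hn : 1 ≤ n) (s : ℕ → ℤ) (hs : ∀ i, |s i| ≤ 1) (hs0 : ∀ i, s i ≠ 0)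
    (τ : ℤ) {l Hn : ℕ} (hl : 1 ≤ l) (P : Finset ℕ) (hP : ∀ p ∈ P, 2 * n^2 * l ≤ p ∧ p ≤ Hn) (hPp : ∀ p ∈ P, p.Prime) (hH : 1 ≤ Hn)
    (L Q : ℝ) (hL : ∑ p ∈ P, 1 / (p : ℝ) ≤ L) (hL1 : 1 ≤ L)
    (hQ : 2 / (l:ℝ) * ∑ t ∈ Icc 1 Hn, 1 / (t:ℝ) ≤ Q) (D : ℕ) (X : ℤ) (T m : ℕ) (hm : 0 < m) (hT : Hn^(n+m) ≤ T)
    (WW : Finset (ℕ → ℕ))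
    (h0 : ∀ w ∈ WW, ∀ i, n ≤ i → w i = 0)
    (hwP : ∀ w ∈ WW, ∀ i, i < n → w i ∈ P)
    (hblk : ∀ w ∈ WW, ∀ i i', i < n → i' < n → i / j = i' / j → w i = w i' → i = i') :
    ∑ w ∈ WW, |∑ b ∈ Ico X (X+T), Qw P τ D n s w b| ≤
      2 * T * SS n q (2*L) Q (DmB n q) 0 +
      (2 * T * (2 * (Real.exp 1 * (2 * (n+1) * L) / m))^m * SS n q (2*L) Q (fun _ => n) 0 +
      WW.card * ((P.card+1 : ℝ)^m * (2 * 2^m * (Hn:ℝ)^(n+m)))) := by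
  set η := (2 * (Real.exp 1 * (2 * (n+1) * L) / m))^m with hη
  set ε := (P.card+1 : ℝ)^m * (2 * 2^m * (Hn:ℝ)^(n+m)) with hε
  have hη0 : 0 ≤ η := by positivity
  have hε0 : 0 ≤ ε := by positivity
  have hX : ∑ p ∈ P, 2 / (p : ℝ) ≤ 2 * L := by
    have : ∑ p ∈ P, 2 / (p : ℝ) = 2 * ∑ p ∈ P, 1 / (p:ℝ) := by
      rw [Finset.mul_sum]; apply Finset.sum_congr rfl; intro i _; ring
    linarith
  set CC := WW.filter fun w => Wd n j s τ w with hCC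
  set WU := CC.filter fun w => ∀ y, ¬ LoneU n s τ w y with hWU
  have hCCW : CC ⊆ WW := filter_subset _ _
  have hWUC : WU ⊆ CC := filter_subset _ _
  have hB : ∑ w ∈ WU, wt n w ≤ SS n q (2*L) Q (DmB n q) 0 := by
    refine sum_words hnq hj hn s hs τ hl P hP (2*L) Q hX (by linarith) hQ (DmB n q) 0 WU
      (fun w hw => h0 w (hCCW (hWUC hw))) (fun w hw => hwP w (hCCW (hWUC hw))) ?_
    intro w hw
    have hw2 := (mem_filter.1 hw).2
    have hw1 := (mem_filter.1 (hWUC hw)).2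
    obtain ⟨I, J, c, B, C, h1, h2⟩ := exists_cert hnq hj s hs0 τ w hw1
    exact ⟨I, J, c, B, C, h2 hw2, Nat.zero_le _⟩
  have hA : ∑ w ∈ CC, wt n w ≤ SS n q (2*L) Q (fun _ => n) 0 := by
    refine sum_words hnq hj hn s hs τ hl P hP (2*L) Q hX (by linarith) hQ (fun _ => n) 0 CC
      (fun w hw => h0 w (hCCW hw)) (fun w hw => hwP w (hCCW hw)) ?_
    intro w hw
    have hw1 := (mem_filter.1 hw).2
    obtain ⟨I, J, c, B, C, h1, h2⟩ := exists_cert hnq hj s hs0 τ w hw1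
    exact ⟨I, J, c, B, C, h1, Nat.zero_le _⟩
  have hpt : ∀ w ∈ WW, |∑ b ∈ Ico X (X+T), Qw P τ D n s w b| ≤
      (if w ∈ WU then 2 * T * wt n w else 0) + ((if w ∈ CC then 2 * T * η * wt n w else 0) + ε) := by
    intro w hw
    have hwn := wt_nonneg n w
    by_cases hc : w ∈ CC
    · by_cases hu : w ∈ WU
      · rw [if_pos hu, if_pos hc]
        have := sum_Qw_le P hPp τ D n s w (hwP w hw) X T (by
          refine le_trans (prod_le_pow (k := n) _ ?_ hH ?_) (le_trans (Nat.pow_le_pow_right hH (Nat.le_add_right n m)) hT)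
          · intro p hp
            obtain ⟨i, hi, rfl⟩ := mem_image.1 hp
            exact (hP _ (hwP w hw i (mem_range.1 hi))).2
          · have := card_image_le (s := range n) (f := w); rwa [card_range] at this)
        have h2 : 0 ≤ 2 * T * η * wt n w := by positivity
        linarith
      · rw [if_neg hu, if_pos hc]
        have : ¬ ∀ y, ¬ LoneU n s τ w y := fun h => hu (mem_filter.2 ⟨hc, h⟩)
        push Not at this
        obtain ⟨y, hy⟩ := this
        have := sum_Qw_lone P hPp hH (fun p hp => (hP p hp).2) τ D n s w (hwP w hw) hy X T m hm hT (by linarith) hL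
        rw [← hη, ← hε] at this
        linarith
    · have hz : ∀ b, Qw P τ D n s w b = 0 := by
        intro b
        by_contra hne
        exact hc (mem_filter.2 ⟨hw, h0 w hw, hblk w hw, cons_of_ne hne⟩)
      have hu : w ∉ WU := fun h => hc (hWUC h)
      rw [if_neg hu, if_neg hc]
      simp only [hz, Finset.sum_const_zero, abs_zero]
      linarith
  refine (Finset.sum_le_sum hpt).trans ?_
  rw [Finset.sum_add_distrib, Finset.sum_add_distrib, Finset.sum_const, nsmul_eq_mul]
  have e1 : ∑ w ∈ WW, (if w ∈ WU then 2 * T * wt n w else 0) = 2 * T * ∑ w ∈ WU, wt n w := by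
    rw [← Finset.sum_filter, filter_mem_eq_inter, inter_eq_right.2 (hWUC.trans hCCW), Finset.mul_sum]
  have e2 : ∑ w ∈ WW, (if w ∈ CC then 2 * T * η * wt n w else 0) = 2 * T * η * ∑ w ∈ CC, wt n w := by
    rw [← Finset.sum_filter, filter_mem_eq_inter, inter_eq_right.2 hCCW, Finset.mul_sum]
  rw [e1, e2]
  gcongr

/-- words with a first repetition at distance at least two -/
theorem rep_words {n : ℕ} (hn : 1 ≤ n) (s : ℕ → ℤ) (hs : ∀ i, |s i| ≤ 1) (hs0 : ∀ i, s i ≠ 0)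
    (τ : ℤ) {l Hn : ℕ} (hl : 1 ≤ l) (P : Finset ℕ) (hP : ∀ p ∈ P, 2 * n^2 * l ≤ p ∧ p ≤ Hn) (hPp : ∀ p ∈ P, p.Prime) (hH : 1 ≤ Hn)
    (L Q : ℝ) (hL : ∑ p ∈ P, 1 / (p : ℝ) ≤ L) (hL1 : 1 ≤ L)
    (hQ : 2 / (l:ℝ) * ∑ t ∈ Icc 1 Hn, 1 / (t:ℝ) ≤ Q) (X : ℤ) (T : ℕ) (hT : Hn^n ≤ T)
    (WW : Finset (ℕ → ℕ))
    (h0 : ∀ w ∈ WW, ∀ i, n ≤ i → w i = 0)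
    (hwP : ∀ w ∈ WW, ∀ i, i < n → w i ∈ P)
    (hrep : ∀ w ∈ WW, (∀ i i', i < n - 1 → i' < n - 1 → w i = w i' → i = i') ∧ ∃ a, a + 2 ≤ n - 1 ∧ w a = w (n-1)) :
    ∑ w ∈ WW, (((Ico X (X+T)).filter fun b => ∀ i, i < n → al τ (w i) (b + posn w s i) ≠ 0).card : ℝ) ≤
      2 * T * SS n n (2*L) Q (fun _ => n) 1 := by
  have hX : ∑ p ∈ P, 2 / (p : ℝ) ≤ 2 * L := by
    have : ∑ p ∈ P, 2 / (p : ℝ) = 2 * ∑ p ∈ P, 1 / (p:ℝ) := by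
      rw [Finset.mul_sum]; apply Finset.sum_congr rfl; intro i _; ring
    linarith
  set CC := WW.filter fun w => Wd n 1 s τ w with hCC
  have hCCW : CC ⊆ WW := filter_subset _ _
  have hA : ∑ w ∈ CC, wt n w ≤ SS n n (2*L) Q (fun _ => n) 1 := by
    refine sum_words (j := 1) (by omega) one_pos hn s hs τ hl P hP (2*L) Q hX (by linarith) hQ (fun _ => n) 1 CC
      (fun w hw => h0 w (hCCW hw)) (fun w hw => hwP w (hCCW hw)) ?_
    intro w hw
    have hw1 := (mem_filter.1 hw).2
    obtain ⟨I, J, c, B, C, h1, h2⟩ := exists_cert (q := n) (j := 1) (by omega) one_pos s hs0 τ w hw1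
    refine ⟨I, J, c, B, C, h1, ?_⟩
    by_contra hJ
    have hJ0 : J = ∅ := by rw [← card_eq_zero]; omega
    have hI0 : I = ∅ := by rw [← card_eq_zero, C.good.card, hJ0]; simp
    subst hJ0 hI0
    obtain ⟨hinj, a, ha, haw⟩ := hrep w (hCCW hw)
    have hcn : ∀ i, i < n - 1 → c i = i := by
      intro i hi
      have e := C.cw i (by omega)
      have e2 := C.walk.c_le i (by omega)
      exact (hinj i (c i) hi (by omega) e).symm
    have hcl : c (n-1) = a := by
      rw [← C.cwinj a (n-1) (by omega) (by omega) haw]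
      exact hcn a (by omega)
    have hcoh := C.walk.coh (n-1) (by omega) (by simp) (a+1) (by omega)
    rw [hcl] at hcoh
    have hst : ∀ i, i < n → ∃ t : ℚ, t ≠ 0 ∧ ∀ z, B (i+1) z = B i z + if z = c i then t else 0 :=
      fun i hi => C.walk.step i hi (by simp)
    -- value at coordinate a+1 is constant after step a+1
    have hconst : ∀ k, a + 2 + k ≤ n → B (a + 2 + k) (a+1) = B (a+2) (a+1) := by
      intro k
      induction k with
      | zero => intro _; rfl
      | succ k ih =>
        intro hk
        obtain ⟨t, _, ht⟩ := hst (a+2+k) (by omega)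
        have : a + 1 ≠ c (a+2+k) := by
          by_cases hkn : a + 2 + k = n - 1
          · rw [hkn, hcl]; omega
          · rw [hcn _ (by omega)]; omega
        have e := ht (a+1)
        rw [if_neg this, add_zero] at e
        rw [← add_assoc, e, ih (by omega)]
    have e1 := hconst (n - 1 + 1 - (a+2)) (by omega)
    have e2 : a + 2 + (n - 1 + 1 - (a+2)) = n - 1 + 1 := by omega
    rw [e2, hcoh] at e1
    obtain ⟨t, ht0, ht⟩ := hst (a+1) (by omega)
    have e3 := ht (a+1)
    rw [hcn (a+1) (by omega), if_pos rfl] at e3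
    apply ht0
    have : B (a + 1 + 1) (a+1) = B (a+2) (a+1) := rfl
    linarith
  have hpt : ∀ w ∈ WW, (((Ico X (X+T)).filter fun b => ∀ i, i < n → al τ (w i) (b + posn w s i) ≠ 0).card : ℝ) ≤
      if w ∈ CC then 2 * T * wt n w else 0 := by
    intro w hw
    split_ifs with hc
    · have := count_hits P hPp τ n s w (hwP w hw) X T ∅ (by simp) (by
          rw [union_empty]
          refine le_trans (prod_le_pow (k := n) _ ?_ hH ?_) hT
          · intro p hp
            obtain ⟨i, hi, rfl⟩ := mem_image.1 hp
            exact (hP _ (hwP w hw i (mem_range.1 hi))).2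
          · have := card_image_le (s := range n) (f := w); rwa [card_range] at this)
      simp only [notMem_empty, false_implies, implies_true, and_true, prod_empty, mul_one] at this
      exact this
    · have : ((Ico X (X+T)).filter fun b => ∀ i, i < n → al τ (w i) (b + posn w s i) ≠ 0) = ∅ := by
        apply filter_eq_empty_iff.2
        intro b _ hb
        apply hc
        refine mem_filter.2 ⟨hw, h0 w hw, ?_, ?_⟩
        · intro i i' _ _ h _; simpa using h
        · have : Qw ∅ τ 0 n s w b ≠ 0 := by
            unfold Qw
            apply mul_ne_zero
            · exact Finset.prod_ne_zero_iff.2 fun i hi => hb i (mem_range.1 hi)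
            · apply Finset.prod_ne_zero_iff.2
              intro v _
              simp [Yv, hp]
          exact cons_of_ne this
      rw [this]; simp
  refine (Finset.sum_le_sum hpt).trans ?_
  rw [← Finset.sum_filter, filter_mem_eq_inter, inter_eq_right.2 hCCW, ← Finset.mul_sum]
  gcongr

end MC


namespace MC
open Finset Classical

def sg (e : Bool) : ℤ := if e then 1 else -1

lemma sg_not (e : Bool) : sg (!e) = - sg e := by cases e <;> simp [sg]
lemma sg_ne (e : Bool) : sg e ≠ 0 := by cases e <;> simp [sg]
lemma sg_abs (e : Bool) : |sg e| = 1 := by cases e <;> simp [sg]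

/-- words of length `j` over `P` -/
noncomputable def words (P : Finset ℕ) : ℕ → Finset (List ℕ)
  | 0 => {[]}
  | j+1 => (P ×ˢ words P j).image fun x => x.1 :: x.2

lemma mem_words {P : Finset ℕ} {j : ℕ} {l : List ℕ} : l ∈ words P j ↔ l.length = j ∧ ∀ x ∈ l, x ∈ P := by
  induction j generalizing l with
  | zero =>
    simp only [words, mem_singleton]
    constructor
    · rintro rfl; simp
    · rintro ⟨h, -⟩; exact List.length_eq_zero_iff.1 h
  | succ j ih =>
    simp only [words, mem_image, mem_product, Prod.exists]
    constructor
    · rintro ⟨a, b, ⟨ha, hb⟩, rfl⟩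
      rw [ih] at hb
      simp only [List.length_cons, List.mem_cons]
      refine ⟨by omega, ?_⟩
      rintro x (rfl | hx)
      · exact ha
      · exact hb.2 x hx
    · rintro ⟨h1, h2⟩
      cases l with
      | nil => simp at h1
      | cons a b =>
        refine ⟨a, b, ⟨h2 a (by simp), ih.2 ⟨by simpa using h1, fun x hx => h2 x (by simp [hx])⟩⟩, rfl⟩

noncomputable def injW (P : Finset ℕ) (j : ℕ) : Finset (List ℕ) := (words P j).filter List.Nodup

noncomputable def LL (P : Finset ℕ) (j : ℕ) : ℕ → Finset (List ℕ)
  | 0 => {[]}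
  | q+1 => (injW P j ×ˢ LL P j q).image fun x => x.1 ++ x.2

lemma LL_spec {P : Finset ℕ} {j : ℕ} (hj : 0 < j) {q : ℕ} : ∀ l ∈ LL P j q, l.length = q * j ∧ (∀ x ∈ l, x ∈ P) ∧
    ∀ i i', i < q * j → i' < q * j → i / j = i' / j → l.getD i 0 = l.getD i' 0 → i = i' := by
  induction q with
  | zero => intro l hl; simp [LL] at hl; subst hl; simp
  | succ q ih =>
    intro l hl
    simp only [LL, mem_image, mem_product, Prod.exists] at hl
    obtain ⟨a, b, ⟨ha, hb⟩, rfl⟩ := hl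
    obtain ⟨h1, h2, h3⟩ := ih b hb
    rw [injW, mem_filter, mem_words] at ha
    obtain ⟨⟨ha1, ha2⟩, ha3⟩ := ha
    refine ⟨by rw [List.length_append, ha1, h1]; ring, ?_, ?_⟩
    · intro x hx
      rcases List.mem_append.1 hx with hx | hx
      · exact ha2 x hx
      · exact h2 x hx
    · intro i i' hi hi' hd he
      have e1 : (q+1) * j = q * j + j := by ring
      rw [e1] at hi hi'
      by_cases h : i < j
      · have h' : i' < j := by
          rw [Nat.div_eq_of_lt h] at hd
          exact ((Nat.div_eq_zero_iff).1 hd.symm).resolve_left (by omega)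
        rw [List.getD_append _ _ _ _ (by omega), List.getD_append _ _ _ _ (by omega),
          List.getD_eq_getElem _ _ (by omega), List.getD_eq_getElem _ _ (by omega)] at he
        exact (ha3.getElem_inj_iff).1 he
      · have h' : ¬ i' < j := by
          intro h'
          rw [Nat.div_eq_of_lt h'] at hd
          have := ((Nat.div_eq_zero_iff).1 hd).resolve_left (by omega)
          exact h this
        rw [List.getD_append_right _ _ _ _ (by omega), List.getD_append_right _ _ _ _ (by omega), ha1] at he
        have := h3 (i - j) (i' - j) (by omega) (by omega) ?_ he
        · omega
        · have e2 : i = (i - j) + j := by omega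
          have e3 : i' = (i' - j) + j := by omega
          rw [e2, e3, Nat.add_div_right _ hj, Nat.add_div_right _ hj] at hd
          omega

lemma card_words (P : Finset ℕ) (j : ℕ) : (words P j).card ≤ P.card ^ j := by
  induction j with
  | zero => simp [words]
  | succ j ih =>
    rw [words]
    refine card_image_le.trans ?_
    rw [card_product, pow_succ, mul_comm]
    exact Nat.mul_le_mul_right _ ih

lemma card_LL {P : Finset ℕ} {j : ℕ} (hj : 0 < j) (q : ℕ) : (LL P j q).card ≤ P.card ^ (q * j) := by
  refine le_trans (card_le_card ?_) (card_words P (q*j))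
  intro l hl
  have := LL_spec hj l hl
  exact mem_words.2 ⟨this.1, this.2.1⟩

section mat
variable {ι : Type*} [Fintype ι] [DecidableEq ι]

noncomputable def Zm (P : Finset ℕ) (A : ℕ → Matrix ι ι ℝ) (j : ℕ) : Matrix ι ι ℝ := ∑ l ∈ injW P j, (l.map A).prod

lemma Zm_pow (P : Finset ℕ) (A : ℕ → Matrix ι ι ℝ) {j : ℕ} (q : ℕ) :
    (Zm P A j)^q = ∑ l ∈ LL P j q, (l.map A).prod := by
  induction q with
  | zero => simp [LL]
  | succ q ih =>
    rw [pow_succ', ih, LL, Finset.sum_image]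
    · rw [Finset.sum_product, Zm, Finset.sum_mul]
      apply Finset.sum_congr rfl
      intro a _
      rw [Finset.mul_sum]
      apply Finset.sum_congr rfl
      intro b _
      simp
    · rintro ⟨a, b⟩ h ⟨a', b'⟩ h' he
      simp only [coe_product, Set.mem_prod, mem_coe] at h h'
      have h1 := (mem_words.1 (mem_filter.1 h.1).1).1
      have h1' := (mem_words.1 (mem_filter.1 h'.1).1).1
      have := List.append_inj he (by rw [h1, h1'])
      exact Prod.ext this.1 this.2
end mat

noncomputable def Am (P : Finset ℕ) (τ : ℤ) (D M : ℕ) (b : ℤ) (p : ℕ) : Matrix (Bool × Fin M) (Bool × Fin M) ℝ :=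
  fun u v => if v.1 = !u.1 ∧ ((v.2 : ℕ):ℤ) = (u.2 : ℕ) + sg u.1 * p then
    al τ p (b + (u.2:ℕ)) * Yv P τ D (b + (u.2:ℕ)) * Yv P τ D (b + (v.2:ℕ)) else 0

noncomputable def Qf (P : Finset ℕ) (τ : ℤ) (D : ℕ) : List ℕ → Bool → ℤ → ℝ
  | [], _, _ => 1
  | p :: l, e, x => al τ p x * Yv P τ D x * Yv P τ D (x + sg e * p) * Qf P τ D l (!e) (x + sg e * p)

lemma Yv_idem (P : Finset ℕ) (τ : ℤ) (D : ℕ) (x : ℤ) : Yv P τ D x * Yv P τ D x = Yv P τ D x := by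
  unfold Yv; split_ifs <;> simp

lemma entry (P : Finset ℕ) (τ : ℤ) (D M : ℕ) (l : List ℕ) (u v : Bool × Fin M) :
    ∃ χ : ℝ, |χ| ≤ 1 ∧ ∀ b, (l.map (Am P τ D M b)).prod u v = χ * Qf P τ D l u.1 (b + (u.2:ℕ)) := by
  induction l generalizing u with
  | nil =>
    refine ⟨if u = v then 1 else 0, by split_ifs <;> simp, fun b => ?_⟩
    simp [Qf, Matrix.one_apply]
  | cons p l ih =>
    by_cases h : ∃ y : Fin M, ((y:ℕ):ℤ) = (u.2 : ℕ) + sg u.1 * p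
    · obtain ⟨y, hy⟩ := h
      obtain ⟨χ, h1, h2⟩ := ih (!u.1, y)
      refine ⟨χ, h1, fun b => ?_⟩
      simp only [List.map_cons, List.prod_cons, Matrix.mul_apply]
      rw [Finset.sum_eq_single (!u.1, y)]
      · rw [h2]
        rw [Qf, Am, if_pos ⟨rfl, hy⟩]
        have : b + ((y:ℕ):ℤ) = b + (u.2:ℕ) + sg u.1 * p := by rw [hy]; ring
        rw [this]; ring
      · intro w _ hw
        simp only [Am]
        rw [if_neg, zero_mul]
        rintro ⟨h3, h4⟩
        apply hw
        ext
        · rw [h3]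
        · have : ((w.2:ℕ):ℤ) = (y:ℕ) := by rw [h4, hy]
          exact_mod_cast this
      · simp
    · refine ⟨0, by simp, fun b => ?_⟩
      simp only [List.map_cons, List.prod_cons, Matrix.mul_apply]
      rw [Finset.sum_eq_zero, zero_mul]
      intro w _
      simp only [Am]
      rw [if_neg, zero_mul]
      rintro ⟨h3, h4⟩
      exact h ⟨w.2, h4⟩

noncomputable def sgn (e : Bool) (i : ℕ) : ℤ := sg e * (-1)^i

lemma sgn_abs (e : Bool) (i : ℕ) : |sgn e i| ≤ 1 := by
  rw [sgn, abs_mul, sg_abs, abs_pow]; simp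
lemma sgn_ne (e : Bool) (i : ℕ) : sgn e i ≠ 0 := by
  rw [sgn]; exact mul_ne_zero (sg_ne e) (by simp)

lemma posn_shift (p : ℕ) (l : List ℕ) (e : Bool) (i : ℕ) :
    posn (fun i => (p :: l).getD i 0) (sgn e) (i+1) = sg e * p + posn (fun i => l.getD i 0) (sgn (!e)) i := by
  simp only [posn]
  rw [Finset.sum_range_succ']
  rw [add_comm]
  congr 1
  · simp [sgn]
  · apply Finset.sum_congr rfl
    intro i _
    simp only [sgn, sg_not, List.getD_cons_succ]
    ring

lemma Qf_Qw (P : Finset ℕ) (τ : ℤ) (D : ℕ) (l : List ℕ) (e : Bool) (x : ℤ) :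
    Qf P τ D l e x * Yv P τ D x = Qw P τ D l.length (sgn e) (fun i => l.getD i 0) x := by
  induction l generalizing e x with
  | nil => simp [Qf, Qw, posn]
  | cons p l ih =>
    have h := ih (!e) (x + sg e * p)
    simp only [Qw] at h ⊢
    simp only [List.length_cons]
    rw [Finset.prod_range_succ' _ l.length, Finset.prod_range_succ' _ (l.length + 1)]
    simp only [posn_shift, List.getD_cons_succ]
    simp only [← add_assoc]
    have e0 : posn (fun i => (p :: l).getD i 0) (sgn e) 0 = 0 := by simp [posn]
    rw [e0]
    simp only [List.getD_cons_zero, add_zero, Qf]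
    calc _ = Qf P τ D l (!e) (x + sg e * p) * Yv P τ D (x + sg e * p) * (al τ p x * (Yv P τ D x * Yv P τ D x)) := by ring
      _ = _ := by rw [h, Yv_idem]; ring

lemma Qf_eq (P : Finset ℕ) (τ : ℤ) (D : ℕ) (l : List ℕ) (hl : l ≠ []) (e : Bool) (x : ℤ) :
    Qf P τ D l e x = Qw P τ D l.length (sgn e) (fun i => l.getD i 0) x := by
  rw [← Qf_Qw]
  cases l with
  | nil => exact absurd rfl hl
  | cons p l =>
    simp only [Qf]
    calc _ = al τ p x * (Yv P τ D x) * Yv P τ D (x + sg e * p) * Qf P τ D l (!e) (x + sg e * p) := by ring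
      _ = al τ p x * (Yv P τ D x * Yv P τ D x) * Yv P τ D (x + sg e * p) * Qf P τ D l (!e) (x + sg e * p) := by rw [Yv_idem]
      _ = _ := by ring

noncomputable def TrB (P : Finset ℕ) (L Q : ℝ) (Hn n q T m : ℕ) : ℝ :=
      2 * T * SS n q (2*L) Q (DmB n q) 0 +
      (2 * T * (2 * (Real.exp 1 * (2 * (n+1) * L) / m))^m * SS n q (2*L) Q (fun _ => n) 0 +
      (P.card:ℝ)^n * ((P.card+1 : ℝ)^m * (2 * 2^m * (Hn:ℝ)^(n+m))))

theorem trace_bound {n j q : ℕ} (hnq : n = q * j) (hj : 0 < j) (hn : 1 ≤ n) 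
    (τ : ℤ) {l Hn : ℕ} (hl : 1 ≤ l) (P : Finset ℕ) (hP : ∀ p ∈ P, 2 * n^2 * l ≤ p ∧ p ≤ Hn) (hPp : ∀ p ∈ P, p.Prime) (hH : 1 ≤ Hn)
    (L Q : ℝ) (hL : ∑ p ∈ P, 1 / (p : ℝ) ≤ L) (hL1 : 1 ≤ L)
    (hQ : 2 / (l:ℝ) * ∑ t ∈ Icc 1 Hn, 1 / (t:ℝ) ≤ Q) (D M : ℕ) (X : ℤ) (T m : ℕ) (hm : 0 < m) (hT : Hn^(n+m) ≤ T) :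
    ∑ b ∈ Ico X (X+T), Matrix.trace ((Zm P (Am P τ D M b) j)^q) ≤ 2 * M * TrB P L Q Hn n q T m := by
  choose χ hχ1 hχ2 using entry P τ D M
  have hlen : ∀ l ∈ LL P j q, l.length = n := fun l hl => by rw [(LL_spec hj l hl).1, hnq]
  have key : ∀ u : Bool × Fin M, ∑ b ∈ Ico X (X+T), ((Zm P (Am P τ D M b) j)^q) u u ≤ TrB P L Q Hn n q T m := by
    intro u
    have inj : Set.InjOn (fun (l : List ℕ) (i : ℕ) => l.getD i 0) (LL P j q : Set (List ℕ)) := by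
      intro a ha b hb he
      have h1 := hlen a ha
      have h2 := hlen b hb
      apply List.ext_getElem (by omega)
      intro i hi hi'
      have := congrFun he i
      simp only at this
      rwa [List.getD_eq_getElem _ _ hi, List.getD_eq_getElem _ _ hi'] at this
    set WW := (LL P j q).image fun l i => l.getD i 0 with hWW
    have h := trace_words hnq hj hn (sgn u.1) (sgn_abs _) (sgn_ne _) τ hl P hP hPp hH L Q hL hL1 hQ D (X + (u.2:ℕ)) T m hm hT WW ?_ ?_ ?_
    · calc _ = ∑ l ∈ LL P j q, χ l u u * ∑ b ∈ Ico X (X+T), Qf P τ D l u.1 (b + (u.2:ℕ)) := by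
            simp only [Zm_pow, Matrix.sum_apply]
            rw [Finset.sum_comm]
            apply Finset.sum_congr rfl
            intro l _
            rw [Finset.mul_sum]
            apply Finset.sum_congr rfl
            intro b _
            rw [hχ2]
        _ ≤ ∑ l ∈ LL P j q, |∑ b ∈ Ico (X + (u.2:ℕ)) (X + (u.2:ℕ) +T), Qw P τ D n (sgn u.1) (fun i => l.getD i 0) b| := by
            apply Finset.sum_le_sum
            intro l hl
            have e : ∑ b ∈ Ico X (X+T), Qf P τ D l u.1 (b + (u.2:ℕ)) =
                ∑ b ∈ Ico (X + (u.2:ℕ)) (X + (u.2:ℕ) +T), Qw P τ D n (sgn u.1) (fun i => l.getD i 0) b := by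
              rw [sum_Ico_eq, sum_Ico_eq]
              apply Finset.sum_congr rfl
              intro t _
              rw [Qf_eq, hlen l hl]
              · congr 1; ring
              · intro h0; have := hlen l hl; rw [h0] at this; simp at this; omega
            rw [e]
            refine (le_abs_self _).trans ?_
            rw [abs_mul]
            exact mul_le_of_le_one_left (abs_nonneg _) (hχ1 _ _ _)
        _ = ∑ w ∈ WW, |∑ b ∈ Ico (X + (u.2:ℕ)) (X + (u.2:ℕ) +T), Qw P τ D n (sgn u.1) w b| := by
            rw [hWW, Finset.sum_image inj]
        _ ≤ _ := by
            refine h.trans ?_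
            rw [TrB]
            have hc : (WW.card : ℝ) ≤ (P.card:ℝ)^n := by
              have : WW.card ≤ P.card ^ n := by
                rw [hWW]
                refine card_image_le.trans ?_
                rw [hnq]; exact card_LL hj q
              exact_mod_cast this
            gcongr
    · intro w hw i hi
      obtain ⟨l, hl, rfl⟩ := mem_image.1 hw
      exact List.getD_eq_default _ _ (by rw [hlen l hl]; exact hi)
    · intro w hw i hi
      obtain ⟨l, hl, rfl⟩ := mem_image.1 hw
      have h1 := hlen l hl
      simp only
      rw [List.getD_eq_getElem _ _ (by omega)]
      exact (LL_spec hj l hl).2.1 _ (List.getElem_mem _)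
    · intro w hw i i' hi hi' h1 h2
      obtain ⟨l, hl, rfl⟩ := mem_image.1 hw
      rw [hnq] at hi hi'
      exact (LL_spec hj l hl).2.2 i i' hi hi' h1 h2
  simp only [Matrix.trace, Matrix.diag_apply]
  rw [Finset.sum_comm]
  refine (Finset.sum_le_sum fun u _ => key u).trans ?_
  rw [Finset.sum_const, card_univ, Fintype.card_prod, Fintype.card_bool, Fintype.card_fin, nsmul_eq_mul]
  push_cast
  exact le_refl _

end MC


namespace MC
open Finset Classical

section ip
variable {κ : Type*}

def ip (S : Finset κ) (u v : κ → ℝ) : ℝ := ∑ k ∈ S, u k * v k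

lemma ip_comm (S : Finset κ) (u v : κ → ℝ) : ip S u v = ip S v u := by
  simp only [ip, mul_comm]
lemma ip_self_nonneg (S : Finset κ) (u : κ → ℝ) : 0 ≤ ip S u u :=
  Finset.sum_nonneg fun k _ => mul_self_nonneg _
lemma ip_cs (S : Finset κ) (u v : κ → ℝ) : (ip S u v)^2 ≤ ip S u u * ip S v v := by
  have := Finset.sum_mul_sq_le_sq_mul_sq S u v
  simpa [ip, sq] using this
lemma ip_add_right (S : Finset κ) (u v w : κ → ℝ) : ip S u (v + w) = ip S u v + ip S u w := by
  simp [ip, mul_add, Finset.sum_add_distrib]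
lemma ip_add_left (S : Finset κ) (u v w : κ → ℝ) : ip S (v + w) u = ip S v u + ip S w u := by
  simp [ip, add_mul, Finset.sum_add_distrib]
lemma ip_sub_right (S : Finset κ) (u v w : κ → ℝ) : ip S u (v - w) = ip S u v - ip S u w := by
  simp [ip, mul_sub, Finset.sum_sub_distrib]
lemma ip_smul_right (S : Finset κ) (c : ℝ) (u v : κ → ℝ) : ip S u (c • v) = c * ip S u v := by
  simp only [ip, Pi.smul_apply, smul_eq_mul, Finset.mul_sum]
  apply Finset.sum_congr rfl; intros; ring

lemma ip_iter (S : Finset κ) (T : (κ → ℝ) → (κ → ℝ)) (hT : ∀ u v, ip S (T u) v = ip S u (T v)) (m : ℕ) (u v : κ → ℝ) :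
    ip S (T^[m] u) v = ip S u (T^[m] v) := by
  induction m generalizing u v with
  | zero => rfl
  | succ m ih => rw [Function.iterate_succ_apply, ih, hT, ← Function.iterate_succ_apply' T m v]

lemma iter_cs (S : Finset κ) (T : (κ → ℝ) → (κ → ℝ)) (hT : ∀ u v, ip S (T u) v = ip S u (T v)) (u : κ → ℝ) (a : ℕ) :
    |ip S u (T u)|^(2^a) ≤ (ip S u u)^(2^a-1) * |ip S u (T^[2^a] u)| := by
  induction a with
  | zero => simp
  | succ a ih =>
    have h1 : (ip S u (T^[2^a] u))^2 ≤ ip S u u * |ip S u (T^[2^(a+1)] u)| := by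
      refine (ip_cs S _ _).trans ?_
      rw [ip_iter S T hT, ← Function.iterate_add_apply, ← two_mul, ← pow_succ']
      exact mul_le_mul_of_nonneg_left (le_abs_self _) (ip_self_nonneg _ _)
    have hk : 1 ≤ 2^a := Nat.one_le_two_pow
    have e : 2^(a+1) - 1 = (2^a - 1) * 2 + 1 := by rw [pow_succ]; omega
    calc |ip S u (T u)|^(2^(a+1)) = (|ip S u (T u)|^(2^a))^2 := by rw [← pow_mul, pow_succ]
      _ ≤ ((ip S u u)^(2^a-1) * |ip S u (T^[2^a] u)|)^2 := pow_le_pow_left₀ (by positivity) ih 2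
      _ = ((ip S u u)^(2^a-1))^2 * (ip S u (T^[2^a] u))^2 := by rw [mul_pow, sq_abs]
      _ ≤ ((ip S u u)^(2^a-1))^2 * (ip S u u * |ip S u (T^[2^(a+1)] u)|) := by
          exact mul_le_mul_of_nonneg_left h1 (by positivity)
      _ = _ := by rw [e, pow_succ _ ((2^a-1)*2), pow_mul]; ring
end ip

section mat
variable {ι : Type*} [Fintype ι] [DecidableEq ι]
open Matrix

lemma ip_sym (S : Matrix ι ι ℝ) (hS : Sᵀ = S) (u v : ι → ℝ) : ip univ (S *ᵥ u) v = ip univ u (S *ᵥ v) := by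
  have h : ∀ x y : ι → ℝ, ip univ x y = x ⬝ᵥ y := fun x y => rfl
  rw [h, h, dotProduct_mulVec, ← mulVec_transpose, hS]

lemma mulVec_iter (S : Matrix ι ι ℝ) (m : ℕ) (u : ι → ℝ) : (fun v => S *ᵥ v)^[m] u = (S^m) *ᵥ u := by
  induction m with
  | zero => simp
  | succ m ih => rw [Function.iterate_succ_apply', ih, pow_succ', Matrix.mulVec_mulVec]

lemma ip_mulVec_le (S : Matrix ι ι ℝ) (u : ι → ℝ) : ip univ (S *ᵥ u) (S *ᵥ u) ≤ ip univ u u * trace (S * Sᵀ) := by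
  have : trace (S * Sᵀ) = ∑ x, ∑ y, S x y * S x y := by
    simp [Matrix.trace, Matrix.mul_apply]
  rw [this, Finset.mul_sum]
  apply Finset.sum_le_sum
  intro x _
  have := ip_cs univ (S x) u
  rw [← sq]
  refine le_trans (le_of_eq ?_) (this.trans (le_of_eq ?_))
  · rfl
  · rw [mul_comm]; rfl

lemma trace_cs (S : Matrix ι ι ℝ) (hS : Sᵀ = S) (u : ι → ℝ) (a : ℕ) (ha : 1 ≤ a) :
    |ip univ u (S *ᵥ u)|^(2^a) ≤ (ip univ u u)^(2^a) * trace (S^(2^a)) := by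
  have h := iter_cs univ (fun v => S *ᵥ v) (ip_sym S hS) u a
  rw [mulVec_iter] at h
  obtain ⟨a, rfl⟩ : ∃ b, a = b + 1 := ⟨a - 1, by omega⟩
  have e : S^(2^(a+1)) = S^(2^a) * S^(2^a) := by rw [← pow_add]; congr 1; rw [pow_succ]; omega
  have hT : (S^(2^a))ᵀ = S^(2^a) := by rw [Matrix.transpose_pow, hS]
  have h2 := ip_mulVec_le (S^(2^a)) u
  rw [hT, ← e] at h2
  rw [ip_sym _ hT, Matrix.mulVec_mulVec, ← e] at h2
  have h3 : 0 ≤ ip univ u (S^(2^(a+1)) *ᵥ u) := by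
    rw [e, ← Matrix.mulVec_mulVec, ← ip_sym _ hT]; exact ip_self_nonneg _ _
  rw [abs_of_nonneg h3] at h
  refine h.trans ((mul_le_mul_of_nonneg_left h2 (pow_nonneg (ip_self_nonneg _ _) _)).trans (le_of_eq ?_))
  have : (ip univ u u)^(2^(a+1)) = (ip univ u u)^(2^(a+1) - 1) * ip univ u u := by
    rw [← pow_succ]; congr 1; have := Nat.one_le_two_pow (n := a+1); omega
  rw [this]; ring

lemma Zm_symm (P : Finset ℕ) (A : ℕ → Matrix ι ι ℝ) (hA : ∀ p ∈ P, (A p)ᵀ = A p) (j : ℕ) : (Zm P A j)ᵀ = Zm P A j := by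
  rw [Zm, Matrix.transpose_sum]
  apply Finset.sum_nbij' (fun l => l.reverse) (fun l => l.reverse)
  · intro l hl; simp only [injW, mem_filter, mem_words] at hl ⊢; simpa using hl
  · intro l hl; simp only [injW, mem_filter, mem_words] at hl ⊢; simpa using hl
  · simp
  · simp
  · intro l hl
    simp only [injW, mem_filter, mem_words] at hl
    rw [Matrix.transpose_list_prod, List.map_map, List.map_reverse]
    congr 2
    apply List.map_congr_left
    intro p hp
    exact hA p (hl.1.2 p hp)

/-- non-backtracking words -/
noncomputable def nbW (P : Finset ℕ) (j : ℕ) : Finset (List ℕ) := (words P j).filter (List.IsChain (· ≠ ·))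

noncomputable def Wpm (P : Finset ℕ) (A : ℕ → Matrix ι ι ℝ) : ℕ → ℕ → Matrix ι ι ℝ
  | 0 => fun _ => 0
  | j+1 => fun p => A p * ((if j = 0 then 1 else ∑ r ∈ P, Wpm P A j r) - Wpm P A j p)
noncomputable def Wm (P : Finset ℕ) (A : ℕ → Matrix ι ι ℝ) (j : ℕ) : Matrix ι ι ℝ :=
  if j = 0 then 1 else ∑ r ∈ P, Wpm P A j r

lemma Wpm_succ (P : Finset ℕ) (A : ℕ → Matrix ι ι ℝ) (j p : ℕ) :
    Wpm P A (j+1) p = A p * (Wm P A j - Wpm P A j p) := rfl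
lemma Wm_zero (P : Finset ℕ) (A : ℕ → Matrix ι ι ℝ) : Wm P A 0 = 1 := rfl
lemma Wm_succ (P : Finset ℕ) (A : ℕ → Matrix ι ι ℝ) (j : ℕ) : Wm P A (j+1) = ∑ r ∈ P, Wpm P A (j+1) r := by
  rw [Wm, if_neg (by omega)]

lemma W_words (P : Finset ℕ) (A : ℕ → Matrix ι ι ℝ) (j : ℕ) :
    Wm P A j = ∑ l ∈ nbW P j, (l.map A).prod ∧
    ∀ p ∈ P, Wpm P A j p = ∑ l ∈ (nbW P j).filter (fun l => l.head? = some p), (l.map A).prod := by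
  induction j with
  | zero =>
    constructor
    · have : nbW P 0 = {[]} := by
        rw [nbW, words, Finset.filter_true_of_mem]; simp
      rw [this]; simp [Wm]
    · intro p hp
      simp only [Wpm, nbW, words]
      symm
      apply Finset.sum_eq_zero
      intro l hl
      simp only [mem_filter, mem_singleton] at hl
      obtain ⟨⟨rfl, -⟩, h⟩ := hl
      simp at h
  | succ j ih =>
    have h2 : ∀ p ∈ P, Wpm P A (j+1) p = ∑ l ∈ (nbW P (j+1)).filter (fun l => l.head? = some p), (l.map A).prod := by
      intro p hp
      rw [Wpm_succ, ih.1, ih.2 p hp, ← Finset.sum_filter_add_sum_filter_not (nbW P j) (fun l => l.head? = some p),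
        add_sub_cancel_left, Finset.mul_sum]
      symm
      apply Finset.sum_nbij' (fun l => l.tail) (fun l => p :: l)
      · intro l hl
        simp only [nbW, mem_filter, mem_words] at hl ⊢
        obtain ⟨⟨⟨h1, h2⟩, h3⟩, h4⟩ := hl
        cases l with
        | nil => simp at h4
        | cons a l =>
          simp only [List.head?_cons, Option.some.injEq] at h4
          subst h4
          rw [List.isChain_cons] at h3
          refine ⟨⟨⟨by simpa using h1, fun x hx => h2 x (by simp at hx; simp [hx])⟩, h3.2⟩, ?_⟩
          intro h5
          exact h3.1 a (by simpa using h5) rfl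
      · intro l hl
        simp only [nbW, mem_filter, mem_words] at hl ⊢
        obtain ⟨⟨⟨h1, h2⟩, h3⟩, h4⟩ := hl
        refine ⟨⟨⟨by simp [h1], ?_⟩, ?_⟩, by simp⟩
        · intro x hx
          rcases List.mem_cons.1 hx with rfl | hx
          · exact hp
          · exact h2 x hx
        · rw [List.isChain_cons]
          refine ⟨?_, h3⟩
          intro y hy h5
          subst h5
          exact h4 (by simpa using hy)
      · intro l hl
        simp only [mem_filter] at hl
        cases l with
        | nil => simp at hl
        | cons a l => simp at hl ⊢; exact hl.2.symm
      · simp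
      · intro l hl
        simp only [mem_filter] at hl
        cases l with
        | nil => simp at hl
        | cons a l => simp at hl ⊢; rw [hl.2]
    refine ⟨?_, h2⟩
    rw [Wm_succ, Finset.sum_congr rfl h2]
    rw [← Finset.sum_biUnion]
    · apply Finset.sum_congr _ (fun _ _ => rfl)
      ext l
      simp only [mem_biUnion, mem_filter]
      constructor
      · rintro ⟨p, _, h, _⟩; exact h
      · intro h
        have h' := h
        simp only [nbW, mem_filter, mem_words] at h'
        cases l with
        | nil => simp at h'
        | cons a l => exact ⟨a, h'.1.2 a (by simp), h, by simp⟩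
    · intro p hp p' hp' hne
      rw [Function.onFun, Finset.disjoint_left]
      intro l h1 h2
      simp only [mem_filter] at h1 h2
      rw [h1.2] at h2
      exact hne (by simpa using h2.2)

lemma W_eq_Z (P : Finset ℕ) (A : ℕ → Matrix ι ι ℝ) (j : ℕ) (F : ι → ℝ)
    (h : ∀ l ∈ nbW P j, ¬ l.Nodup → ∀ x, F x ≠ 0 → ∀ y, (l.map A).prod x y = 0) :
    ip univ F (Wm P A j *ᵥ F) = ip univ F (Zm P A j *ᵥ F) := by
  have e : Zm P A j = ∑ l ∈ (nbW P j).filter List.Nodup, (l.map A).prod := by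
    rw [Zm]
    apply Finset.sum_congr _ (fun _ _ => rfl)
    ext l
    simp only [injW, nbW, mem_filter]
    constructor
    · rintro ⟨h1, h2⟩
      exact ⟨⟨h1, List.Pairwise.isChain h2⟩, h2⟩
    · rintro ⟨⟨h1, _⟩, h2⟩; exact ⟨h1, h2⟩
  rw [(W_words P A j).1, e, ← Finset.sum_filter_add_sum_filter_not (nbW P j) List.Nodup, Matrix.add_mulVec, ip_add_right]
  rw [add_eq_left, ip]
  apply Finset.sum_eq_zero
  intro x _
  by_cases hx : F x = 0
  · simp [hx]
  · have : ((∑ l ∈ (nbW P j).filter (fun l => ¬ l.Nodup), (l.map A).prod) *ᵥ F) x = 0 := by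
      simp only [Matrix.mulVec, dotProduct]
      apply Finset.sum_eq_zero
      intro y _
      rw [Matrix.sum_apply, Finset.sum_eq_zero, zero_mul]
      intro l hl
      rw [mem_filter] at hl
      exact h l hl.1 hl.2 x hx y
    rw [this, mul_zero]
end mat
end MC


namespace MC
open Finset Classical Matrix

section mat
variable {ι : Type*} [Fintype ι] [DecidableEq ι]

structure Sys (P : Finset ℕ) (A : ℕ → Matrix ι ι ℝ) (d : ℕ → ι → ℝ) (D0 : ℝ) : Prop where
  sym : ∀ p ∈ P, (A p)ᵀ = A p
  sq : ∀ p ∈ P, A p * A p = diagonal (d p)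
  dA : ∀ p ∈ P, diagonal (d p) * A p = A p
  dd : ∀ p ∈ P, ∀ x, d p x * d p x = d p x
  hD : ∀ x, ∑ p ∈ P, d p x ≤ D0
  h1 : 1 ≤ D0

variable {P : Finset ℕ} {A : ℕ → Matrix ι ι ℝ} {d : ℕ → ι → ℝ} {D0 : ℝ}

def AT (P : Finset ℕ) (A : ℕ → Matrix ι ι ℝ) : Matrix ι ι ℝ := ∑ p ∈ P, A p
def DT (P : Finset ℕ) (d : ℕ → ι → ℝ) (x : ι) : ℝ := ∑ p ∈ P, d p x

lemma Sys.d_nonneg (h : Sys P A d D0) {p : ℕ} (hp : p ∈ P) (x : ι) : 0 ≤ d p x := by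
  rw [← h.dd p hp x]; exact mul_self_nonneg _

lemma Sys.DT_nonneg (h : Sys P A d D0) (x : ι) : 0 ≤ DT P d x :=
  Finset.sum_nonneg fun _ hp => h.d_nonneg hp x

lemma Sys.AT_sym (h : Sys P A d D0) : (AT P A)ᵀ = AT P A := by
  rw [AT, Matrix.transpose_sum]
  exact Finset.sum_congr rfl h.sym

lemma Sys.Ap_Wp (h : Sys P A d D0) {p : ℕ} (hp : p ∈ P) (j : ℕ) :
    A p * Wpm P A (j+1) p = diagonal (d p) * Wm P A j - Wpm P A j p := by
  rw [Wpm_succ, ← Matrix.mul_assoc, h.sq p hp, Matrix.mul_sub]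
  congr 1
  cases j with
  | zero => simp [Wpm]
  | succ j => rw [Wpm_succ, ← Matrix.mul_assoc, h.dA p hp]

lemma Sys.A_W (h : Sys P A d D0) (j : ℕ) :
    AT P A * Wm P A (j+1) = Wm P A (j+2) + (diagonal (DT P d) * Wm P A j - (if j = 0 then 0 else Wm P A j)) := by
  have e1 : diagonal (DT P d) = ∑ p ∈ P, diagonal (d p) := by
    ext x y
    rw [Matrix.sum_apply]
    by_cases hxy : x = y
    · subst hxy; simp [DT]
    · simp [Matrix.diagonal_apply_ne _ hxy]
  have e2 : (if j = 0 then 0 else Wm P A j) = ∑ p ∈ P, Wpm P A j p := by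
    split_ifs with hj
    · subst hj; simp [Wpm]
    · rw [Wm, if_neg hj]
  rw [e2, e1, AT, Finset.sum_mul, Finset.sum_mul, ← Finset.sum_sub_distrib, Wm_succ P A (j+1), ← Finset.sum_add_distrib]
  apply Finset.sum_congr rfl
  intro p hp
  rw [← h.Ap_Wp hp, Wpm_succ P A (j+1), ← Matrix.mul_add]
  simp

lemma Wm_one : Wm P A 1 = AT P A := by
  rw [Wm_succ, AT]
  apply Finset.sum_congr rfl
  intro p _
  rw [Wpm_succ, Wm_zero]; simp [Wpm]

noncomputable def Um (P : Finset ℕ) (A : ℕ → Matrix ι ι ℝ) (d : ℕ → ι → ℝ) : ℕ → Matrix ι ι ℝ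
  | 0 => 1
  | 1 => AT P A
  | j+2 => AT P A * Um P A d (j+1) - diagonal (fun x => DT P d x - 1) * Um P A d j

lemma diag_sub_one (D : ι → ℝ) : diagonal (fun x => D x - 1) = diagonal D - (1 : Matrix ι ι ℝ) := by
  rw [← Matrix.diagonal_one, Matrix.diagonal_sub]

lemma Sys.U_W (h : Sys P A d D0) (j : ℕ) : Um P A d (j+2) = Wm P A (j+2) + Um P A d j := by
  induction j using Nat.strong_induction_on with
  | _ j ih =>
    match j with
    | 0 =>
      have := h.A_W 0
      simp only [zero_add, if_true, Wm_one, Wm_zero] at this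
      simp only [Um, zero_add]
      rw [this, diag_sub_one]
      simp only [Matrix.mul_one, sub_zero]
      abel
    | 1 =>
      have h1 := h.A_W 1
      simp only [one_ne_zero, if_false, Wm_one] at h1
      have h0 := ih 0 (by omega)
      simp only [zero_add] at h0
      have : Um P A d (1+2) = AT P A * Um P A d 2 - diagonal (fun x => DT P d x - 1) * Um P A d 1 := rfl
      rw [this, h0, Matrix.mul_add]
      have h1' : AT P A * Wm P A 2 = _ := h1
      rw [h1', diag_sub_one]
      have e0 : Um P A d 0 = 1 := rfl
      have e1 : Um P A d 1 = AT P A := rfl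
      rw [e0, e1, Matrix.mul_one, Matrix.sub_mul, Matrix.one_mul]
      abel
    | j+2 =>
      have h1 := ih (j+1) (by omega)
      have h0 := ih j (by omega)
      have hA := h.A_W (j+2)
      rw [if_neg (by omega)] at hA
      have : Um P A d (j+2+2) = AT P A * Um P A d (j+1+2) - diagonal (fun x => DT P d x - 1) * Um P A d (j+2) := rfl
      have hU : Um P A d (j+2) = AT P A * Um P A d (j+1) - diagonal (fun x => DT P d x - 1) * Um P A d j := rfl
      rw [this, h1, Matrix.mul_add]
      have hA' : AT P A * Wm P A (j+1+2) = _ := hA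
      rw [hA']
      nth_rewrite 1 [h0]
      rw [hU, diag_sub_one]
      simp only [Matrix.sub_mul, Matrix.mul_add, Matrix.one_mul]
      abel

lemma Sys.norm_A (h : Sys P A d D0) (u : ι → ℝ) :
    ip univ (AT P A *ᵥ u) (AT P A *ᵥ u) ≤ D0^2 * ip univ u u := by
  set y := AT P A *ᵥ u with hy
  have hD0 : 0 < D0 := by linarith [h.h1]
  have e1 : ip univ y (AT P A *ᵥ u) = ∑ p ∈ P, ip univ (fun x => d p x * y x) (A p *ᵥ u) := by
    rw [AT, Matrix.sum_mulVec]
    simp only [ip, Finset.sum_apply, Finset.mul_sum]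
    rw [Finset.sum_comm]
    apply Finset.sum_congr rfl
    intro p hp
    apply Finset.sum_congr rfl
    intro x _
    have : (A p *ᵥ u) x = d p x * (A p *ᵥ u) x := by
      conv_lhs => rw [← h.dA p hp, ← Matrix.mulVec_mulVec, Matrix.mulVec_diagonal]
    rw [this]
    have := h.dd p hp x
    linear_combination (-(y x * (A p *ᵥ u) x)) * this + 0
  have e2 : ∀ p ∈ P, ip univ (fun x => d p x * y x) (A p *ᵥ u) ≤
      1/2 * ((1/D0) * ∑ x, d p x * (y x)^2 + D0 * ∑ x, d p x * (u x)^2) := by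
    intro p hp
    have h3 : ip univ (A p *ᵥ u) (A p *ᵥ u) = ∑ x, d p x * (u x)^2 := by
      rw [ip_sym _ (h.sym p hp), Matrix.mulVec_mulVec, h.sq p hp]
      simp only [ip, Matrix.mulVec_diagonal]
      apply Finset.sum_congr rfl; intro x _; ring
    have h4 : ip univ (fun x => d p x * y x) (fun x => d p x * y x) = ∑ x, d p x * (y x)^2 := by
      simp only [ip]
      apply Finset.sum_congr rfl; intro x _
      have := h.dd p hp x
      linear_combination (y x)^2 * this
    rw [← h3, ← h4]
    simp only [ip, Finset.mul_sum, ← Finset.sum_add_distrib]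
    apply Finset.sum_le_sum
    intro x _
    set a := d p x * y x
    set b := (A p *ᵥ u) x
    have : 0 ≤ 1/2 * (1/D0) * (a - D0 * b)^2 := by positivity
    have e : 1/2 * (1/D0) * (a - D0 * b)^2 = 1/2 * (1/D0 * (a*a) + D0 * (b * b)) - a * b := by
      field_simp; ring
    linarith
  have e3 : ∀ v : ι → ℝ, ∑ p ∈ P, ∑ x, d p x * (v x)^2 ≤ D0 * ip univ v v := by
    intro v
    rw [Finset.sum_comm]
    simp only [ip, Finset.mul_sum]
    apply Finset.sum_le_sum
    intro x _
    rw [← Finset.sum_mul]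
    have := h.hD x
    nlinarith [sq_nonneg (v x)]
  have e4 := Finset.sum_le_sum e2
  rw [← e1, ← Finset.mul_sum, Finset.sum_add_distrib, ← Finset.mul_sum, ← Finset.mul_sum] at e4
  have h5 := e3 y
  have h6 := e3 u
  have h7 : (1/D0) * ∑ p ∈ P, ∑ x, d p x * (y x)^2 ≤ ip univ y y := by
    rw [one_div, inv_mul_le_iff₀ hD0]; exact h5
  have h8 : D0 * ∑ p ∈ P, ∑ x, d p x * (u x)^2 ≤ D0 * (D0 * ip univ u u) := mul_le_mul_of_nonneg_left h6 hD0.le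
  rw [← hy] at e4
  nlinarith

lemma ip_sub_sq {κ : Type*} (S : Finset κ) (u v : κ → ℝ) : ip S (u - v) (u - v) ≤ 2 * ip S u u + 2 * ip S v v := by
  simp only [ip, Finset.mul_sum, ← Finset.sum_add_distrib]
  apply Finset.sum_le_sum
  intro x _
  simp only [Pi.sub_apply]
  nlinarith [sq_nonneg (u x + v x)]

lemma Sys.W_crude_sq (h : Sys P A d D0) (F : ι → ℝ) (j : ℕ) :
    ip univ (Wm P A j *ᵥ F) (Wm P A j *ᵥ F) ≤ (2*D0)^(2*j) * ip univ F F := by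
  have hD0 := h.h1
  induction j using Nat.strong_induction_on with
  | _ j ih =>
    match j with
    | 0 => simp [Wm_zero]
    | 1 =>
      rw [Wm_one]
      refine (h.norm_A F).trans ?_
      have := ip_self_nonneg univ F
      have : D0^2 ≤ (2*D0)^(2*1) := by norm_num; nlinarith
      gcongr
    | j+2 =>
      have h1 := ih (j+1) (by omega)
      have h0 := ih j (by omega)
      have hA := h.A_W j
      set c : ι → ℝ := fun x => DT P d x - (if j = 0 then 0 else 1) with hc
      have e : Wm P A (j+2) = AT P A * Wm P A (j+1) - diagonal c * Wm P A j := by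
        rw [hA, hc]
        split_ifs with hj
        · simp only [sub_zero]; abel
        · rw [diag_sub_one, Matrix.sub_mul, Matrix.one_mul]; abel
      rw [e, Matrix.sub_mulVec]
      refine (ip_sub_sq _ _ _).trans ?_
      have h2 := h.norm_A (Wm P A (j+1) *ᵥ F)
      rw [Matrix.mulVec_mulVec] at h2
      have h3 : ip univ ((diagonal c * Wm P A j) *ᵥ F) ((diagonal c * Wm P A j) *ᵥ F) ≤ D0^2 * ip univ (Wm P A j *ᵥ F) (Wm P A j *ᵥ F) := by
        rw [← Matrix.mulVec_mulVec]
        simp only [ip, Matrix.mulVec_diagonal, Finset.mul_sum]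
        apply Finset.sum_le_sum
        intro x _
        have hcx : (c x)^2 ≤ D0^2 := by
          apply sq_le_sq'
          · have := h.DT_nonneg x; simp only [hc]; split_ifs <;> linarith
          · have : DT P d x ≤ D0 := h.hD x
            simp only [hc]; split_ifs <;> linarith
        nlinarith [sq_nonneg ((Wm P A j *ᵥ F) x)]
      have hF := ip_self_nonneg univ F
      have e1 : (2*D0)^(2*(j+1)) = (2*D0)^(2*j) * (2*D0)^2 := by rw [← pow_add]; ring_nf
      have e2 : (2*D0)^(2*(j+2)) = (2*D0)^(2*j) * (2*D0)^4 := by rw [← pow_add]; ring_nf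
      set E := (2*D0)^(2*j) with hE
      have hEF : 0 ≤ E * ip univ F F := by positivity
      rw [e1] at h1
      rw [e2]
      have hD2 : 0 ≤ D0^2 := by positivity
      have h4 := mul_le_mul_of_nonneg_left h1 hD2
      have h5 := mul_le_mul_of_nonneg_left h0 hD2
      have h6 : 2 * (D0^2 * (E * (2*D0)^2 * ip univ F F)) + 2 * (D0^2 * (E * ip univ F F)) ≤ E * (2*D0)^4 * ip univ F F := by
        have : 2 * (D0^2 * (E * (2*D0)^2 * ip univ F F)) + 2 * (D0^2 * (E * ip univ F F)) = (8 * D0^4 + 2 * D0^2) * (E * ip univ F F) := by ring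
        rw [this]
        have : E * (2*D0)^4 * ip univ F F = 16 * D0^4 * (E * ip univ F F) := by ring
        rw [this]
        apply mul_le_mul_of_nonneg_right _ hEF
        have : D0^2 * 1 ≤ D0^2 * D0^2 := mul_le_mul_of_nonneg_left (by nlinarith) hD2
        nlinarith
      linarith

lemma Sys.W_crude (h : Sys P A d D0) (F : ι → ℝ) (j : ℕ) :
    |ip univ F (Wm P A j *ᵥ F)| ≤ (2*D0)^j * ip univ F F := by
  have hD0 := h.h1
  apply abs_le_of_sq_le_sq _ (by have := ip_self_nonneg univ F; positivity)
  refine (ip_cs _ _ _).trans ?_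
  have := mul_le_mul_of_nonneg_left (h.W_crude_sq F j) (ip_self_nonneg univ F)
  refine this.trans (le_of_eq ?_)
  rw [mul_comm 2 j, pow_mul]; ring

lemma Sys.U_bound (h : Sys P A d D0) (F : ι → ℝ) {B G : ℝ} (hB : 0 ≤ B) (hG : 2 ≤ G^2) (hG0 : 1 ≤ G) (R : ℕ)
    (hW : ∀ k ≤ R, |ip univ F (Wm P A k *ᵥ F)| ≤ B * G^k * ip univ F F) :
    ∀ k ≤ R, |ip univ F (Um P A d k *ᵥ F)| ≤ 2 * B * G^k * ip univ F F := by
  have hF := ip_self_nonneg univ F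
  intro k
  induction k using Nat.strong_induction_on with
  | _ k ih =>
    intro hk
    match k with
    | 0 =>
      have e : Um P A d 0 = Wm P A 0 := rfl
      rw [e]
      refine (hW 0 hk).trans ?_
      have : 0 ≤ B * ip univ F F := by positivity
      simp only [pow_zero, mul_one]; linarith
    | 1 =>
      have e : Um P A d 1 = Wm P A 1 := Wm_one.symm
      rw [e]
      refine (hW 1 hk).trans ?_
      have : 0 ≤ B * G^1 * ip univ F F := by positivity
      linarith
    | k+2 =>
      rw [h.U_W, Matrix.add_mulVec, ip_add_right]
      refine (abs_add_le _ _).trans ?_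
      have h1 := hW (k+2) hk
      have h0 := ih k (by omega) (by omega)
      have h2 : 0 ≤ B * G^k * ip univ F F := by positivity
      have e : G^(k+2) = G^k * G^2 := by rw [pow_add]
      rw [e] at h1 ⊢
      nlinarith

end mat
end MC


namespace MC
open Finset Classical Matrix

section mat
variable {ι : Type*} [Fintype ι] [DecidableEq ι]
variable {P : Finset ℕ} {A : ℕ → Matrix ι ι ℝ} {d : ℕ → ι → ℝ} {D0 : ℝ}

noncomputable def kap (P : Finset ℕ) (d : ℕ → ι → ℝ) (D0 : ℝ) (l : ℕ) (x : ι) : ℝ :=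
  if l = 0 then Real.sqrt (D0 + 1 - DT P d x) else Real.sqrt D0

noncomputable def ccf (k : ℕ → ι → ℝ) : ℕ → ι → ℝ
  | 0, _ => 1
  | l+1, x => k l x * ccf k l x

noncomputable def dil (n : ℕ) (A : Matrix ι ι ℝ) (k : ℕ → ι → ℝ) (u : ℕ × ι → ℝ) : ℕ × ι → ℝ := fun z =>
  (if z.1 = 0 then (A *ᵥ (fun y => u (0, y))) z.2 else k (z.1 - 1) z.2 * u (z.1 - 1, z.2)) +
  (if z.1 < n then k z.1 z.2 * u (z.1 + 1, z.2) else 0)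

lemma ip_dil (n : ℕ) (A : Matrix ι ι ℝ) (k : ℕ → ι → ℝ) (u v : ℕ × ι → ℝ) :
    ip (range (n+1) ×ˢ univ) (dil n A k u) v = ip univ (A *ᵥ (fun y => u (0, y))) (fun y => v (0, y)) +
      ∑ x, ∑ l ∈ range n, k l x * (u (l, x) * v (l+1, x) + u (l+1, x) * v (l, x)) := by
  simp only [ip]
  rw [Finset.sum_product_right, ← Finset.sum_add_distrib]
  apply Finset.sum_congr rfl
  intro x _
  simp only [dil, add_mul, Finset.sum_add_distrib]
  rw [Finset.sum_range_succ', Finset.sum_range_succ _ n]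
  simp only [Nat.add_eq_zero_iff, one_ne_zero, and_false, if_false, if_true, lt_irrefl, zero_mul, add_zero,
    Nat.add_sub_cancel]
  have : ∑ l ∈ range n, (if l < n then k l x * u (l+1, x) else 0) * v (l, x) = ∑ l ∈ range n, k l x * (u (l+1,x) * v (l,x)) := by
    apply Finset.sum_congr rfl
    intro l hl
    rw [if_pos (mem_range.1 hl), mul_assoc]
  rw [this]
  simp only [mul_add, Finset.sum_add_distrib, mul_assoc]
  ring

lemma dil_sym (n : ℕ) (A : Matrix ι ι ℝ) (hA : Aᵀ = A) (k : ℕ → ι → ℝ) (u v : ℕ × ι → ℝ) :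
    ip (range (n+1) ×ˢ univ) (dil n A k u) v = ip (range (n+1) ×ˢ univ) u (dil n A k v) := by
  rw [ip_comm _ u, ip_dil, ip_dil, ip_sym A hA, ip_comm]
  congr 1
  apply Finset.sum_congr rfl
  intro x _
  apply Finset.sum_congr rfl
  intro l _
  ring

noncomputable def uu (P : Finset ℕ) (A : ℕ → Matrix ι ι ℝ) (d : ℕ → ι → ℝ) (D0 : ℝ) (F : ι → ℝ) (i : ℕ) : ℕ × ι → ℝ := fun z =>
  if z.1 ≤ i then ccf (kap P d D0) z.1 z.2 * (Um P A d (i - z.1) *ᵥ F) z.2 else 0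

lemma Sys.dil_uu_zero (_h : Sys P A d D0) (F : ι → ℝ) (n : ℕ) (z : ℕ × ι) :
    dil n (AT P A) (kap P d D0) (uu P A d D0 F 0) z = uu P A d D0 F 1 z := by
  obtain ⟨l, x⟩ := z
  match l with
  | 0 => simp [dil, uu, ccf, Um]
  | 1 => simp [dil, uu, ccf, Um]
  | l+2 => simp [dil, uu]

lemma Sys.dil_uu_succ (h : Sys P A d D0) (F : ι → ℝ) (n i : ℕ) (hi : i < n) (z : ℕ × ι) :
    dil n (AT P A) (kap P d D0) (uu P A d D0 F (i+1)) z = uu P A d D0 F (i+2) z + D0 * uu P A d D0 F i z := by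
  obtain ⟨l, x⟩ := z
  have hU : Um P A d (i+2) = AT P A * Um P A d (i+1) - diagonal (fun x => DT P d x - 1) * Um P A d i := rfl
  match l with
  | 0 =>
    simp only [dil, uu, if_true, zero_le, zero_add, ccf, one_mul, Nat.sub_zero]
    rw [if_pos (by omega), if_pos (by omega), hU, Matrix.sub_mulVec, ← Matrix.mulVec_mulVec, ← Matrix.mulVec_mulVec]
    have hk : kap P d D0 0 x * kap P d D0 0 x = D0 + 1 - DT P d x := by
      simp only [kap, if_true]
      apply Real.mul_self_sqrt
      have : DT P d x ≤ D0 := h.hD x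
      linarith
    simp only [Pi.sub_apply, Matrix.mulVec_diagonal, Nat.add_sub_cancel, mul_one]
    linear_combination (Um P A d i *ᵥ F) x * hk
  | l+1 =>
    have hk : kap P d D0 (l+1) x * kap P d D0 (l+1) x = D0 := by
      simp only [kap, Nat.add_eq_zero_iff, one_ne_zero, and_false, if_false]
      exact Real.mul_self_sqrt (by linarith [h.h1])
    simp only [dil, uu, Nat.add_eq_zero_iff, one_ne_zero, and_false, if_false, Nat.add_sub_cancel]
    have e1 : kap P d D0 l x * (if l ≤ i + 1 then ccf (kap P d D0) l x * (Um P A d (i+1-l) *ᵥ F) x else 0) =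
        if l + 1 ≤ i + 2 then ccf (kap P d D0) (l+1) x * (Um P A d (i+2-(l+1)) *ᵥ F) x else 0 := by
      by_cases hl : l ≤ i + 1
      · rw [if_pos hl, if_pos (by omega), show i+2-(l+1) = i+1-l by omega, ccf]; ring
      · rw [if_neg hl, if_neg (by omega), mul_zero]
    rw [e1]
    congr 1
    by_cases hl : l + 1 ≤ i
    · rw [if_pos (by omega), if_pos (by omega), if_pos hl, show i + 1 - (l+1+1) = i - (l+1) by omega]
      have : ccf (kap P d D0) (l+1+1) x = kap P d D0 (l+1) x * ccf (kap P d D0) (l+1) x := rfl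
      rw [this]
      linear_combination (ccf (kap P d D0) (l+1) x * (Um P A d (i-(l+1)) *ᵥ F) x) * hk
    · have h0 : ¬ (l + 1 + 1 ≤ i + 1) := by omega
      rw [if_neg h0, if_neg hl]
      simp

lemma Sys.ip_uu0 (_h : Sys P A d D0) (F : ι → ℝ) (n : ℕ) (v : ℕ × ι → ℝ) :
    ip (range (n+1) ×ˢ univ) (uu P A d D0 F 0) v = ip univ F (fun x => v (0, x)) := by
  simp only [ip]
  rw [Finset.sum_product_right]
  apply Finset.sum_congr rfl
  intro x _
  rw [Finset.sum_range_succ', Finset.sum_eq_zero]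
  · simp [uu, ccf, Um]
  · intro l _; simp [uu]

theorem Sys.dilation (h : Sys P A d D0) (F : ι → ℝ) {B G : ℝ} (hB : 0 ≤ B) (hG : 0 ≤ G) (hG2 : D0 ≤ G^2) (a : ℕ)
    (hU : ∀ k ≤ 2^a, |ip univ F (Um P A d k *ᵥ F)| ≤ B * G^k * ip univ F F) :
    |ip univ F (AT P A *ᵥ F)|^(2^a) ≤ (ip univ F F)^(2^a) * (B * (2*G)^(2^a)) := by
  set R := 2^a with hR
  have hF := ip_self_nonneg univ F
  set T := dil R (AT P A) (kap P d D0) with hT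
  set S : Finset (ℕ × ι) := range (R+1) ×ˢ univ with hS
  have hsym : ∀ u v, ip S (T u) v = ip S u (T v) := dil_sym R (AT P A) h.AT_sym _
  set Fh := uu P A d D0 F 0 with hFh
  have key : ∀ m i, m + i ≤ R → |ip S (T^[m] Fh) (uu P A d D0 F i)| ≤ B * (2*G)^m * G^i * ip univ F F := by
    intro m
    induction m with
    | zero =>
      intro i hi
      have := hU i (by omega)
      rw [Function.iterate_zero_apply, hS, hFh, h.ip_uu0]
      simp only [uu, zero_le, if_true, ccf, one_mul, pow_zero, mul_one, Nat.sub_zero]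
      exact this
    | succ m ih =>
      intro i hi
      rw [Function.iterate_succ_apply', hsym]
      match i with
      | 0 =>
        have e : T (uu P A d D0 F 0) = uu P A d D0 F 1 := by
          ext z; exact h.dil_uu_zero F R z
        rw [e]
        refine (ih 1 (by omega)).trans ?_
        have : 0 ≤ B * (2*G)^m * G^1 * ip univ F F := by positivity
        rw [pow_succ (2*G) m]
        simp only [pow_one, pow_zero] at this ⊢
        linarith
      | i+1 =>
        have e : T (uu P A d D0 F (i+1)) = uu P A d D0 F (i+2) + D0 • uu P A d D0 F i := by
          ext z
          simp only [Pi.add_apply, Pi.smul_apply, smul_eq_mul]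
          exact h.dil_uu_succ F R i (by omega) z
        rw [e, ip_add_right, ip_smul_right]
        have h2 := ih (i+2) (by omega)
        have h0 := ih i (by omega)
        refine (abs_add_le _ _).trans ?_
        rw [abs_mul, abs_of_nonneg (by linarith [h.h1] : (0:ℝ) ≤ D0)]
        have h3 := mul_le_mul_of_nonneg_left h0 (by linarith [h.h1] : (0:ℝ) ≤ D0)
        set E := B * (2*G)^m * G^i * ip univ F F with hE
        have hE0 : 0 ≤ E := by positivity
        have e2 : B * (2*G)^m * G^(i+2) * ip univ F F = E * G^2 := by rw [hE, pow_add]; ring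
        have e3 : B * (2*G)^(m+1) * G^(i+1) * ip univ F F = 2 * (E * G^2) := by rw [hE, pow_succ, pow_succ]; ring
        rw [e2] at h2
        rw [e3]
        nlinarith [mul_le_mul_of_nonneg_right hG2 hE0]
  have h1 := iter_cs S T hsym Fh a
  have h2 := key R 0 (by omega)
  rw [ip_iter S T hsym] at h2
  have e1 : ip S Fh (T Fh) = ip univ F (AT P A *ᵥ F) := by
    rw [hS, hFh, h.ip_uu0]
    congr 1
    ext x
    rw [hT, h.dil_uu_zero]
    simp [uu, ccf, Um]
  have e2 : ip S Fh Fh = ip univ F F := by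
    rw [hS, hFh, h.ip_uu0]
    congr 1
    ext x
    simp [uu, ccf, Um]
  rw [e1, e2, ← hR] at h1
  refine h1.trans ?_
  refine (mul_le_mul_of_nonneg_left h2 (by positivity)).trans (le_of_eq ?_)
  have : (ip univ F F)^R = (ip univ F F)^(R-1) * ip univ F F := by
    rw [← pow_succ]; congr 1; have := Nat.one_le_two_pow (n := a); omega
  rw [this]; ring

/-- spectral conclusion -/
theorem Sys.spectral (h : Sys P A d D0) (F : ι → ℝ) {B G : ℝ} (hB : 0 ≤ B) (hG : 1 ≤ G) (hG3 : 2 ≤ G^2) (hG2 : D0 ≤ G^2) (a R0 : ℕ)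
    (hB0 : (2*D0)^R0 ≤ B) (hB1 : 1 ≤ B)
    (hN : ∀ j ≤ 2^a, ∀ l ∈ nbW P j, ¬ l.Nodup → ∀ x, F x ≠ 0 → ∀ y, (l.map A).prod x y = 0)
    (hZ : ∀ j, R0 < j → j ≤ 2^a → |ip univ F (Zm P A j *ᵥ F)| ≤ G^j * ip univ F F) :
    |ip univ F (AT P A *ᵥ F)|^(2^a) ≤ (ip univ F F)^(2^a) * (2 * B * (2*G)^(2^a)) := by
  have hF := ip_self_nonneg univ F
  apply h.dilation F (by positivity) (by linarith) hG2
  apply h.U_bound F hB hG3 hG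
  intro k hk
  by_cases hk0 : k ≤ R0
  · refine (h.W_crude F k).trans ?_
    have h1 : (2*D0)^k ≤ (2*D0)^R0 := pow_le_pow_right₀ (by linarith [h.h1]) hk0
    have h2 : 1 ≤ G^k := one_le_pow₀ hG
    apply mul_le_mul_of_nonneg_right _ hF
    nlinarith
  · rw [W_eq_Z P A k F (hN k hk)]
    refine (hZ k (by omega) hk).trans ?_
    apply mul_le_mul_of_nonneg_right _ hF
    have h2 : 0 ≤ G^k := by positivity
    nlinarith

end mat
end MC


namespace MC
open Finset Classical Matrix

lemma al_cube (τ : ℤ) (p : ℕ) (x : ℤ) : al τ p x * al τ p x * al τ p x = al τ p x := by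
  unfold al; split_ifs <;> norm_num

lemma al_shift (τ : ℤ) (p : ℕ) (x : ℤ) (e : Bool) : al τ p (x + sg e * p) = al τ p x := by
  have h1 : ((p:ℤ) ∣ x + sg e * p) ↔ (p:ℤ) ∣ x := dvd_add_left (Dvd.intro_left _ rfl)
  have h2 : ((p:ℤ) ∣ x + sg e * p + τ) ↔ (p:ℤ) ∣ x + τ := by
    rw [show x + sg e * p + τ = x + τ + sg e * p by ring]
    exact dvd_add_left (Dvd.intro_left _ rfl)
  simp only [al, h1, h2]

variable (P : Finset ℕ) (τ : ℤ) (D M : ℕ) (b : ℤ)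

lemma Am_cube (p : ℕ) (u v : Bool × Fin M) : Am P τ D M b p u v * Am P τ D M b p u v * Am P τ D M b p u v = Am P τ D M b p u v := by
  unfold Am
  split_ifs
  · set a := al τ p (b + (u.2:ℕ))
    set y := Yv P τ D (b + (u.2:ℕ)) with hy
    set z := Yv P τ D (b + (v.2:ℕ)) with hz
    have h1 : a * a * a = a := al_cube _ _ _
    have h2 : y * y = y := Yv_idem _ _ _ _
    have h3 : z * z = z := Yv_idem _ _ _ _
    calc a * y * z * (a * y * z) * (a * y * z) = (a * a * a) * ((y * y) * y) * ((z * z) * z) := by ring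
      _ = _ := by rw [h1, h2, h2, h3, h3]
  · simp

lemma Am_uniq {p : ℕ} {u v v' : Bool × Fin M} (h : Am P τ D M b p u v ≠ 0) (h' : Am P τ D M b p u v' ≠ 0) : v = v' := by
  unfold Am at h h'
  split_ifs at h with h1
  · split_ifs at h' with h2
    · ext
      · rw [h1.1, h2.1]
      · have : ((v.2:ℕ):ℤ) = (v'.2:ℕ) := by rw [h1.2, h2.2]
        exact_mod_cast this
    · exact absurd rfl h'
  · exact absurd rfl h

lemma Am_sym (p : ℕ) : (Am P τ D M b p)ᵀ = Am P τ D M b p := by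
  ext u v
  rw [Matrix.transpose_apply]
  unfold Am
  by_cases h : v.1 = !u.1 ∧ ((v.2 : ℕ):ℤ) = (u.2 : ℕ) + sg u.1 * p
  · have h' : u.1 = !v.1 ∧ ((u.2 : ℕ):ℤ) = (v.2 : ℕ) + sg v.1 * p := by
      refine ⟨by rw [h.1]; simp, ?_⟩
      rw [h.1, sg_not, h.2]; ring
    rw [if_pos h, if_pos h']
    have : al τ p (b + (v.2:ℕ)) = al τ p (b + (u.2:ℕ)) := by
      rw [h.2, ← add_assoc, al_shift]
    rw [this]; ring
  · have h' : ¬ (u.1 = !v.1 ∧ ((u.2 : ℕ):ℤ) = (v.2 : ℕ) + sg v.1 * p) := by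
      rintro ⟨h1, h2⟩
      apply h
      refine ⟨by rw [h1]; simp, ?_⟩
      rw [h1, sg_not, h2]; ring
    rw [if_neg h, if_neg h']

noncomputable def dm (p : ℕ) (u : Bool × Fin M) : ℝ := ∑ v, Am P τ D M b p u v * Am P τ D M b p u v

lemma dm_mul (p : ℕ) (u w : Bool × Fin M) : dm P τ D M b p u * Am P τ D M b p u w = Am P τ D M b p u w := by
  by_cases hw : Am P τ D M b p u w = 0
  · rw [hw, mul_zero]
  · rw [dm, Finset.sum_eq_single w, Am_cube]
    · intro v _ hv
      have : Am P τ D M b p u v = 0 := by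
        by_contra h
        exact hv (Am_uniq P τ D M b h hw)
      rw [this, mul_zero]
    · simp

lemma dm_le (p : ℕ) (u : Bool × Fin M) : dm P τ D M b p u ≤ (if hit τ p (b + (u.2:ℕ)) then 1 else 0) * Yv P τ D (b + (u.2:ℕ)) := by
  by_cases h : ∃ w, Am P τ D M b p u w ≠ 0
  · obtain ⟨w, hw⟩ := h
    have h1 : dm P τ D M b p u = 1 := by
      have := dm_mul P τ D M b p u w
      exact mul_right_cancel₀ hw (by rw [this, one_mul])
    rw [h1]
    unfold Am at hw
    split_ifs at hw with hc
    · have ha : al τ p (b + (u.2:ℕ)) ≠ 0 := fun h => hw (by rw [h]; ring)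
      have hy : Yv P τ D (b + (u.2:ℕ)) ≠ 0 := fun h => hw (by rw [h]; ring)
      rw [if_pos (hit_of_al ha)]
      have := Yv_idem P τ D (b + (u.2:ℕ))
      have : Yv P τ D (b + (u.2:ℕ)) = 1 := mul_right_cancel₀ hy (by rw [this, one_mul])
      rw [this]; norm_num
    · exact absurd rfl hw
  · push Not at h
    have : dm P τ D M b p u = 0 := by
      rw [dm]; apply Finset.sum_eq_zero; intro v _; rw [h v, mul_zero]
    rw [this]
    apply mul_nonneg
    · split_ifs <;> norm_num
    · unfold Yv; split_ifs <;> norm_num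

lemma Am_sys (hD : 1 ≤ D) : Sys P (Am P τ D M b) (dm P τ D M b) (D:ℝ) where
  sym p _ := Am_sym P τ D M b p
  sq p _ := by
    ext u w
    rw [Matrix.mul_apply]
    by_cases h : u = w
    · subst h
      rw [Matrix.diagonal_apply_eq, dm]
      apply Finset.sum_congr rfl
      intro v _
      congr 1
      conv_lhs => rw [← Am_sym P τ D M b p]
      rfl
    · rw [Matrix.diagonal_apply_ne _ h]
      apply Finset.sum_eq_zero
      intro v _
      by_contra hne
      apply h
      have h1 : Am P τ D M b p v u ≠ 0 := by
        intro h0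
        apply hne
        have : Am P τ D M b p u v = 0 := by
          rw [← Am_sym P τ D M b p]; exact h0
        rw [this, zero_mul]
      exact Am_uniq P τ D M b h1 (right_ne_zero_of_mul hne)
  dA p _ := by
    ext u w
    rw [Matrix.diagonal_mul, dm_mul]
  dd p _ u := by
    nth_rewrite 2 [dm]
    rw [Finset.mul_sum, dm]
    apply Finset.sum_congr rfl
    intro v _
    have := dm_mul P τ D M b p u v
    rw [dm] at this
    rw [← mul_assoc, this]
  hD u := by
    refine (Finset.sum_le_sum fun p _ => dm_le P τ D M b p u).trans ?_
    rw [← Finset.sum_mul]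
    have : ∑ p ∈ P, (if hit τ p (b + (u.2:ℕ)) then (1:ℝ) else 0) = hp P τ (b + (u.2:ℕ)) := by
      rw [hp, card_filter]; push_cast; rfl
    rw [this, Yv]
    split_ifs with hh
    · rw [mul_one]; exact_mod_cast hh
    · rw [mul_zero]; positivity
  h1 := by exact_mod_cast hD

variable {P τ D}
/-- nice integers -/
def nice (P : Finset ℕ) (τ : ℤ) (D R : ℕ) (x : ℤ) : Prop :=
  hp P τ x ≤ D ∧ ∀ e : Bool, ∀ j ≤ R, ∀ l ∈ nbW P j, ¬ l.Nodup → Qf P τ D l e x = 0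

lemma al_of_Qf {l : List ℕ} {e : Bool} {x : ℤ} (h : Qf P τ D l e x ≠ 0) (i : ℕ) (hi : i < l.length) :
    al τ (l.getD i 0) (x + posn (fun i => l.getD i 0) (sgn e) i) ≠ 0 := by
  rw [Qf_eq _ _ _ _ (by rintro rfl; simp at hi), Qw] at h
  have := Finset.prod_ne_zero_iff.1 (left_ne_zero_of_mul h) i (mem_range.2 hi)
  exact this

lemma exists_rep (l : List ℕ) (hc : l.IsChain (· ≠ ·)) (hn : ¬ l.Nodup) :
    ∃ k, k < l.length ∧ (∀ i i', i < k → i' < k → l.getD i 0 = l.getD i' 0 → i = i') ∧ ∃ a, a + 2 ≤ k ∧ l.getD a 0 = l.getD k 0 := by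
  have hex : ∃ k, k < l.length ∧ ∃ a, a < k ∧ l.getD a 0 = l.getD k 0 := by
    by_contra hno
    push Not at hno
    apply hn
    rw [List.nodup_iff_injective_get]
    intro a b hab
    have aux : ∀ a b : Fin l.length, l.get a = l.get b → ¬ a < b := by
      intro a b hab hlt
      apply hno b b.2 a hlt
      rw [List.getD_eq_getElem _ _ a.2, List.getD_eq_getElem _ _ b.2]
      exact hab
    rcases lt_trichotomy a b with h | h | h
    · exact absurd h (aux a b hab)
    · exact h
    · exact absurd h (aux b a hab.symm)
  set k := Nat.find hex with hk
  obtain ⟨h1, a, h2, h3⟩ := Nat.find_spec hex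
  have hmin : ∀ k' < k, ¬ _ := fun k' hk' => Nat.find_min hex hk'
  refine ⟨k, h1, ?_, a, ?_, h3⟩
  · intro i i' hi hi' he
    rcases lt_trichotomy i i' with h | h | h
    · exact absurd ⟨by omega, i, h, he⟩ (hmin i' hi')
    · exact h
    · exact absurd ⟨by omega, i', h, he.symm⟩ (hmin i hi)
  · by_contra hlt
    have hak : a + 1 = k := by omega
    rw [List.isChain_iff_getElem] at hc
    have := hc a (by omega)
    rw [← hk, List.getD_eq_getElem _ _ (by omega), List.getD_eq_getElem _ _ (by omega)] at h3
    apply this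
    rw [h3]
    congr 1
    omega

/-- density of integers that are not nice although `hp ≤ D` -/
theorem rep_density {R : ℕ} {l Hn : ℕ} (hl : 1 ≤ l) (hP : ∀ p ∈ P, 2 * R^2 * l ≤ p ∧ p ≤ Hn) (hPp : ∀ p ∈ P, p.Prime) (hH : 1 ≤ Hn)
    (L Q : ℝ) (hL : ∑ p ∈ P, 1 / (p : ℝ) ≤ L) (hL1 : 1 ≤ L)
    (hQ : 2 / (l:ℝ) * ∑ t ∈ Icc 1 Hn, 1 / (t:ℝ) ≤ Q) (X : ℤ) (T : ℕ) (hT : Hn^R ≤ T) :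
    (((Ico X (X+T)).filter fun x => hp P τ x ≤ D ∧ ¬ nice P τ D R x).card : ℝ) ≤
      2 * ∑ n ∈ Icc 1 R, 2 * T * SS n n (2*L) Q (fun _ => n) 1 := by
  set WW : ℕ → Finset (ℕ → ℕ) := fun n => ((words P n).image fun l i => l.getD i 0).filter fun w =>
    (∀ i i', i < n - 1 → i' < n - 1 → w i = w i' → i = i') ∧ ∃ a, a + 2 ≤ n - 1 ∧ w a = w (n-1) with hWW
  have hbound : ∀ e : Bool, ∀ n ∈ Icc 1 R, ∑ w ∈ WW n, (((Ico X (X+T)).filter fun b => ∀ i, i < n → al τ (w i) (b + posn w (sgn e) i) ≠ 0).card : ℝ) ≤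
      2 * T * SS n n (2*L) Q (fun _ => n) 1 := by
    intro e n hn
    rw [mem_Icc] at hn
    apply rep_words hn.1 (sgn e) (sgn_abs e) (sgn_ne e) τ hl P _ hPp hH L Q hL hL1 hQ X T _ (WW n)
    · intro w hw i hi
      rw [hWW, mem_filter, mem_image] at hw
      obtain ⟨⟨l, hl, rfl⟩, -⟩ := hw
      exact List.getD_eq_default _ _ (by rw [(mem_words.1 hl).1]; exact hi)
    · intro w hw i hi
      rw [hWW, mem_filter, mem_image] at hw
      obtain ⟨⟨l, hl, rfl⟩, -⟩ := hw
      rw [mem_words] at hl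
      simp only
      rw [List.getD_eq_getElem _ _ (by omega)]
      exact hl.2 _ (List.getElem_mem _)
    · intro w hw
      rw [hWW, mem_filter] at hw
      exact hw.2
    · intro p hp
      refine ⟨le_trans ?_ (hP p hp).1, (hP p hp).2⟩
      exact Nat.mul_le_mul_right _ (Nat.mul_le_mul_left _ (Nat.pow_le_pow_left hn.2 2))
    · exact (Nat.pow_le_pow_right hH hn.2).trans hT
  have hsub : ((Ico X (X+T)).filter fun x => hp P τ x ≤ D ∧ ¬ nice P τ D R x) ⊆
      (univ : Finset Bool).biUnion fun e => (Icc 1 R).biUnion fun n => (WW n).biUnion fun w =>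
        (Ico X (X+T)).filter fun b => ∀ i, i < n → al τ (w i) (b + posn w (sgn e) i) ≠ 0 := by
    intro x hx
    rw [mem_filter] at hx
    obtain ⟨hx, hD, hn⟩ := hx
    simp only [nice, not_and, hD, true_implies] at hn
    push Not at hn
    obtain ⟨e, j, hj, l, hl, hnd, hq⟩ := hn
    rw [nbW, mem_filter, mem_words] at hl
    obtain ⟨k, hk, h1, a, h2, h3⟩ := exists_rep l hl.2 hnd
    simp only [mem_biUnion, mem_univ, true_and]
    have hget : ∀ i, i < k + 1 → (l.take (k+1)).getD i 0 = l.getD i 0 := by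
      intro i hi
      rw [List.getD_eq_getElem _ _ (by rw [List.length_take]; omega), List.getD_eq_getElem _ _ (by omega), List.getElem_take]
    refine ⟨e, k+1, mem_Icc.2 ⟨by omega, by omega⟩, fun i => (l.take (k+1)).getD i 0, ?_, ?_⟩
    · rw [hWW, mem_filter, mem_image]
      refine ⟨⟨l.take (k+1), mem_words.2 ⟨by rw [List.length_take]; omega, fun x hx => hl.1.2 x (List.mem_of_mem_take hx)⟩, rfl⟩, ?_, ?_⟩
      · intro i i' hi hi' he
        simp only [Nat.add_sub_cancel] at hi hi'
        simp only at he
        rw [hget i (by omega), hget i' (by omega)] at he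
        exact h1 i i' hi hi' he
      · refine ⟨a, by simpa using h2, ?_⟩
        simp only [Nat.add_sub_cancel]
        rw [hget a (by omega), hget k (by omega)]
        exact h3
    · rw [mem_filter]
      refine ⟨hx, ?_⟩
      intro i hi
      have e1 : posn (fun i => (l.take (k+1)).getD i 0) (sgn e) i = posn (fun i => l.getD i 0) (sgn e) i := by
        simp only [posn]
        apply Finset.sum_congr rfl
        intro i' hi'
        rw [hget i' (by have := mem_range.1 hi'; omega)]
      rw [e1]
      simp only
      rw [hget i hi]
      exact al_of_Qf hq i (by omega)
  have hc := card_le_card hsub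
  have : (((Ico X (X+T)).filter fun x => hp P τ x ≤ D ∧ ¬ nice P τ D R x).card : ℝ) ≤
      ∑ e : Bool, ∑ n ∈ Icc 1 R, ∑ w ∈ WW n, (((Ico X (X+T)).filter fun b => ∀ i, i < n → al τ (w i) (b + posn w (sgn e) i) ≠ 0).card : ℝ) := by
    have : (((Ico X (X+T)).filter fun x => hp P τ x ≤ D ∧ ¬ nice P τ D R x).card) ≤
      ∑ e : Bool, ∑ n ∈ Icc 1 R, ∑ w ∈ WW n, (((Ico X (X+T)).filter fun b => ∀ i, i < n → al τ (w i) (b + posn w (sgn e) i) ≠ 0).card) := by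
      refine hc.trans (card_biUnion_le.trans ?_)
      apply Finset.sum_le_sum; intro e _
      refine card_biUnion_le.trans ?_
      apply Finset.sum_le_sum; intro n _
      exact card_biUnion_le
    exact_mod_cast this
  refine this.trans ?_
  refine (Finset.sum_le_sum fun e _ => Finset.sum_le_sum fun n hn => hbound e n hn).trans ?_
  rw [Finset.sum_const, card_univ, Fintype.card_bool, nsmul_eq_mul]
  push_cast
  exact le_refl _

end MC


namespace MC
open Finset Classical Matrix

noncomputable def II (N : ℕ) : Finset ℤ := Ioc (N:ℤ) (2 * (N:ℤ))

noncomputable def St (P : Finset ℕ) (τ : ℤ) (N : ℕ) (f g : ℤ → ℝ) : ℝ :=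
  ∑ n ∈ II N, ∑ p ∈ P, f n * g (n + p) * al τ p n

noncomputable def Fb (f g : ℤ → ℝ) (M : ℕ) (b : ℤ) (u : Bool × Fin M) : ℝ :=
  if u.1 then f (b + (u.2:ℕ)) else g (b + (u.2:ℕ))

lemma win {N : ℕ} (ψ : ℤ → ℝ) (hψ : ∀ n, n ∉ II N → ψ n = 0) (M : ℕ) (b : ℤ) :
    ∑ x : Fin M, ψ (b + (x:ℕ)) = ∑ n ∈ II N, if b ≤ n ∧ n < b + M then ψ n else 0 := by
  rw [← Finset.sum_filter, Fin.sum_univ_eq_sum_range (fun x => ψ (b + (x:ℕ)))]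
  have e : ∑ x ∈ range M, ψ (b + (x:ℕ)) = ∑ n ∈ Ico b (b+M), ψ n := (sum_Ico_eq ψ b M).symm
  rw [e]
  symm
  apply Finset.sum_subset_zero_on_sdiff
  · intro n hn
    rw [mem_filter] at hn
    exact mem_Ico.2 hn.2
  · intro n hn
    rw [mem_sdiff, mem_filter, mem_Ico] at hn
    apply hψ
    intro h
    exact hn.2 ⟨h, hn.1⟩
  · intros; rfl

lemma ip_Fb {N : ℕ} (f g : ℤ → ℝ) (hf : ∀ n, n ∉ II N → f n = 0) (hg : ∀ n, n ∉ II N → g n = 0) (M : ℕ) (b : ℤ) :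
    ip univ (Fb f g M b) (Fb f g M b) = ∑ n ∈ II N, if b ≤ n ∧ n < b + M then (f n)^2 + (g n)^2 else 0 := by
  rw [← win (fun n => (f n)^2 + (g n)^2) (fun n hn => by simp [hf n hn, hg n hn])]
  rw [ip, Fintype.sum_prod_type, Fintype.sum_bool, ← Finset.sum_add_distrib]
  apply Finset.sum_congr rfl
  intro x _
  simp [Fb, sq]

lemma sum_pair (P : Finset ℕ) (τ : ℤ) (D M : ℕ) (b : ℤ) (p : ℕ) (f g : ℤ → ℝ) :
    ip univ (Fb f g M b) (Am P τ D M b p *ᵥ Fb f g M b) =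
      2 * ∑ x : Fin M, ∑ y : Fin M, f (b + (x:ℕ)) * Am P τ D M b p (true, x) (false, y) * g (b + (y:ℕ)) := by
  have h0 : ∀ (e : Bool) (x y : Fin M), Am P τ D M b p (e, x) (e, y) = 0 := by
    intro e x y
    unfold Am
    rw [if_neg]
    rintro ⟨h, -⟩
    cases e <;> simp at h
  have hs : ∀ x y : Fin M, Am P τ D M b p (false, x) (true, y) = Am P τ D M b p (true, y) (false, x) := by
    intro x y
    conv_lhs => rw [← Am_sym P τ D M b p]
    rfl
  simp only [ip, Matrix.mulVec, dotProduct]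
  rw [Fintype.sum_prod_type, Fintype.sum_bool]
  simp only [Fintype.sum_prod_type, Fintype.sum_bool, h0, zero_mul, Finset.sum_const_zero, zero_add, add_zero, Fb, if_true, hs,
    Bool.false_eq_true, if_false, Finset.mul_sum]
  have : ∑ x : Fin M, ∑ y : Fin M, g (b + (x:ℕ)) * (Am P τ D M b p (true, y) (false, x) * f (b + (y:ℕ))) =
    ∑ x : Fin M, ∑ y : Fin M, f (b + (x:ℕ)) * Am P τ D M b p (true, x) (false, y) * g (b + (y:ℕ)) := by
    rw [Finset.sum_comm]
    apply Finset.sum_congr rfl; intro x _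
    apply Finset.sum_congr rfl; intro y _
    ring
  rw [this]
  rw [← Finset.sum_add_distrib]
  apply Finset.sum_congr rfl; intro x _
  rw [← Finset.sum_add_distrib]
  apply Finset.sum_congr rfl; intro y _
  ring

lemma form_Fb {P : Finset ℕ} {τ : ℤ} {D N : ℕ} (f g : ℤ → ℝ) (hf : ∀ n, n ∉ II N → f n = 0)
    (hfD : ∀ n, f n ≠ 0 → hp P τ n ≤ D) (hgD : ∀ n, g n ≠ 0 → hp P τ n ≤ D) (M : ℕ) (b : ℤ) :
    ip univ (Fb f g M b) (AT P (Am P τ D M b) *ᵥ Fb f g M b) =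
      2 * ∑ n ∈ II N, ∑ p ∈ P, if b ≤ n ∧ n + p < b + M then f n * g (n+p) * al τ p n else 0 := by
  have e1 : ip univ (Fb f g M b) (AT P (Am P τ D M b) *ᵥ Fb f g M b) = ∑ p ∈ P, ip univ (Fb f g M b) (Am P τ D M b p *ᵥ Fb f g M b) := by
    rw [AT, Matrix.sum_mulVec]
    simp only [ip, Finset.sum_apply, Finset.mul_sum]
    rw [Finset.sum_comm]
  rw [e1]
  simp only [sum_pair]
  rw [← Finset.mul_sum]
  congr 1
  rw [Finset.sum_comm (s := II N)]
  apply Finset.sum_congr rfl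
  intro p _
  have hw := win (N := N) (fun n => if n + p < b + M then f n * g (n+p) * al τ p n else 0)
    (fun n hn => by simp [hf n hn]) M b
  have e2 : ∀ n ∈ II N, (if b ≤ n ∧ n + p < b + M then f n * g (n+p) * al τ p n else 0) =
      if b ≤ n ∧ n < b + M then (if n + p < b + M then f n * g (n+p) * al τ p n else 0) else 0 := by
    intro n _
    rw [← ite_and]
    congr 1
    apply propext
    constructor
    · rintro ⟨h1, h2⟩; exact ⟨⟨h1, by omega⟩, h2⟩
    · rintro ⟨⟨h1, _⟩, h2⟩; exact ⟨h1, h2⟩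
  rw [Finset.sum_congr rfl e2, ← hw]
  apply Finset.sum_congr rfl
  intro x _
  by_cases hx : b + (x:ℕ) + p < b + M
  · rw [if_pos hx]
    have hxp : (x:ℕ) + p < M := by omega
    rw [Finset.sum_eq_single (⟨(x:ℕ) + p, hxp⟩ : Fin M)]
    · unfold Am
      rw [if_pos (by simp [sg])]
      simp only
      push_cast
      rw [← add_assoc]
      by_cases h1 : f (b + (x:ℕ)) = 0
      · rw [h1]; ring
      · by_cases h2 : g (b + (x:ℕ) + p) = 0
        · rw [h2]; ring
        · rw [Yv, Yv, if_pos (hfD _ h1), if_pos (hgD _ h2)]; ring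
    · intro y _ hy
      unfold Am
      rw [if_neg]; · ring
      rintro ⟨-, h⟩
      apply hy
      ext
      simp [sg] at h
      simp only
      exact_mod_cast h
    · simp
  · rw [if_neg hx]
    apply Finset.sum_eq_zero
    intro y _
    unfold Am
    rw [if_neg]; · ring
    rintro ⟨-, h⟩
    simp [sg] at h
    have := y.2
    omega

lemma card_win (N M : ℕ) (n : ℤ) (hn : n ∈ II N) (p : ℕ) (hp : p ≤ M) :
    ((Ico ((N:ℤ)+1-M) ((N:ℤ)+1-M+(N+M : ℕ))).filter fun b => b ≤ n ∧ n + p < b + M).card = M - p := by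
  have : ((Ico ((N:ℤ)+1-M) ((N:ℤ)+1-M+(N+M : ℕ))).filter fun b => b ≤ n ∧ n + p < b + M) = Ioc (n + p - M) n := by
    ext b
    simp only [II, mem_Ioc] at hn
    simp only [mem_filter, mem_Ico, mem_Ioc]
    push_cast
    omega
  rw [this, Int.card_Ioc]
  omega

lemma hit_add {τ : ℤ} {p : ℕ} {n : ℤ} : hit τ p (n + p) ↔ hit τ p n := by
  have h1 : ((p:ℤ) ∣ n + p) ↔ (p:ℤ) ∣ n := by simp
  have h2 : ((p:ℤ) ∣ n + p + τ) ↔ (p:ℤ) ∣ n + τ := by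
    rw [show n + p + τ = n + τ + p by ring]; simp
  simp only [hit, h1, h2]

lemma abs_al_le_hit (τ : ℤ) (p : ℕ) (n : ℤ) : |al τ p n| ≤ if hit τ p n then 1 else 0 := by
  split_ifs with h
  · exact abs_al_le _ _ _
  · have : al τ p n = 0 := by by_contra h'; exact h (hit_of_al h')
    simp [this]

lemma sum_hit (P : Finset ℕ) (τ : ℤ) (n : ℤ) : ∑ p ∈ P, (if hit τ p n then (1:ℝ) else 0) = hp P τ n := by
  rw [hp, card_filter]; push_cast; rfl

lemma shift_le {N : ℕ} (ψ : ℤ → ℝ) (h0 : ∀ n, 0 ≤ ψ n) (hψ : ∀ n, n ∉ II N → ψ n = 0) (p : ℤ) :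
    ∑ n ∈ II N, ψ (n + p) ≤ ∑ n ∈ II N, ψ n := by
  have : ∑ n ∈ II N, ψ (n + p) = ∑ m ∈ (II N).image (fun n => n + p), ψ m := by
    rw [Finset.sum_image]; intro a _ b _ h; simpa using h
  rw [this, ← Finset.sum_filter_add_sum_filter_not ((II N).image (fun n => n + p)) (fun m => m ∈ II N)]
  have e : ∑ m ∈ ((II N).image (fun n => n + p)).filter (fun m => ¬ m ∈ II N), ψ m = 0 := by
    apply Finset.sum_eq_zero; intro m hm; exact hψ m (mem_filter.1 hm).2
  rw [e, add_zero]
  apply Finset.sum_le_sum_of_subset_of_nonneg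
  · intro m hm; exact (mem_filter.1 hm).2
  · intro m _ _; exact h0 m

/-- crude second moment bound -/
lemma crude_sq {P : Finset ℕ} {τ : ℤ} {N : ℕ} (f g : ℤ → ℝ) (hg : ∀ n, n ∉ II N → g n = 0) :
    (∑ n ∈ II N, ∑ p ∈ P, |f n * g (n+p) * al τ p n|)^2 ≤
      (∑ n ∈ II N, (f n)^2 * hp P τ n) * (∑ n ∈ II N, (g n)^2 * hp P τ n) := by
  set χ : ℕ → ℤ → ℝ := fun p n => if hit τ p n then 1 else 0 with hχ
  have hχ2 : ∀ p n, χ p n ^2 = χ p n := by intro p n; simp only [hχ]; split_ifs <;> simp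
  have hχ0 : ∀ p n, 0 ≤ χ p n := by intro p n; simp only [hχ]; split_ifs <;> simp
  have h1 : ∑ n ∈ II N, ∑ p ∈ P, |f n * g (n+p) * al τ p n| ≤ ∑ z ∈ II N ×ˢ P, (|f z.1| * χ z.2 z.1) * (|g (z.1+z.2)| * χ z.2 z.1) := by
    rw [Finset.sum_product]
    apply Finset.sum_le_sum; intro n _
    apply Finset.sum_le_sum; intro p _
    rw [abs_mul, abs_mul]
    have := abs_al_le_hit τ p n
    calc |f n| * |g (n+p)| * |al τ p n| ≤ |f n| * |g (n+p)| * χ p n := by gcongr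
      _ = _ := by have := hχ2 p n; simp only; linear_combination (-(|f n| * |g (n+p)|)) * this
  have h2 := Finset.sum_mul_sq_le_sq_mul_sq (II N ×ˢ P) (fun z => |f z.1| * χ z.2 z.1) (fun z => |g (z.1+z.2)| * χ z.2 z.1)
  have h0 : 0 ≤ ∑ n ∈ II N, ∑ p ∈ P, |f n * g (n+p) * al τ p n| :=
    Finset.sum_nonneg fun n _ => Finset.sum_nonneg fun p _ => abs_nonneg _
  refine (pow_le_pow_left₀ h0 h1 2).trans (h2.trans ?_)
  have e1 : ∑ z ∈ II N ×ˢ P, (|f z.1| * χ z.2 z.1)^2 = ∑ n ∈ II N, (f n)^2 * hp P τ n := by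
    rw [Finset.sum_product]
    apply Finset.sum_congr rfl; intro n _
    rw [← sum_hit, Finset.mul_sum]
    apply Finset.sum_congr rfl; intro p _
    rw [mul_pow, sq_abs, hχ2]
  have e2 : ∑ z ∈ II N ×ˢ P, (|g (z.1+z.2)| * χ z.2 z.1)^2 ≤ ∑ n ∈ II N, (g n)^2 * hp P τ n := by
    rw [Finset.sum_product_right]
    have : ∀ p ∈ P, ∑ n ∈ II N, (|g (n+p)| * χ p n)^2 ≤ ∑ n ∈ II N, (g n)^2 * χ p n := by
      intro p _
      refine le_trans (le_of_eq ?_) (shift_le (fun n => (g n)^2 * χ p n) (fun n => mul_nonneg (sq_nonneg _) (hχ0 _ _))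
        (fun n hn => by simp [hg n hn]) p)
      apply Finset.sum_congr rfl; intro n _
      have : χ p (n+p) = χ p n := by simp only [hχ, hit_add]
      simp only [mul_pow, sq_abs, hχ2, this]
    refine (Finset.sum_le_sum this).trans (le_of_eq ?_)
    rw [Finset.sum_comm]
    apply Finset.sum_congr rfl; intro n _
    rw [← sum_hit, Finset.mul_sum]
  rw [e1]
  exact mul_le_mul_of_nonneg_left e2 (Finset.sum_nonneg fun n _ => by positivity)

theorem window_bound {P : Finset ℕ} {τ : ℤ} {D N M Hn : ℕ} (hM : Hn ≤ M) (hD : 1 ≤ D) (hPH : ∀ p ∈ P, p ≤ Hn) (f g : ℤ → ℝ)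
    (hf : ∀ n, n ∉ II N → f n = 0) (hg : ∀ n, n ∉ II N → g n = 0)
    (hfD : ∀ n, f n ≠ 0 → hp P τ n ≤ D) (hgD : ∀ n, g n ≠ 0 → hp P τ n ≤ D)
    (hf2 : ∑ n ∈ II N, (f n)^2 ≤ N) (hg2 : ∑ n ∈ II N, (g n)^2 ≤ N) {K4 : ℝ} 
    (hf4 : ∑ n ∈ II N, (f n)^4 ≤ N * K4) (hg4 : ∑ n ∈ II N, (g n)^4 ≤ N * K4)
    (Gc : ℝ) (hGc : 0 ≤ Gc) (bad : Finset ℤ)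
    (hgood : ∀ b ∈ Ico ((N:ℤ)+1-M) ((N:ℤ)+1-M+(N+M : ℕ)), b ∉ bad → |ip univ (Fb f g M b) (AT P (Am P τ D M b) *ᵥ Fb f g M b)| ≤
      Gc * ip univ (Fb f g M b) (Fb f g M b)) :
    M * |St P τ N f g| ≤ Gc * M * N + D * M * Real.sqrt (N * K4) * Real.sqrt bad.card + Hn * (D * N) := by
  set BB := Ico ((N:ℤ)+1-M) ((N:ℤ)+1-M+(N+M : ℕ)) with hBB
  set φ : ℤ → ℕ → ℝ := fun n p => f n * g (n+p) * al τ p n with hφ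
  have hD' : (1:ℝ) ≤ D := by exact_mod_cast hD
  -- crude
  have hcr : ∑ n ∈ II N, ∑ p ∈ P, |φ n p| ≤ D * N := by
    apply le_of_sq_le_sq _ (by positivity)
    refine (crude_sq f g hg).trans ?_
    have aux : ∀ f : ℤ → ℝ, (∀ n, f n ≠ 0 → hp P τ n ≤ D) → ∑ n ∈ II N, (f n)^2 ≤ N → ∑ n ∈ II N, (f n)^2 * hp P τ n ≤ D * N := by
      intro f hfD hf2
      calc ∑ n ∈ II N, (f n)^2 * hp P τ n ≤ ∑ n ∈ II N, (f n)^2 * D := by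
            apply Finset.sum_le_sum; intro n _
            by_cases h : f n = 0
            · simp [h]
            · have : (hp P τ n : ℝ) ≤ D := by exact_mod_cast hfD n h
              exact mul_le_mul_of_nonneg_left this (sq_nonneg _)
        _ = (∑ n ∈ II N, (f n)^2) * D := by rw [Finset.sum_mul]
        _ ≤ N * D := by gcongr
        _ = _ := mul_comm _ _
    rw [sq]
    exact mul_le_mul (aux f hfD hf2) (aux g hgD hg2) (Finset.sum_nonneg fun n _ => by positivity) (by positivity)
  -- sum over windows
  have hsum : ∑ b ∈ BB, ip univ (Fb f g M b) (AT P (Am P τ D M b) *ᵥ Fb f g M b) = 2 * ∑ n ∈ II N, ∑ p ∈ P, ((M:ℝ) - p) * φ n p := by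
    simp only [form_Fb f g hf hfD hgD]
    rw [← Finset.mul_sum, Finset.sum_comm]
    congr 1
    apply Finset.sum_congr rfl; intro n hn
    rw [Finset.sum_comm]
    apply Finset.sum_congr rfl; intro p hp
    rw [← Finset.sum_filter, Finset.sum_const, nsmul_eq_mul]
    have hpM : p ≤ M := (hPH p hp).trans hM
    have := card_win N M n hn p hpM
    rw [hBB, this, Nat.cast_sub hpM]
  have hexp : ∑ n ∈ II N, ∑ p ∈ P, ((M:ℝ) - p) * φ n p = M * St P τ N f g - ∑ n ∈ II N, ∑ p ∈ P, (p:ℝ) * φ n p := by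
    rw [St, Finset.mul_sum, ← Finset.sum_sub_distrib]
    apply Finset.sum_congr rfl; intro n _
    rw [Finset.mul_sum, ← Finset.sum_sub_distrib]
    apply Finset.sum_congr rfl; intro p _
    simp only [hφ]; ring
  have herr : |∑ n ∈ II N, ∑ p ∈ P, (p:ℝ) * φ n p| ≤ Hn * (D * N) := by
    refine (Finset.abs_sum_le_sum_abs _ _).trans ?_
    refine le_trans ?_ (mul_le_mul_of_nonneg_left hcr (by positivity))
    rw [Finset.mul_sum]
    apply Finset.sum_le_sum; intro n _
    refine (Finset.abs_sum_le_sum_abs _ _).trans ?_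
    rw [Finset.mul_sum]
    apply Finset.sum_le_sum; intro p hp
    rw [abs_mul, abs_of_nonneg (by positivity : (0:ℝ) ≤ p)]
    have : (p:ℝ) ≤ Hn := by exact_mod_cast hPH p hp
    gcongr
  -- window norm sums
  set nn : ℤ → ℝ := fun b => ip univ (Fb f g M b) (Fb f g M b) with hnn
  have hnn0 : ∀ b, 0 ≤ nn b := fun b => ip_self_nonneg _ _
  have hall : ∀ b, |ip univ (Fb f g M b) (AT P (Am P τ D M b) *ᵥ Fb f g M b)| ≤ D * nn b := by
    intro b
    apply abs_le_of_sq_le_sq _ (mul_nonneg (by positivity) (hnn0 b))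
    refine (ip_cs _ _ _).trans ?_
    have := mul_le_mul_of_nonneg_left ((Am_sys P τ D M b hD).norm_A (Fb f g M b)) (hnn0 b)
    refine this.trans (le_of_eq ?_)
    simp only [hnn]; ring
  have hT1 : ∑ b ∈ BB, nn b ≤ 2 * (M * N) := by
    simp only [hnn, ip_Fb f g hf hg]
    rw [Finset.sum_comm]
    have : ∀ n ∈ II N, ∑ b ∈ BB, (if b ≤ n ∧ n < b + M then (f n)^2 + (g n)^2 else 0) = M * ((f n)^2 + (g n)^2) := by
      intro n hn
      rw [← Finset.sum_filter, Finset.sum_const, nsmul_eq_mul]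
      have := card_win N M n hn 0 (by omega)
      simp only [Nat.cast_zero, add_zero, Nat.sub_zero] at this
      rw [this]
    rw [Finset.sum_congr rfl this, ← Finset.mul_sum, Finset.sum_add_distrib]
    have : (0:ℝ) ≤ M := by positivity
    nlinarith
  have hT2 : ∑ b ∈ BB.filter (· ∈ bad), nn b ≤ 2 * (M * Real.sqrt (N * K4) * Real.sqrt bad.card) := by
    simp only [hnn, ip_Fb f g hf hg]
    rw [Finset.sum_comm]
    set ρ : ℤ → ℝ := fun n => (((BB.filter (· ∈ bad)).filter fun b => b ≤ n ∧ n < b + M).card : ℝ) with hρ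
    have e : ∀ n ∈ II N, ∑ b ∈ BB.filter (· ∈ bad), (if b ≤ n ∧ n < b + M then (f n)^2 + (g n)^2 else 0) = (f n)^2 * ρ n + (g n)^2 * ρ n := by
      intro n hn
      rw [← Finset.sum_filter, Finset.sum_const, nsmul_eq_mul]
      simp only [hρ]; ring
    rw [Finset.sum_congr rfl e, Finset.sum_add_distrib]
    have hρM : ∀ n, ρ n ≤ M := by
      intro n
      have : ((BB.filter (· ∈ bad)).filter fun b => b ≤ n ∧ n < b + M).card ≤ (Ioc (n - M) n).card := by
        apply card_le_card
        intro b hb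
        rw [mem_filter] at hb
        rw [mem_Ioc]; omega
      rw [Int.card_Ioc] at this
      have h2 : ((BB.filter (· ∈ bad)).filter fun b => b ≤ n ∧ n < b + M).card ≤ M := by omega
      simp only [hρ]; exact_mod_cast h2
    have hρ0 : ∀ n, 0 ≤ ρ n := fun n => by simp only [hρ]; positivity
    have hρs : ∑ n ∈ II N, ρ n ≤ M * bad.card := by
      have : ∑ n ∈ II N, ρ n = ∑ b ∈ BB.filter (· ∈ bad), (((II N).filter fun n => b ≤ n ∧ n < b + M).card : ℝ) := by
        simp only [hρ, card_filter]
        push_cast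
        rw [Finset.sum_comm]
      rw [this]
      have h3 : ∀ b ∈ BB.filter (· ∈ bad), (((II N).filter fun n => b ≤ n ∧ n < b + M).card : ℝ) ≤ M := by
        intro b _
        have : ((II N).filter fun n => b ≤ n ∧ n < b + M).card ≤ (Ico b (b+M)).card := by
          apply card_le_card; intro n hn; rw [mem_filter] at hn; exact mem_Ico.2 hn.2
        rw [Int.card_Ico] at this
        have : ((II N).filter fun n => b ≤ n ∧ n < b + M).card ≤ M := by omega
        exact_mod_cast this
      refine (Finset.sum_le_sum h3).trans ?_
      rw [Finset.sum_const, nsmul_eq_mul, mul_comm]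
      have : (BB.filter (· ∈ bad)).card ≤ bad.card := card_le_card (by intro b hb; exact (mem_filter.1 hb).2)
      have : ((BB.filter (· ∈ bad)).card : ℝ) ≤ bad.card := by exact_mod_cast this
      gcongr
    have hρ2 : ∑ n ∈ II N, (ρ n)^2 ≤ M^2 * bad.card := by
      calc ∑ n ∈ II N, (ρ n)^2 ≤ ∑ n ∈ II N, M * ρ n := by
            apply Finset.sum_le_sum; intro n _; rw [sq]; exact mul_le_mul_of_nonneg_right (hρM n) (hρ0 n)
        _ ≤ M * (M * bad.card) := by rw [← Finset.mul_sum]; gcongr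
        _ = _ := by ring
    have aux : ∀ f : ℤ → ℝ, ∑ n ∈ II N, (f n)^4 ≤ N * K4 → ∑ n ∈ II N, (f n)^2 * ρ n ≤ M * Real.sqrt (N * K4) * Real.sqrt bad.card := by
      intro f hf4
      have hnk : 0 ≤ N * K4 := le_trans (Finset.sum_nonneg fun n _ => by positivity) hf4
      apply le_of_sq_le_sq _ (by positivity)
      refine (Finset.sum_mul_sq_le_sq_mul_sq _ _ _).trans ?_
      have e1 : ∑ n ∈ II N, ((f n)^2)^2 = ∑ n ∈ II N, (f n)^4 := by
        apply Finset.sum_congr rfl; intro n _; ring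
      rw [e1, mul_pow, mul_pow, Real.sq_sqrt hnk, Real.sq_sqrt (by positivity)]
      calc _ ≤ (N * K4) * (M^2 * bad.card) := by
            apply mul_le_mul hf4 hρ2 (Finset.sum_nonneg fun n _ => by positivity) hnk
        _ = _ := by ring
    linarith [aux f hf4, aux g hg4]
  have htot : ∑ b ∈ BB, |ip univ (Fb f g M b) (AT P (Am P τ D M b) *ᵥ Fb f g M b)| ≤
      Gc * (2 * (M * N)) + D * (2 * (M * Real.sqrt (N * K4) * Real.sqrt bad.card)) := by
    calc _ ≤ ∑ b ∈ BB, (Gc * nn b + (if b ∈ bad then D * nn b else 0)) := by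
          apply Finset.sum_le_sum; intro b hb
          split_ifs with hbad
          · have := hall b
            have := mul_nonneg hGc (hnn0 b)
            linarith
          · rw [add_zero]; exact hgood b hb hbad
      _ = Gc * ∑ b ∈ BB, nn b + D * ∑ b ∈ BB.filter (· ∈ bad), nn b := by
          rw [Finset.sum_add_distrib, ← Finset.mul_sum, ← Finset.sum_filter, ← Finset.mul_sum]
      _ ≤ _ := by gcongr
  have h9 : |2 * (M * St P τ N f g - ∑ n ∈ II N, ∑ p ∈ P, (p:ℝ) * φ n p)| ≤ Gc * (2 * (M * N)) + D * (2 * (M * Real.sqrt (N * K4) * Real.sqrt bad.card)) := by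
    rw [← hexp, ← hsum]
    exact (Finset.abs_sum_le_sum_abs _ _).trans htot
  rw [abs_mul, abs_two] at h9
  have h10 : |M * St P τ N f g| ≤ |M * St P τ N f g - ∑ n ∈ II N, ∑ p ∈ P, (p:ℝ) * φ n p| + |∑ n ∈ II N, ∑ p ∈ P, (p:ℝ) * φ n p| := by
    have := abs_add_le (M * St P τ N f g - ∑ n ∈ II N, ∑ p ∈ P, (p:ℝ) * φ n p) (∑ n ∈ II N, ∑ p ∈ P, (p:ℝ) * φ n p)
    simpa using this
  rw [abs_mul, abs_of_nonneg (by positivity : (0:ℝ) ≤ M)] at h10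
  nlinarith
end MC


namespace MC
open Finset Classical Matrix

lemma II_eq (N : ℕ) : II N = Ico ((N:ℤ)+1) ((N:ℤ)+1+N) := by
  ext n; simp only [II, mem_Ioc, mem_Ico]; omega

lemma sq_le_choose (J : ℕ) (hJ : 2 ≤ J) (h : ℕ) (hh : J ≤ h) : h^2 ≤ J^2 * h.choose J := by
  induction h, hh using Nat.le_induction with
  | base => simp
  | succ h hh ih =>
    have h2 : (h+1).choose J * (h + 1 - J) = (h+1) * h.choose J := by
      have := Nat.choose_mul_succ_eq h J
      rw [← this]; ring
    obtain ⟨k, hk⟩ := Nat.exists_eq_add_of_le hh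
    have h3 : h + 1 - J = k + 1 := by omega
    rw [h3] at h2
    have h5 : (h+1)*(k+1) ≤ h^2 := by
      have : k + 2 ≤ h := by omega
      nlinarith
    have h6 : (h+1)^2 * (k+1) ≤ J^2 * (h+1).choose J * (k+1) := by
      calc (h+1)^2 * (k+1) = (h+1) * ((h+1)*(k+1)) := by ring
        _ ≤ (h+1) * h^2 := Nat.mul_le_mul_left _ h5
        _ ≤ (h+1) * (J^2 * h.choose J) := Nat.mul_le_mul_left _ ih
        _ = J^2 * ((h+1) * h.choose J) := by ring
        _ = J^2 * (h+1).choose J * (k+1) := by rw [← h2]; ring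
    exact Nat.le_of_mul_le_mul_right h6 (by omega)

lemma prod_le_pow_card' {Hn : ℕ} (U : Finset ℕ) (h : ∀ p ∈ U, p ≤ Hn) : ∏ p ∈ U, p ≤ Hn ^ U.card :=
  Finset.prod_le_pow_card _ _ _ h

lemma moment {P : Finset ℕ} {τ : ℤ} {N Hn J : ℕ} (hPH : ∀ p ∈ P, p ≤ Hn) (hPp : ∀ p ∈ P, p.Prime) {L : ℝ} (hL0 : 0 < L)
    (hL : ∑ p ∈ P, 1 / (p : ℝ) ≤ L) (hJ : 0 < J) (hN : Hn^J ≤ N) :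
    ∑ n ∈ II N, ((hp P τ n).choose J : ℝ) ≤ 2 * N * (Real.exp 1 * (2 * L) / J)^J := by
  have e1 : ∀ n, ((hp P τ n).choose J : ℝ) = ∑ U ∈ P.powersetCard J, if ∀ p ∈ U, hit τ p n then (1:ℝ) else 0 := by
    intro n
    rw [hp, ← card_powersetCard, ← Finset.sum_filter, Finset.sum_const, nsmul_eq_mul, mul_one]
    congr 2
    ext U
    simp only [mem_powersetCard, mem_filter, Finset.subset_iff]
    constructor
    · rintro ⟨h1, h2⟩; exact ⟨⟨fun x hx => (h1 hx).1, h2⟩, fun x hx => (h1 hx).2⟩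
    · rintro ⟨⟨h1, h2⟩, h3⟩; exact ⟨fun x hx => ⟨h1 hx, h3 x hx⟩, h2⟩
  simp only [e1]
  rw [Finset.sum_comm]
  have e2 : ∀ U ∈ P.powersetCard J, ∑ n ∈ II N, (if ∀ p ∈ U, hit τ p n then (1:ℝ) else 0) ≤ 2 * N * ∏ p ∈ U, (2 * (1 / (p:ℝ))) := by
    intro U hU
    rw [mem_powersetCard] at hU
    have := count_hits P hPp τ 0 (fun _ => 0) (fun _ => 0) (by simp) ((N:ℤ)+1) N U (by simpa using hU.1) (by
      simp only [range_zero, image_empty, empty_union]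
      refine (prod_le_pow_card' U (fun p hp => hPH p (hU.1 hp))).trans ?_
      rw [hU.2]; exact hN)
    rw [← Finset.sum_filter, Finset.sum_const, nsmul_eq_mul, mul_one, II_eq]
    have e3 : (filter (fun n => ∀ p ∈ U, hit τ p n) (Ico ((N:ℤ)+1) ((N:ℤ)+1+N))) = ((Ico ((N:ℤ)+1) ((N:ℤ)+1+N)).filter fun b => (∀ i, i < 0 → al τ ((fun _ => 0) i) (b + posn (fun _ => 0) (fun _ => 0) i) ≠ 0) ∧
      ∀ l ∈ U, ∃ v ∈ range (0+1), hit τ l (b + posn (fun _ => 0) (fun _ => 0) v)) := by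
      apply Finset.filter_congr
      intro b _
      simp [posn]
    rw [e3]
    refine this.trans (le_of_eq ?_)
    have ew : wt 0 (fun _ => 0) = 1 := by simp [wt]
    rw [ew, mul_one]
    congr 1
    apply Finset.prod_congr rfl; intro p _; push_cast; ring
  refine (Finset.sum_le_sum e2).trans ?_
  rw [← Finset.mul_sum]
  apply mul_le_mul_of_nonneg_left _ (by positivity)
  apply esymm_le P (fun p => 2 * (1 / (p:ℝ))) (fun i _ => by positivity) (by positivity) _ hJ
  rw [← Finset.mul_sum]; linarith

lemma tail_sq {P : Finset ℕ} {τ : ℤ} {N Hn J : ℕ} (hPH : ∀ p ∈ P, p ≤ Hn) (hPp : ∀ p ∈ P, p.Prime) {L : ℝ} (hL0 : 0 < L)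
    (hL : ∑ p ∈ P, 1 / (p : ℝ) ≤ L) (hJ : 2 ≤ J) (hN : Hn^J ≤ N) :
    ∑ n ∈ II N, (if J ≤ hp P τ n then (hp P τ n : ℝ)^2 else 0) ≤ J^2 * (2 * N * (Real.exp 1 * (2 * L) / J)^J) := by
  refine le_trans ?_ (mul_le_mul_of_nonneg_left (moment (τ := τ) hPH hPp hL0 hL (by omega) hN) (by positivity))
  rw [Finset.mul_sum]
  apply Finset.sum_le_sum; intro n _
  split_ifs with h
  · exact_mod_cast sq_le_choose J hJ _ h
  · positivity

lemma second_moment {P : Finset ℕ} {τ : ℤ} {N Hn : ℕ} (hH : 1 ≤ Hn) (hPH : ∀ p ∈ P, p ≤ Hn) (hPp : ∀ p ∈ P, p.Prime) {L : ℝ} (hL1 : 1 ≤ L)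
    (hL : ∑ p ∈ P, 1 / (p : ℝ) ≤ L) (hN : Hn^2 ≤ N) :
    ∑ n ∈ II N, (hp P τ n : ℝ)^2 ≤ 50 * L^2 * N := by
  have hN1 : Hn^1 ≤ N := by rw [pow_one]; nlinarith
  have m1 := moment (τ := τ) hPH hPp (by linarith) hL (J := 1) (by omega) hN1
  have m2 := moment (τ := τ) hPH hPp (by linarith) hL (J := 2) (by omega) hN
  have e : ∀ n, (hp P τ n : ℝ)^2 = 2 * ((hp P τ n).choose 2 : ℝ) + ((hp P τ n).choose 1 : ℝ) := by
    intro n; rw [Nat.cast_choose_two, Nat.choose_one_right]; ring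
  simp only [e]
  rw [Finset.sum_add_distrib, ← Finset.mul_sum]
  have he := Real.exp_one_lt_d9
  have he0 := Real.exp_pos 1
  have hN0 : (0:ℝ) ≤ N := by positivity
  simp only [Nat.cast_one, Nat.cast_ofNat, pow_one, div_one] at m1 m2
  have h1 : Real.exp 1 * (2*L) ≤ 5.5 * L^2 := by nlinarith
  have h2 : (Real.exp 1 * (2*L)/2)^2 ≤ 7.5 * L^2 := by
    have : (Real.exp 1)^2 ≤ 7.5 := by nlinarith
    have h3 : (Real.exp 1 * (2*L)/2)^2 = (Real.exp 1)^2 * L^2 := by ring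
    rw [h3]; gcongr
  have h4 := mul_le_mul_of_nonneg_left h1 hN0
  have h5 := mul_le_mul_of_nonneg_left h2 hN0
  have : 0 ≤ N * L^2 := by positivity
  nlinarith

/-- Cauchy-Schwarz with the fourth moment -/
lemma cs4 {N : ℕ} (u ρ : ℤ → ℝ) {K E : ℝ} (h4 : ∑ n ∈ II N, (u n)^4 ≤ K) (hρ : ∑ n ∈ II N, (ρ n)^2 ≤ E) :
    ∑ n ∈ II N, (u n)^2 * ρ n ≤ Real.sqrt (K * E) := by
  apply Real.le_sqrt_of_sq_le
  refine (Finset.sum_mul_sq_le_sq_mul_sq _ _ _).trans ?_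
  have e1 : ∑ n ∈ II N, ((u n)^2)^2 = ∑ n ∈ II N, (u n)^4 := by
    apply Finset.sum_congr rfl; intro n _; ring
  rw [e1]
  have h0 : 0 ≤ ∑ n ∈ II N, (u n)^4 := Finset.sum_nonneg fun n _ => by positivity
  exact mul_le_mul h4 hρ (Finset.sum_nonneg fun n _ => by positivity) (h0.trans h4)

/-- `u` supported on `bad` -/
lemma St_crude {P : Finset ℕ} {τ : ℤ} {N : ℕ} (u g : ℤ → ℝ) (hg : ∀ n, n ∉ II N → g n = 0) {K : ℝ}
    (hu4 : ∑ n ∈ II N, (u n)^4 ≤ K) (hg4 : ∑ n ∈ II N, (g n)^4 ≤ K) {bu bg : ℤ → Prop} (hbu : ∀ n, u n ≠ 0 → bu n)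
    (hbg : ∀ n, g n ≠ 0 → bg n) {E1 E2 : ℝ}
    (h1 : ∑ n ∈ II N, (if bu n then (hp P τ n : ℝ)^2 else 0) ≤ E1) (h2 : ∑ n ∈ II N, (if bg n then (hp P τ n : ℝ)^2 else 0) ≤ E2) :
    |St P τ N u g|^2 ≤ Real.sqrt (K * E1) * Real.sqrt (K * E2) := by
  have aux : ∀ (u : ℤ → ℝ) (bu : ℤ → Prop) (E1 : ℝ), ∑ n ∈ II N, (u n)^4 ≤ K → (∀ n, u n ≠ 0 → bu n) →
      ∑ n ∈ II N, (if bu n then (hp P τ n : ℝ)^2 else 0) ≤ E1 → ∑ n ∈ II N, (u n)^2 * hp P τ n ≤ Real.sqrt (K * E1) := by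
    intro u bu E1 hu4 hbu h1
    have : ∑ n ∈ II N, (u n)^2 * hp P τ n = ∑ n ∈ II N, (u n)^2 * (if bu n then (hp P τ n : ℝ) else 0) := by
      apply Finset.sum_congr rfl; intro n _
      by_cases h : u n = 0
      · simp [h]
      · rw [if_pos (hbu n h)]
    rw [this]
    apply cs4 u _ hu4
    refine le_trans (le_of_eq ?_) h1
    apply Finset.sum_congr rfl; intro n _
    split_ifs <;> simp
  have h3 : |St P τ N u g| ≤ ∑ n ∈ II N, ∑ p ∈ P, |u n * g (n+p) * al τ p n| := by
    refine (Finset.abs_sum_le_sum_abs _ _).trans ?_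
    exact Finset.sum_le_sum fun n _ => Finset.abs_sum_le_sum_abs _ _
  refine (pow_le_pow_left₀ (abs_nonneg _) h3 2).trans ((crude_sq u g hg).trans ?_)
  exact mul_le_mul (aux u bu E1 hu4 hbu h1) (aux g bg E2 hg4 hbg h2) (Finset.sum_nonneg fun n _ => by positivity) (Real.sqrt_nonneg _)

lemma St_sub_left (P : Finset ℕ) (τ : ℤ) (N : ℕ) (f f' g : ℤ → ℝ) : St P τ N (fun n => f n - f' n) g = St P τ N f g - St P τ N f' g := by
  simp only [St, ← Finset.sum_sub_distrib]
  apply Finset.sum_congr rfl; intro n _; apply Finset.sum_congr rfl; intro p _; ring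

lemma St_sub_right (P : Finset ℕ) (τ : ℤ) (N : ℕ) (f g g' : ℤ → ℝ) : St P τ N f (fun n => g n - g' n) = St P τ N f g - St P τ N f g' := by
  simp only [St, ← Finset.sum_sub_distrib]
  apply Finset.sum_congr rfl; intro n _; apply Finset.sum_congr rfl; intro p _; ring

/-- replacing f, g by their restrictions to a set of good integers -/
lemma St_restrict {P : Finset ℕ} {τ : ℤ} {N : ℕ} (f g : ℤ → ℝ) (hg : ∀ n, n ∉ II N → g n = 0) {K : ℝ}
    (hf4 : ∑ n ∈ II N, (f n)^4 ≤ K) (hg4 : ∑ n ∈ II N, (g n)^4 ≤ K) (gd bd : ℤ → Prop) (hbd : ∀ n, bd n ↔ ¬ gd n) {E1 E2 : ℝ}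
    (h1 : ∑ n ∈ II N, (if bd n then (hp P τ n : ℝ)^2 else 0) ≤ E1) (h2 : ∑ n ∈ II N, (hp P τ n : ℝ)^2 ≤ E2) :
    |St P τ N f g| ≤ |St P τ N (fun n => if gd n then f n else 0) (fun n => if gd n then g n else 0)| +
      2 * Real.sqrt (Real.sqrt (K * E1) * Real.sqrt (K * E2)) := by
  set f' : ℤ → ℝ := fun n => if gd n then f n else 0 with hf'
  set g' : ℤ → ℝ := fun n => if gd n then g n else 0 with hg'
  have q4 : ∀ (f : ℤ → ℝ), ∑ n ∈ II N, (f n)^4 ≤ K → ∀ b : ℤ → Prop, ∑ n ∈ II N, (if b n then f n else 0)^4 ≤ K := by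
    intro f hf b
    refine le_trans (Finset.sum_le_sum fun n _ => ?_) hf
    by_cases hb : b n
    · rw [if_pos hb]
    · rw [if_neg hb, zero_pow (by norm_num)]; positivity
  have ef : ∀ f : ℤ → ℝ, (fun n => f n - (if gd n then f n else 0)) = fun n => if bd n then f n else 0 := by
    intro f; funext n; have := hbd n; by_cases h : gd n <;> simp [h, this]
  have h2' : ∑ n ∈ II N, (if (fun _ : ℤ => True) n then (hp P τ n : ℝ)^2 else 0) ≤ E2 := by simpa using h2
  have a1 : |St P τ N (fun n => f n - f' n) g|^2 ≤ Real.sqrt (K * E1) * Real.sqrt (K * E2) := by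
    have e' : (fun n => f n - f' n) = fun n => if bd n then f n else 0 := ef f
    rw [e']
    exact St_crude (fun n => if bd n then f n else 0) g hg (q4 f hf4 _) hg4 (bu := bd) (bg := fun _ => True) (by intro n hn; by_contra h; rw [if_neg h] at hn; exact hn rfl) (by simp) h1 (by simpa using h2)
  have a2 : |St P τ N f' (fun n => g n - g' n)|^2 ≤ Real.sqrt (K * E1) * Real.sqrt (K * E2) := by
    have e' : (fun n => g n - g' n) = fun n => if bd n then g n else 0 := ef g
    rw [e', mul_comm]
    exact St_crude f' (fun n => if bd n then g n else 0) (by intro n hn; simp [hg n hn]) (q4 f hf4 _) (q4 g hg4 _) (bu := fun _ => True) (bg := bd)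
      (by simp) (by intro n hn; by_contra h; rw [if_neg h] at hn; exact hn rfl) (by simpa using h2) h1
  have b1 := Real.le_sqrt_of_sq_le a1
  have b2 := Real.le_sqrt_of_sq_le a2
  rw [St_sub_left] at b1
  rw [St_sub_right] at b2
  have c1 := abs_add_le (St P τ N f g - St P τ N f' g) ((St P τ N f' g - St P τ N f' g') + St P τ N f' g')
  have c2 := abs_add_le (St P τ N f' g - St P τ N f' g') (St P τ N f' g')
  have e : St P τ N f g - St P τ N f' g + (St P τ N f' g - St P τ N f' g' + St P τ N f' g') = St P τ N f g := by ring
  rw [e] at c1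
  linarith
end MC


namespace MC
open Finset Classical Matrix

lemma trace_even_nonneg {ι : Type*} [Fintype ι] [DecidableEq ι] (S : Matrix ι ι ℝ) (hS : Sᵀ = S) (e : ℕ) (he : 1 ≤ e) :
    0 ≤ trace (S^(2^e)) := by
  obtain ⟨k, rfl⟩ : ∃ k, e = k + 1 := ⟨e - 1, by omega⟩
  have h1 : S^(2^(k+1)) = (S^(2^k))ᵀ * S^(2^k) := by
    rw [Matrix.transpose_pow, hS, ← pow_add]
    congr 1; rw [pow_succ]; ring
  rw [h1, Matrix.trace]
  apply Finset.sum_nonneg; intro i _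
  rw [Matrix.diag_apply, Matrix.mul_apply]
  apply Finset.sum_nonneg; intro k _
  rw [Matrix.transpose_apply]
  exact mul_self_nonneg _

theorem good_b {P : Finset ℕ} {τ : ℤ} {D M : ℕ} {b : ℤ} (hD : 1 ≤ D) (f g : ℤ → ℝ) {B G Gc : ℝ} (hB1 : 1 ≤ B) (hG : 1 ≤ G)
    (hG3 : 2 ≤ G^2) (hG2 : (D:ℝ) ≤ G^2) (a R0 : ℕ) (hB0 : (2*(D:ℝ))^R0 ≤ B)
    (hf : ∀ n, f n ≠ 0 → nice P τ D (2^a) n) (hg : ∀ n, g n ≠ 0 → nice P τ D (2^a) n) (qe : ℕ → ℕ) (hqe : ∀ j, R0 < j → j ≤ 2^a → 1 ≤ qe j)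
    (htr : ∀ j, R0 < j → j ≤ 2^a → trace ((Zm P (Am P τ D M b) j)^(2^(qe j))) ≤ (G^j)^(2^(qe j)))
    (hGc0 : 0 ≤ Gc) (hGc : 2 * B * (2*G)^(2^a) ≤ Gc^(2^a)) :
    |ip univ (Fb f g M b) (AT P (Am P τ D M b) *ᵥ Fb f g M b)| ≤ Gc * ip univ (Fb f g M b) (Fb f g M b) := by
  set F := Fb f g M b with hF
  have hFF := ip_self_nonneg univ F
  have hN : ∀ j ≤ 2^a, ∀ l ∈ nbW P j, ¬ l.Nodup → ∀ x, F x ≠ 0 → ∀ y, (l.map (Am P τ D M b)).prod x y = 0 := by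
    intro j hj l hl hnd x hx y
    obtain ⟨χ, -, h⟩ := entry P τ D M l x y
    rw [h b]
    have hn : nice P τ D (2^a) (b + (x.2:ℕ)) := by
      rw [hF, Fb] at hx
      split_ifs at hx
      · exact hf _ hx
      · exact hg _ hx
    rw [hn.2 x.1 j hj l hl hnd, mul_zero]
  have hZ : ∀ j, R0 < j → j ≤ 2^a → |ip univ F (Zm P (Am P τ D M b) j *ᵥ F)| ≤ G^j * ip univ F F := by
    intro j hj1 hj2
    have h1 := trace_cs (Zm P (Am P τ D M b) j) (Zm_symm P _ (fun p _ => Am_sym P τ D M b p) j) F (qe j) (hqe j hj1 hj2)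
    have h2 := h1.trans (mul_le_mul_of_nonneg_left (htr j hj1 hj2) (pow_nonneg hFF _))
    rw [← mul_pow, mul_comm] at h2
    have hG0 : 0 ≤ G^j := by positivity
    exact (pow_le_pow_iff_left₀ (abs_nonneg _) (mul_nonneg hG0 hFF) (by positivity)).1 h2
  have := (Am_sys P τ D M b hD).spectral F (by linarith) hG hG3 hG2 a R0 hB0 hB1 hN hZ
  have h2 := this.trans (mul_le_mul_of_nonneg_left hGc (pow_nonneg hFF _))
  rw [← mul_pow, mul_comm] at h2
  exact (pow_le_pow_iff_left₀ (abs_nonneg _) (mul_nonneg hGc0 hFF) (by positivity)).1 h2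

/-- Markov: few bad windows. -/
theorem bad_exists {P : Finset ℕ} {τ : ℤ} {D M T : ℕ} {X : ℤ} {G : ℝ} (hG : 1 ≤ G) (a R0 : ℕ) (qe : ℕ → ℕ)
    (hqe : ∀ j, R0 < j → j ≤ 2^a → 1 ≤ qe j) {E : ℝ} (hE : 0 ≤ E)
    (htr : ∀ j, R0 < j → j ≤ 2^a → ∑ b ∈ Ico X (X+T), trace ((Zm P (Am P τ D M b) j)^(2^(qe j))) ≤ E * (G^j)^(2^(qe j))) :
    ∃ bad : Finset ℤ, (bad.card : ℝ) ≤ 2^a * E ∧ ∀ b ∈ Ico X (X+T), b ∉ bad → ∀ j, R0 < j → j ≤ 2^a →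
      trace ((Zm P (Am P τ D M b) j)^(2^(qe j))) ≤ (G^j)^(2^(qe j)) := by
  set bj : ℕ → Finset ℤ := fun j => (Ico X (X+T)).filter fun b => (G^j)^(2^(qe j)) < trace ((Zm P (Am P τ D M b) j)^(2^(qe j))) with hbj
  refine ⟨(Ioc R0 (2^a)).biUnion bj, ?_, ?_⟩
  · have h1 : ((Ioc R0 (2^a)).biUnion bj).card ≤ ∑ j ∈ Ioc R0 (2^a), (bj j).card := card_biUnion_le
    have h2 : (((Ioc R0 (2^a)).biUnion bj).card : ℝ) ≤ ∑ j ∈ Ioc R0 (2^a), ((bj j).card : ℝ) := by exact_mod_cast h1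
    refine h2.trans ?_
    have h3 : ∀ j ∈ Ioc R0 (2^a), ((bj j).card : ℝ) ≤ E := by
      intro j hj
      rw [mem_Ioc] at hj
      have hV : 0 < (G^j)^(2^(qe j)) := by positivity
      have h4 : ((bj j).card : ℝ) * (G^j)^(2^(qe j)) ≤ ∑ b ∈ Ico X (X+T), trace ((Zm P (Am P τ D M b) j)^(2^(qe j))) := by
        rw [← nsmul_eq_mul, ← Finset.sum_const]
        calc _ ≤ ∑ b ∈ bj j, trace ((Zm P (Am P τ D M b) j)^(2^(qe j))) := by
              apply Finset.sum_le_sum; intro b hb; exact (mem_filter.1 hb).2.le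
          _ ≤ _ := by
              apply Finset.sum_le_sum_of_subset_of_nonneg (filter_subset _ _)
              intro b _ _
              exact trace_even_nonneg _ (Zm_symm P _ (fun p _ => Am_sym P τ D M b p) j) _ (hqe j hj.1 hj.2)
      exact le_of_mul_le_mul_right (h4.trans (htr j hj.1 hj.2)) hV
    refine (Finset.sum_le_sum h3).trans ?_
    rw [Finset.sum_const, nsmul_eq_mul, Nat.card_Ioc]
    apply mul_le_mul_of_nonneg_right _ hE
    have : 2^a - R0 ≤ 2^a := Nat.sub_le _ _
    exact_mod_cast this
  · intro b hb hnb j hj1 hj2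
    by_contra h
    push Not at h
    apply hnb
    rw [mem_biUnion]
    exact ⟨j, mem_Ioc.2 ⟨hj1, hj2⟩, mem_filter.2 ⟨hb, h⟩⟩

/-- sum of hp^2 over non nice integers -/
lemma nonnice_sq {P : Finset ℕ} {τ : ℤ} {D R N : ℕ} {E1 E2 : ℝ}
    (h1 : ∑ n ∈ II N, (if D ≤ hp P τ n then (hp P τ n : ℝ)^2 else 0) ≤ E1)
    (h2 : (((Ico ((N:ℤ)+1) ((N:ℤ)+1+N)).filter fun x => hp P τ x ≤ D ∧ ¬ nice P τ D R x).card : ℝ) ≤ E2)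
    (bd : ℤ → Prop) (hbd : ∀ n, bd n ↔ ¬ nice P τ D R n) :
    ∑ n ∈ II N, (if bd n then (hp P τ n : ℝ)^2 else 0) ≤ E1 + D^2 * E2 := by
  have h3 : ∀ n ∈ II N, (if bd n then (hp P τ n : ℝ)^2 else 0) ≤ (if D ≤ hp P τ n then (hp P τ n : ℝ)^2 else 0) +
      (if hp P τ n ≤ D ∧ ¬ nice P τ D R n then (D:ℝ)^2 else 0) := by
    intro n _
    by_cases hb : bd n
    · rw [if_pos hb]
      have hn := (hbd n).1 hb
      by_cases h : D ≤ hp P τ n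
      · rw [if_pos h]
        have : (0:ℝ) ≤ (if hp P τ n ≤ D ∧ ¬ nice P τ D R n then (D:ℝ)^2 else 0) := by split_ifs <;> positivity
        linarith
      · rw [if_neg h, if_pos ⟨by omega, hn⟩, zero_add]
        have : (hp P τ n : ℝ) ≤ D := by exact_mod_cast (by omega : hp P τ n ≤ D)
        gcongr
    · rw [if_neg hb]
      apply add_nonneg <;> split_ifs <;> positivity
  refine (Finset.sum_le_sum h3).trans ?_
  rw [Finset.sum_add_distrib]
  apply add_le_add h1
  rw [← Finset.sum_filter, Finset.sum_const, nsmul_eq_mul, mul_comm, II_eq]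
  exact mul_le_mul_of_nonneg_left h2 (by positivity)
end MC


namespace MC
open Finset Classical Matrix

lemma SS_rep {n : ℕ} {L Q W : ℝ} (hL : 0 ≤ L) (hQ : 0 ≤ Q) (hW : (n:ℝ) + 2 ≤ W) (hWL : 4 * L ≤ W) (hWQ : W^(5+256*n) * Q ≤ 1) :
    SS n n (2*L) Q (fun _ => n) 1 ≤ W * (W^(321*n+69) * Q) := by
  have hW1 : (1:ℝ) ≤ W := by have : (0:ℝ) ≤ n := by positivity
                             linarith
  have hW0 : (0:ℝ) ≤ W := by linarith
  rw [SS]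
  have h1 : ∀ r ∈ Icc 1 n, ((n:ℝ) + 2)^(5*r) * (2^n * ((n:ℝ)+2)^(64 * (n + 1 + 4 * r * n))) * ((2*L) ^ n * Q ^ r) ≤ W^(321*n+69) * Q := by
    intro r hr
    rw [mem_Icc] at hr
    obtain ⟨k, rfl⟩ : ∃ k, r = k + 1 := ⟨r - 1, by omega⟩
    calc ((n:ℝ) + 2)^(5*(k+1)) * (2^n * ((n:ℝ)+2)^(64 * (n + 1 + 4 * (k+1) * n))) * ((2*L) ^ n * Q ^ (k+1))
        ≤ W^(5*(k+1)) * (2^n * W^(64 * (n + 1 + 4 * (k+1) * n))) * ((2*L) ^ n * Q ^ (k+1)) := by gcongr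
      _ = (4*L)^n * W^(5*(k+1)) * W^(64 * (n + 1 + 4 * (k+1) * n)) * Q^(k+1) := by
          rw [show (4*L) = 2 * (2*L) by ring, mul_pow 2 (2*L)]; ring
      _ ≤ W^n * W^(5*(k+1)) * W^(64 * (n + 1 + 4 * (k+1) * n)) * Q^(k+1) := by gcongr
      _ = W^(321*n+69) * Q * (W^(5+256*n) * Q)^k := by
          rw [mul_pow, ← pow_mul, pow_succ Q, ← pow_add, ← pow_add]
          have : n + 5*(k+1) + 64 * (n + 1 + 4 * (k+1) * n) = (321*n+69) + (5+256*n)*k := by ring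
          rw [this, pow_add]; ring
      _ ≤ W^(321*n+69) * Q * 1 := by
          apply mul_le_mul_of_nonneg_left (pow_le_one₀ (by positivity) hWQ) (by positivity)
      _ = _ := mul_one _
  refine (Finset.sum_le_sum h1).trans ?_
  rw [Finset.sum_const, nsmul_eq_mul, Nat.card_Icc]
  apply mul_le_mul_of_nonneg_right _ (by positivity)
  have : ((n + 1 - 1 : ℕ):ℝ) = n := by simp
  rw [this]; linarith

lemma SS_gen {n q : ℕ} {X Y Q W : ℝ} {Dm : ℕ → ℕ} (hX : 0 ≤ X) (hY : 0 ≤ Y) (hQ : 0 ≤ Q) (hW : (n:ℝ) + 2 ≤ W) {A e : ℕ}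
    (hD : ∀ r ≤ n, X ^ Dm r ≤ Y * W^(A + e * r))
    (hWQ : W^(5+256*q + e) * Q ≤ 1) :
    SS n q X Q Dm 0 ≤ W * (2^n * Y * W^(64*(q+1)+A)) := by
  have hW1 : (1:ℝ) ≤ W := by have : (0:ℝ) ≤ n := by positivity
                             linarith
  have hW0 : (0:ℝ) ≤ W := by linarith
  rw [SS]
  have h1 : ∀ r ∈ Icc 0 n, ((n:ℝ) + 2)^(5*r) * (2^n * ((n:ℝ)+2)^(64 * (q + 1 + 4 * r * q))) * (X ^ Dm r * Q ^ r) ≤ 2^n * Y * W^(64*(q+1)+A) := by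
    intro r hr
    rw [mem_Icc] at hr
    have h2 := hD r hr.2
    calc ((n:ℝ) + 2)^(5*r) * (2^n * ((n:ℝ)+2)^(64 * (q + 1 + 4 * r * q))) * (X ^ Dm r * Q ^ r)
        ≤ W^(5*r) * (2^n * W^(64 * (q + 1 + 4 * r * q))) * ((Y * W^(A + e * r)) * Q ^ r) := by gcongr
      _ = 2^n * Y * W^(64*(q+1)+A) * (W^(5+256*q + e) * Q)^r := by
          rw [mul_pow, ← pow_mul]
          have : (5*r) + (64 * (q + 1 + 4 * r * q)) + (A + e * r) = (64*(q+1)+A) + (5+256*q+e)*r := by ring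
          calc _ = 2^n * Y * Q^r * (W^((5*r) + (64 * (q + 1 + 4 * r * q)) + (A + e * r))) := by
                rw [pow_add W (5*r + _), pow_add W (5*r)]; ring
            _ = _ := by rw [this, pow_add]; ring
      _ ≤ 2^n * Y * W^(64*(q+1)+A) * 1 := by
          apply mul_le_mul_of_nonneg_left (pow_le_one₀ (by positivity) hWQ) (by positivity)
      _ = _ := mul_one _
  refine (Finset.sum_le_sum h1).trans ?_
  rw [Finset.sum_const, nsmul_eq_mul, Nat.card_Icc]
  apply mul_le_mul_of_nonneg_right _ (by positivity)
  push_cast [Nat.sub_zero]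
  linarith

lemma SS_main {n q : ℕ} {L Q W : ℝ} (hL : 1 ≤ L) (hQ : 0 ≤ Q) (hW : (n:ℝ) + 2 ≤ W) (hWL : 2 * L ≤ W)
    (hWQ : W^(7+296*q) * Q ≤ 1) :
    SS n q (2*L) Q (DmB n q) 0 ≤ W * (2^n * (Real.sqrt (2*L))^n * W^(74*(q+1))) := by
  have hW1 : (1:ℝ) ≤ W := by linarith
  have hs1 : 1 ≤ Real.sqrt (2*L) := by rw [Real.one_le_sqrt]; linarith
  have hsW : Real.sqrt (2*L) ≤ W := by
    rw [Real.sqrt_le_left (by linarith)]; nlinarith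
  have := SS_gen (n := n) (q := q) (X := 2*L) (Y := (Real.sqrt (2*L))^n) (Dm := DmB n q) (A := 10*(q+1)) (e := 2 + 40*q) (by linarith) (by positivity) hQ hW ?_ ?_
  · refine this.trans (le_of_eq ?_)
    congr 3; ring
  · intro r _
    have h1 : (2*L)^(DmB n q r) = (Real.sqrt (2*L))^(2 * DmB n q r) := by
      rw [pow_mul, Real.sq_sqrt (by linarith)]
    rw [h1]
    have h2 : 2 * DmB n q r ≤ n + (10*(q+1) + (2+40*q)*r) := by
      unfold DmB
      refine (Nat.mul_div_le _ _).trans (le_of_eq ?_)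
      ring
    refine (pow_le_pow_right₀ hs1 h2).trans ?_
    rw [pow_add]
    gcongr
  · refine le_trans (le_of_eq ?_) hWQ
    congr 2; ring

lemma SS_err {n q : ℕ} {L Q W : ℝ} (hL : 1 ≤ L) (hQ : 0 ≤ Q) (hW : (n:ℝ) + 2 ≤ W) 
    (hWQ : W^(7+296*q) * Q ≤ 1) :
    SS n q (2*L) Q (fun _ => n) 0 ≤ W * (2^n * (2*L)^n * W^(64*(q+1))) := by
  have hW1 : (1:ℝ) ≤ W := by have : (0:ℝ) ≤ n := by positivity
                             linarith
  refine SS_gen (n := n) (q := q) (X := 2*L) (Y := (2*L)^n) (Dm := fun _ => n) (A := 0) (e := 0) (by linarith) (by positivity) hQ hW ?_ ?_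
  · intro r _; simp
  · refine le_trans ?_ hWQ
    apply mul_le_mul_of_nonneg_right _ hQ
    apply pow_le_pow_right₀ hW1; omega

lemma TrB_le {P : Finset ℕ} {L Q W : ℝ} {Hn n q T m : ℕ} (hL : 1 ≤ L) (hQ : 0 ≤ Q) (hW : (n:ℝ) + 2 ≤ W) (hWL : 2 * L ≤ W)
    (hWQ : W^(7+296*q) * Q ≤ 1) (hH : 2 ≤ Hn) (hP : P.card + 1 ≤ Hn) (hm : 81 * (n+1) * L ≤ m) (hT : Hn^(2*n+3*m+1) ≤ T) :
    TrB P L Q Hn n q T m ≤ 5 * T * (W * (2^n * (Real.sqrt (2*L))^n * W^(74*(q+1)))) := by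
  have hW1 : (1:ℝ) ≤ W := by linarith
  have hs1 : 1 ≤ Real.sqrt (2*L) := by rw [Real.one_le_sqrt]; linarith
  have hn0 : (0:ℝ) ≤ n := by positivity
  have hm0 : (0:ℝ) < m := by nlinarith
  have h1 := SS_main (n := n) (q := q) hL hQ hW hWL hWQ
  have h2 := SS_err (n := n) (q := q) hL hQ hW hWQ
  set Z := W * (2^n * (Real.sqrt (2*L))^n * W^(74*(q+1))) with hZ
  have hZ1 : 1 ≤ Z := by
    rw [hZ]
    have a1 : (1:ℝ) ≤ 2^n := one_le_pow₀ (by norm_num)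
    have a2 := one_le_pow₀ hs1 (n := n)
    have a3 := one_le_pow₀ hW1 (n := 74*(q+1))
    exact one_le_mul_of_one_le_of_one_le hW1 (one_le_mul_of_one_le_of_one_le (one_le_mul_of_one_le_of_one_le a1 a2) a3)
  have hx : 2 * (Real.exp 1 * (2 * (n+1) * L) / m) ≤ Real.exp (-2) := by
    have e3 : Real.exp 1 * 4 ≤ 81 * Real.exp (-2) := by
      have : Real.exp 1 = Real.exp 3 * Real.exp (-2) := by rw [← Real.exp_add]; norm_num
      rw [this]
      have e : Real.exp 3 = (Real.exp 1)^3 := by rw [← Real.exp_nat_mul]; norm_num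
      have h9 := Real.exp_one_lt_d9
      have h8 : (Real.exp 1)^3 ≤ 2.7182818286^3 := by gcongr
      have : Real.exp 3 * 4 ≤ 81 := by rw [e]; norm_num at h8 ⊢; linarith
      nlinarith [Real.exp_pos (-2)]
    rw [← mul_div_assoc, div_le_iff₀ hm0]
    calc 2 * (Real.exp 1 * (2*(n+1)*L)) = (Real.exp 1 * 4) * ((n+1)*L) := by ring
      _ ≤ (81 * Real.exp (-2)) * ((n+1)*L) := by gcongr
      _ = Real.exp (-2) * (81 * (n+1) * L) := by ring
      _ ≤ _ := by gcongr
  have hx2 : (2 * (Real.exp 1 * (2 * (n+1) * L) / m))^m * (2*L)^n ≤ 1 := by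
    calc (2 * (Real.exp 1 * (2 * (n+1) * L) / m))^m * (2*L)^n ≤ (Real.exp (-2))^m * (Real.exp (2*L))^n := by
          have : 2 * L ≤ Real.exp (2*L) := by linarith [Real.add_one_le_exp (2*L)]
          gcongr
      _ = Real.exp (m * (-2) + n * (2*L)) := by rw [← Real.exp_nat_mul, ← Real.exp_nat_mul, ← Real.exp_add]
      _ ≤ 1 := by rw [Real.exp_le_one_iff]; nlinarith
  have hT0 : (0:ℝ) ≤ T := by positivity
  have t2 : 2 * T * (2 * (Real.exp 1 * (2 * (n+1) * L) / m))^m * SS n q (2*L) Q (fun _ => n) 0 ≤ 2 * T * Z := by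
    calc _ ≤ 2 * T * (2 * (Real.exp 1 * (2 * (n+1) * L) / m))^m * (W * (2^n * (2*L)^n * W^(64*(q+1)))) := by gcongr
      _ = 2 * T * (W * (2^n * ((2 * (Real.exp 1 * (2 * (n+1) * L) / m))^m * (2*L)^n) * W^(64*(q+1)))) := by ring
      _ ≤ 2 * T * (W * (2^n * (Real.sqrt (2*L))^n * W^(74*(q+1)))) := by
          have a2 := one_le_pow₀ hs1 (n := n)
          gcongr
          · exact hx2.trans a2
          · omega
  have t3 : (P.card:ℝ)^n * ((P.card+1 : ℝ)^m * (2 * 2^m * (Hn:ℝ)^(n+m))) ≤ T * Z := by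
    have hPc : (P.card : ℝ) + 1 ≤ Hn := by exact_mod_cast hP
    have hH' : (2:ℝ) ≤ Hn := by exact_mod_cast hH
    calc _ ≤ (Hn:ℝ)^n * ((Hn:ℝ)^m * (Hn * Hn^m * (Hn:ℝ)^(n+m))) := by
          gcongr
          linarith
      _ = (Hn:ℝ)^(2*n+3*m+1) := by ring
      _ ≤ T := by exact_mod_cast hT
      _ ≤ T * Z := by nlinarith
  rw [TrB]
  have t1 := mul_le_mul_of_nonneg_left h1 (by positivity : (0:ℝ) ≤ 2 * T)
  linarith
end MC


namespace MC
open Finset Classical Matrix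

lemma pow_dvd_fact (p n : ℕ) : p^(n/p) ∣ n.factorial := by
  rcases Nat.eq_zero_or_pos p with rfl | hp
  · simp
  have h : ∀ k, p^k ∣ (p*k).factorial := by
    intro k
    induction k with
    | zero => simp
    | succ k ih =>
      have e : p * (k+1) = (p*k + (p-1)) + 1 := by rw [mul_add]; omega
      rw [pow_succ, e, Nat.factorial_succ, ← e, mul_comm]
      exact mul_dvd_mul (dvd_mul_right _ _) (ih.trans (Nat.factorial_dvd_factorial (by omega)))
  exact (h (n/p)).trans (Nat.factorial_dvd_factorial (Nat.mul_div_le n p))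

/-- Mertens-type upper bound -/
lemma mertens {P : Finset ℕ} (hPp : ∀ p ∈ P, p.Prime) {n : ℕ} (hn : 1 ≤ n) (hP : ∀ p ∈ P, p ≤ n) :
    ∑ p ∈ P, Real.log p / p ≤ Real.log n + 2 := by
  have hn0 : (0:ℝ) < n := by exact_mod_cast hn
  have h1 : ∏ p ∈ P, p^(n/p) ∣ n.factorial := by
    apply Finset.prod_dvd_of_isRelPrime
    · intro p hp q hq hpq
      exact Nat.coprime_iff_isRelPrime.1 (Nat.Coprime.pow _ _ ((Nat.coprime_primes (hPp p hp) (hPp q hq)).2 hpq))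
    · intro p _; exact pow_dvd_fact p n
  have h2 : ∏ p ∈ P, p^(n/p) ≤ n^n := (Nat.le_of_dvd (Nat.factorial_pos n) h1).trans (Nat.factorial_le_pow n)
  have h3 : ∑ p ∈ P, ((n/p : ℕ):ℝ) * Real.log p ≤ n * Real.log n := by
    have h4 : Real.log ((∏ p ∈ P, p^(n/p) : ℕ):ℝ) ≤ Real.log ((n^n : ℕ):ℝ) := by
      apply Real.log_le_log
      · have : 0 < ∏ p ∈ P, p^(n/p) := Finset.prod_pos fun p hp => pow_pos (hPp p hp).pos _
        exact_mod_cast this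
      · exact_mod_cast h2
    push_cast at h4
    rw [Real.log_pow, Real.log_prod] at h4
    · simpa only [Real.log_pow] using h4
    · intro p hp
      have := (hPp p hp).pos
      positivity
  have h5 : ∑ p ∈ P, Real.log p ≤ n * 2 := by
    have h6 : ∏ p ∈ P, p ≤ 4^n := by
      refine le_trans ?_ (primorial_le_four_pow n)
      rw [primorial]
      apply Finset.prod_le_prod_of_subset_of_one_le'
      · intro p hp; rw [mem_filter, mem_range]; exact ⟨by have := hP p hp; omega, hPp p hp⟩
      · intro p hp _; exact (mem_filter.1 hp).2.one_lt.le
    have h7 : Real.log ((∏ p ∈ P, p : ℕ):ℝ) ≤ Real.log ((4^n : ℕ):ℝ) := by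
      apply Real.log_le_log
      · have : 0 < ∏ p ∈ P, p := Finset.prod_pos fun p hp => (hPp p hp).pos
        exact_mod_cast this
      · exact_mod_cast h6
    push_cast at h7
    rw [Real.log_pow, Real.log_prod] at h7
    · have : Real.log 4 ≤ 2 := by
        rw [Real.log_le_iff_le_exp (by norm_num)]
        have : Real.exp 2 = Real.exp 1 * Real.exp 1 := by rw [← Real.exp_add]; norm_num
        rw [this]; nlinarith [Real.exp_one_gt_d9]
      nlinarith
    · intro p hp
      have := (hPp p hp).pos
      positivity
  have h8 : n * ∑ p ∈ P, Real.log p / p ≤ ∑ p ∈ P, ((n/p : ℕ):ℝ) * Real.log p + ∑ p ∈ P, Real.log p := by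
    rw [Finset.mul_sum, ← Finset.sum_add_distrib]
    apply Finset.sum_le_sum; intro p hp
    have hp1 : (1:ℝ) ≤ p := by exact_mod_cast (hPp p hp).one_lt.le
    have hl := Real.log_nonneg hp1
    have : (n:ℝ)/p ≤ ((n/p : ℕ):ℝ) + 1 := (Nat.lt_floor_add_one _).le.trans (le_of_eq (by rw [Nat.floor_div_eq_div]))
    calc n * (Real.log p / p) = (n/p) * Real.log p := by ring
      _ ≤ (((n/p : ℕ):ℝ) + 1) * Real.log p := by gcongr
      _ = _ := by ring
  have h9 : n * ∑ p ∈ P, Real.log p / p ≤ n * (Real.log n + 2) := by linarith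
  exact le_of_mul_le_mul_left h9 hn0

lemma L_le {P : Finset ℕ} {H0 H : ℝ} (h0 : 1 ≤ H0) (hH : H0 ≤ H) (hP : ∀ p ∈ P, Nat.Prime p ∧ H0 ≤ (p:ℝ) ∧ (p:ℝ) ≤ H) :
    (∑ p ∈ P, 1 / (p:ℝ)) * Real.log H0 ≤ Real.log H + 2 := by
  have hf1 : 1 ≤ ⌊H⌋₊ := Nat.one_le_floor_iff _ |>.2 (h0.trans hH)
  have h1 := mertens (fun p hp => (hP p hp).1) hf1 (fun p hp => Nat.le_floor (hP p hp).2.2)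
  have h2 : Real.log (⌊H⌋₊:ℝ) ≤ Real.log H := by
    apply Real.log_le_log
    · exact_mod_cast hf1
    · exact Nat.floor_le (by linarith)
  rw [Finset.sum_mul]
  refine le_trans (Finset.sum_le_sum fun p hp => ?_) (h1.trans (by linarith))
  have := Real.log_le_log (by linarith) (hP p hp).2.1
  rw [one_div, mul_comm, ← div_eq_mul_inv]
  gcongr

lemma harm_le {n : ℕ} {H : ℝ} (hn : 1 ≤ n) (hH : (n:ℝ) ≤ H) : ∑ t ∈ Icc 1 n, 1 / (t:ℝ) ≤ 1 + Real.log H := by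
  have h := harmonic_le_one_add_log n
  rw [harmonic_eq_sum_Icc] at h
  push_cast at h
  simp only [one_div]
  refine h.trans ?_
  have hn0 : (0:ℝ) < n := by exact_mod_cast hn
  linarith [Real.log_le_log hn0 hH]

lemma L_le' {P : Finset ℕ} {H0 H : ℝ} (h0 : 1 ≤ H0) (hH : H0 ≤ H) (hP : ∀ p ∈ P, Nat.Prime p ∧ H0 ≤ (p:ℝ) ∧ (p:ℝ) ≤ H) :
    (∑ p ∈ P, 1 / (p:ℝ)) ≤ 1 + Real.log H := by
  have hf1 : 1 ≤ ⌊H⌋₊ := Nat.one_le_floor_iff _ |>.2 (h0.trans hH)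
  refine le_trans ?_ (harm_le hf1 (Nat.floor_le (by linarith)))
  apply Finset.sum_le_sum_of_subset_of_nonneg
  · intro p hp; rw [mem_Icc]; exact ⟨(hP p hp).1.one_lt.le, Nat.le_floor (hP p hp).2.2⟩
  · intros; positivity

lemma params (C K : ℝ) (hC : 0 < C) (hK : 1 ≤ K) : ∃ h0 : ℝ, 100 ≤ h0 ∧ ∀ h E L : ℝ, h0 ≤ h →
    h^((2:ℝ)/3) * Real.log h^2 ≤ E → E ≤ h → 1 ≤ L → L * E ≤ h + 2 →
    40 ≤ Real.log h ∧ 1192000 * Real.log h^3 ≤ E ∧ 8080 * h * Real.log h^3 ≤ E^2 ∧ 64 * C * L ≤ E ∧ 4 * (K * L + 1) ≤ h ∧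
      Real.log h + 2 * C * L ≤ h/2 := by
  set A : ℝ := 30000000 + 128 * C + 32 * K with hA
  refine ⟨max (A^3) (Real.exp 40 + 100), le_max_of_le_right (by linarith [Real.exp_pos 40]), ?_⟩
  intro h E L hh hE1 hE2 hL hLE
  have hA0 : 0 < A := by positivity
  have hhA : A^3 ≤ h := (le_max_left _ _).trans hh
  have hhe : Real.exp 40 + 100 ≤ h := (le_max_right _ _).trans hh
  have h0 : 0 < h := by linarith [Real.exp_pos 40]
  have hl : 40 ≤ Real.log h := by
    rw [Real.le_log_iff_exp_le h0]; linarith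
  set ℓ := Real.log h with hℓ
  set u : ℝ := h^((1:ℝ)/3) with hu
  have hu3 : u^3 = h := by
    rw [hu, ← Real.rpow_natCast, ← Real.rpow_mul h0.le]; norm_num
  have hu2 : h^((2:ℝ)/3) = u^2 := by
    rw [hu, ← Real.rpow_natCast, ← Real.rpow_mul h0.le]; norm_num
  have hu0 : 0 < u := by positivity
  have huA : A ≤ u := by
    rw [← hu3] at hhA
    exact (pow_le_pow_iff_left₀ hA0.le hu0.le (by norm_num)).1 hhA
  have hlu : ℓ ≤ 3 * u := by
    have : ℓ = 3 * Real.log u := by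
      rw [hℓ, ← hu3, Real.log_pow]; norm_num
    rw [this]
    linarith [Real.log_le_sub_one_of_pos hu0]
  rw [hu2] at hE1
  have hu7 : 30000000 ≤ u := by linarith
  have huC : 128 * C ≤ u := by linarith
  have huK : 32 * K ≤ u := by linarith
  have hl2 : 1600 ≤ ℓ^2 := by nlinarith
  have hE3 : u^4 * ℓ^4 ≤ E^2 := by
    have := pow_le_pow_left₀ (by positivity) hE1 2
    calc u^4 * ℓ^4 = (u^2*ℓ^2)^2 := by ring
      _ ≤ _ := this
  have hEu : 1600 * u ≤ E := by nlinarith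
  have hE0 : 0 < E := by nlinarith
  have hLE' : L * E ≤ 2 * h := by
    linarith [Real.exp_pos 40]
  refine ⟨hl, ?_, ?_, ?_, ?_, ?_⟩
  · have : 1192000 * ℓ ≤ u^2 := by nlinarith
    calc 1192000 * ℓ^3 = (1192000 * ℓ) * ℓ^2 := by ring
      _ ≤ u^2 * ℓ^2 := by gcongr
      _ ≤ E := hE1
  · refine le_trans ?_ hE3
    rw [← hu3]
    have : 8080 ≤ u * ℓ := by nlinarith
    calc 8080 * u^3 * ℓ^3 = 8080 * (u^3*ℓ^3) := by ring
      _ ≤ (u * ℓ) * (u^3*ℓ^3) := by gcongr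
      _ = _ := by ring
  · have h1 : 64 * C * (L * E) ≤ E^2 := by
      calc 64 * C * (L * E) ≤ 64 * C * (2 * h) := by gcongr
        _ = 128 * C * u^3 := by rw [hu3]; ring
        _ ≤ u * u^3 := by gcongr
        _ = u^4 * 1 := by ring
        _ ≤ u^4 * ℓ^4 := by gcongr; exact one_le_pow₀ (by linarith)
        _ ≤ _ := hE3
    nlinarith
  · have h1 : K * L * 8 ≤ h := by
      have : K * (L * E) ≤ K * (2*h) := by gcongr
      have h2 : 16 * K ≤ E := by linarith
      have h3 : K * L * 8 * E ≤ h * E := by nlinarith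
      exact le_of_mul_le_mul_right h3 hE0
    linarith [Real.exp_pos 40]
  · have h1 : 2 * C * L * 4 ≤ h := by
      have : C * (L * E) ≤ C * (2*h) := by gcongr
      have h2 : 16 * C ≤ E := by linarith
      have h3 : 2 * C * L * 4 * E ≤ h * E := by nlinarith
      exact le_of_mul_le_mul_right h3 hE0
    have h2 : ℓ * 4 ≤ h := by
      have : 12 * u ≤ u^3 := by nlinarith [mul_pos hu0 hu0]
      linarith
    linarith
end MC


namespace MC
open Finset Classical Matrix

lemma pow_le_N {Hn N k : ℕ} {h L : ℝ} (h0 : 0 ≤ h) (hH : (Hn:ℝ) ≤ Real.exp h) (hN : Real.exp (L * h^2) ≤ N) (hk : (k:ℝ) ≤ L * h) :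
    Hn^k ≤ N := by
  have : (Hn:ℝ)^k ≤ N := by
    calc (Hn:ℝ)^k ≤ (Real.exp h)^k := by gcongr
      _ = Real.exp (k * h) := by rw [← Real.exp_nat_mul]
      _ ≤ Real.exp (L * h^2) := by apply Real.exp_le_exp.2; nlinarith
      _ ≤ N := hN
  exact_mod_cast this

lemma hpow_exp {h : ℝ} (hh : 0 < h) (k : ℕ) : h^k = Real.exp (k * Real.log h) := by
  rw [Real.exp_nat_mul, Real.exp_log hh]

lemma two_exp : 2 * Real.exp 1 ≤ Real.exp 2 := by
  have : Real.exp 2 = Real.exp 1 * Real.exp 1 := by rw [← Real.exp_add]; norm_num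
  rw [this]
  exact mul_le_mul_of_nonneg_right (by linarith [Real.exp_one_gt_d9]) (Real.exp_pos _).le

set_option maxHeartbeats 1000000 in
lemma tr_param {P : Finset ℕ} {h E L G : ℝ} {j N T M Hn : ℕ} (hh : 100 ≤ h) (hl : 40 ≤ Real.log h) (hE1 : 1192000 * Real.log h^3 ≤ E)
    (hE2 : 8080 * h * Real.log h^3 ≤ E^2) (hL : 1 ≤ L) (hLh : 4 * L ≤ h)
    (hj1 : E ≤ 8000 * Real.log h^2 * j) (hj2 : 2400 * (j:ℝ) ≤ h) (hN : Real.exp (L * h^2) ≤ N) (hT : N ≤ T)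
    (hHn : (Hn:ℝ) ≤ Real.exp h) (hHn2 : 2 ≤ Hn) (hPc : P.card + 1 ≤ Hn) (hM : (M:ℝ) ≤ Real.exp (2*h))
    (hG : Real.exp 6002 * Real.sqrt (2*L) ≤ G) :
    ∃ e m : ℕ, 1 ≤ e ∧ 0 < m ∧ ((2^e*j : ℕ):ℝ) ≤ h ∧ 1 ≤ 2^e*j ∧ Hn^(2^e*j+m) ≤ T ∧
      2 * M * TrB P L (Real.exp (-(E/2))) Hn (2^e*j) (2^e) T m ≤ T * Real.exp (-2*h) * (G^j)^(2^e) := by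
  set ℓ := Real.log h with hℓ
  have hE0 : 0 < E := by
    have : 0 < ℓ^3 := by positivity
    linarith
  have hl2 : 0 < ℓ^2 := by positivity
  have hj149 : 149 * ℓ ≤ j := by
    have h1 : 8000 * ℓ^2 * (149 * ℓ) ≤ 8000 * ℓ^2 * j := by
      refine le_trans (le_of_eq ?_) (hE1.trans hj1); ring
    exact le_of_mul_le_mul_left h1 (by positivity)
  have hj0 : (0:ℝ) < j := by linarith
  have hjn : 0 < j := by exact_mod_cast hj0
  obtain ⟨e, he1, he2⟩ := exists_nat_pow_near (x := h / (600 * j)) (y := (2:ℝ)) (by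
    rw [le_div_iff₀ (by positivity)]; linarith) (by norm_num)
  rw [le_div_iff₀ (by positivity)] at he1
  rw [div_lt_iff₀ (by positivity)] at he2
  have hepos : 1 ≤ e := by
    by_contra h'
    have : e = 0 := by omega
    subst this
    norm_num at he2
    linarith
  set q : ℝ := (2:ℝ)^e with hq
  have hq2 : 2 ≤ q := by
    calc (2:ℝ) = 2^1 := by norm_num
      _ ≤ 2^e := pow_le_pow_right₀ (by norm_num) hepos
  set n : ℕ := 2^e * j with hn
  have hnr : (n:ℝ) = q * j := by rw [hn, hq]; push_cast; ring
  have hn1 : 600 * (n:ℝ) ≤ h := by rw [hnr]; linarith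
  have hn2 : h ≤ 1200 * n := by
    rw [hnr]
    have : (2:ℝ)^(e+1) = 2 * q := by rw [hq, pow_succ]; ring
    rw [this] at he2
    linarith
  have hnpos : 1 ≤ n := Nat.mul_pos (by positivity) hjn
  have hn1' : (1:ℝ) ≤ n := by exact_mod_cast hnpos
  set m : ℕ := ⌈81 * ((n:ℝ)+1) * L⌉₊ with hm
  have hm1 : 81 * ((n:ℝ)+1) * L ≤ m := Nat.le_ceil _
  have hm2 : (m:ℝ) ≤ 81 * ((n:ℝ)+1) * L + 1 := (Nat.ceil_lt_add_one (by positivity)).le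
  have hm0 : 0 < m := by
    have : (0:ℝ) < m := lt_of_lt_of_le (by positivity) hm1
    exact_mod_cast this
  have hbig : Hn^(2*n+3*m+1) ≤ T := by
    refine (pow_le_N (by linarith) hHn hN ?_).trans hT
    push_cast
    have : 250 * ((n:ℝ)+1) * L ≤ L * h := by nlinarith
    nlinarith
  refine ⟨e, m, hepos, hm0, by linarith, hnpos, le_trans (Nat.pow_le_pow_right (by omega) (by omega)) hbig, ?_⟩
  have hh0 : 0 < h := by linarith
  have hqE : q * E ≤ (40/3) * h * ℓ^2 := by
    have h1 : q * E ≤ q * (8000 * ℓ^2 * j) := by gcongr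
    have h2 : q * (8000 * ℓ^2 * j) = (40/3) * ℓ^2 * (q * (600 * j)) := by ring
    have h3 : (40/3) * ℓ^2 * (q * (600 * j)) ≤ (40/3) * ℓ^2 * h := by gcongr
    linarith
  have hWQ : h^(7+296*2^e) * Real.exp (-(E/2)) ≤ 1 := by
    rw [hpow_exp hh0, ← Real.exp_add, Real.exp_le_one_iff]
    push_cast
    rw [← hq]
    have h1 : (7 + 296 * q) * ℓ ≤ 303 * q * ℓ := by
      apply mul_le_mul_of_nonneg_right _ (by linarith); linarith
    have h2 : 303 * q * ℓ * E ≤ (E/2) * E := by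
      calc 303 * q * ℓ * E = 303 * ℓ * (q * E) := by ring
        _ ≤ 303 * ℓ * ((40/3) * h * ℓ^2) := by gcongr
        _ = (8080 * h * ℓ^3)/2 := by ring
        _ ≤ E^2/2 := by gcongr
        _ = _ := by ring
    have h3 := le_of_mul_le_mul_right h2 hE0
    linarith
  have hT1 := TrB_le (P := P) (T := T) (n := n) (q := 2^e) (m := m) hL (Real.exp_pos (-(E/2))).le (W := h) (by linarith) (by linarith) hWQ hHn2 hPc hm1 hbig
  have hW : h * h^(74*(2^e+1)) ≤ Real.exp n := by
    rw [← pow_succ', hpow_exp hh0]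
    apply Real.exp_le_exp.2
    push_cast
    rw [← hq, hnr]
    have h1 : (74 * (q+1) + 1) ≤ 149 * q := by linarith
    calc (74 * (q+1) + 1) * ℓ ≤ 149 * q * ℓ := by gcongr
      _ = q * (149 * ℓ) := by ring
      _ ≤ q * j := by gcongr
  set s := Real.sqrt (2*L) with hs
  have hs0 : 0 ≤ s := Real.sqrt_nonneg _
  have hT2 : TrB P L (Real.exp (-(E/2))) Hn n (2^e) T m ≤ 5 * T * (2 * Real.exp 1 * s)^n := by
    refine hT1.trans ?_
    have e1 : h * (2^n * s^n * h^(74*(2^e+1))) = (h * h^(74*(2^e+1))) * (2^n * s^n) := by ring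
    have e2 : (2 * Real.exp 1 * s)^n = Real.exp n * (2^n * s^n) := by
      rw [mul_pow, mul_pow, ← Real.exp_nat_mul, mul_one]; ring
    rw [e1, e2]
    gcongr
  have hGn : Real.exp (5*h) * (2 * Real.exp 1 * s)^n ≤ (G^j)^(2^e) := by
    have e1 : (G^j)^(2^e) = G^n := by rw [← pow_mul, hn, mul_comm]
    rw [e1]
    have h2e : 2 * Real.exp 1 ≤ Real.exp 2 := two_exp
    calc Real.exp (5*h) * (2 * Real.exp 1 * s)^n ≤ Real.exp (n * 6000) * (Real.exp 2 * s)^n := by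
          refine mul_le_mul (Real.exp_le_exp.2 (by linarith)) ?_ (by positivity) (Real.exp_pos _).le
          exact pow_le_pow_left₀ (by positivity) (mul_le_mul_of_nonneg_right h2e hs0) n
      _ = (Real.exp 6000 * (Real.exp 2 * s))^n := by rw [mul_pow _ (Real.exp 2 * s), Real.exp_nat_mul]
      _ = (Real.exp 6002 * s)^n := by rw [← mul_assoc, ← Real.exp_add]; norm_num
      _ ≤ G^n := by gcongr
  have h10 : 10 * Real.exp (2*h) ≤ Real.exp (-2*h) * Real.exp (5*h) := by
    rw [← Real.exp_add]
    have : Real.exp (-2*h+5*h) = Real.exp (2*h) * Real.exp h := by rw [← Real.exp_add]; ring_nf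
    rw [this]
    have : 10 ≤ Real.exp h := by linarith [Real.add_one_le_exp h]
    rw [mul_comm]
    exact mul_le_mul_of_nonneg_left this (Real.exp_pos _).le
  have hT0 : (0:ℝ) ≤ T := by positivity
  calc 2 * M * TrB P L (Real.exp (-(E/2))) Hn n (2^e) T m ≤ 2 * M * (5 * T * (2 * Real.exp 1 * s)^n) := by gcongr
    _ = 10 * M * T * (2 * Real.exp 1 * s)^n := by ring
    _ ≤ 10 * Real.exp (2*h) * T * (2 * Real.exp 1 * s)^n := by gcongr
    _ ≤ (Real.exp (-2*h) * Real.exp (5*h)) * T * (2 * Real.exp 1 * s)^n := by gcongr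
    _ = T * Real.exp (-2*h) * (Real.exp (5*h) * (2 * Real.exp 1 * s)^n) := by ring
    _ ≤ _ := by gcongr

lemma rep_num {h E L : ℝ} {R N : ℕ} (hh : 100 ≤ h) (hl : 40 ≤ Real.log h) (hE1 : 1192000 * Real.log h^3 ≤ E)
    (hL : 1 ≤ L) (hLh : 4 * L ≤ h) (hR : 2000 * Real.log h * R ≤ E) (hRh : (R:ℝ) + 2 ≤ h) :
    2 * ∑ n ∈ Icc 1 R, 2 * (N:ℝ) * SS n n (2*L) (Real.exp (-(E/2))) (fun _ => n) 1 ≤ 4 * h * N * Real.exp (-(E/4)) := by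
  set ℓ := Real.log h with hℓ
  have hh0 : 0 < h := by linarith
  have hE3 : 1000 * ℓ ≤ E := by
    refine le_trans ?_ hE1
    have : ℓ ≤ ℓ^3 := by nlinarith [sq_nonneg ℓ, mul_pos (by linarith : (0:ℝ) < ℓ) (by linarith : (0:ℝ) < ℓ)]
    have : 0 ≤ ℓ := by linarith
    linarith
  have h1 : ∀ n ∈ Icc 1 R, 2 * (N:ℝ) * SS n n (2*L) (Real.exp (-(E/2))) (fun _ => n) 1 ≤ 2 * N * Real.exp (-(E/4)) := by
    intro n hn
    rw [mem_Icc] at hn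
    have hnR : (n:ℝ) ≤ R := by exact_mod_cast hn.2
    have hnl : ℓ * n ≤ ℓ * R := by gcongr
    apply mul_le_mul_of_nonneg_left _ (by positivity)
    refine (SS_rep (W := h) (by linarith) (Real.exp_pos _).le (by linarith) hLh ?_).trans ?_
    · rw [hpow_exp hh0, ← Real.exp_add, Real.exp_le_one_iff]
      push_cast
      rw [← hℓ]
      nlinarith
    · rw [← mul_assoc, ← pow_succ', hpow_exp hh0, ← Real.exp_add]
      apply Real.exp_le_exp.2
      push_cast
      rw [← hℓ]
      nlinarith
  have h2 := Finset.sum_le_sum h1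
  rw [Finset.sum_const, nsmul_eq_mul, Nat.card_Icc, Nat.add_sub_cancel] at h2
  have h3 : (R:ℝ) * (2 * N * Real.exp (-(E/4))) ≤ h * (2 * N * Real.exp (-(E/4))) := by
    gcongr; linarith
  nlinarith

lemma beta_num {h E L C K : ℝ} {D N : ℕ} (hh : 100 ≤ h) (hl : 40 ≤ Real.log h) (hE1 : 1192000 * Real.log h^3 ≤ E)
    (hC : 0 < C) (hL : 1 ≤ L) (hCL : 64 * C * L ≤ E) (hK : K = 8 * C + 50) (hD : K * L ≤ D) (hDh : (D:ℝ) ≤ h) :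
    (D:ℝ)^2 * (2 * N * (Real.exp 1 * (2 * L) / D)^D) + (D:ℝ)^2 * (4 * h * N * Real.exp (-(E/4))) ≤ N * (Real.exp (-(8*C*L)) / 50) := by
  set ℓ := Real.log h with hℓ
  have hh0 : 0 < h := by linarith
  have hE3 : 1000 * ℓ ≤ E := by
    refine le_trans ?_ hE1
    have : ℓ ≤ ℓ^3 := by nlinarith [sq_nonneg ℓ, mul_pos (by linarith : (0:ℝ) < ℓ) (by linarith : (0:ℝ) < ℓ)]
    have : 0 ≤ ℓ := by linarith
    linarith
  have hKL : 8*C*L + 50 * L ≤ D := by rw [hK] at hD; linarith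
  have hCL0 : 0 < C * L := by positivity
  have hD0 : (0:ℝ) < D := by linarith
  have hN0 : (0:ℝ) ≤ N := by positivity
  have e7 : Real.exp 7 ≥ 200 := by
    have : Real.exp 7 = (Real.exp 1)^7 := by rw [← Real.exp_nat_mul]; norm_num
    rw [this]
    have h1 : (2:ℝ)^7 ≤ 2.7^7 := by norm_num
    have h2 : (2.7:ℝ)^7 ≤ (Real.exp 1)^7 := by
      gcongr; linarith [Real.exp_one_gt_d9]
    refine le_trans ?_ h2
    norm_num
  have p1 : (D:ℝ)^2 * (2 * N * (Real.exp 1 * (2 * L) / D)^D) ≤ N * (Real.exp (-(8*C*L)) / 100) := by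
    have hx : Real.exp 1 * (2*L) / D ≤ Real.exp (-2) := by
      rw [div_le_iff₀ hD0]
      have e3 : Real.exp 1 * 2 ≤ 50 * Real.exp (-2) := by
        have : Real.exp 1 = Real.exp 3 * Real.exp (-2) := by rw [← Real.exp_add]; norm_num
        rw [this]
        have e : Real.exp 3 = (Real.exp 1)^3 := by rw [← Real.exp_nat_mul]; norm_num
        have h9 := Real.exp_one_lt_d9
        have h8 : (Real.exp 1)^3 ≤ 2.7182818286^3 := by gcongr
        have : Real.exp 3 * 2 ≤ 50 := by rw [e]; norm_num at h8 ⊢; linarith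
        nlinarith [Real.exp_pos (-2)]
      calc Real.exp 1 * (2*L) = (Real.exp 1 * 2) * L := by ring
        _ ≤ (50 * Real.exp (-2)) * L := by gcongr
        _ = Real.exp (-2) * (50 * L) := by ring
        _ ≤ _ := by gcongr; linarith
    have h2 : (D:ℝ)^2 ≤ 2 * Real.exp D := by
      have := Real.quadratic_le_exp_of_nonneg hD0.le
      nlinarith
    have h3 : (Real.exp 1 * (2 * L) / D)^D ≤ Real.exp (-(2*D)) := by
      calc _ ≤ (Real.exp (-2))^D := by gcongr
        _ = Real.exp (-(2*D)) := by rw [← Real.exp_nat_mul]; ring_nf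
    calc (D:ℝ)^2 * (2 * N * (Real.exp 1 * (2 * L) / D)^D) ≤ (2 * Real.exp D) * (2 * N * Real.exp (-(2*D))) := by gcongr
      _ = N * (4 * Real.exp (-D)) := by
          have : Real.exp (-(D:ℝ)) = Real.exp D * Real.exp (-(2*D)) := by rw [← Real.exp_add]; ring_nf
          rw [this]; ring
      _ ≤ N * (Real.exp (-(8*C*L)) / 100) := by
          gcongr
          have h4 : Real.exp (-(D:ℝ)) ≤ Real.exp (-(8*C*L)) * Real.exp (-7) * Real.exp (-7) := by
            rw [← Real.exp_add, ← Real.exp_add]; apply Real.exp_le_exp.2; linarith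
          have h5 : Real.exp (-7) ≤ 1/200 := by
            rw [Real.exp_neg, inv_eq_one_div]; exact one_div_le_one_div_of_le (by norm_num) e7
          have h6 := Real.exp_pos (-(8*C*L))
          have h7 := Real.exp_pos (-7)
          have h8 : Real.exp (-7) * Real.exp (-7) ≤ 1/200 * (1/200) := by gcongr
          have h9 : Real.exp (-(8*C*L)) * (Real.exp (-7) * Real.exp (-7)) ≤ Real.exp (-(8*C*L)) * (1/200*(1/200)) := by gcongr
          nlinarith
  have p2 : (D:ℝ)^2 * (4 * h * N * Real.exp (-(E/4))) ≤ N * (Real.exp (-(8*C*L)) / 100) := by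
    calc (D:ℝ)^2 * (4 * h * N * Real.exp (-(E/4))) ≤ h^2 * (4 * h * N * Real.exp (-(E/4))) := by gcongr
      _ = N * (4 * h^3 * Real.exp (-(E/4))) := by ring
      _ ≤ N * (Real.exp (-(8*C*L)) / 100) := by
          gcongr
          rw [le_div_iff₀ (by norm_num)]
          have h4 : 4 * h^3 * Real.exp (-(E/4)) * 100 ≤ h^5 * Real.exp (-(E/4)) := by
            have : 4 * h^3 * 100 ≤ h^5 := by
              have h5 : (400:ℝ) ≤ h^2 := by nlinarith
              calc 4 * h^3 * 100 = 400 * h^3 := by ring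
                _ ≤ h^2 * h^3 := by gcongr
                _ = _ := by ring
            calc _ = (4 * h^3 * 100) * Real.exp (-(E/4)) := by ring
              _ ≤ _ := by gcongr
          refine h4.trans ?_
          rw [hpow_exp hh0, ← Real.exp_add]
          apply Real.exp_le_exp.2
          rw [← hℓ]
          push_cast
          linarith
  linarith
end MC


namespace MC
open Finset Classical Matrix

lemma R_param {h E : ℝ} (hl : 40 ≤ Real.log h) (hE1 : 1192000 * Real.log h^3 ≤ E) :
    ∃ a : ℕ, 2000 * Real.log h * 2^a ≤ E ∧ E ≤ 4000 * Real.log h * 2^a := by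
  set ℓ := Real.log h with hℓ
  have h0 : 0 < ℓ := by linarith
  have h1 : 2000 * ℓ ≤ E := by
    refine le_trans ?_ hE1
    have : ℓ * 1 ≤ ℓ * ℓ^2 := mul_le_mul_of_nonneg_left (by nlinarith) h0.le
    have : ℓ * ℓ^2 = ℓ^3 := by ring
    linarith
  obtain ⟨a, ha1, ha2⟩ := exists_nat_pow_near (x := E / (2000 * ℓ)) (y := (2:ℝ)) (by
    rw [le_div_iff₀ (by positivity)]; linarith) (by norm_num)
  rw [le_div_iff₀ (by positivity)] at ha1
  rw [div_lt_iff₀ (by positivity), pow_succ] at ha2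
  exact ⟨a, by linarith, by linarith⟩

lemma l_param {h E : ℝ} (hh : 100 ≤ h) (hE3 : 8 * Real.log h ≤ E) :
    ∃ l : ℕ, 1 ≤ l ∧ 2 * h^2 * l ≤ Real.exp E ∧ 2 / (l:ℝ) * (1 + h) ≤ Real.exp (-(E/2)) := by
  have hh0 : 0 < h := by linarith
  have h4 : h^4 ≤ Real.exp (E/2) := by
    rw [hpow_exp hh0]; apply Real.exp_le_exp.2; push_cast; linarith
  have hEE : Real.exp E = Real.exp (E/2) * Real.exp (E/2) := by rw [← Real.exp_add]; ring_nf
  have h44 : h^4 * 1 ≤ Real.exp (E/2) * Real.exp (E/2) :=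
    mul_le_mul h4 (le_trans (one_le_pow₀ (by linarith)) h4) (by norm_num) (Real.exp_pos _).le
  have h2 : (10000:ℝ) ≤ h^2 := by nlinarith
  have h40 : 10000 * h^2 ≤ h^4 := by
    calc 10000 * h^2 ≤ h^2 * h^2 := by gcongr
      _ = _ := by ring
  set y := Real.exp E / (2 * h^2) with hy
  have hy2 : 2 ≤ y := by
    rw [hy, le_div_iff₀ (by positivity), hEE]; linarith
  have hl1 : y < (⌊y⌋₊:ℝ) + 1 := Nat.lt_floor_add_one y
  have hl2 : (⌊y⌋₊:ℝ) ≤ y := Nat.floor_le (by linarith)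
  have hl3 : y / 2 ≤ (⌊y⌋₊:ℝ) := by linarith
  have hlpos : (0:ℝ) < (⌊y⌋₊:ℝ) := by linarith
  refine ⟨⌊y⌋₊, by exact_mod_cast hlpos, ?_, ?_⟩
  · rw [hy, le_div_iff₀ (by positivity)] at hl2
    linarith
  · have hq : Real.exp (-(E/2)) * Real.exp (E/2) = 1 := by rw [← Real.exp_add]; simp
    rw [div_mul_eq_mul_div, div_le_iff₀ hlpos]
    have h5 : Real.exp (-(E/2)) * (y/2) ≤ Real.exp (-(E/2)) * (⌊y⌋₊:ℝ) := by gcongr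
    refine le_trans ?_ h5
    have h6 : Real.exp (-(E/2)) * (y/2) = Real.exp (E/2) / (4 * h^2) := by
      rw [hy, hEE]
      calc _ = (Real.exp (-(E/2)) * Real.exp (E/2)) * Real.exp (E/2) / (4*h^2) := by field_simp; norm_num
        _ = _ := by rw [hq, one_mul]
    rw [h6, le_div_iff₀ (by positivity)]
    refine le_trans ?_ h4
    have h7 : 2 * (1+h) * 4 ≤ h^2 := by nlinarith
    calc 2 * (1+h) * (4*h^2) = (2 * (1+h) * 4) * h^2 := by ring
      _ ≤ h^2 * h^2 := by gcongr
      _ = _ := by ring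

lemma err_num {N : ℕ} {C L : ℝ} (hL : 0 ≤ L) :
    Real.sqrt (Real.sqrt ((N * Real.exp (4*C*L)) * (N * (Real.exp (-(8*C*L)) / 50))) *
      Real.sqrt ((N * Real.exp (4*C*L)) * (50 * L^2 * N))) ≤ Real.sqrt L * N := by
  rw [← Real.sqrt_mul (by positivity)]
  have e : (N * Real.exp (4*C*L)) * (N * (Real.exp (-(8*C*L)) / 50)) * ((N * Real.exp (4*C*L)) * (50 * L^2 * N)) =
      ((Real.sqrt L * N)^2)^2 := by
    have h1 : Real.exp (4*C*L) * Real.exp (4*C*L) * Real.exp (-(8*C*L)) = 1 := by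
      rw [← Real.exp_add, ← Real.exp_add]; ring_nf; simp
    rw [mul_pow, Real.sq_sqrt hL]
    calc _ = (Real.exp (4*C*L) * Real.exp (4*C*L) * Real.exp (-(8*C*L))) * (L * (N:ℝ)^2)^2 := by ring
      _ = _ := by rw [h1, one_mul]
  rw [e, Real.sqrt_sq (by positivity), Real.sqrt_sq (by positivity)]

lemma bad_num {N M D a : ℕ} {h C L c : ℝ} (hh : 100 ≤ h) (hD : (D:ℝ) ≤ h) (ha : 2 * (2:ℝ)^a ≤ h) (hM : M ≤ N)
    (hc0 : c ≤ 2^a * (((N+M:ℕ):ℝ) * Real.exp (-2*h))) (hC : Real.log h + 2 * C * L ≤ h/2) (hlh : Real.log h ≤ h) :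
    D * Real.sqrt (N * Real.exp (4*C*L)) * Real.sqrt c ≤ N := by
  have hh0 : 0 < h := by linarith
  have hM' : (M:ℝ) ≤ N := by exact_mod_cast hM
  have hc : c ≤ h * N * Real.exp (-2*h) := by
    refine hc0.trans ?_
    push_cast
    calc (2:ℝ)^a * (((N:ℝ)+M) * Real.exp (-2*h)) ≤ (2:ℝ)^a * (((N:ℝ)+N) * Real.exp (-2*h)) := by gcongr
      _ = (2 * (2:ℝ)^a) * (N * Real.exp (-2*h)) := by ring
      _ ≤ h * (N * Real.exp (-2*h)) := by gcongr
      _ = _ := by ring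
  rw [mul_assoc, ← Real.sqrt_mul (by positivity)]
  have h1 : Real.sqrt (N * Real.exp (4*C*L) * c) ≤ N * (1 / h) := by
    rw [Real.sqrt_le_left (by positivity)]
    calc N * Real.exp (4*C*L) * c ≤ N * Real.exp (4*C*L) * (h * N * Real.exp (-2*h)) := by gcongr
      _ = (N:ℝ)^2 * (h * (Real.exp (4*C*L) * Real.exp (-2*h))) := by ring
      _ ≤ (N:ℝ)^2 * (1/h)^2 := by
          gcongr
          rw [div_pow, one_pow, le_div_iff₀ (by positivity)]
          have e : h * (Real.exp (4*C*L) * Real.exp (-2*h)) * h^2 = h^3 * (Real.exp (4*C*L) * Real.exp (-2*h)) := by ring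
          rw [e, hpow_exp hh0, ← Real.exp_add, ← Real.exp_add, Real.exp_le_one_iff]
          push_cast
          linarith
      _ = _ := by ring
  calc (D:ℝ) * Real.sqrt (N * Real.exp (4*C*L) * c) ≤ h * (N * (1/h)) := by gcongr
    _ = N := by field_simp

lemma B_num {h : ℝ} {D R R0 : ℕ} (hh : 100 ≤ h) (hl : 0 < Real.log h) (hD : 2 * (D:ℝ) ≤ h) (hR0 : (R0:ℝ) * (2 * Real.log h) ≤ R) :
    (2*(D:ℝ))^R0 ≤ Real.exp R := by
  calc (2*(D:ℝ))^R0 ≤ h^R0 := by gcongr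
    _ = Real.exp (R0 * Real.log h) := hpow_exp (by linarith) _
    _ ≤ Real.exp R := by
      apply Real.exp_le_exp.2
      have : 0 ≤ (R0:ℝ) * Real.log h := by positivity
      linarith

lemma Gc_num {G : ℝ} (hG : 0 ≤ G) (a : ℕ) :
    2 * Real.exp ((2^a : ℕ):ℝ) * (2*G)^(2^a) ≤ (4 * Real.exp 1 * G)^(2^a) := by
  have h1 : Real.exp ((2^a:ℕ):ℝ) = (Real.exp 1)^(2^a) := by rw [← Real.exp_nat_mul, mul_one]
  have h2 : (2:ℝ) ≤ 2^(2^a) := by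
    calc (2:ℝ) = 2^1 := by norm_num
      _ ≤ 2^(2^a) := pow_le_pow_right₀ (by norm_num) Nat.one_le_two_pow
  have e : (4 * Real.exp 1 * G)^(2^a) = 2^(2^a) * (Real.exp 1)^(2^a) * (2*G)^(2^a) := by
    rw [← mul_pow, ← mul_pow]; ring_nf
  rw [h1, e]
  gcongr
end MC


namespace MC
open Finset Classical Matrix

/-- bound for functions supported on nice integers -/
theorem St_nice {P : Finset ℕ} {τ : ℤ} {N D Hn a l : ℕ} {h E L G C : ℝ} (hh : 100 ≤ h) (hl : 40 ≤ Real.log h)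
    (hE1 : 1192000 * Real.log h^3 ≤ E)
    (hE2 : 8080 * h * Real.log h^3 ≤ E^2) (hL : 1 ≤ L) (hLh : 4 * L ≤ h) (hCL : Real.log h + 2 * C * L ≤ h/2)
    (ha1 : 2000 * Real.log h * 2^a ≤ E) (ha2 : E ≤ 4000 * Real.log h * 2^a) (hEh : E ≤ h)
    (hl1 : 1 ≤ l) (hlP : ∀ p ∈ P, 2 * h^2 * l ≤ p) (hPp : ∀ p ∈ P, p.Prime) (hPH : ∀ p ∈ P, p ≤ Hn)
    (hQ : 2 / (l:ℝ) * ∑ t ∈ Icc 1 Hn, 1 / (t:ℝ) ≤ Real.exp (-(E/2)))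
    (hPL : ∑ p ∈ P, 1 / (p:ℝ) ≤ L)
    (hHn : (Hn:ℝ) ≤ Real.exp h) (hHn2 : 2 ≤ Hn) (hPc : P.card + 1 ≤ Hn) (hN : Real.exp (L * h^2) ≤ N)
    (hD1 : 1 ≤ D) (hD2 : 2 * (D:ℝ) ≤ h) (hDH : D ≤ Hn)
    (hG : Real.exp 6002 * Real.sqrt (2*L) ≤ G) (hG1 : 1 ≤ G) (hG3 : 2 ≤ G^2) (hG2 : (D:ℝ) ≤ G^2)
    (f g : ℤ → ℝ) (hf : ∀ n, n ∉ II N → f n = 0) (hg : ∀ n, n ∉ II N → g n = 0)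
    (hfn : ∀ n, f n ≠ 0 → nice P τ D (2^a) n) (hgn : ∀ n, g n ≠ 0 → nice P τ D (2^a) n)
    (hf2 : ∑ n ∈ II N, (f n)^2 ≤ N) (hg2 : ∑ n ∈ II N, (g n)^2 ≤ N)
    (hf4 : ∑ n ∈ II N, (f n)^4 ≤ N * Real.exp (4*C*L)) (hg4 : ∑ n ∈ II N, (g n)^4 ≤ N * Real.exp (4*C*L)) :
    |St P τ N f g| ≤ (4 * Real.exp 1 * G + 2) * N := by
  have hh0 : 0 < h := by linarith
  have hl0 : 0 < Real.log h := by linarith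
  have hN2 : Hn^2 ≤ N := pow_le_N hh0.le hHn hN (by push_cast; nlinarith)
  set M : ℕ := Hn^2 with hM
  have hMe : (M:ℝ) ≤ Real.exp (2*h) := by
    have : Real.exp (2*h) = (Real.exp h)^2 := by rw [← Real.exp_nat_mul]; norm_num
    rw [this, hM]; push_cast; gcongr
  have hHM : Hn ≤ M := by rw [hM]; nlinarith
  have ha3 : 80000 * (2:ℝ)^a ≤ h := by
    have : 80000 * (2:ℝ)^a ≤ 2000 * Real.log h * 2^a := by
      apply mul_le_mul_of_nonneg_right _ (by positivity); linarith
    linarith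
  set R0 : ℕ := ⌊(2:ℝ)^a / (2 * Real.log h)⌋₊ with hR0
  have hR0' : (R0:ℝ) * (2 * Real.log h) ≤ ((2^a : ℕ):ℝ) := by
    rw [← le_div_iff₀ (by positivity)]; push_cast
    exact Nat.floor_le (by positivity)
  have hjE : ∀ j : ℕ, R0 < j → E ≤ 8000 * Real.log h^2 * j := by
    intro j hj
    have h1 : (2:ℝ)^a / (2 * Real.log h) < j := Nat.lt_of_floor_lt hj
    rw [div_lt_iff₀ (by positivity)] at h1
    refine ha2.trans ?_
    calc 4000 * Real.log h * 2^a ≤ 4000 * Real.log h * (j * (2 * Real.log h)) := by gcongr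
      _ = _ := by ring
  have hpar : ∀ j : ℕ, ∃ e : ℕ, R0 < j → j ≤ 2^a → 1 ≤ e ∧
      ∑ b ∈ Ico ((N:ℤ)+1-M) ((N:ℤ)+1-M+(N+M:ℕ)), trace ((Zm P (Am P τ D M b) j)^(2^e)) ≤
        (((N+M:ℕ):ℝ) * Real.exp (-2*h)) * (G^j)^(2^e) := by
    intro j
    by_cases hj : R0 < j ∧ j ≤ 2^a
    · have hj2 : 2400 * (j:ℝ) ≤ h := by
        have : (j:ℝ) ≤ 2^a := by exact_mod_cast hj.2
        linarith [pow_pos (by norm_num : (0:ℝ) < 2) a]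
      obtain ⟨e, m, he1, hm, hn1, hn2, hT, hTr⟩ := tr_param (P := P) (T := N+M) (M := M) hh hl hE1 hE2 hL hLh (hjE j hj.1) hj2 hN (by omega) hHn hHn2 hPc hMe hG
      refine ⟨e, fun _ _ => ⟨he1, ?_⟩⟩
      refine le_trans (trace_bound (n := 2^e*j) rfl (by omega) hn2 τ hl1 P ?_ hPp (by omega) L _ hPL hL hQ D M _ (N+M) m hm hT) hTr
      intro p hp
      refine ⟨?_, hPH p hp⟩
      have h1 : (2 * ((2^e*j:ℕ):ℝ)^2 * l) ≤ p := by
        refine le_trans ?_ (hlP p hp)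
        gcongr
      exact_mod_cast h1
    · exact ⟨0, fun h1 h2 => absurd ⟨h1, h2⟩ hj⟩
  choose qe hqe using hpar
  obtain ⟨bad, hbad1, hbad2⟩ := bad_exists hG1 a R0 qe (fun j h1 h2 => (hqe j h1 h2).1) (by positivity) (fun j h1 h2 => (hqe j h1 h2).2)
  have hB1 : (1:ℝ) ≤ Real.exp ((2^a:ℕ):ℝ) := Real.one_le_exp (by positivity)
  have hw := window_bound (D := D) hHM hD1 hPH f g hf hg (fun n hn => (hfn n hn).1) (fun n hn => (hgn n hn).1) hf2 hg2 hf4 hg4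
    (4 * Real.exp 1 * G) (by positivity) bad (by
      intro b hb hbb
      exact good_b hD1 f g hB1 hG1 hG3 hG2 a R0 (B_num hh hl0 hD2 hR0') hfn hgn qe (fun j h1 h2 => (hqe j h1 h2).1)
        (hbad2 b hb hbb) (by positivity) (Gc_num (by linarith) a))
  have hlogh : Real.log h ≤ h := (Real.log_le_sub_one_of_pos hh0).trans (by linarith)
  have hbn := bad_num (N := N) (M := M) (D := D) (a := a) hh (by linarith [Nat.cast_nonneg (α := ℝ) D]) (by linarith [pow_pos (by norm_num : (0:ℝ) < 2) a]) hN2 hbad1 hCL hlogh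
  have hHn0 : (0:ℝ) < Hn := by exact_mod_cast (by omega : 0 < Hn)
  have hM0 : (0:ℝ) < M := by rw [hM]; push_cast; positivity
  have h3 : (Hn:ℝ) * (D * N) ≤ M * N := by
    have : (D:ℝ) ≤ Hn := by exact_mod_cast hDH
    calc (Hn:ℝ) * (D * N) ≤ Hn * (Hn * N) := by gcongr
      _ = M * N := by rw [hM]; push_cast; ring
  have h4 : (D:ℝ) * M * Real.sqrt (N * Real.exp (4*C*L)) * Real.sqrt bad.card ≤ M * N := by
    calc _ = M * (D * Real.sqrt (N * Real.exp (4*C*L)) * Real.sqrt bad.card) := by ring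
      _ ≤ _ := by gcongr
  have h5 : M * |St P τ N f g| ≤ M * ((4 * Real.exp 1 * G + 2) * N) := by
    calc M * |St P τ N f g| ≤ _ := hw
      _ ≤ 4 * Real.exp 1 * G * M * N + M * N + M * N := by gcongr
      _ = _ := by ring
  exact le_of_mul_le_mul_left h5 hM0
end MC


namespace MC
open Finset Classical Matrix

lemma sum_ite_pow_le {N k : ℕ} (hk : Even k) (hk0 : k ≠ 0) (f : ℤ → ℝ) (gd : ℤ → Prop) {A : ℝ} (h : ∑ n ∈ II N, (f n)^k ≤ A) :
    ∑ n ∈ II N, (if gd n then f n else 0)^k ≤ A := by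
  refine le_trans (Finset.sum_le_sum fun n _ => ?_) h
  split_ifs
  · exact le_rfl
  · rw [zero_pow hk0]; exact hk.pow_nonneg _

set_option maxHeartbeats 2000000 in
theorem St_big (C : ℝ) (hC : 0 < C) : ∃ h0 : ℝ, 100 ≤ h0 ∧ ∃ Cg : ℝ, 0 < Cg ∧ ∀ (P : Finset ℕ) (τ : ℤ) (N : ℕ) (H0 H L : ℝ) (f g : ℤ → ℝ),
    1 ≤ H0 → H0 ≤ H → h0 ≤ Real.log H → Real.log H ^ ((2 : ℝ) / 3) * Real.log (Real.log H) ^ 2 ≤ Real.log H0 →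
    (∀ p ∈ P, Nat.Prime p ∧ H0 ≤ (p : ℝ) ∧ (p : ℝ) ≤ H) → L = ∑ p ∈ P, (1 : ℝ) / (p : ℝ) → 1 ≤ L →
    Real.exp (L * (Real.log H)^2) ≤ N → (∀ n, n ∉ II N → f n = 0) → (∀ n, n ∉ II N → g n = 0) →
    ∑ n ∈ II N, (f n)^2 ≤ N → ∑ n ∈ II N, (g n)^2 ≤ N →
    ∑ n ∈ II N, (f n)^4 ≤ N * Real.exp (4*C*L) → ∑ n ∈ II N, (g n)^4 ≤ N * Real.exp (4*C*L) →
    |St P τ N f g| ≤ Cg * Real.sqrt L * N := by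
  obtain ⟨h0, hh0, hpar⟩ := params C (8*C+50) hC (by linarith)
  set K := 8 * C + 50 with hK
  refine ⟨h0, hh0, 4 * Real.exp 1 * (Real.exp 6002 * Real.sqrt (4*K)) + 4, by positivity, ?_⟩
  intro P τ N H0 H L f g h1 h2 h3 h4 hP hL hL1 hN hf hg hf2 hg2 hf4 hg4
  set h := Real.log H with hh
  set E := Real.log H0 with hE
  have hH0 : 0 < H := by linarith
  have hEh : E ≤ h := Real.log_le_log (by linarith) h2
  have hLE : L * E ≤ h + 2 := by rw [hL]; exact L_le h1 h2 hP
  obtain ⟨p1, p2, p3, p4, p5, p6⟩ := hpar h E L h3 h4 hEh hL1 hLE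
  have h100 : 100 ≤ h := hh0.trans h3
  have hK50 : 50 ≤ K := by linarith
  have hKL : 50 * L ≤ K * L := by gcongr
  have hLh : 4 * L ≤ h := by linarith
  obtain ⟨a, ha1, ha2⟩ := R_param p1 p2
  have hE3 : 8 * Real.log h ≤ E := by
    refine le_trans ?_ p2
    have : Real.log h * 1 ≤ Real.log h * (Real.log h)^2 := mul_le_mul_of_nonneg_left (by nlinarith) (by linarith)
    have : Real.log h * (Real.log h)^2 = (Real.log h)^3 := by ring
    linarith
  obtain ⟨l, hl1, hl2, hl3⟩ := l_param h100 hE3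
  have hexpE : Real.exp E = H0 := Real.exp_log (by linarith)
  have hexph : Real.exp h = H := Real.exp_log hH0
  set Hn := ⌊H⌋₊ with hHn
  have hHn1 : (Hn:ℝ) ≤ Real.exp h := by rw [hexph]; exact Nat.floor_le hH0.le
  have hHn2 : h ≤ Hn := by
    have := Nat.lt_floor_add_one H
    have := Real.add_one_le_exp h
    rw [hexph] at this
    linarith
  have hHn3 : 2 ≤ Hn := by
    have : (2:ℝ) ≤ Hn := by linarith
    exact_mod_cast this
  have hPp : ∀ p ∈ P, p.Prime := fun p hp => (hP p hp).1
  have hPH : ∀ p ∈ P, p ≤ Hn := fun p hp => Nat.le_floor (hP p hp).2.2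
  have hPc : P.card + 1 ≤ Hn := by
    have : P ⊆ Icc 2 Hn := fun p hp => mem_Icc.2 ⟨(hPp p hp).two_le, hPH p hp⟩
    have := card_le_card this
    rw [Nat.card_Icc] at this
    omega
  set D := ⌈K * L⌉₊ with hD
  have hD1 : K * L ≤ D := Nat.le_ceil _
  have hD2 : (D:ℝ) ≤ K * L + 1 := (Nat.ceil_lt_add_one (by positivity)).le
  have hD3 : 2 ≤ D := by
    have : (2:ℝ) ≤ D := by linarith
    exact_mod_cast this
  have hD4 : 2 * (D:ℝ) ≤ h := by linarith
  have hDh : (D:ℝ) ≤ h := by linarith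
  have hDH : D ≤ Hn := by
    have : (D:ℝ) ≤ Hn := by linarith
    exact_mod_cast this
  have hPL : ∑ p ∈ P, 1 / (p:ℝ) ≤ L := hL.ge
  have hh0' : 0 ≤ h := by linarith
  have hLhh : h ≤ L * h := le_mul_of_one_le_left hh0' hL1
  have ha3 : 80000 * (2:ℝ)^a ≤ h := by
    have : 80000 * (2:ℝ)^a ≤ 2000 * Real.log h * 2^a := by
      apply mul_le_mul_of_nonneg_right _ (by positivity); linarith
    linarith
  have ha0 : (0:ℝ) < 2^a := by positivity
  have hND : Hn^D ≤ N := pow_le_N hh0' hHn1 hN (by linarith)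
  have hN2 : Hn^2 ≤ N := pow_le_N hh0' hHn1 hN (by push_cast; linarith)
  have hNR : Hn^(2^a) ≤ N := pow_le_N hh0' hHn1 hN (by push_cast; linarith)
  have hQ : 2 / (l:ℝ) * ∑ t ∈ Icc 1 Hn, 1 / (t:ℝ) ≤ Real.exp (-(E/2)) := by
    refine le_trans ?_ hl3
    gcongr
    exact harm_le (by omega) (by rw [← hexph]; exact hHn1)
  have hlP : ∀ p ∈ P, 2 * h^2 * l ≤ p := fun p hp => by
    rw [hexpE] at hl2; exact hl2.trans (hP p hp).2.1
  have hP2 : ∀ p ∈ P, 2 * (2^a)^2 * l ≤ p ∧ p ≤ Hn := by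
    intro p hp
    refine ⟨?_, hPH p hp⟩
    have h1 : (2 * (((2:ℝ)^a))^2 * l) ≤ p := by
      refine le_trans ?_ (hlP p hp)
      gcongr
      linarith
    exact_mod_cast h1
  -- exceptional integers
  have t1 := tail_sq (τ := τ) hPH hPp (by linarith) hPL hD3 hND
  have t2 := rep_density (P := P) (τ := τ) (D := D) hl1 hP2 hPp (by omega) L _ hPL hL1 hQ ((N:ℤ)+1) N hNR
  have t3 := rep_num (N := N) (R := 2^a) h100 p1 p2 hL1 hLh (by push_cast; exact ha1) (by push_cast; linarith)
  have t4 := nonnice_sq (R := 2^a) t1 (t2.trans t3) (fun n => ¬ nice P τ D (2^a) n) (fun n => Iff.rfl)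
  have t5 := beta_num (N := N) h100 p1 p2 hC hL1 p4 hK hD1 hDh
  have t6 := second_moment (τ := τ) (by omega) hPH hPp hL1 hPL hN2
  have t7 := St_restrict f g hg hf4 hg4 (fun n => nice P τ D (2^a) n) (fun n => ¬ nice P τ D (2^a) n) (fun n => Iff.rfl) (t4.trans t5) t6
  have t8 := err_num (N := N) (C := C) (L := L) (by linarith)
  -- main
  set G := Real.exp 6002 * Real.sqrt (4 * K * L) with hG
  have he1 : (1:ℝ) ≤ Real.exp 6002 := Real.one_le_exp (by norm_num)
  have hGsq : 4 * K * L ≤ G^2 := by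
    rw [hG, mul_pow, Real.sq_sqrt (by positivity)]
    exact le_mul_of_one_le_left (by positivity) (one_le_pow₀ he1)
  have hG1 : 1 ≤ G := by
    have : (1:ℝ) ≤ Real.sqrt (4*K*L) := by rw [Real.one_le_sqrt]; linarith
    exact one_le_mul_of_one_le_of_one_le he1 this
  have hGG : Real.exp 6002 * Real.sqrt (2*L) ≤ G := by
    rw [hG]; gcongr; linarith
  have t9 := St_nice (τ := τ) (D := D) (a := a) (C := C) h100 p1 p2 p3 hL1 hLh p6 ha1 ha2 hEh hl1 hlP hPp hPH hQ hPL hHn1 hHn3 hPc hN (by omega) hD4 hDH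
    hGG hG1 (by linarith) (by linarith)
    (fun n => if nice P τ D (2^a) n then f n else 0) (fun n => if nice P τ D (2^a) n then g n else 0)
    (fun n hn => by simp only [hf n hn, ite_self]) (fun n hn => by simp only [hg n hn, ite_self])
    (fun n hn => by by_contra h'; simp [h'] at hn) (fun n hn => by by_contra h'; simp [h'] at hn)
    (sum_ite_pow_le (by decide) (by norm_num) f _ hf2) (sum_ite_pow_le (by decide) (by norm_num) g _ hg2)
    (sum_ite_pow_le (by decide) (by norm_num) f _ hf4) (sum_ite_pow_le (by decide) (by norm_num) g _ hg4)
  have hsL : 1 ≤ Real.sqrt L := by rw [Real.one_le_sqrt]; exact hL1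
  have hGe : G = Real.exp 6002 * Real.sqrt (4*K) * Real.sqrt L := by
    rw [hG, Real.sqrt_mul (by positivity), mul_assoc]
  have hN0 : (0:ℝ) ≤ N := by positivity
  have hNs : (N:ℝ) ≤ Real.sqrt L * N := le_mul_of_one_le_left hN0 hsL
  rw [hGe] at t9
  calc |St P τ N f g| ≤ (4 * Real.exp 1 * (Real.exp 6002 * Real.sqrt (4*K) * Real.sqrt L) + 2) * N + 2 * (Real.sqrt L * N) := by linarith
    _ ≤ 4 * Real.exp 1 * (Real.exp 6002 * Real.sqrt (4*K) * Real.sqrt L) * N + 4 * (Real.sqrt L * N) := by linarith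
    _ = _ := by ring

theorem St_all (C : ℝ) (hC : 0 < C) : ∃ Cg : ℝ, 0 < Cg ∧ ∀ (P : Finset ℕ) (τ : ℤ) (N : ℕ) (H0 H L : ℝ) (f g : ℤ → ℝ),
    1 ≤ H0 → H0 ≤ H → Real.log H ^ ((2 : ℝ) / 3) * Real.log (Real.log H) ^ 2 ≤ Real.log H0 →
    (∀ p ∈ P, Nat.Prime p ∧ H0 ≤ (p : ℝ) ∧ (p : ℝ) ≤ H) → L = ∑ p ∈ P, (1 : ℝ) / (p : ℝ) → Real.exp 1 ≤ L →
    Real.exp (L * (Real.log H)^2) ≤ N → (∀ n, n ∉ II N → f n = 0) → (∀ n, n ∉ II N → g n = 0) →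
    ∑ n ∈ II N, (f n)^2 ≤ N → ∑ n ∈ II N, (g n)^2 ≤ N →
    ∑ n ∈ II N, (f n)^4 ≤ N * Real.exp (4*C*L) → ∑ n ∈ II N, (g n)^4 ≤ N * Real.exp (4*C*L) →
    |St P τ N f g| ≤ Cg * Real.sqrt L * N := by
  obtain ⟨h0, hh0, Cg, hCg, hbig⟩ := St_big C hC
  set A := Real.sqrt (50 * Real.exp (4*C*(1+h0))) * (1 + h0) with hA
  have hA0 : 0 < A := by positivity
  refine ⟨Cg + A, by positivity, ?_⟩
  intro P τ N H0 H L f g h1 h2 h4 hP hL hLe hN hf hg hf2 hg2 hf4 hg4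
  have he := Real.exp_one_gt_d9
  have hL1 : 1 ≤ L := by linarith
  have hN0 : (0:ℝ) ≤ N := by positivity
  have hsL : 1 ≤ Real.sqrt L := by rw [Real.one_le_sqrt]; exact hL1
  by_cases hb : h0 ≤ Real.log H
  · refine (hbig P τ N H0 H L f g h1 h2 hb h4 hP hL hL1 hN hf hg hf2 hg2 hf4 hg4).trans ?_
    gcongr; linarith
  · push Not at hb
    have hH0 : 0 < H := by linarith
    have hLh : L ≤ 1 + Real.log H := by rw [hL]; exact L_le' h1 h2 hP
    have hL2 : L ≤ 1 + h0 := by linarith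
    have hexph : Real.exp (Real.log H) = H := Real.exp_log hH0
    have hPp : ∀ p ∈ P, p.Prime := fun p hp => (hP p hp).1
    have hPH : ∀ p ∈ P, p ≤ ⌊H⌋₊ := fun p hp => Nat.le_floor (hP p hp).2.2
    have hHn1 : ((⌊H⌋₊:ℕ):ℝ) ≤ Real.exp (Real.log H) := by rw [hexph]; exact Nat.floor_le hH0.le
    have hN2 : ⌊H⌋₊^2 ≤ N := pow_le_N (by linarith) hHn1 hN (by push_cast; nlinarith)
    have t6 := second_moment (τ := τ) (Nat.one_le_floor_iff _ |>.2 (h1.trans h2)) hPH hPp hL1 hL.ge hN2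
    have t7 := St_crude f g hg hf4 hg4 (bu := fun _ => True) (bg := fun _ => True) (fun _ _ => trivial) (fun _ _ => trivial) (E1 := 50 * L^2 * N) (E2 := 50 * L^2 * N) (by simpa using t6) (by simpa using t6)
    rw [Real.mul_self_sqrt (by positivity)] at t7
    have h5 : |St P τ N f g|^2 ≤ (A * N)^2 := by
      refine t7.trans ?_
      rw [hA, mul_pow, mul_pow, Real.sq_sqrt (by positivity)]
      have : Real.exp (4*C*L) ≤ Real.exp (4*C*(1+h0)) := by gcongr
      calc N * Real.exp (4*C*L) * (50 * L^2 * N) ≤ N * Real.exp (4*C*(1+h0)) * (50 * (1+h0)^2 * N) := by gcongr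
        _ = _ := by ring
    have h6 := abs_le_of_sq_le_sq' h5 (by positivity)
    have h7 : A * N ≤ (Cg + A) * Real.sqrt L * N := by
      have : A * 1 ≤ (Cg + A) * Real.sqrt L := by gcongr; linarith
      gcongr; linarith
    linarith [h6.2]
end MC


namespace MC
open Finset Classical Matrix

lemma count_dvd (n : ℤ) (p k : ℕ) (hp : 0 < p) :
    ∑ t ∈ range (p*k), (if (p:ℤ) ∣ n + (t:ℤ) then (1:ℝ) else 0) = k := by
  rw [Finset.sum_boole]
  have e : ((range (p*k)).filter fun t : ℕ => (p:ℤ) ∣ n + (t:ℤ)).card = ((Ico n (n + (p*k:ℕ))).filter fun x => (p:ℤ) ∣ x).card := by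
    apply Finset.card_bij (fun (t:ℕ) _ => n + (t:ℤ))
    · intro t ht
      simp only [mem_filter, mem_range, mem_Ico] at ht ⊢
      refine ⟨⟨by omega, ?_⟩, ht.2⟩
      have : ((t:ℕ):ℤ) < ((p*k:ℕ):ℤ) := by exact_mod_cast ht.1
      linarith
    · intro a _ b _ h
      have : (a:ℤ) = b := by linarith
      exact_mod_cast this
    · intro x hx
      simp only [mem_filter, mem_Ico] at hx
      refine ⟨(x - n).toNat, ?_, ?_⟩
      · have h1 : (((x-n).toNat:ℕ):ℤ) = x - n := Int.toNat_of_nonneg (by linarith [hx.1.1])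
        simp only [mem_filter, mem_range]
        rw [h1]
        refine ⟨?_, by simpa using hx.2⟩
        have : (((x-n).toNat:ℕ):ℤ) < ((p*k:ℕ):ℤ) := by rw [h1]; linarith [hx.1.2]
        exact_mod_cast this
      · have h1 : (((x-n).toNat:ℕ):ℤ) = x - n := Int.toNat_of_nonneg (by linarith [hx.1.1])
        rw [h1]; ring
  rw [e]
  have h2 := Int.Ico_filter_dvd_card n (n + (p*k:ℕ)) (r := (p:ℤ)) (by exact_mod_cast hp)
  have h3 : ⌈((n + (p*k:ℕ) : ℤ) : ℚ) / ((p:ℤ):ℚ)⌉ = ⌈(n:ℚ) / ((p:ℤ):ℚ)⌉ + k := by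
    rw [← Int.ceil_add_natCast]
    congr 1
    push_cast
    have : (p:ℚ) ≠ 0 := by exact_mod_cast hp.ne'
    field_simp
  rw [h3] at h2
  have h4 : (((Ico n (n + (p*k:ℕ))).filter fun x => (p:ℤ) ∣ x).card : ℤ) = k := by
    rw [h2]; simp
  exact_mod_cast h4

/-- weight -/
noncomputable def ww (p : ℕ) (n : ℤ) : ℝ := (if (p:ℤ) ∣ n then (1:ℝ) else 0) - 1 / (p:ℝ)

noncomputable def Sv (P : Finset ℕ) (N : ℕ) (f g : ℤ → ℝ) : ℝ := ∑ n ∈ II N, ∑ p ∈ P, f n * g (n + p) * ww p n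

lemma sum_al (P : Finset ℕ) (hP : ∀ p ∈ P, p.Prime) {p : ℕ} (hp : p ∈ P) (n : ℤ) :
    ∑ t ∈ range (∏ p ∈ P, p), al (t:ℤ) p n = (∏ p ∈ P, p : ℕ) * ww p n := by
  obtain ⟨k, hk⟩ := Finset.dvd_prod_of_mem (fun p => p) hp
  have hp0 := (hP p hp).pos
  rw [hk]
  simp only [al, Finset.sum_sub_distrib, count_dvd n p k hp0, ww]
  rw [Finset.sum_const, card_range, nsmul_eq_mul]
  have : (p:ℝ) ≠ 0 := by exact_mod_cast hp0.ne'
  push_cast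
  field_simp

lemma Sv_le {P : Finset ℕ} (hP : ∀ p ∈ P, p.Prime) {N : ℕ} {f g : ℤ → ℝ} {B : ℝ} (h : ∀ τ, |St P τ N f g| ≤ B) :
    |Sv P N f g| ≤ B := by
  set W := ∏ p ∈ P, p with hW
  have hW0 : (0:ℝ) < W := by
    have : 0 < W := Finset.prod_pos fun p hp => (hP p hp).pos
    exact_mod_cast this
  have e : ∑ t ∈ range W, St P (t:ℤ) N f g = W * Sv P N f g := by
    simp only [St, Sv]
    rw [Finset.sum_comm, Finset.mul_sum]
    apply Finset.sum_congr rfl; intro n _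
    rw [Finset.sum_comm, Finset.mul_sum]
    apply Finset.sum_congr rfl; intro p hp
    rw [← Finset.mul_sum, sum_al P hP hp]
    ring
  have h2 : |W * Sv P N f g| ≤ W * B := by
    rw [← e]
    refine (Finset.abs_sum_le_sum_abs _ _).trans ?_
    refine (Finset.sum_le_sum fun (t:ℕ) _ => h (t:ℤ)).trans ?_
    rw [Finset.sum_const, card_range, nsmul_eq_mul]
  rw [abs_mul, abs_of_pos hW0] at h2
  exact le_of_mul_le_mul_left h2 hW0

noncomputable def Sg (P : Finset ℕ) (N : ℕ) (σ : ℤ) (f g : ℤ → ℝ) : ℝ := ∑ n ∈ II N, ∑ p ∈ P, f n * g (n + σ * p) * ww p n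

lemma Sg_one (P : Finset ℕ) (N : ℕ) (f g : ℤ → ℝ) : Sg P N 1 f g = Sv P N f g := by
  simp only [Sg, Sv, one_mul]

lemma ww_shift (p : ℕ) (n : ℤ) : ww p (n + p) = ww p n := by
  simp only [ww, dvd_add_self_right]

lemma Sg_neg (P : Finset ℕ) (N : ℕ) (f g : ℤ → ℝ) (hf : ∀ n, n ∉ II N → f n = 0) (hg : ∀ n, n ∉ II N → g n = 0) :
    Sg P N (-1) f g = Sv P N g f := by
  simp only [Sg, Sv]
  rw [Finset.sum_comm, Finset.sum_comm (s := II N)]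
  apply Finset.sum_congr rfl; intro p _
  rw [← tsum_eq_sum (L := SummationFilter.unconditional ℤ) (f := fun n => f n * g (n + -1 * p) * ww p n) (fun n hn => by simp [hf n hn])]
  rw [← tsum_eq_sum (L := SummationFilter.unconditional ℤ) (f := fun n => g n * f (n + p) * ww p n) (fun n hn => by simp [hg n hn])]
  rw [← (Equiv.addRight (p:ℤ)).tsum_eq]
  congr 1
  funext n
  simp only [Equiv.coe_addRight, ww_shift]
  rw [show n + (p:ℤ) + -1 * p = n by ring]
  ring

lemma cplx {P : Finset ℕ} {N : ℕ} {σ : ℤ} {f g : ℤ → ℂ} {B : ℝ}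
    (h1 : |Sg P N σ (fun n => (f n).re) (fun n => (g n).re)| ≤ B) (h2 : |Sg P N σ (fun n => (f n).im) (fun n => (g n).im)| ≤ B)
    (h3 : |Sg P N σ (fun n => (f n).im) (fun n => (g n).re)| ≤ B) (h4 : |Sg P N σ (fun n => (f n).re) (fun n => (g n).im)| ≤ B) :
    ‖∑ n ∈ II N, ∑ p ∈ P, f n * (starRingEnd ℂ) (g (n + σ * p)) * ((ww p n : ℝ) : ℂ)‖ ≤ 4 * B := by
  have e1 : (∑ n ∈ II N, ∑ p ∈ P, f n * (starRingEnd ℂ) (g (n + σ * p)) * ((ww p n : ℝ) : ℂ)).re =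
      Sg P N σ (fun n => (f n).re) (fun n => (g n).re) + Sg P N σ (fun n => (f n).im) (fun n => (g n).im) := by
    simp only [Sg, Complex.re_sum, ← Finset.sum_add_distrib]
    apply Finset.sum_congr rfl; intro n _; apply Finset.sum_congr rfl; intro p _
    simp [Complex.mul_re, Complex.mul_im]
    ring
  have e2 : (∑ n ∈ II N, ∑ p ∈ P, f n * (starRingEnd ℂ) (g (n + σ * p)) * ((ww p n : ℝ) : ℂ)).im =
      Sg P N σ (fun n => (f n).im) (fun n => (g n).re) - Sg P N σ (fun n => (f n).re) (fun n => (g n).im) := by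
    simp only [Sg, Complex.im_sum, ← Finset.sum_sub_distrib]
    apply Finset.sum_congr rfl; intro n _; apply Finset.sum_congr rfl; intro p _
    simp [Complex.mul_re, Complex.mul_im]
    ring
  refine (Complex.norm_le_abs_re_add_abs_im _).trans ?_
  rw [e1, e2]
  have := abs_add_le (Sg P N σ (fun n => (f n).re) (fun n => (g n).re)) (Sg P N σ (fun n => (f n).im) (fun n => (g n).im))
  have := abs_sub (Sg P N σ (fun n => (f n).im) (fun n => (g n).re)) (Sg P N σ (fun n => (f n).re) (fun n => (g n).im))
  linarith

lemma rpow_conv {x y : ℝ} {k : ℕ} (hk : k ≠ 0) (hx : 0 ≤ x) (h : x ^ ((1:ℝ)/(k:ℝ)) ≤ y) : x ≤ y^k := by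
  rw [one_div] at h
  calc x = (x ^ ((k:ℝ)⁻¹))^k := (Real.rpow_inv_natCast_pow hx hk).symm
    _ ≤ y^k := by gcongr

lemma part_le {N k : ℕ} (hk : Even k) {f : ℤ → ℂ} {F : ℤ → ℝ} (hF : ∀ n, |F n| ≤ ‖f n‖) {A : ℝ} (h : ∑ n ∈ II N, ‖f n‖^k ≤ A) :
    ∑ n ∈ II N, (F n)^k ≤ A := by
  refine le_trans (Finset.sum_le_sum fun n _ => ?_) h
  rw [← hk.pow_abs]
  exact pow_le_pow_left₀ (abs_nonneg _) (hF n) k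
end MC

theorem cor_maic :
    ∀ C : ℝ, 0 < C → ∃ C' : ℝ, 0 < C' ∧
      ∀ (N : ℕ) (H₀ H : ℝ) (P : Finset ℕ) (L : ℝ) (f g : ℤ → ℂ),
        0 < N →
        1 ≤ H₀ → H₀ ≤ H →
        Real.log H ^ ((2 : ℝ) / 3) * Real.log (Real.log H) ^ 2 ≤ Real.log H₀ →
        (∀ p ∈ P, Nat.Prime p ∧ H₀ ≤ (p : ℝ) ∧ (p : ℝ) ≤ H) →
        L = ∑ p ∈ P, (1 : ℝ) / (p : ℝ) →
        Real.exp 1 ≤ L →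
        Real.log H ≤ Real.sqrt (Real.log (N : ℝ) / L) →
        (∀ n : ℤ, n ∉ Finset.Ioc (N : ℤ) (2 * (N : ℤ)) → f n = 0) →
        (∀ n : ℤ, n ∉ Finset.Ioc (N : ℤ) (2 * (N : ℤ)) → g n = 0) →
        ((1 / (N : ℝ)) * ∑ n ∈ Finset.Ioc (N : ℤ) (2 * (N : ℤ)), ‖f n‖ ^ 2) ^ ((1 : ℝ) / 2) ≤ 1 →
        ((1 / (N : ℝ)) * ∑ n ∈ Finset.Ioc (N : ℤ) (2 * (N : ℤ)), ‖g n‖ ^ 2) ^ ((1 : ℝ) / 2) ≤ 1 →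
        ((1 / (N : ℝ)) * ∑ n ∈ Finset.Ioc (N : ℤ) (2 * (N : ℤ)), ‖f n‖ ^ 4) ^ ((1 : ℝ) / 4) ≤
          Real.exp (C * L) →
        ((1 / (N : ℝ)) * ∑ n ∈ Finset.Ioc (N : ℤ) (2 * (N : ℤ)), ‖g n‖ ^ 4) ^ ((1 : ℝ) / 4) ≤
          Real.exp (C * L) →
        (1 / ((N : ℝ) * L)) *
            ‖(∑ n ∈ Finset.Ioc (N : ℤ) (2 * (N : ℤ)), ∑ σ ∈ ({-1, 1} : Finset ℤ), ∑ p ∈ P,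
                if (p : ℤ) ∣ n then f n * (starRingEnd ℂ) (g (n + σ * (p : ℤ))) else 0) -
              ∑ n ∈ Finset.Ioc (N : ℤ) (2 * (N : ℤ)), ∑ σ ∈ ({-1, 1} : Finset ℤ), ∑ p ∈ P,
                f n * (starRingEnd ℂ) (g (n + σ * (p : ℤ))) / (p : ℂ)‖ ≤
          C' / Real.sqrt L := by
  intro C hC
  obtain ⟨Cg, hCg, hall⟩ := MC.St_all C hC
  refine ⟨8 * Cg, by positivity, ?_⟩
  intro N H₀ H P L f g hN h1 h2 h3 hP hL hLe hHN hf hg hf2 hg2 hf4 hg4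
  have hN0 : (0:ℝ) < N := by exact_mod_cast hN
  have hN1 : (1:ℝ) ≤ N := by exact_mod_cast hN
  have hL0 : 0 < L := lt_of_lt_of_le (Real.exp_pos 1) hLe
  have hNe : Real.exp (L * (Real.log H)^2) ≤ N := by
    rw [← Real.le_log_iff_exp_le hN0]
    have h5 := (Real.le_sqrt (Real.log_nonneg (h1.trans h2))
      (div_nonneg (Real.log_nonneg hN1) hL0.le)).1 hHN
    rw [le_div_iff₀ hL0] at h5
    linarith
  have conv2 : ∀ u : ℤ → ℂ, ((1 / (N : ℝ)) * ∑ n ∈ Finset.Ioc (N : ℤ) (2 * (N : ℤ)), ‖u n‖ ^ 2) ^ ((1 : ℝ) / 2) ≤ 1 →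
      ∑ n ∈ MC.II N, ‖u n‖^2 ≤ N := by
    intro u hu
    have h5 := MC.rpow_conv (k := 2) (x := (1 / (N : ℝ)) * ∑ n ∈ Finset.Ioc (N : ℤ) (2 * (N : ℤ)), ‖u n‖ ^ 2) (y := 1) (by norm_num) (by positivity) (by push_cast; exact hu)
    rw [one_pow, one_div, inv_mul_le_iff₀ hN0, mul_one] at h5
    exact h5
  have conv4 : ∀ u : ℤ → ℂ, ((1 / (N : ℝ)) * ∑ n ∈ Finset.Ioc (N : ℤ) (2 * (N : ℤ)), ‖u n‖ ^ 4) ^ ((1 : ℝ) / 4) ≤ Real.exp (C*L) →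
      ∑ n ∈ MC.II N, ‖u n‖^4 ≤ N * Real.exp (4*C*L) := by
    intro u hu
    have h5 := MC.rpow_conv (k := 4) (x := (1 / (N : ℝ)) * ∑ n ∈ Finset.Ioc (N : ℤ) (2 * (N : ℤ)), ‖u n‖ ^ 4) (y := Real.exp (C*L)) (by norm_num) (by positivity) (by push_cast; exact hu)
    rw [one_div, inv_mul_le_iff₀ hN0, ← Real.exp_nat_mul] at h5
    refine h5.trans (le_of_eq ?_)
    push_cast; ring_nf
  have f2 := conv2 f hf2
  have g2 := conv2 g hg2
  have f4 := conv4 f hf4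
  have g4 := conv4 g hg4
  have hPp : ∀ p ∈ P, p.Prime := fun p hp => (hP p hp).1
  set B := Cg * Real.sqrt L * N with hB
  have key : ∀ (u v : ℤ → ℂ) (U V : ℤ → ℝ), (∀ n, |U n| ≤ ‖u n‖) → (∀ n, |V n| ≤ ‖v n‖) →
      (∀ n, n ∉ MC.II N → u n = 0) → (∀ n, n ∉ MC.II N → v n = 0) →
      ∑ n ∈ MC.II N, ‖u n‖^2 ≤ N → ∑ n ∈ MC.II N, ‖v n‖^2 ≤ N →
      ∑ n ∈ MC.II N, ‖u n‖^4 ≤ N * Real.exp (4*C*L) → ∑ n ∈ MC.II N, ‖v n‖^4 ≤ N * Real.exp (4*C*L) →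
      |MC.Sv P N U V| ≤ B ∧ |MC.Sg P N 1 U V| ≤ B ∧ |MC.Sg P N (-1) V U| ≤ B := by
    intro u v U V hU hV hu hv u2 v2 u4 v4
    have hU0 : ∀ n, n ∉ MC.II N → U n = 0 := fun n hn => by
      have := hU n; rw [hu n hn, norm_zero] at this; exact abs_nonpos_iff.1 this
    have hV0 : ∀ n, n ∉ MC.II N → V n = 0 := fun n hn => by
      have := hV n; rw [hv n hn, norm_zero] at this; exact abs_nonpos_iff.1 this
    have : |MC.Sv P N U V| ≤ B := MC.Sv_le hPp fun τ =>
      hall P τ N H₀ H L U V h1 h2 h3 hP hL hLe hNe hU0 hV0 (MC.part_le (by decide) hU u2) (MC.part_le (by decide) hV v2)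
        (MC.part_le (by decide) hU u4) (MC.part_le (by decide) hV v4)
    refine ⟨this, ?_, ?_⟩
    · rw [MC.Sg_one]; exact this
    · rw [MC.Sg_neg P N V U hV0 hU0]; exact this
  have hre : ∀ u : ℤ → ℂ, ∀ n, |(u n).re| ≤ ‖u n‖ := fun u n => Complex.abs_re_le_norm _
  have him : ∀ u : ℤ → ℂ, ∀ n, |(u n).im| ≤ ‖u n‖ := fun u n => Complex.abs_im_le_norm _
  have c1 := MC.cplx (P := P) (N := N) (σ := 1) (f := f) (g := g) (B := B)
    (key f g _ _ (hre f) (hre g) hf hg f2 g2 f4 g4).2.1 (key f g _ _ (him f) (him g) hf hg f2 g2 f4 g4).2.1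
    (key f g _ _ (him f) (hre g) hf hg f2 g2 f4 g4).2.1 (key f g _ _ (hre f) (him g) hf hg f2 g2 f4 g4).2.1
  have c2 := MC.cplx (P := P) (N := N) (σ := -1) (f := f) (g := g) (B := B)
    (key g f _ _ (hre g) (hre f) hg hf g2 f2 g4 f4).2.2 (key g f _ _ (him g) (him f) hg hf g2 f2 g4 f4).2.2
    (key g f _ _ (hre g) (him f) hg hf g2 f2 g4 f4).2.2 (key g f _ _ (him g) (hre f) hg hf g2 f2 g4 f4).2.2
  have e : (∑ n ∈ Finset.Ioc (N : ℤ) (2 * (N : ℤ)), ∑ σ ∈ ({-1, 1} : Finset ℤ), ∑ p ∈ P,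
                if (p : ℤ) ∣ n then f n * (starRingEnd ℂ) (g (n + σ * (p : ℤ))) else 0) -
              ∑ n ∈ Finset.Ioc (N : ℤ) (2 * (N : ℤ)), ∑ σ ∈ ({-1, 1} : Finset ℤ), ∑ p ∈ P,
                f n * (starRingEnd ℂ) (g (n + σ * (p : ℤ))) / (p : ℂ) =
      (∑ n ∈ MC.II N, ∑ p ∈ P, f n * (starRingEnd ℂ) (g (n + (-1) * p)) * ((MC.ww p n : ℝ) : ℂ)) +
      ∑ n ∈ MC.II N, ∑ p ∈ P, f n * (starRingEnd ℂ) (g (n + 1 * p)) * ((MC.ww p n : ℝ) : ℂ) := by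
    have aux : ∀ (σ n : ℤ) (p : ℕ), f n * (starRingEnd ℂ) (g (n + σ * p)) * ((MC.ww p n : ℝ) : ℂ) =
        (if (p : ℤ) ∣ n then f n * (starRingEnd ℂ) (g (n + σ * (p : ℤ))) else 0) -
          f n * (starRingEnd ℂ) (g (n + σ * (p : ℤ))) / (p : ℂ) := by
      intro σ n p
      rw [MC.ww]
      split_ifs
      · push_cast; ring
      · push_cast; ring
    simp only [aux]
    have hne : (-1:ℤ) ∉ ({1} : Finset ℤ) := by decide
    simp only [Finset.sum_insert hne, Finset.sum_singleton, Finset.sum_sub_distrib, Finset.sum_add_distrib, MC.II]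
    ring
  rw [e]
  have hT := (norm_add_le _ _).trans (add_le_add c2 c1)
  have hsL : 0 < Real.sqrt L := Real.sqrt_pos.2 hL0
  calc _ ≤ (1 / ((N : ℝ) * L)) * (4 * B + 4 * B) := mul_le_mul_of_nonneg_left hT (by positivity)
    _ = 8 * Cg / Real.sqrt L := by
      rw [hB]
      have hLs : L = Real.sqrt L * Real.sqrt L := (Real.mul_self_sqrt hL0.le).symm
      rw [eq_div_iff hsL.ne']
      calc 1 / ((N:ℝ) * L) * (4 * (Cg * Real.sqrt L * N) + 4 * (Cg * Real.sqrt L * N)) * Real.sqrt L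
          = 8 * Cg * (Real.sqrt L * Real.sqrt L) * (N / (N * L)) := by ring
        _ = 8 * Cg := by rw [← hLs]; field_simp
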